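/- Fix μ ∈ ℕ, assume d₁ ≥ 2, and assume that K₁ := (n + 2 − dim V₁* − μ)/2^{d₁−1} satisfies K₁ > 4(d₁−1). Then for every ε > 0 there exists δ > 0 such that, uniformly for all integers d ≥ 1, all P₁ ≥ 1, and all 𝐳 ∈ A₁^μ ∩ ℤ^{n−m+1} with l := |𝐳| < P₁^{(d₁−1)/(2d₂)}: N_{d,𝐳}(P₁) = 𝔖_{d,𝐳}·J_𝐳·d^{m−r−d₁}·l^{m−r}·P₁^{m+1−d₁} + O(d^{m−r}·max{d^{(d₁−1)(r+1)/2^{d₁−1}+ε}, d^{3−d₁}}·l^{m−r+4d₂}·P₁^{m+1−d₁−δ}), the implied constant depending only on F, n, m, r, μ, δ and ε. -/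

import Mathlib

open MvPolynomial MeasureTheory
open scoped BigOperators ENNReal Classical

noncomputable section

namespace PaperTM

/-- Index type for the `n + 2` variables `(x₀,…,x_r, y_{r+1},…,y_m, z_{m+1},…,z_{n+1})`. -/
abbrev Idx (n m r : ℕ) := Fin (r + 1) ⊕ (Fin (m - r) ⊕ Fin (n - m + 1))

/-- `e(t) = exp(2 π i t)`. -/
def eexp (t : ℝ) : ℂ := Complex.exp (2 * Real.pi * Complex.I * t)

variable {n m r : ℕ}

/-- Evaluation of `F` at a triple of vectors with entries in a commutative ring. -/
def evalF {R : Type} [CommRing R] (F : MvPolynomial (Idx n m r) ℤ)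
    (x : Fin (r + 1) → R) (y : Fin (m - r) → R) (z : Fin (n - m + 1) → R) : R :=
  MvPolynomial.aeval (Sum.elim x (Sum.elim y z)) F

/-- `F` is bihomogeneous of bidegree `(d₁, d₂)`:
`F(a𝐱, ab𝐲, b𝐳) = a^{d₁} b^{d₂} F(𝐱,𝐲,𝐳)` for all scalars `a, b`. -/
def Bihomogeneous (F : MvPolynomial (Idx n m r) ℤ) (d₁ d₂ : ℕ) : Prop :=
  ∀ (R : Type) [CommRing R], ∀ (a b : R) (x : Fin (r + 1) → R) (y : Fin (m - r) → R)
    (z : Fin (n - m + 1) → R),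
    evalF F (fun i => a * x i) (fun j => a * b * y j) (fun k => b * z k) =
      a ^ d₁ * b ^ d₂ * evalF F x y z

/-- The partial derivative `∂F/∂t_i`, viewed as a polynomial with complex coefficients. -/
def pderivC (F : MvPolynomial (Idx n m r) ℤ) (i : Idx n m r) :
    MvPolynomial (Idx n m r) ℂ :=
  MvPolynomial.map (Int.castRingHom ℂ) (MvPolynomial.pderiv i F)

/-- The ideal of `V₁* = {∂F/∂x_i = 0 (0 ≤ i ≤ r), ∂F/∂y_j = 0 (r+1 ≤ j ≤ m)}`. -/
def idealV1 (F : MvPolynomial (Idx n m r) ℤ) : Ideal (MvPolynomial (Idx n m r) ℂ) :=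
  Ideal.span ((Set.range fun i : Fin (r + 1) => pderivC F (Sum.inl i)) ∪
    (Set.range fun j : Fin (m - r) => pderivC F (Sum.inr (Sum.inl j))))

/-- The ideal of `V₂* = {∂F/∂y_j = 0 (r+1 ≤ j ≤ m), ∂F/∂z_k = 0 (m+1 ≤ k ≤ n+1)}`. -/
def idealV2 (F : MvPolynomial (Idx n m r) ℤ) : Ideal (MvPolynomial (Idx n m r) ℂ) :=
  Ideal.span ((Set.range fun j : Fin (m - r) => pderivC F (Sum.inr (Sum.inl j))) ∪
    (Set.range fun k : Fin (n - m + 1) => pderivC F (Sum.inr (Sum.inr k))))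

/-- The dimension of the affine variety `V₁* ⊆ ℂ^{n+2}`. -/
def dimV1 (F : MvPolynomial (Idx n m r) ℤ) : WithBot ℕ∞ :=
  ringKrullDim (MvPolynomial (Idx n m r) ℂ ⧸ idealV1 F)

/-- The dimension of the affine variety `V₂* ⊆ ℂ^{n+2}`. -/
def dimV2 (F : MvPolynomial (Idx n m r) ℤ) : WithBot ℕ∞ :=
  ringKrullDim (MvPolynomial (Idx n m r) ℂ ⧸ idealV2 F)

/-- The polynomial `F(𝐱, 𝐘, 𝐙)` with complex coefficients obtained from `F` by specializing
the variables `𝐱` to a fixed point of `ℂ^{r+1}`. -/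
def subsX (x : Fin (r + 1) → ℂ) (p : MvPolynomial (Idx n m r) ℤ) :
    MvPolynomial (Fin (m - r) ⊕ Fin (n - m + 1)) ℂ :=
  MvPolynomial.aeval (Sum.elim (fun i => MvPolynomial.C (x i))
    (Sum.elim (fun j => MvPolynomial.X (Sum.inl j)) (fun k => MvPolynomial.X (Sum.inr k)))) p

/-- Specialization of the variables `𝐳` to a fixed point of `ℂ^{n-m+1}`. -/
def subsZ (z : Fin (n - m + 1) → ℂ) (p : MvPolynomial (Idx n m r) ℤ) :
    MvPolynomial (Fin (r + 1) ⊕ Fin (m - r)) ℂ :=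
  MvPolynomial.aeval (Sum.elim (fun i => MvPolynomial.X (Sum.inl i))
    (Sum.elim (fun j => MvPolynomial.X (Sum.inr j)) (fun k => MvPolynomial.C (z k)))) p

/-- Dimension of `V₂,𝐱* = {(𝐲,𝐳) : ∂F/∂y_j(𝐱,𝐲,𝐳) = 0, ∂F/∂z_k(𝐱,𝐲,𝐳) = 0}`. -/
def dimV2x (F : MvPolynomial (Idx n m r) ℤ) (x : Fin (r + 1) → ℂ) : WithBot ℕ∞ :=
  ringKrullDim (MvPolynomial (Fin (m - r) ⊕ Fin (n - m + 1)) ℂ ⧸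
    Ideal.span
      ((Set.range fun j : Fin (m - r) => subsX x (MvPolynomial.pderiv (Sum.inr (Sum.inl j)) F)) ∪
       (Set.range fun k : Fin (n - m + 1) => subsX x (MvPolynomial.pderiv (Sum.inr (Sum.inr k)) F))))

/-- Dimension of `V₁,𝐳* = {(𝐱,𝐲) : ∂F/∂x_i(𝐱,𝐲,𝐳) = 0, ∂F/∂y_j(𝐱,𝐲,𝐳) = 0}`. -/
def dimV1z (F : MvPolynomial (Idx n m r) ℤ) (z : Fin (n - m + 1) → ℂ) : WithBot ℕ∞ :=
  ringKrullDim (MvPolynomial (Fin (r + 1) ⊕ Fin (m - r)) ℂ ⧸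
    Ideal.span
      ((Set.range fun i : Fin (r + 1) => subsZ z (MvPolynomial.pderiv (Sum.inl i) F)) ∪
       (Set.range fun j : Fin (m - r) => subsZ z (MvPolynomial.pderiv (Sum.inr (Sum.inl j)) F))))

/-- The set `A₂^λ = {𝐱 ∈ ℂ^{r+1} : dim V₂,𝐱* < dim V₂* − (r+1) + λ}`, where `D₂ = dim V₂*`;
the inequality is stated equivalently as `dim V₂,𝐱* + (r+1) < D₂ + λ`. -/
def A2set (F : MvPolynomial (Idx n m r) ℤ) (lam D₂ : ℕ) : Set (Fin (r + 1) → ℂ) :=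
  {x | dimV2x F x + (((r + 1 : ℕ) : ℕ∞) : WithBot ℕ∞) < (((D₂ + lam : ℕ) : ℕ∞) : WithBot ℕ∞)}

/-- The set `A₁^μ = {𝐳 ∈ ℂ^{n-m+1} : dim V₁,𝐳* < dim V₁* − (n−m+1) + μ}`, where `D₁ = dim V₁*`. -/
def A1set (F : MvPolynomial (Idx n m r) ℤ) (mu D₁ : ℕ) : Set (Fin (n - m + 1) → ℂ) :=
  {z | dimV1z F z + (((n - m + 1 : ℕ) : ℕ∞) : WithBot ℕ∞) < (((D₁ + mu : ℕ) : ℕ∞) : WithBot ℕ∞)}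

/-- The exponential sum `S_d(α)`. -/
def Sd (F : MvPolynomial (Idx n m r) ℤ) (d : ℕ) (P₁ P₂ α : ℝ) : ℂ :=
  ∑' q : (Fin (r + 1) → ℤ) × (Fin (m - r) → ℤ) × (Fin (n - m + 1) → ℤ),
    if ‖q.1‖ ≤ P₁ ∧ ‖q.2.1‖ ≤ d * ‖q.1‖ * P₂ ∧ ‖q.2.2‖ ≤ P₂ then
      eexp (α * (evalF F (fun i => (d : ℤ) * q.1 i) q.2.1 q.2.2 : ℤ))
    else 0

/-- The complete exponential sum `S_{a,q,d}`. -/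
def Saqd (F : MvPolynomial (Idx n m r) ℤ) (d a q : ℕ) : ℂ :=
  ∑' b : (Fin (r + 1) → ZMod q) × (Fin (m - r) → ZMod q) × (Fin (n - m + 1) → ZMod q),
    eexp ((a : ℝ) / (q : ℝ) *
      ((evalF F (fun i => (d : ZMod q) * b.1 i) b.2.1 b.2.2).val : ℝ))

/-- The term `A_d(q) = q^{-(n+2)} ∑_{0 ≤ a < q, (a,q)=1} S_{a,q,d}` of the singular series. -/
def Aq (F : MvPolynomial (Idx n m r) ℤ) (d q : ℕ) : ℂ :=
  (q : ℂ) ^ (-((n : ℤ) + 2)) *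
    ∑ a ∈ (Finset.range q).filter fun a => Nat.gcd a q = 1, Saqd F d a q

/-- The singular series `𝔖_d`. -/
def singSeries (F : MvPolynomial (Idx n m r) ℤ) (d : ℕ) : ℂ := ∑' q : ℕ, Aq F d q

/-- The partial singular series `𝔖_d(Q)`. -/
def singSeriesPartial (F : MvPolynomial (Idx n m r) ℤ) (d Q : ℕ) : ℂ :=
  ∑ q ∈ Finset.Icc 1 Q, Aq F d q

/-- The integral `I(β)` over the region `|𝐮| ≤ 1`, `|𝐯| ≤ |𝐮|`, `|𝐰| ≤ 1`. -/
def Ibeta (F : MvPolynomial (Idx n m r) ℤ) (β : ℝ) : ℂ :=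
  ∫ p : (Fin (r + 1) → ℝ) × (Fin (m - r) → ℝ) × (Fin (n - m + 1) → ℝ),
    if ‖p.1‖ ≤ 1 ∧ ‖p.2.1‖ ≤ ‖p.1‖ ∧ ‖p.2.2‖ ≤ 1 then
      eexp (β * evalF F p.1 p.2.1 p.2.2)
    else 0

/-- The truncated singular integral `J(φ) = ∫_{|β| ≤ φ} I(β) dβ`. -/
def Jphi (F : MvPolynomial (Idx n m r) ℤ) (φ : ℝ) : ℂ :=
  ∫ β in Set.Icc (-φ) φ, Ibeta F β

/-- The singular integral `J = ∫_ℝ I(β) dβ`. -/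
def Jint (F : MvPolynomial (Idx n m r) ℤ) : ℂ := ∫ β : ℝ, Ibeta F β

/-- The constant `σ_d = d^{m-r-d₁} 𝔖_d J`. -/
def sigmaD (F : MvPolynomial (Idx n m r) ℤ) (d₁ d : ℕ) : ℂ :=
  (d : ℂ) ^ ((m : ℤ) - r - d₁) * singSeries F d * Jint F

/-- `S_{a,q,d}(𝐱)`, the complete exponential sum with `𝐱` fixed. -/
def SaqdX (F : MvPolynomial (Idx n m r) ℤ) (d : ℕ) (x : Fin (r + 1) → ℤ) (a q : ℕ) : ℂ :=
  ∑' b : (Fin (m - r) → ZMod q) × (Fin (n - m + 1) → ZMod q),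
    eexp ((a : ℝ) / (q : ℝ) *
      ((evalF F (fun i => ((d * x i : ℤ) : ZMod q)) b.1 b.2).val : ℝ))

/-- The singular series `𝔖_{d,𝐱} = ∑_q q^{-(n-r+1)} ∑_{(a,q)=1} S_{a,q,d}(𝐱)`. -/
def singSeriesX (F : MvPolynomial (Idx n m r) ℤ) (d : ℕ) (x : Fin (r + 1) → ℤ) : ℂ :=
  ∑' q : ℕ, (q : ℂ) ^ (-((n : ℤ) - r + 1)) *
    ∑ a ∈ (Finset.range q).filter fun a => Nat.gcd a q = 1, SaqdX F d x a q

/-- `I_𝐱(β) = ∫_{[-1,1]^{m-r} × [-1,1]^{n-m+1}} e(β F(𝐱, k𝐯, 𝐰)) d𝐯 d𝐰` with `k = |𝐱|`. -/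
def IbetaX (F : MvPolynomial (Idx n m r) ℤ) (x : Fin (r + 1) → ℤ) (β : ℝ) : ℂ :=
  ∫ p : (Fin (m - r) → ℝ) × (Fin (n - m + 1) → ℝ),
    if ‖p.1‖ ≤ 1 ∧ ‖p.2‖ ≤ 1 then
      eexp (β * evalF F (fun i => (x i : ℝ)) (fun j => ‖x‖ * p.1 j) p.2)
    else 0

/-- `J_{d,𝐱} = ∫_ℝ I_𝐱(d^{d₁} β) dβ`. -/
def JdX (F : MvPolynomial (Idx n m r) ℤ) (d₁ d : ℕ) (x : Fin (r + 1) → ℤ) : ℂ :=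
  ∫ β : ℝ, IbetaX F x ((d : ℝ) ^ d₁ * β)

/-- `S_{a,q,d}(𝐳)`, the complete exponential sum with `𝐳` fixed. -/
def SaqdZ (F : MvPolynomial (Idx n m r) ℤ) (d : ℕ) (z : Fin (n - m + 1) → ℤ) (a q : ℕ) : ℂ :=
  ∑' b : (Fin (r + 1) → ZMod q) × (Fin (m - r) → ZMod q),
    eexp ((a : ℝ) / (q : ℝ) *
      ((evalF F (fun i => (d : ZMod q) * b.1 i) b.2 (fun k => ((z k : ℤ) : ZMod q))).val : ℝ))

/-- The singular series `𝔖_{d,𝐳} = ∑_q q^{-(m+1)} ∑_{(a,q)=1} S_{a,q,d}(𝐳)`. -/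
def singSeriesZ (F : MvPolynomial (Idx n m r) ℤ) (d : ℕ) (z : Fin (n - m + 1) → ℤ) : ℂ :=
  ∑' q : ℕ, (q : ℂ) ^ (-((m : ℤ) + 1)) *
    ∑ a ∈ (Finset.range q).filter fun a => Nat.gcd a q = 1, SaqdZ F d z a q

/-- `I_𝐳(β) = ∫_{(𝐮,𝐯) ∈ [-1,1]^{r+1} × [-1,1]^{m-r}, |𝐯| < |𝐮|} e(β F(𝐮, l𝐯, 𝐳)) d𝐮 d𝐯`
with `l = |𝐳|`. -/
def IbetaZ (F : MvPolynomial (Idx n m r) ℤ) (z : Fin (n - m + 1) → ℤ) (β : ℝ) : ℂ :=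
  ∫ p : (Fin (r + 1) → ℝ) × (Fin (m - r) → ℝ),
    if ‖p.1‖ ≤ 1 ∧ ‖p.2‖ ≤ 1 ∧ ‖p.2‖ < ‖p.1‖ then
      eexp (β * evalF F p.1 (fun j => ‖z‖ * p.2 j) (fun k => (z k : ℝ)))
    else 0

/-- `J_𝐳 = ∫_ℝ I_𝐳(β) dβ`. -/
def JZ (F : MvPolynomial (Idx n m r) ℤ) (z : Fin (n - m + 1) → ℤ) : ℂ :=
  ∫ β : ℝ, IbetaZ F z β

/-- The major arcs `𝔐^{(1)}(θ)` (with `dt = d̃ = d₁ + d₂ - 2`). -/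
def majorArc1 (d d₁ dt : ℕ) (P θ : ℝ) : Set ℝ :=
  {α | α ∈ Set.Icc (0 : ℝ) 1 ∧ ∃ q a : ℕ, 0 < q ∧ d ∣ q ∧ a < q ∧
    (q : ℝ) ≤ d * P ^ (((dt : ℝ) + 1) * θ) ∧
    |α * q - a| ≤ ((d : ℝ) ^ (d₁ - 1))⁻¹ * P ^ (-1 + ((dt : ℝ) + 1) * θ)}

/-- The major arcs `𝔐^{(2)}(θ)`. -/
def majorArc2 (d d₁ dt : ℕ) (P θ : ℝ) : Set ℝ :=
  {α | α ∈ Set.Icc (0 : ℝ) 1 ∧ ∃ q a : ℕ, 0 < q ∧ a < q ∧ Nat.gcd a q = 1 ∧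
    (q : ℝ) ≤ P ^ (((dt : ℝ) + 1) * θ) ∧
    |α * q - a| ≤ ((d : ℝ) ^ d₁)⁻¹ * P ^ (-1 + ((dt : ℝ) + 1) * θ)}

/-- The minor arcs `𝔪(θ) = [0,1) \ (𝔐^{(1)}(θ) ∪ 𝔐^{(2)}(θ))`. -/
def minorArcs (d d₁ dt : ℕ) (P θ : ℝ) : Set ℝ :=
  Set.Ico (0 : ℝ) 1 \ (majorArc1 d d₁ dt P θ ∪ majorArc2 d d₁ dt P θ)

set_option linter.unusedSectionVars false

section Family

variable {σ τ J : Type} [Fintype σ] [Fintype τ] [Fintype J]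

/-- The ideal generated by the specialisation at `p` of a family of polynomials. -/
def famIdeal (f : J → MvPolynomial σ (MvPolynomial τ ℂ)) (p : τ → ℂ) :
    Ideal (MvPolynomial σ ℂ) :=
  Ideal.span (Set.range fun j => MvPolynomial.map (MvPolynomial.eval p) (f j))

/-- All monomials of degree `t` lie in the specialised ideal. -/
def PowMem (f : J → MvPolynomial σ (MvPolynomial τ ℂ)) (p : τ → ℂ) (t : ℕ) : Prop :=
  ∀ s : σ →₀ ℕ, s.degree = t → monomial s (1 : ℂ) ∈ famIdeal f p

lemma exists_le_degree {s : σ →₀ ℕ} {t : ℕ} (h : t ≤ s.degree) :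
    ∃ a b : σ →₀ ℕ, s = a + b ∧ b.degree = t := by
  induction t with
  | zero => exact ⟨s, 0, by simp, by simp⟩
  | succ t ih =>
    obtain ⟨a, b, rfl, hb⟩ := ih (by omega)
    have ha : a ≠ 0 := by
      rintro rfl
      simp [hb] at h
    obtain ⟨i, hi⟩ := Finsupp.ne_iff.mp ha
    refine ⟨a - Finsupp.single i 1, b + Finsupp.single i 1, ?_, ?_⟩
    · ext j
      simp only [Finsupp.add_apply, Finsupp.tsub_apply, Finsupp.single_apply]
      simp only [Finsupp.coe_zero, Pi.zero_apply] at hi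
      split_ifs with hij
      · subst hij; omega
      · omega
    · rw [map_add, hb]; simp

lemma PowMem.mono {f : J → MvPolynomial σ (MvPolynomial τ ℂ)} {p : τ → ℂ} {t t' : ℕ}
    (h : PowMem f p t) (htt : t ≤ t') : PowMem f p t' := by
  intro s hs
  obtain ⟨a, b, rfl, hb⟩ := exists_le_degree (t := t) (s := s) (by omega)
  have : monomial (a + b) (1 : ℂ) = monomial a 1 * monomial b 1 := by
    rw [monomial_mul]; simp
  rw [this]
  exact Ideal.mul_mem_left _ _ (h b hb)

attribute [local instance] MvPolynomial.gradedAlgebra in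
lemma famIdeal_homogeneous {f : J → MvPolynomial σ (MvPolynomial τ ℂ)} {e : J → ℕ}
    (hf : ∀ j, (f j).IsHomogeneous (e j)) (p : τ → ℂ) :
    (famIdeal f p).IsHomogeneous (homogeneousSubmodule σ ℂ) := by
  apply Ideal.homogeneous_span
  rintro _ ⟨j, rfl⟩
  exact ⟨e j, (hf j).map _⟩

lemma PowMem.exists_poly {f : J → MvPolynomial σ (MvPolynomial τ ℂ)} {e : J → ℕ}
    (hf : ∀ j, (f j).IsHomogeneous (e j)) {p₀ : τ → ℂ} {t : ℕ} (h : PowMem f p₀ t) :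
    ∃ g : MvPolynomial τ ℂ, eval p₀ g ≠ 0 ∧ ∀ p, eval p g ≠ 0 → PowMem f p t := by
  let M := ((Finset.univ : Finset σ).finsuppAntidiag t : Finset (σ →₀ ℕ))
  have hM : ∀ s, s ∈ M ↔ s.degree = t := by
    intro s
    simp [M, Finset.mem_finsuppAntidiag, Finsupp.degree_eq_sum]
  have h1 : ∀ s : M, ∃ c : J → MvPolynomial σ ℂ,
      ∑ j, c j * MvPolynomial.map (MvPolynomial.eval p₀) (f j) = monomial s.1 1 := by
    intro s
    exact Ideal.mem_span_range_iff_exists_fun.mp (h s.1 ((hM _).mp s.2))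
  choose c hc using h1
  let v : M → MvPolynomial σ (MvPolynomial τ ℂ) := fun s => ∑ j, map C (c s j) * f j
  have hv : ∀ (p : τ → ℂ) s, map (eval p) (v s) = ∑ j, c s j * map (eval p) (f j) := by
    intro p s
    simp only [v, map_sum, map_mul, map_map]
    refine Finset.sum_congr rfl fun j _ => ?_
    congr 1
    have : (eval p).comp C = RingHom.id ℂ := by ext; simp
    rw [this, map_id]
  let W : Matrix M M (MvPolynomial τ ℂ) := fun s s' => coeff s'.1 (v s)
  have hW : ∀ p, eval p W.det = (Matrix.of fun s s' : M => coeff s'.1 (map (eval p) (v s))).det := by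
    intro p
    rw [RingHom.map_det]
    congr 1
  refine ⟨W.det, ?_, ?_⟩
  · rw [hW]
    have : (Matrix.of fun s s' : M => coeff s'.1 (map (eval p₀) (v s))) = 1 := by
      ext s s'
      simp only [Matrix.of_apply, hv, hc, coeff_monomial, Matrix.one_apply]
      exact if_congr Subtype.ext_iff.symm rfl rfl
    rw [this]; simp
  · intro p hp s hs
    rw [hW] at hp
    set A := (Matrix.of fun s s' : M => coeff s'.1 (map (eval p) (v s))) with hA
    have hmem : ∀ s : M, homogeneousComponent t (map (eval p) (v s)) ∈ famIdeal f p := by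
      intro s
      refine homogeneousComponent_mem_of_mem (famIdeal_homogeneous hf p) ?_ _
      rw [hv]
      exact Ideal.sum_mem _ fun j _ => Ideal.mul_mem_left _ _ (Ideal.subset_span ⟨j, rfl⟩)
    have hexp : ∀ s : M, homogeneousComponent t (map (eval p) (v s)) =
        ∑ s' : M, A s s' • monomial s'.1 (1 : ℂ) := by
      intro s
      ext u
      rw [coeff_homogeneousComponent, coeff_sum]
      simp only [coeff_smul, coeff_monomial, smul_eq_mul, mul_ite, mul_one, mul_zero]
      split_ifs with hu
      · rw [Finset.sum_eq_single (⟨u, (hM u).mpr hu⟩ : M)]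
        · simp [hA]
        · intro b _ hb
          rw [if_neg]
          intro h; apply hb; exact Subtype.ext h
        · simp
      · symm
        apply Finset.sum_eq_zero
        intro b _
        rw [if_neg]
        rintro rfl
        exact hu ((hM _).mp b.2)
    have key : A.det • monomial s (1 : ℂ) =
        ∑ u : M, A.adjugate ⟨s, (hM s).mpr hs⟩ u •
          homogeneousComponent t (map (eval p) (v u)) := by
      simp only [hexp, Finset.smul_sum, smul_smul]
      rw [Finset.sum_comm]
      simp only [← Finset.sum_smul]
      have h3 : ∀ s' : M, ∑ u, A.adjugate ⟨s, (hM s).mpr hs⟩ u * A u s' =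
          (A.adjugate * A) ⟨s, (hM s).mpr hs⟩ s' := fun s' => by rw [Matrix.mul_apply]
      simp only [h3, Matrix.adjugate_mul, Matrix.smul_apply, Matrix.one_apply, smul_eq_mul,
        mul_ite, mul_one, mul_zero]
      simp
    have h4 : A.det • monomial s (1 : ℂ) ∈ famIdeal f p := by
      rw [key]
      refine Ideal.sum_mem _ fun u _ => ?_
      rw [smul_eq_C_mul]
      exact Ideal.mul_mem_left _ _ (hmem u)
    have h5 : monomial s (1 : ℂ) = C (A.det)⁻¹ * (A.det • monomial s (1 : ℂ)) := by
      rw [smul_eq_C_mul, ← mul_assoc, ← C_mul, inv_mul_cancel₀ hp]; simp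
    rw [h5]
    exact Ideal.mul_mem_left _ _ h4

/-- Uniformity of the Nullstellensatz exponent in a family of homogeneous polynomials. -/
lemma exists_uniform_powMem {f : J → MvPolynomial σ (MvPolynomial τ ℂ)} {e : J → ℕ}
    (hf : ∀ j, (f j).IsHomogeneous (e j)) :
    ∃ t₀, ∀ p : τ → ℂ, (∃ t, PowMem f p t) → PowMem f p t₀ := by
  let G : Set (MvPolynomial τ ℂ) := {g | ∃ t, ∀ p, eval p g ≠ 0 → PowMem f p t}
  have hfg : (Ideal.span G).FG := IsNoetherian.noetherian _
  obtain ⟨s, hsG, hs⟩ := (Submodule.fg_span_iff_fg_span_finset_subset G).mp hfg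
  choose! tt htt using (fun g (hg : g ∈ (s : Set (MvPolynomial τ ℂ))) => hsG hg)
  refine ⟨s.sup tt, ?_⟩
  rintro p ⟨t, ht⟩
  obtain ⟨g, hg, hg'⟩ := ht.exists_poly hf
  by_contra hcon
  have hz : ∀ g' ∈ s, eval p g' = 0 := by
    intro g' hg's
    by_contra hne
    exact hcon ((htt g' hg's p hne).mono (Finset.le_sup hg's))
  have hgs : g ∈ Submodule.span (MvPolynomial τ ℂ) (s : Set (MvPolynomial τ ℂ)) := by
    rw [← hs]
    exact Submodule.subset_span ⟨t, hg'⟩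
  have hle : Submodule.span (MvPolynomial τ ℂ) (s : Set (MvPolynomial τ ℂ)) ≤
      RingHom.ker (eval p) := by
    rw [Submodule.span_le]
    intro g' hg'
    exact hz g' hg'
  exact hg (hle hgs)

end Family

section Hilbert

variable {σ J : Type} [Fintype σ] [Fintype J]

lemma homogeneousComponent_succ_mul {q l : MvPolynomial σ ℂ} (hl : l.IsHomogeneous 1) (n : ℕ) :
    homogeneousComponent (n + 1) (q * l) = homogeneousComponent n q * l := by
  conv_lhs => rw [← sum_homogeneousComponent q]
  rw [Finset.sum_mul, map_sum]
  have h : ∀ i, homogeneousComponent (n + 1) (homogeneousComponent i q * l) =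
      if i = n then homogeneousComponent i q * l else 0 := by
    intro i
    rw [homogeneousComponent_of_mem
      ((mem_homogeneousSubmodule _ _).mpr ((homogeneousComponent_isHomogeneous i q).mul hl))]
    simp [eq_comm]
  simp only [h, Finset.sum_ite_eq', Finset.mem_range]
  split_ifs with hn
  · rfl
  · rw [homogeneousComponent_eq_zero _ _ (by omega), zero_mul]

/-- The spanning set of functions on `S`: monomials of low degree times monomials in the
linear forms. -/
def hilbFun {D : ℕ} (l : Fin D → MvPolynomial σ ℂ) (S : Finset (σ → ℂ)) (t s : ℕ)
    (i : (σ → Fin t) × (Fin D → Fin (s + 1))) : S → ℂ :=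
  fun x => (∏ a, x.1 a ^ (i.1 a : ℕ)) * ∏ c, (eval x.1 (l c)) ^ (i.2 c : ℕ)

def hilbSpan {D : ℕ} (l : Fin D → MvPolynomial σ ℂ) (S : Finset (σ → ℂ)) (t s : ℕ) :
    Submodule ℂ (S → ℂ) := Submodule.span ℂ (Set.range (hilbFun l S t s))

lemma hilbSpan_mono {D : ℕ} (l : Fin D → MvPolynomial σ ℂ) (S : Finset (σ → ℂ)) (t : ℕ)
    {s s' : ℕ} (h : s ≤ s') : hilbSpan l S t s ≤ hilbSpan l S t s' := by
  apply Submodule.span_mono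
  rintro _ ⟨i, rfl⟩
  refine ⟨(i.1, fun c => ⟨i.2 c, by have := (i.2 c).2; omega⟩), ?_⟩
  rfl

lemma mul_mem_hilbSpan {D : ℕ} (l : Fin D → MvPolynomial σ ℂ) (S : Finset (σ → ℂ)) (t s : ℕ)
    (c : Fin D) {g : S → ℂ} (hg : g ∈ hilbSpan l S t s) :
    (fun x => g x * eval x.1 (l c)) ∈ hilbSpan l S t (s + 1) := by
  induction hg using Submodule.span_induction with
  | mem g hg =>
    obtain ⟨i, rfl⟩ := hg
    refine Submodule.subset_span ⟨(i.1, fun c' => if c' = c then ⟨i.2 c' + 1, by omega⟩ else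
      ⟨i.2 c', by omega⟩), ?_⟩
    funext x
    simp only [hilbFun, mul_assoc]
    congr 1
    rw [← Finset.mul_prod_erase _ _ (Finset.mem_univ c),
      ← Finset.mul_prod_erase (Finset.univ) (fun c' => (eval x.1 (l c')) ^ (i.2 c' : ℕ))
        (Finset.mem_univ c)]
    have : ∏ x_1 ∈ Finset.univ.erase c, eval x.1 (l x_1) ^
        ((if x_1 = c then ⟨i.2 x_1 + 1, by omega⟩ else ⟨i.2 x_1, by omega⟩ : Fin (s + 1 + 1)) : ℕ)
        = ∏ x_1 ∈ Finset.univ.erase c, eval x.1 (l x_1) ^ (i.2 x_1 : ℕ) := by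
      refine Finset.prod_congr rfl fun c' hc' => ?_
      rw [if_neg (Finset.ne_of_mem_erase hc')]
    rw [this]
    simp only [if_true, pow_succ]
    ring
  | zero =>
    have : (fun x : S => (0 : S → ℂ) x * eval x.1 (l c)) = 0 := by funext x; simp
    rw [this]; exact Submodule.zero_mem _
  | add f g _ _ hf hg =>
    have : (fun x => (f + g) x * eval x.1 (l c)) =
        (fun x : S => f x * eval x.1 (l c)) + fun x : S => g x * eval x.1 (l c) := by
      funext x; simp [add_mul]
    rw [this]; exact Submodule.add_mem _ hf hg
  | smul a f _ hf =>
    have : (fun x => (a • f) x * eval x.1 (l c)) = a • (fun x : S => f x * eval x.1 (l c)) := by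
      funext x; simp [mul_assoc]
    rw [this]; exact Submodule.smul_mem _ _ hf

/-- Evaluation of polynomials on a finite set of points. -/
def evalOn (S : Finset (σ → ℂ)) : MvPolynomial σ ℂ →ₗ[ℂ] (S → ℂ) :=
  LinearMap.pi fun x => (aeval x.1 : MvPolynomial σ ℂ →ₐ[ℂ] ℂ).toLinearMap

lemma evalOn_apply (S : Finset (σ → ℂ)) (P : MvPolynomial σ ℂ) (x : S) :
    evalOn S P x = eval x.1 P := by
  simp [evalOn, aeval_eq_eval]

attribute [local instance] MvPolynomial.gradedAlgebra in
lemma evalOn_mem_hilbSpan {D : ℕ} {f : J → MvPolynomial σ ℂ} {e : J → ℕ}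
    (hf : ∀ j, (f j).IsHomogeneous (e j)) {l : Fin D → MvPolynomial σ ℂ}
    (hl : ∀ c, (l c).IsHomogeneous 1) {t : ℕ}
    (ht : ∀ s : σ →₀ ℕ, s.degree = t → monomial s (1 : ℂ) ∈
      Ideal.span (Set.range f) ⊔ Ideal.span (Set.range l))
    {S : Finset (σ → ℂ)} (hS : ∀ x ∈ S, ∀ j, eval x (f j) = 0) (s : ℕ) :
    ∀ u : σ →₀ ℕ, u.degree = s → evalOn S (monomial u 1) ∈ hilbSpan l S t s := by
  have hvan : ∀ P ∈ Ideal.span (Set.range f), evalOn S P = 0 := by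
    intro P hP
    obtain ⟨c, rfl⟩ := Ideal.mem_span_range_iff_exists_fun.mp hP
    funext x
    rw [evalOn_apply, map_sum]
    simp [hS x.1 x.2]
  have hlow : ∀ s < t, ∀ u : σ →₀ ℕ, u.degree = s →
      evalOn S (monomial u 1) ∈ hilbSpan l S t s := by
    intro s hst u hu
    refine Submodule.subset_span ⟨(fun a => ⟨u a, ?_⟩, fun _ => 0), ?_⟩
    · have : u a ≤ u.degree := Finsupp.le_degree a u
      omega
    · funext x
      simp only [hilbFun, evalOn_apply, eval_monomial]
      simp [Finsupp.prod_fintype]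
  induction s with
  | zero =>
    intro u hu
    by_cases h0 : 0 < t
    · exact hlow 0 h0 u hu
    · have ht0 : t = 0 := by omega
      subst ht0
      have h1 := ht u hu
      obtain ⟨A, hA, B, hB, hAB⟩ := Submodule.mem_sup.mp h1
      have hu0 : u = 0 := (Finsupp.degree_eq_zero_iff u).mp hu
      subst hu0
      have hA' : homogeneousComponent 0 A ∈ Ideal.span (Set.range f) := by
        apply homogeneousComponent_mem_of_mem _ hA
        apply Ideal.homogeneous_span
        rintro _ ⟨j, rfl⟩
        exact ⟨e j, hf j⟩
      have hB' : homogeneousComponent 0 B = 0 := by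
        obtain ⟨b, rfl⟩ := Ideal.mem_span_range_iff_exists_fun.mp hB
        rw [homogeneousComponent_zero]
        have : ∀ c, coeff 0 (l c) = 0 := fun c => (hl c).coeff_eq_zero (by simp)
        rw [coeff_sum]
        simp [coeff_mul, this]
      have := congrArg (homogeneousComponent 0) hAB
      rw [map_add, hB', add_zero, homogeneousComponent_of_mem (m := 0) (n := 0)
        (isHomogeneous_monomial 1 hu), if_pos rfl] at this
      rw [← this, hvan _ hA']
      exact Submodule.zero_mem _
  | succ s ih =>
    intro u hu
    by_cases hst : s + 1 < t
    · exact hlow _ hst u hu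
    obtain ⟨a, b, rfl, hb⟩ := exists_le_degree (t := t) (s := u) (by omega)
    have hmul : monomial (a + b) (1 : ℂ) = monomial a 1 * monomial b 1 := by
      rw [monomial_mul]; simp
    have h1 : monomial (a + b) (1 : ℂ) ∈
        Ideal.span (Set.range f) ⊔ Ideal.span (Set.range l) := by
      rw [hmul]
      exact Ideal.mul_mem_left _ _ (ht b hb)
    obtain ⟨A, hA, B, hB, hAB⟩ := Submodule.mem_sup.mp h1
    have hA' : homogeneousComponent (s + 1) A ∈ Ideal.span (Set.range f) := by
      apply homogeneousComponent_mem_of_mem _ hA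
      apply Ideal.homogeneous_span
      rintro _ ⟨j, rfl⟩
      exact ⟨e j, hf j⟩
    obtain ⟨b', rfl⟩ := Ideal.mem_span_range_iff_exists_fun.mp hB
    have := congrArg (homogeneousComponent (s + 1)) hAB
    rw [map_add, homogeneousComponent_of_mem (m := s + 1)
        (isHomogeneous_monomial 1 hu), if_pos rfl, map_sum] at this
    simp only [homogeneousComponent_succ_mul (hl _)] at this
    rw [← this, map_add, hvan _ hA', zero_add, map_sum]
    refine Submodule.sum_mem _ fun c _ => ?_
    have h2 : evalOn S (homogeneousComponent s (b' c) * l c) =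
        fun x => evalOn S (homogeneousComponent s (b' c)) x * eval x.1 (l c) := by
      funext x; simp [evalOn_apply]
    rw [h2]
    apply mul_mem_hilbSpan
    rw [homogeneousComponent_apply, map_sum]
    refine Submodule.sum_mem _ fun v hv => ?_
    rw [show monomial v (coeff v (b' c)) = coeff v (b' c) • monomial v (1 : ℂ) by
      rw [smul_monomial]; simp, map_smul]
    exact Submodule.smul_mem _ _ (ih v (Finset.mem_filter.mp hv).2)

/-- Number of integral points in a box on a projective-type variety cut out by the `f j`, such that
`f` together with `D` linear forms generates all monomials of degree `t`. -/
lemma card_le_of_powMem {D : ℕ} {f : J → MvPolynomial σ ℂ} {e : J → ℕ}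
    (hf : ∀ j, (f j).IsHomogeneous (e j)) {l : Fin D → MvPolynomial σ ℂ}
    (hl : ∀ c, (l c).IsHomogeneous 1) {t : ℕ}
    (ht : ∀ s : σ →₀ ℕ, s.degree = t → monomial s (1 : ℂ) ∈
      Ideal.span (Set.range f) ⊔ Ideal.span (Set.range l))
    (S : Finset (σ → ℤ)) (hS : ∀ x ∈ S, ∀ j, eval (fun i => (x i : ℂ)) (f j) = 0)
    (a : σ → ℤ) (R : ℕ) (hR : ∀ x ∈ S, ∀ i, a i ≤ x i ∧ x i < a i + R) :
    S.card ≤ t ^ Fintype.card σ * (Fintype.card σ * R + 1) ^ D := by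
  let cs : (σ → ℤ) → (σ → ℂ) := fun x i => (x i : ℂ)
  have hcs : Function.Injective cs := fun x y h => by
    funext i
    have := congrFun h i
    simpa [cs] using this
  let S' := S.image cs
  have hcard : S'.card = S.card := Finset.card_image_of_injective _ hcs
  have hS' : ∀ x ∈ S', ∀ j, eval x (f j) = 0 := by
    intro x hx
    obtain ⟨y, hy, rfl⟩ := Finset.mem_image.mp hx
    exact hS y hy
  set s := Fintype.card σ * R with hs
  have hmem : ∀ P : MvPolynomial σ ℂ, P.totalDegree ≤ s → evalOn S' P ∈ hilbSpan l S' t s := by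
    intro P hP
    rw [P.as_sum, map_sum]
    refine Submodule.sum_mem _ fun v hv => ?_
    rw [show monomial v (coeff v P) = coeff v P • monomial v (1 : ℂ) by
      rw [smul_monomial]; simp, map_smul]
    refine Submodule.smul_mem _ _ (hilbSpan_mono l S' t ?_
      (evalOn_mem_hilbSpan hf hl ht hS' v.degree v rfl))
    exact (le_totalDegree hv).trans hP
  have htop : hilbSpan l S' t s = ⊤ := by
    rw [eq_top_iff]
    intro g _
    have : g = ∑ x : S', g x • (Pi.single x (1 : ℂ)) := by
      funext y
      simp [Finset.sum_apply, Pi.single_apply]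
    rw [this]
    refine Submodule.sum_mem _ fun x _ => Submodule.smul_mem _ _ ?_
    obtain ⟨x, hx⟩ := x
    obtain ⟨y, hy, rfl⟩ := Finset.mem_image.mp hx
    let L : MvPolynomial σ ℂ :=
      ∏ i, ∏ c ∈ (Finset.Ico (a i) (a i + R)).erase (y i), (X i - C (c : ℂ))
    have hLdeg : L.totalDegree ≤ s := by
      refine (totalDegree_finsetProd _ _).trans ?_
      calc _ ≤ ∑ _i : σ, R := by
            refine Finset.sum_le_sum fun i _ => ?_
            refine (totalDegree_finsetProd _ _).trans ?_
            calc _ ≤ ∑ _c ∈ (Finset.Ico (a i) (a i + R)).erase (y i), 1 := by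
                  refine Finset.sum_le_sum fun c _ => ?_
                  refine (totalDegree_sub_C_le _ _).trans ?_
                  simp
              _ ≤ R := by
                  simp only [Finset.sum_const, smul_eq_mul, mul_one]
                  refine (Finset.card_erase_le).trans ?_
                  simp
        _ = s := by simp [hs]
    have hLy : eval (cs y) L ≠ 0 := by
      simp only [L, map_prod, map_sub, eval_X, eval_C]
      refine Finset.prod_ne_zero_iff.mpr fun i _ => Finset.prod_ne_zero_iff.mpr fun c hc => ?_
      have := Finset.ne_of_mem_erase hc
      simp only [cs]
      rw [sub_ne_zero]
      exact_mod_cast this.symm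
    have hLz : ∀ z ∈ S, z ≠ y → eval (cs z) L = 0 := by
      intro z hz hzy
      obtain ⟨i, hi⟩ := Function.ne_iff.mp hzy
      simp only [L, map_prod, map_sub, eval_X, eval_C]
      refine Finset.prod_eq_zero (Finset.mem_univ i) (Finset.prod_eq_zero (i := z i) ?_ ?_)
      · rw [Finset.mem_erase, Finset.mem_Ico]
        exact ⟨hi, hR z hz i⟩
      · simp [cs]
    have : (Pi.single ⟨cs y, hx⟩ (1 : ℂ) : S' → ℂ) = (eval (cs y) L)⁻¹ • evalOn S' L := by
      funext w
      obtain ⟨w, hw⟩ := w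
      obtain ⟨z, hz, rfl⟩ := Finset.mem_image.mp hw
      simp only [Pi.smul_apply, evalOn_apply, smul_eq_mul]
      by_cases hzy : z = y
      · subst hzy
        simp [inv_mul_cancel₀ hLy]
      · rw [hLz z hz hzy, mul_zero, Pi.single_eq_of_ne]
        intro h
        exact hzy (hcs (Subtype.ext_iff.mp h))
    rw [this]
    exact Submodule.smul_mem _ _ (hmem L hLdeg)
  have hfin := finrank_range_le_card (R := ℂ) (hilbFun l S' t s)
  unfold Set.finrank at hfin
  change Module.finrank ℂ (hilbSpan l S' t s) ≤ _ at hfin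
  rw [htop, finrank_top, Module.finrank_fintype_fun_eq_card] at hfin
  simpa [hcard] using hfin

end Hilbert

section Krull

variable {ι J : Type} [Fintype ι]

/-- The linear form with coefficient vector `a`. -/
def linForm (a : ι → ℂ) : MvPolynomial ι ℂ := ∑ i, C (a i) * X i

lemma eval_linForm (a v : ι → ℂ) : eval v (linForm a) = ∑ i, a i * v i := by
  simp [linForm]

lemma linForm_isHomogeneous (a : ι → ℂ) : (linForm a).IsHomogeneous 1 := by
  refine IsHomogeneous.sum _ _ _ fun i _ => ?_
  exact isHomogeneous_C_mul_X _ _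

/-- The ideal of polynomials vanishing at the origin. -/
def originIdeal (ι : Type) : Ideal (MvPolynomial ι ℂ) := RingHom.ker (eval (0 : ι → ℂ))

lemma originIdeal_isMaximal : (originIdeal ι).IsMaximal :=
  RingHom.ker_isMaximal_of_surjective _ fun c => ⟨C c, by simp⟩

lemma originIdeal_le {p : Ideal (MvPolynomial ι ℂ)} (h : ∀ i, X i ∈ p) : originIdeal ι ≤ p := by
  intro f hf
  have h1 : f ∈ Ideal.span (X '' (Set.univ : Set ι) : Set (MvPolynomial ι ℂ)) := by
    rw [mem_ideal_span_X_image]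
    intro s hs
    by_contra! hcon
    have hs0 : s = 0 := by ext i; simpa using hcon i
    subst hs0
    rw [mem_support_iff] at hs
    apply hs
    have : eval (0 : ι → ℂ) f = 0 := hf
    rwa [eval_zero, constantCoeff_eq] at this
  refine Ideal.span_le.mpr ?_ h1
  rintro _ ⟨i, -, rfl⟩
  exact h i

lemma exists_linForm_notMem (s : Finset (Ideal (MvPolynomial ι ℂ)))
    (hs : ∀ p ∈ s, ∃ i, X i ∉ p) : ∃ a : ι → ℂ, ∀ p ∈ s, linForm a ∉ p := by
  let φ : (ι → ℂ) →ₗ[ℂ] MvPolynomial ι ℂ :=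
    { toFun := linForm
      map_add' := fun a b => by simp [linForm, add_mul, Finset.sum_add_distrib]
      map_smul' := fun c a => by simp [linForm, Finset.smul_sum, smul_eq_C_mul, mul_assoc] }
  let T : Finset (Subspace ℂ (ι → ℂ)) :=
    s.image fun p => (p.restrictScalars ℂ).comap φ
  have hT : ⊤ ∉ T := by
    intro h
    obtain ⟨p, hp, hp'⟩ := Finset.mem_image.mp h
    obtain ⟨i, hi⟩ := hs p hp
    apply hi
    have : (Pi.single i 1 : ι → ℂ) ∈ (p.restrictScalars ℂ).comap φ := by rw [hp']; trivial
    have h2 : linForm (Pi.single i 1 : ι → ℂ) ∈ p := this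
    have h3 : linForm (Pi.single i 1 : ι → ℂ) = X i := by
      unfold linForm
      rw [Finset.sum_eq_single i]
      · simp
      · intro j _ hj; simp [hj]
      · simp
    rwa [h3] at h2
  have hne := Subspace.biUnion_ne_univ_of_top_notMem hT
  obtain ⟨a, ha⟩ := (Set.ne_univ_iff_exists_notMem _).mp hne
  refine ⟨a, fun p hp hmem => ha ?_⟩
  simp only [Set.mem_iUnion]
  exact ⟨_, Finset.mem_image_of_mem _ hp, hmem⟩

lemma exists_linForm_krullDim_le {I : Ideal (MvPolynomial ι ℂ)} {D : ℕ}
    (hI : Order.krullDim (PrimeSpectrum.zeroLocus (I : Set (MvPolynomial ι ℂ))) ≤ ((D + 1 : ℕ) : ℕ∞)) :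
    ∃ a : ι → ℂ, Order.krullDim (PrimeSpectrum.zeroLocus
      ((I ⊔ Ideal.span {linForm a} : Ideal _) : Set (MvPolynomial ι ℂ))) ≤ ((D : ℕ) : ℕ∞) := by
  have hfin := I.finite_minimalPrimes_of_isNoetherianRing (MvPolynomial ι ℂ)
  obtain ⟨a, ha⟩ := exists_linForm_notMem (hfin.toFinset.filter fun p => ∃ i, X i ∉ p)
    (fun p hp => (Finset.mem_filter.mp hp).2)
  refine ⟨a, ?_⟩
  set J := I ⊔ Ideal.span {linForm a} with hJ
  rw [Order.krullDim]
  refine iSup_le fun p => ?_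
  by_cases hp0 : p.length = 0
  · rw [hp0]; exact_mod_cast Nat.zero_le D
  have hIJ : ∀ q : PrimeSpectrum.zeroLocus (J : Set (MvPolynomial ι ℂ)), I ≤ q.1.asIdeal :=
    fun q => le_trans le_sup_left q.2
  let toI : PrimeSpectrum.zeroLocus (J : Set (MvPolynomial ι ℂ)) →
      PrimeSpectrum.zeroLocus (I : Set (MvPolynomial ι ℂ)) := fun q => ⟨q.1, hIJ q⟩
  have hmono : StrictMono toI := fun q q' h => h
  obtain ⟨p0, hp0min, hp0le⟩ := Ideal.exists_minimalPrimes_le (hIJ p.head)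
  have hp0prime : p0.IsPrime := hp0min.1.1
  have hX : ∃ i, X i ∉ p0 := by
    by_contra! hcon
    have h1 : originIdeal ι ≤ p0 := originIdeal_le hcon
    have hmax := originIdeal_isMaximal (ι := ι)
    have h2 : originIdeal ι = p.head.1.asIdeal :=
      hmax.eq_of_le p.head.1.2.ne_top (h1.trans hp0le)
    have h3 : originIdeal ι = (p ⟨1, by omega⟩).1.asIdeal := by
      refine hmax.eq_of_le (p ⟨1, by omega⟩).1.2.ne_top ?_
      rw [h2]
      exact p.monotone (a := 0) (b := ⟨1, by omega⟩) (by simp)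
    have h4 : p.head < p ⟨1, by omega⟩ := p.strictMono (a := 0) (b := ⟨1, by omega⟩)
      (by simp [Fin.lt_def])
    apply h4.ne
    apply Subtype.ext
    apply PrimeSpectrum.ext
    rw [← h2, h3]
  have hnot : linForm a ∉ p0 := ha p0 (by simp [hp0min, hX])
  have hin : linForm a ∈ p.head.1.asIdeal :=
    p.head.2 (Ideal.mem_sup_right (Ideal.subset_span rfl) : linForm a ∈ J)
  let q0 : PrimeSpectrum.zeroLocus (I : Set (MvPolynomial ι ℂ)) := ⟨⟨p0, hp0prime⟩, hp0min.1.2⟩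
  have hlt : q0 < (p.map toI hmono).head := by
    refine lt_of_le_of_ne hp0le ?_
    intro h
    apply hnot
    have : p0 = p.head.1.asIdeal := congrArg (fun q => q.1.asIdeal) h
    rw [this]; exact hin
  have hlen := Order.LTSeries.length_le_krullDim ((p.map toI hmono).cons q0 hlt)
  have h5 := hlen.trans hI
  have h6 : ((p.map toI hmono).cons q0 hlt).length = p.length + 1 := by
    simp [LTSeries.map]
  rw [h6] at h5
  have h7 : p.length + 1 ≤ D + 1 := by exact_mod_cast h5
  exact_mod_cast Nat.le_of_succ_le_succ h7

lemma exists_linForms_krullDim_le {I : Ideal (MvPolynomial ι ℂ)} {D : ℕ}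
    (hI : Order.krullDim (PrimeSpectrum.zeroLocus (I : Set (MvPolynomial ι ℂ))) ≤ ((D : ℕ) : ℕ∞)) :
    ∃ a : Fin D → ι → ℂ, Order.krullDim (PrimeSpectrum.zeroLocus
      ((I ⊔ Ideal.span (Set.range fun c => linForm (a c)) : Ideal _) :
        Set (MvPolynomial ι ℂ))) ≤ ((0 : ℕ) : ℕ∞) := by
  induction D generalizing I with
  | zero =>
    refine ⟨Fin.elim0, ?_⟩
    rw [Set.range_eq_empty, Ideal.span_empty, sup_bot_eq]
    exact hI
  | succ D ih =>
    obtain ⟨a0, ha0⟩ := exists_linForm_krullDim_le hI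
    obtain ⟨a, ha⟩ := ih ha0
    refine ⟨Fin.cons a0 a, ?_⟩
    have : (Set.range fun c => linForm ((Fin.cons a0 a : Fin (D + 1) → ι → ℂ) c)) =
        {linForm a0} ∪ Set.range fun c => linForm (a c) := by
      ext f
      simp only [Set.mem_range, Fin.exists_fin_succ, Fin.cons_zero, Fin.cons_succ,
        Set.mem_union, Set.mem_singleton_iff]
      exact or_congr eq_comm Iff.rfl
    rw [this, Ideal.span_union, ← sup_assoc]
    exact ha

/-- Restriction of polynomials to the line through `v`. -/
def lineHom (v : ι → ℂ) : MvPolynomial ι ℂ →ₐ[ℂ] Polynomial ℂ :=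
  aeval fun i => Polynomial.C (v i) * Polynomial.X

lemma lineHom_of_isHomogeneous (v : ι → ℂ) {f : MvPolynomial ι ℂ} {e : ℕ}
    (hf : f.IsHomogeneous e) : lineHom v f = Polynomial.C (eval v f) * Polynomial.X ^ e := by
  conv_lhs => rw [f.as_sum]
  conv_rhs => rw [f.as_sum]
  simp only [map_sum, Finset.sum_mul]
  refine Finset.sum_congr rfl fun s hs => ?_
  have hse : s.degree = e := by
    by_contra h
    exact (mem_support_iff.mp hs) (hf.coeff_eq_zero h)
  rw [lineHom, aeval_monomial, eval_monomial, Finsupp.prod_fintype _ _ (by simp),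
    Finsupp.prod_fintype _ _ (by simp)]
  simp only [mul_pow, Finset.prod_mul_distrib, Finset.prod_pow_eq_pow_sum]
  rw [← Finsupp.degree_eq_sum, hse]
  simp only [Polynomial.algebraMap_apply, map_mul, map_prod, map_pow]
  simp [mul_assoc]

/-- If the common zero locus of homogeneous polynomials has dimension at most `D`, then it meets
some linear subspace of codimension `D` only in the origin. -/
lemma exists_linForms_only_zero {f : J → MvPolynomial ι ℂ} {e : J → ℕ}
    (hf : ∀ j, (f j).IsHomogeneous (e j)) {D : ℕ}
    (hD : ringKrullDim (MvPolynomial ι ℂ ⧸ Ideal.span (Set.range f)) ≤ ((D : ℕ) : ℕ∞)) :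
    ∃ a : Fin D → ι → ℂ, ∀ v : ι → ℂ, (∀ j, eval v (f j) = 0) →
      (∀ c, ∑ i, a c i * v i = 0) → v = 0 := by
  rw [ringKrullDim_quotient] at hD
  obtain ⟨a, ha⟩ := exists_linForms_krullDim_le hD
  refine ⟨a, fun v hv hav => ?_⟩
  by_contra hne
  obtain ⟨i, hi⟩ := Function.ne_iff.mp hne
  set J' := Ideal.span (Set.range f) ⊔ Ideal.span (Set.range fun c => linForm (a c)) with hJ'
  let P := RingHom.ker (lineHom v)
  have hPprime : P.IsPrime := RingHom.ker_isPrime _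
  have hJP : J' ≤ P := by
    refine sup_le (Ideal.span_le.mpr ?_) (Ideal.span_le.mpr ?_)
    · rintro _ ⟨j, rfl⟩
      change lineHom v (f j) = 0
      rw [lineHom_of_isHomogeneous v (hf j), hv j]; simp
    · rintro _ ⟨c, rfl⟩
      change lineHom v (linForm (a c)) = 0
      rw [lineHom_of_isHomogeneous v (linForm_isHomogeneous _), eval_linForm, hav c]; simp
  have hPM : P ≤ originIdeal ι := by
    intro g hg
    have h1 : lineHom v g = 0 := hg
    have h2 : (Polynomial.aeval (0 : ℂ)).comp (lineHom v) = (aeval (0 : ι → ℂ)) := by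
      ext j; simp [lineHom]
    have h3 := DFunLike.congr_fun h2 g
    rw [AlgHom.comp_apply, h1, map_zero] at h3
    change eval 0 g = 0
    rw [← aeval_eq_eval]; exact h3.symm
  have hM := originIdeal_isMaximal (ι := ι)
  let p1 : PrimeSpectrum.zeroLocus (J' : Set (MvPolynomial ι ℂ)) := ⟨⟨P, hPprime⟩, hJP⟩
  let p2 : PrimeSpectrum.zeroLocus (J' : Set (MvPolynomial ι ℂ)) :=
    ⟨⟨originIdeal ι, hM.isPrime⟩, hJP.trans hPM⟩
  have h12 : p1 ≤ p2 := hPM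
  have hmax := Order.krullDim_nonpos_iff_forall_isMax.mp
    (by simpa using ha : Order.krullDim (PrimeSpectrum.zeroLocus (J' : Set (MvPolynomial ι ℂ))) ≤ 0)
  have h21 : p2 ≤ p1 := hmax p1 h12
  have hX : (X i : MvPolynomial ι ℂ) ∈ P := h21 (by
    change eval 0 (X i) = 0
    simp)
  have h4 : lineHom v (X i) = 0 := hX
  simp only [lineHom, aeval_X, mul_eq_zero, Polynomial.X_ne_zero, or_false,
    Polynomial.C_eq_zero] at h4
  exact hi h4

end Krull

section Polar

variable {ι : Type} [Fintype ι] {R S : Type} [CommRing R] [CommRing S]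

/-- The `i`-th component of the multilinear form attached to the degree `k + 1` part of a
polynomial of degree at most `k + 1`. -/
def polar : (k : ℕ) → MvPolynomial ι R → ι → (Fin k → ι → R) → R
  | 0, G, i, _ => constantCoeff (pderiv i G)
  | k + 1, G, i, h => ∑ a, h 0 a * polar k (pderiv a G) i (Fin.tail h)

lemma pderiv_comm' (i j : ι) (G : MvPolynomial ι R) :
    pderiv i (pderiv j G) = pderiv j (pderiv i G) := by
  ext m
  simp only [coeff_pderiv]
  rw [add_right_comm]
  by_cases hij : i = j
  · subst hij; rfl
  · simp [hij, Ne.symm hij]; ring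

lemma polar_add (k : ℕ) (G H : MvPolynomial ι R) (i : ι) (h : Fin k → ι → R) :
    polar k (G + H) i h = polar k G i h + polar k H i h := by
  induction k generalizing G H with
  | zero => simp [polar]
  | succ k ih => simp [polar, ih, mul_add, Finset.sum_add_distrib]

lemma polar_C_mul (k : ℕ) (c : R) (G : MvPolynomial ι R) (i : ι) (h : Fin k → ι → R) :
    polar k (C c * G) i h = c * polar k G i h := by
  induction k generalizing G with
  | zero => simp [polar]
  | succ k ih =>
    simp only [polar, pderiv_C_mul, ih, Finset.mul_sum]
    exact Finset.sum_congr rfl fun _ _ => by ring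

lemma polar_zero (k : ℕ) (i : ι) (h : Fin k → ι → R) : polar k 0 i h = 0 := by
  have := polar_C_mul k (0 : R) 0 i h
  simpa using this

lemma polar_sum {α : Type*} (s : Finset α) (k : ℕ) (G : α → MvPolynomial ι R) (i : ι)
    (h : Fin k → ι → R) : polar k (∑ a ∈ s, G a) i h = ∑ a ∈ s, polar k (G a) i h := by
  induction s using Finset.induction_on with
  | empty => simp [polar_zero]
  | insert a s ha ih => rw [Finset.sum_insert ha, Finset.sum_insert ha, polar_add, ih]

lemma polar_map (φ : R →+* S) (k : ℕ) (G : MvPolynomial ι R) (i : ι) (h : Fin k → ι → R) :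
    polar k (map φ G) i (fun j a => φ (h j a)) = φ (polar k G i h) := by
  induction k generalizing G with
  | zero => simp [polar, pderiv_map, constantCoeff_map]
  | succ k ih =>
    simp only [polar, pderiv_map, map_sum, map_mul]
    refine Finset.sum_congr rfl fun a _ => ?_
    rw [← ih]
    rfl

lemma polar_pderiv_comm (k : ℕ) (G : MvPolynomial ι R) (i a : ι) (h : Fin k → ι → R) :
    polar k (pderiv a G) i h = polar k (pderiv i G) a h := by
  induction k generalizing G with
  | zero => simp only [polar]; rw [pderiv_comm']
  | succ k ih =>
    simp only [polar]
    refine Finset.sum_congr rfl fun b _ => ?_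
    rw [pderiv_comm' b a, ih, pderiv_comm' i b]

lemma polar_update_add (k : ℕ) (G : MvPolynomial ι R) (i : ι) (h : Fin k → ι → R) (j : Fin k)
    (u v : ι → R) :
    polar k G i (Function.update h j (u + v)) =
      polar k G i (Function.update h j u) + polar k G i (Function.update h j v) := by
  induction k generalizing G with
  | zero => exact j.elim0
  | succ k ih =>
    simp only [polar]
    rw [← Finset.sum_add_distrib]
    refine Finset.sum_congr rfl fun b _ => ?_
    refine Fin.cases ?_ (fun j => ?_) j
    · simp [add_mul]
    · simp only [Fin.tail_update_succ, ih, mul_add]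
      rw [Function.update_of_ne (Fin.succ_ne_zero j).symm,
        Function.update_of_ne (Fin.succ_ne_zero j).symm,
        Function.update_of_ne (Fin.succ_ne_zero j).symm]

lemma polar_symm (k : ℕ) (G : MvPolynomial ι R) (h : Fin k → ι → R) (j : Fin k)
    (u v : ι → R) :
    ∑ i, polar k G i (Function.update h j u) * v i =
      ∑ i, polar k G i (Function.update h j v) * u i := by
  induction k generalizing G with
  | zero => exact j.elim0
  | succ k ih =>
    simp only [polar]
    refine Fin.cases ?_ (fun j => ?_) j
    · simp only [Function.update_self, Finset.sum_mul, Fin.tail_update_zero]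
      rw [Finset.sum_comm]
      refine Finset.sum_congr rfl fun a _ => Finset.sum_congr rfl fun i _ => ?_
      rw [polar_pderiv_comm]
      ring
    · simp only [Fin.tail_update_succ, Finset.sum_mul]
      rw [Finset.sum_comm]
      conv_rhs => rw [Finset.sum_comm]
      refine Finset.sum_congr rfl fun a _ => ?_
      have := ih (pderiv a G) (Fin.tail h) j
      rw [Function.update_of_ne (Fin.succ_ne_zero j).symm,
        Function.update_of_ne (Fin.succ_ne_zero j).symm]
      simp only [mul_assoc, ← Finset.mul_sum]
      rw [this]

/-- Rescaling of the variables. -/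
def scaleVars (c : ι → R) (G : MvPolynomial ι R) : MvPolynomial ι R :=
  aeval (fun i => C (c i) * X i) G

lemma eval_scaleVars (c v : ι → R) (G : MvPolynomial ι R) :
    eval v (scaleVars c G) = eval (fun i => c i * v i) G := by
  induction G using MvPolynomial.induction_on with
  | C a => simp [scaleVars]
  | add p q hp hq => simp only [scaleVars, map_add] at *; rw [hp, hq]
  | mul_X p i hp =>
    simp only [scaleVars, map_mul, aeval_X, eval_C, eval_X] at *
    rw [hp]

lemma pderiv_scaleVars (c : ι → R) (i : ι) (G : MvPolynomial ι R) :
    pderiv i (scaleVars c G) = C (c i) * scaleVars c (pderiv i G) := by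
  induction G using MvPolynomial.induction_on with
  | C a => simp [scaleVars]
  | add p q hp hq => simp only [scaleVars, map_add, mul_add] at *; rw [hp, hq]
  | mul_X p j hp =>
    simp only [scaleVars, map_mul, aeval_X, pderiv_mul, map_add] at *
    rw [hp]
    by_cases hij : j = i
    · subst hij; simp; ring
    · rw [pderiv_X_of_ne hij]; simp; ring

lemma polar_scaleVars (k : ℕ) (c : ι → R) (G : MvPolynomial ι R) (i : ι) (h : Fin k → ι → R) :
    polar k (scaleVars c G) i h = c i * polar k G i (fun j a => c a * h j a) := by
  induction k generalizing G with
  | zero =>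
    simp only [polar, pderiv_scaleVars, map_mul, constantCoeff_C]
    rw [constantCoeff_eq, ← constantCoeff_eq, ← eval_zero, eval_scaleVars]
    have h0 : (fun i => c i * (0 : ι → R) i) = 0 := by ext; simp
    rw [h0]
  | succ k ih =>
    simp only [polar, pderiv_scaleVars, polar_C_mul, ih, Finset.mul_sum]
    refine Finset.sum_congr rfl fun a _ => ?_
    have : (fun (j : Fin k) b => c b * Fin.tail h j b) = Fin.tail fun j b => c b * h j b := rfl
    rw [this]; ring

lemma polar_diag (k : ℕ) {G : MvPolynomial ι R} (hG : G.IsHomogeneous (k + 1)) (i : ι)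
    (v : ι → R) : polar k G i (fun _ => v) = k.factorial * eval v (pderiv i G) := by
  induction k generalizing G with
  | zero =>
    have h1 : (pderiv i G).IsHomogeneous 0 := hG.pderiv
    have h2 := totalDegree_eq_zero_iff_eq_C.mp ((totalDegree_zero_iff_isHomogeneous _).mpr h1)
    simp only [polar]
    rw [h2]; simp
  | succ k ih =>
    simp only [polar]
    have h1 : ∀ a, polar k (pderiv a G) i (Fin.tail fun _ => v) =
        k.factorial * eval v (pderiv i (pderiv a G)) := fun a => ih (by simpa using hG.pderiv)
    simp only [h1]
    have h2 : (pderiv i G).IsHomogeneous (k + 1) := by simpa using hG.pderiv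
    have h3 := congrArg (eval v) h2.sum_X_mul_pderiv
    simp only [map_sum, map_mul, eval_X, map_nsmul] at h3
    have h4 : ∀ a, v a * (k.factorial * eval v (pderiv i (pderiv a G))) =
        k.factorial * (v a * eval v (pderiv a (pderiv i G))) := fun a => by
      rw [pderiv_comm']; ring
    simp only [h4, ← Finset.mul_sum, h3, Nat.factorial_succ]
    push_cast
    rw [nsmul_eq_mul]; push_cast; ring

lemma polar_isHomogeneous {σ : Type} (k : ℕ) (G : MvPolynomial ι S) (i : ι)
    (h : Fin k → ι → MvPolynomial σ S) (hh : ∀ j a, (h j a).IsHomogeneous 1) :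
    (polar k (map C G) i h).IsHomogeneous k := by
  induction k generalizing G with
  | zero =>
    simp only [polar, pderiv_map, constantCoeff_map]
    exact isHomogeneous_C _ _
  | succ k ih =>
    simp only [polar, pderiv_map]
    refine IsHomogeneous.sum _ _ _ fun a _ => ?_
    have := (hh 0 a).mul (ih (pderiv a G) (Fin.tail h) fun j a => hh j.succ a)
    rwa [add_comm 1 k] at this

/-- All monomials of `P` have degree smaller than `n`. -/
def DegLt (P : MvPolynomial ι R) (n : ℕ) : Prop := ∀ s, n ≤ s.degree → coeff s P = 0

lemma DegLt.mono {P : MvPolynomial ι R} {n m : ℕ} (h : DegLt P n) (hnm : n ≤ m) : DegLt P m :=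
  fun s hs => h s (hnm.trans hs)

lemma DegLt.add {P Q : MvPolynomial ι R} {n : ℕ} (hP : DegLt P n) (hQ : DegLt Q n) :
    DegLt (P + Q) n := fun s hs => by rw [coeff_add, hP s hs, hQ s hs, add_zero]

lemma DegLt.C_mul {P : MvPolynomial ι R} {n : ℕ} (c : R) (hP : DegLt P n) :
    DegLt (C c * P) n := fun s hs => by rw [coeff_C_mul, hP s hs, mul_zero]

lemma DegLt.zero (n : ℕ) : DegLt (0 : MvPolynomial ι R) n := fun s _ => coeff_zero s

lemma DegLt.sum {α : Type*} (s : Finset α) {P : α → MvPolynomial ι R} {n : ℕ}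
    (hP : ∀ a ∈ s, DegLt (P a) n) : DegLt (∑ a ∈ s, P a) n := fun t ht => by
  rw [coeff_sum]
  exact Finset.sum_eq_zero fun a ha => hP a ha t ht

lemma DegLt.eq_zero {P : MvPolynomial ι R} (h : DegLt P 0) : P = 0 := by
  ext s; rw [h s (Nat.zero_le _), coeff_zero]

lemma DegLt.X_mul {P : MvPolynomial ι R} {n : ℕ} (i : ι) (hP : DegLt P n) :
    DegLt (X i * P) (n + 1) := fun s hs => by
  rw [coeff_X_mul']
  split_ifs with h
  · apply hP
    have h1 : 1 ≤ s i := Nat.one_le_iff_ne_zero.mpr (Finsupp.mem_support_iff.mp h)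
    have h2 : s - Finsupp.single i 1 + Finsupp.single i 1 = s :=
      tsub_add_cancel_of_le (by simpa [Finsupp.single_le_iff] using h1)
    have h3 := congrArg Finsupp.degree h2
    rw [map_add, Finsupp.degree_single] at h3
    omega
  · rfl

lemma DegLt.pderiv {P : MvPolynomial ι R} {n : ℕ} (i : ι) (hP : DegLt P (n + 1)) :
    DegLt (pderiv i P) n := fun s hs => by
  rw [coeff_pderiv, hP, zero_mul]
  rw [map_add, Finsupp.degree_single]; omega

lemma degLt_monomial (s : ι →₀ ℕ) (c : R) : DegLt (monomial s c) (s.degree + 1) := fun t ht => by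
  rw [coeff_monomial, if_neg]
  rintro rfl
  omega

/-- Translation of the variables. -/
def translate (h : ι → R) (P : MvPolynomial ι R) : MvPolynomial ι R :=
  aeval (fun i => X i + C (h i)) P

lemma eval_translate (h x : ι → R) (P : MvPolynomial ι R) :
    eval x (translate h P) = eval (x + h) P := by
  induction P using MvPolynomial.induction_on with
  | C a => simp [translate]
  | add p q hp hq => simp only [translate, map_add] at *; rw [hp, hq]
  | mul_X p i hp =>
    simp only [translate, map_mul, aeval_X, map_add, eval_C, eval_X] at *
    rw [hp]; simp

lemma translate_monomial_degLt (h : ι → R) (s : ι →₀ ℕ) (c : R) :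
    DegLt (translate h (monomial s c) - monomial s c) s.degree ∧
    DegLt (translate h (monomial s c) - monomial s c -
      ∑ i, C (h i) * pderiv i (monomial s c)) (s.degree - 1) := by
  induction hn : s.degree generalizing s with
  | zero =>
    obtain rfl := (Finsupp.degree_eq_zero_iff s).mp hn
    have : (monomial 0 c : MvPolynomial ι R) = C c := rfl
    rw [this]
    simp only [translate, algHom_C, algebraMap_eq, sub_self, pderiv_C, mul_zero,
      Finset.sum_const_zero]
    exact ⟨DegLt.zero _, DegLt.zero _⟩
  | succ n ih =>
    obtain ⟨i, hi⟩ : ∃ i, s i ≠ 0 := by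
      by_contra! hcon
      have : s = 0 := Finsupp.ext hcon
      simp [this] at hn
    obtain ⟨a, rfl⟩ : ∃ a, s = a + Finsupp.single i 1 :=
      ⟨s - Finsupp.single i 1, (tsub_add_cancel_of_le (by
        simpa [Finsupp.single_le_iff] using Nat.one_le_iff_ne_zero.mpr hi)).symm⟩
    have han : a.degree = n := by
      rw [map_add, Finsupp.degree_single] at hn; omega
    obtain ⟨h1, h2⟩ := ih a han
    set P : MvPolynomial ι R := monomial a c with hP
    have hmul : (monomial (a + Finsupp.single i 1) c : MvPolynomial ι R) = X i * P := by
      rw [hP, X, monomial_mul, add_comm, one_mul]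
    rw [hmul]
    have hPd : DegLt P (n + 1) := han ▸ degLt_monomial a c
    have e1 : translate h (X i * P) - X i * P =
        X i * (translate h P - P) + C (h i) * ((translate h P - P) + P) := by
      simp only [translate, map_mul, aeval_X]; ring
    have e2 : translate h (X i * P) - X i * P - ∑ j, C (h j) * pderiv j (X i * P) =
        X i * (translate h P - P - ∑ j, C (h j) * pderiv j P) +
          C (h i) * (translate h P - P) := by
      have e3 : ∑ j, C (h j) * pderiv j (X i * P) =
          C (h i) * P + X i * ∑ j, C (h j) * pderiv j P := by
        simp only [pderiv_mul, mul_add, Finset.sum_add_distrib, Finset.mul_sum]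
        congr 1
        · rw [Finset.sum_eq_single i]
          · simp
          · intro j _ hj
            rw [pderiv_X_of_ne hj.symm]; simp
          · simp
        · exact Finset.sum_congr rfl fun _ _ => by ring
      rw [e3, e1]; ring
    refine ⟨?_, ?_⟩
    · rw [e1]
      exact (h1.X_mul i).add (((h1.mono (Nat.le_succ n)).add hPd).C_mul _)
    · rw [e2]
      refine DegLt.add ?_ (h1.C_mul _)
      rcases Nat.eq_zero_or_pos n with h0 | h0
      · subst h0
        rw [h2.eq_zero, mul_zero]
        exact DegLt.zero _
      · exact (h2.X_mul i).mono (by omega)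

lemma translate_sub_degLt {P : MvPolynomial ι R} {n : ℕ} (h : ι → R) (hP : DegLt P (n + 1)) :
    DegLt (translate h P - P) n := by
  have : translate h P - P = ∑ s ∈ P.support,
      (translate h (monomial s (coeff s P)) - monomial s (coeff s P)) := by
    rw [Finset.sum_sub_distrib, ← P.as_sum]
    congr 1
    have := congrArg (translate h) P.as_sum
    simpa only [translate, map_sum] using this
  rw [this]
  refine DegLt.sum _ fun s hs => ((translate_monomial_degLt h s _).1).mono ?_
  by_contra hcon
  exact (mem_support_iff.mp hs) (hP s (by omega))

lemma translate_sub_sub_degLt {P : MvPolynomial ι R} {n : ℕ} (h : ι → R)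
    (hP : DegLt P (n + 2)) :
    DegLt (translate h P - P - ∑ i, C (h i) * pderiv i P) n := by
  have : translate h P - P - ∑ i, C (h i) * pderiv i P = ∑ s ∈ P.support,
      (translate h (monomial s (coeff s P)) - monomial s (coeff s P) -
        ∑ i, C (h i) * pderiv i (monomial s (coeff s P))) := by
    rw [Finset.sum_sub_distrib, Finset.sum_sub_distrib, ← P.as_sum, Finset.sum_comm]
    congr 1
    · congr 1
      have := congrArg (translate h) P.as_sum
      simpa only [translate, map_sum] using this
    · refine Finset.sum_congr rfl fun i _ => ?_
      rw [← Finset.mul_sum, ← map_sum, ← P.as_sum]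
  rw [this]
  refine DegLt.sum _ fun s hs => ((translate_monomial_degLt h s _).2).mono ?_
  by_contra hcon
  exact (mem_support_iff.mp hs) (hP s (by omega))

lemma polar_eq_zero_of_degLt (k : ℕ) {P : MvPolynomial ι R} (hP : DegLt P (k + 1)) (i : ι)
    (h : Fin k → ι → R) : polar k P i h = 0 := by
  induction k generalizing P with
  | zero =>
    simp only [polar]
    rw [(hP.pderiv i).eq_zero, map_zero]
  | succ k ih =>
    simp only [polar]
    exact Finset.sum_eq_zero fun a _ => by rw [ih (hP.pderiv a), mul_zero]

/-- Iterated differences of a function. -/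
def iterDiff {M : Type} [AddCommGroup M] {A : Type} [AddCommGroup A] :
    (k : ℕ) → (M → A) → (Fin k → M) → M → A
  | 0, f, _ => f
  | k + 1, f, h => iterDiff k (fun x => f (x + h 0) - f x) (Fin.tail h)

/-- The `k`-fold difference of a polynomial of degree at most `k + 1` is affine linear. -/
lemma iterDiff_eval (k : ℕ) {G : MvPolynomial ι R} (hG : DegLt G (k + 2)) (h : Fin k → ι → R) :
    ∃ c, ∀ x, iterDiff k (fun x => eval x G) h x = ∑ i, polar k G i h * x i + c := by
  induction k generalizing G with
  | zero =>
    refine ⟨constantCoeff G, fun x => ?_⟩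
    simp only [iterDiff, polar]
    have h1 := (translate_sub_sub_degLt (n := 0) x hG).eq_zero
    have h2 := congrArg (eval (0 : ι → R)) h1
    simp only [map_sub, map_sum, map_mul, eval_C, eval_translate, map_zero, zero_add] at h2
    simp only [← eval_zero]
    rw [sub_sub, sub_eq_zero] at h2
    change eval x G = _
    rw [h2, add_comm]
    congr 1
    exact Finset.sum_congr rfl fun i _ => mul_comm _ _
  | succ k ih =>
    obtain ⟨c, hc⟩ := ih (G := translate (h 0) G - G) (translate_sub_degLt _ hG) (Fin.tail h)
    refine ⟨c, fun x => ?_⟩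
    have e1 : iterDiff (k + 1) (fun x => eval x G) h x =
        iterDiff k (fun x => eval x (translate (h 0) G - G)) (Fin.tail h) x := by
      simp only [iterDiff, map_sub, eval_translate]
    rw [e1, hc]
    congr 1
    refine Finset.sum_congr rfl fun i _ => ?_
    congr 1
    have h3 := translate_sub_sub_degLt (n := k + 1) (h 0) hG
    have h4 : translate (h 0) G - G = (translate (h 0) G - G -
        ∑ i, C (h 0 i) * pderiv i G) + ∑ i, C (h 0 i) * pderiv i G := by ring
    rw [h4, polar_add, polar_eq_zero_of_degLt k h3, zero_add, polar_sum]
    simp only [polar_C_mul, polar]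

end Polar

section Spec

variable {R S : Type} [CommRing R] [CommRing S]

/-- The variables `(𝐱, 𝐲)`. -/
abbrev VIdx (m r : ℕ) := Fin (r + 1) ⊕ Fin (m - r)

/-- The inclusion of the variables `(𝐱, 𝐲)` in the set of all variables. -/
def embIdx : VIdx m r → Idx n m r := Sum.elim Sum.inl (fun j => Sum.inr (Sum.inl j))

/-- The polynomial in `(𝐱, 𝐲)` obtained by specializing `𝐳`. -/
def spec (z : Fin (n - m + 1) → R) (F : MvPolynomial (Idx n m r) ℤ) :
    MvPolynomial (VIdx m r) R :=
  evalF F (fun i => X (Sum.inl i)) (fun j => X (Sum.inr j)) (fun k => C (z k))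

lemma map_evalF (φ : R →+* S) (F : MvPolynomial (Idx n m r) ℤ) (x : Fin (r + 1) → R)
    (y : Fin (m - r) → R) (z : Fin (n - m + 1) → R) :
    φ (evalF F x y z) = evalF F (fun i => φ (x i)) (fun j => φ (y j)) (fun k => φ (z k)) := by
  unfold evalF
  rw [map_aeval, aeval_def, coe_eval₂Hom]
  congr 1
  · exact Subsingleton.elim _ _
  · funext i
    rcases i with i | i | i <;> rfl

lemma map_spec (φ : R →+* S) (z : Fin (n - m + 1) → R) (F : MvPolynomial (Idx n m r) ℤ) :
    map φ (spec z F) = spec (fun k => φ (z k)) F := by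
  simp only [spec, map_evalF, map_X, map_C]

lemma eval_spec (v : VIdx m r → R) (z : Fin (n - m + 1) → R) (F : MvPolynomial (Idx n m r) ℤ) :
    eval v (spec z F) = evalF F (fun i => v (Sum.inl i)) (fun j => v (Sum.inr j)) z := by
  simp only [spec, map_evalF, eval_X, eval_C]

lemma pderiv_spec (i : VIdx m r) (z : Fin (n - m + 1) → R) (F : MvPolynomial (Idx n m r) ℤ) :
    pderiv i (spec z F) = spec z (pderiv (embIdx i) F) := by
  unfold spec evalF
  induction F using MvPolynomial.induction_on with
  | C a => simp
  | add p q hp hq => simp only [map_add, hp, hq]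
  | mul_X p j hp =>
    simp only [map_mul, aeval_X, pderiv_mul, map_add, hp]
    congr 2
    rcases i with i | i <;> rcases j with j | j | j <;>
      simp [embIdx, pderiv_X, Pi.single_apply]

lemma isHomogeneous_of_scale {ι : Type} (G : MvPolynomial ι R) (d : ℕ)
    (h : aeval (fun i => (Polynomial.X * Polynomial.C (X i) : Polynomial (MvPolynomial ι R))) G =
      Polynomial.X ^ d * Polynomial.C G) : G.IsHomogeneous d := by
  have key : ∀ P : MvPolynomial ι R, (aeval (fun i => (Polynomial.X * Polynomial.C (X i) :
      Polynomial (MvPolynomial ι R))) P).coeff d = homogeneousComponent d P := by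
    intro P
    have hmon : ∀ (s : ι →₀ ℕ) (a : R), aeval (fun i => (Polynomial.X * Polynomial.C (X i) :
        Polynomial (MvPolynomial ι R))) (monomial s a) =
        Polynomial.X ^ s.degree * Polynomial.C (monomial s a) := by
      intro s a
      rw [aeval_monomial, monomial_eq, Finsupp.prod, Finsupp.prod, Finsupp.degree_apply,
        map_mul, map_prod]
      simp only [mul_pow, Finset.prod_mul_distrib, Finset.prod_pow_eq_pow_sum, map_pow]
      have : (algebraMap R (Polynomial (MvPolynomial ι R))) a = Polynomial.C (C a) := rfl
      rw [this]
      ring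
    induction P using MvPolynomial.induction_on' with
    | monomial s a =>
      rw [hmon, Polynomial.coeff_X_pow_mul']
      ext t
      rw [coeff_homogeneousComponent]
      by_cases hts : s = t
      · subst hts
        split_ifs with h1 h2 h2
        · rw [h2, Nat.sub_self, Polynomial.coeff_C_zero]
        · rw [Polynomial.coeff_C, if_neg (by omega), coeff_zero]
        · omega
        · rfl
      · have : coeff t (monomial s a) = 0 := by rw [coeff_monomial, if_neg hts]
        rw [this, ite_self]
        split_ifs
        · rw [Polynomial.coeff_C]
          split_ifs
          · exact this
          · exact coeff_zero _
        · exact coeff_zero _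
    | add p q hp hq => rw [map_add, Polynomial.coeff_add, hp, hq, map_add]
  have h1 := key G
  rw [h, Polynomial.coeff_X_pow_mul', if_pos le_rfl, Nat.sub_self, Polynomial.coeff_C_zero] at h1
  rw [h1]
  exact homogeneousComponent_isHomogeneous d G

lemma spec_isHomogeneous {F : MvPolynomial (Idx n m r) ℤ} {d₁ d₂ : ℕ}
    (hF : Bihomogeneous F d₁ d₂) (z : Fin (n - m + 1) → R) : (spec z F).IsHomogeneous d₁ := by
  apply isHomogeneous_of_scale
  have h := hF (Polynomial (MvPolynomial (VIdx m r) R)) Polynomial.X 1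
    (fun i => Polynomial.C (X (Sum.inl i))) (fun j => Polynomial.C (X (Sum.inr j)))
    (fun k => Polynomial.C (C (z k)))
  simp only [one_pow, mul_one, one_mul] at h
  rw [← map_evalF Polynomial.C F] at h
  rw [show Polynomial.C (spec z F) = _ from rfl, spec, ← h]
  rw [← AlgHom.coe_toRingHom, map_evalF]
  simp only [AlgHom.coe_toRingHom, aeval_X, aeval_C]
  rfl

lemma scaleVars_spec {F : MvPolynomial (Idx n m r) ℤ} {d₁ d₂ : ℕ}
    (hF : Bihomogeneous F d₁ d₂) (l : R) (z : Fin (n - m + 1) → R) :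
    scaleVars (Sum.elim (fun _ => 1) (fun _ => l)) (spec (fun k => l * z k) F) =
      C (l ^ d₂) * spec z F := by
  have h := hF (MvPolynomial (VIdx m r) R) 1 (C l)
    (fun i => X (Sum.inl i)) (fun j => X (Sum.inr j)) (fun k => C (z k))
  simp only [one_pow, one_mul] at h
  unfold spec
  rw [map_pow, ← h, scaleVars, ← AlgHom.coe_toRingHom, map_evalF]
  simp only [AlgHom.coe_toRingHom, aeval_X, aeval_C, Sum.elim_inl, Sum.elim_inr, map_one,
    one_mul, algebraMap_eq, map_mul]

lemma subsZ_eq_spec (z : Fin (n - m + 1) → ℂ) (F : MvPolynomial (Idx n m r) ℤ) :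
    subsZ z F = spec z F := rfl

/-- `dimV1z` in terms of the partial derivatives of the specialized polynomial. -/
lemma dimV1z_eq (z : Fin (n - m + 1) → ℂ) (F : MvPolynomial (Idx n m r) ℤ) :
    dimV1z F z = ringKrullDim (MvPolynomial (VIdx m r) ℂ ⧸
      Ideal.span (Set.range fun i => pderiv i (spec z F))) := by
  have : (fun i : VIdx m r => pderiv i (spec z F)) =
      Sum.elim (fun i : Fin (r + 1) => subsZ z (pderiv (Sum.inl i) F))
        (fun j : Fin (m - r) => subsZ z (pderiv (Sum.inr (Sum.inl j)) F)) := by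
    funext i
    rcases i with i | i <;> simp [pderiv_spec, embIdx, subsZ_eq_spec]
  rw [this, Set.Sum.elim_range]
  rfl

lemma dimV1z_nonneg {F : MvPolynomial (Idx n m r) ℤ} {d₁ d₂ : ℕ}
    (hF : Bihomogeneous F d₁ d₂) (hd : 2 ≤ d₁) (z : Fin (n - m + 1) → ℂ) :
    0 ≤ dimV1z F z := by
  rw [dimV1z_eq]
  have hne : Ideal.span (Set.range fun i : VIdx m r => pderiv i (spec z F)) ≠ ⊤ := by
    have hle : Ideal.span (Set.range fun i : VIdx m r => pderiv i (spec z F)) ≤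
        RingHom.ker (constantCoeff (R := ℂ) (σ := VIdx m r)) := by
      rw [Ideal.span_le]
      rintro _ ⟨i, rfl⟩
      have h1 : (pderiv i (spec z F)).IsHomogeneous (d₁ - 1) := (spec_isHomogeneous hF z).pderiv
      change constantCoeff _ = 0
      rw [constantCoeff_eq]
      by_contra h
      have h2 := h1 h
      simp at h2
      omega
    intro htop
    rw [htop, top_le_iff] at hle
    exact RingHom.ker_ne_top _ hle
  have := Ideal.Quotient.nontrivial_iff.mpr hne
  exact ringKrullDim_nonneg_of_nontrivial

lemma dimV1z_le_of_mem_A1set {F : MvPolynomial (Idx n m r) ℤ} {d₁ d₂ : ℕ}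
    (hF : Bihomogeneous F d₁ d₂) (hd : 2 ≤ d₁) {mu D₁ : ℕ} {z : Fin (n - m + 1) → ℂ}
    (hz : z ∈ A1set F mu D₁) :
    ∃ D' : ℕ, D₁ + mu = D' + (n - m + 2) ∧ dimV1z F z ≤ ((D' : ℕ) : ℕ∞) := by
  have h0 := dimV1z_nonneg hF hd z
  have h1 : dimV1z F z + (((n - m + 1 : ℕ) : ℕ∞) : WithBot ℕ∞) <
    (((D₁ + mu : ℕ) : ℕ∞) : WithBot ℕ∞) := hz
  revert h0 h1
  generalize dimV1z F z = e
  intro h0 h1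
  induction e using WithBot.recBotCoe with
  | bot => simp at h0
  | coe e =>
    induction e using ENat.recTopCoe with
    | top => exact absurd h1 (by rw [← WithBot.coe_add]; simp)
    | coe e =>
      rw [← WithBot.coe_add, WithBot.coe_lt_coe] at h1
      norm_cast at h1
      refine ⟨D₁ + mu - (n - m + 2), by omega, ?_⟩
      norm_cast
      omega

end Spec

section Geometry

/-- The universal family of ideals used to count the zeros of the multilinear forms: the forms
themselves, the diagonal, and generic linear forms. -/
def polarFam (k : ℕ) (F : MvPolynomial (Idx n m r) ℤ) (D' : ℕ) :
    VIdx m r ⊕ ((Fin k × VIdx m r) ⊕ Fin D') →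
      MvPolynomial (Fin (k + 1) × VIdx m r)
        (MvPolynomial (Fin (n - m + 1) ⊕ (Fin D' × VIdx m r)) ℂ) :=
  Sum.elim (fun i => polar (k + 1) (map C (spec (fun c => X (Sum.inl c)) F)) i
      (fun j b => X (j, b)))
    (Sum.elim (fun jb => X (jb.1.succ, jb.2) - X (0, jb.2))
      (fun c => ∑ i, C (X (Sum.inr (c, i))) * X (0, i)))

lemma polarFam_isHomogeneous (k : ℕ) (F : MvPolynomial (Idx n m r) ℤ) (D' : ℕ)
    (j : VIdx m r ⊕ ((Fin k × VIdx m r) ⊕ Fin D')) :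
    (polarFam k F D' j).IsHomogeneous (Sum.elim (fun _ => k + 1) (fun _ => 1) j) := by
  rcases j with i | jb | c
  · exact polar_isHomogeneous (k + 1) (spec (fun c => X (Sum.inl c)) F) i (fun j b => X (j, b))
      fun j a => isHomogeneous_X _ (j, a)
  · change (X (jb.1.succ, jb.2) - X (0, jb.2) : MvPolynomial (Fin (k + 1) × VIdx m r)
      (MvPolynomial (Fin (n - m + 1) ⊕ (Fin D' × VIdx m r)) ℂ)).IsHomogeneous 1
    exact (isHomogeneous_X _ _).sub (isHomogeneous_X _ _)
  · change (∑ i, C (X (Sum.inr (c, i))) * X (0, i) : MvPolynomial (Fin (k + 1) × VIdx m r)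
      (MvPolynomial (Fin (n - m + 1) ⊕ (Fin D' × VIdx m r)) ℂ)).IsHomogeneous 1
    refine IsHomogeneous.sum _ _ _ fun i _ => ?_
    have := (isHomogeneous_C (Fin (k + 1) × VIdx m r) (X (Sum.inr (c, i)) :
      MvPolynomial (Fin (n - m + 1) ⊕ (Fin D' × VIdx m r)) ℂ)).mul
        (isHomogeneous_X _ ((0 : Fin (k + 1)), i))
    rw [zero_add] at this
    exact this

lemma map_polarFam (k : ℕ) (F : MvPolynomial (Idx n m r) ℤ) (D' : ℕ)
    (p : Fin (n - m + 1) ⊕ (Fin D' × VIdx m r) → ℂ)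
    (j : VIdx m r ⊕ ((Fin k × VIdx m r) ⊕ Fin D')) :
    map (eval p) (polarFam k F D' j) =
      Sum.elim (fun i => polar (k + 1) (map C (spec (fun c => p (Sum.inl c)) F)) i
        (fun j b => X (j, b)))
      (Sum.elim (fun jb => X (jb.1.succ, jb.2) - X (0, jb.2))
        (fun c => ∑ i, C (p (Sum.inr (c, i))) * X ((0 : Fin (k + 1)), i))) j := by
  rcases j with i | jb | c
  · simp only [polarFam, Sum.elim_inl]
    rw [← polar_map, map_map]
    have : (map (eval p)).comp (C : _ →+* MvPolynomial (Fin (k + 1) × VIdx m r)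
        (MvPolynomial (Fin (n - m + 1) ⊕ (Fin D' × VIdx m r)) ℂ)) = C.comp (eval p) := by
      ext <;> simp
    rw [this, ← map_map, map_spec]
    simp only [map_X, eval_X]
  · simp [polarFam]
  · simp [polarFam]

lemma eval_polar_X {σ ι : Type} [Fintype ι] (k : ℕ) (G : MvPolynomial ι ℂ) (i : ι)
    (g : Fin k → ι → σ) (v : σ → ℂ) :
    eval v (polar k (map C G) i (fun j b => X (g j b))) = polar k G i (fun j b => v (g j b)) := by
  rw [← polar_map, map_map]
  have : (eval v).comp (C : ℂ →+* MvPolynomial σ ℂ) = RingHom.id ℂ := by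
    ext; simp
  rw [this, map_id]
  simp

lemma exists_powMem_of_only_zero {σ τ J : Type} [Fintype σ] [Fintype τ] [Fintype J]
    (f : J → MvPolynomial σ (MvPolynomial τ ℂ)) (p : τ → ℂ)
    (h : ∀ v, (∀ j, eval v (map (eval p) (f j)) = 0) → v = 0) : ∃ t, PowMem f p t := by
  have h1 : ∀ a : σ, ∃ na : ℕ, (X a : MvPolynomial σ ℂ) ^ na ∈ famIdeal f p := by
    intro a
    have : (X a : MvPolynomial σ ℂ) ∈ vanishingIdeal ℂ (zeroLocus ℂ (famIdeal f p)) := by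
      rw [mem_vanishingIdeal_iff]
      intro v hv
      have : v = 0 := by
        apply h
        intro j
        have := (mem_zeroLocus_iff.mp hv) _ (Ideal.subset_span ⟨j, rfl⟩)
        simpa [aeval_eq_eval] using this
      rw [this]
      simp
    rwa [vanishingIdeal_zeroLocus_eq_radical] at this
  choose na hna using h1
  refine ⟨∑ a, na a + 1, fun s hs => ?_⟩
  obtain ⟨a, ha⟩ : ∃ a, na a ≤ s a := by
    by_contra! hcon
    have : ∑ a, s a ≤ ∑ a, na a := Finset.sum_le_sum fun a _ => (hcon a).le
    rw [Finsupp.degree_eq_sum] at hs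
    omega
  have hs2 : (monomial s (1 : ℂ)) = monomial (s - Finsupp.single a (na a)) 1 * X a ^ na a := by
    rw [X_pow_eq_monomial, monomial_mul, one_mul, tsub_add_cancel_of_le]
    simpa [Finsupp.single_le_iff] using ha
  rw [hs2]
  exact Ideal.mul_mem_left _ _ (hna a)

theorem exists_card_polar_zeros_le (k : ℕ) (F : MvPolynomial (Idx n m r) ℤ) (d₂ : ℕ)
    (hF : Bihomogeneous F (k + 2) d₂) (D' : ℕ) :
    ∃ Cc : ℕ, ∀ z : Fin (n - m + 1) → ℂ, dimV1z F z ≤ ((D' : ℕ) : ℕ∞) →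
      ∀ (R : ℕ), 1 ≤ R → ∀ (a : Fin (k + 1) × VIdx m r → ℤ)
      (S : Finset (Fin (k + 1) × VIdx m r → ℤ)),
      (∀ x ∈ S, ∀ i, polar (k + 1) (spec z F) i (fun j b => (x (j, b) : ℂ)) = 0) →
      (∀ x ∈ S, ∀ p, a p ≤ x p ∧ x p < a p + R) →
      S.card ≤ Cc * R ^ (k * Fintype.card (VIdx m r) + D') := by
  obtain ⟨t₀, ht₀⟩ := exists_uniform_powMem (f := polarFam k F D')
    (polarFam_isHomogeneous k F D')
  set N := Fintype.card (Fin (k + 1) × VIdx m r) with hN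
  set D := k * Fintype.card (VIdx m r) + D' with hD
  refine ⟨t₀ ^ N * (N + 1) ^ D, fun z hz R hR a S hS hSa => ?_⟩
  rw [dimV1z_eq] at hz
  have hhom : ∀ i : VIdx m r, (pderiv i (spec z F)).IsHomogeneous (k + 1) := fun i =>
    (spec_isHomogeneous hF z).pderiv
  obtain ⟨b, hb⟩ := exists_linForms_only_zero hhom hz
  set p : Fin (n - m + 1) ⊕ (Fin D' × VIdx m r) → ℂ := Sum.elim z (fun ci => b ci.1 ci.2) with hp
  have hpow : PowMem (polarFam k F D') p t₀ := by
    apply ht₀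
    apply exists_powMem_of_only_zero
    intro v hv
    simp only [map_polarFam] at hv
    have hdiag : ∀ j c, v (j, c) = v (0, c) := by
      intro j c
      refine Fin.cases rfl (fun j => ?_) j
      have := hv (Sum.inr (Sum.inl (j, c)))
      simpa [sub_eq_zero] using this
    have hzero : (fun c => v (0, c)) = 0 := by
      apply hb
      · intro i
        have := hv (Sum.inl i)
        simp only [Sum.elim_inl] at this
        rw [eval_polar_X] at this
        simp only [hdiag] at this
        rw [polar_diag (k + 1) (spec_isHomogeneous hF _)] at this
        have h2 := (mul_eq_zero.mp this).resolve_left (by exact_mod_cast Nat.factorial_ne_zero _)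
        exact h2
      · intro c
        have := hv (Sum.inr (Sum.inr c))
        simpa [hp] using this
    funext jc
    rw [← Prod.mk.eta (p := jc), hdiag]
    exact congrFun hzero _
  have e : Fin D ≃ (Fin k × VIdx m r) ⊕ Fin D' :=
    (Fintype.equivFinOfCardEq (by simp [hD])).symm
  set l : (Fin k × VIdx m r) ⊕ Fin D' → MvPolynomial (Fin (k + 1) × VIdx m r) ℂ :=
    fun j => map (eval p) (polarFam k F D' (Sum.inr j)) with hl
  have h1 := card_le_of_powMem (D := D)
    (f := fun i => map (eval p) (polarFam k F D' (Sum.inl i))) (e := fun _ => k + 1)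
    (fun i => (polarFam_isHomogeneous k F D' (Sum.inl i)).map _)
    (l := fun c => l (e c))
    (fun c => (polarFam_isHomogeneous k F D' (Sum.inr (e c))).map _) (t := t₀)
    (by
      intro s hs
      have h2 := hpow s hs
      have h3 : famIdeal (polarFam k F D') p =
          Ideal.span (Set.range fun i => map (eval p) (polarFam k F D' (Sum.inl i))) ⊔
          Ideal.span (Set.range fun c => l (e c)) := by
        rw [← Ideal.span_union, famIdeal]
        congr 1
        have h4 : (Set.range fun c => l (e c)) = Set.range l := e.surjective.range_comp l
        rw [h4, ← Set.Sum.elim_range]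
        congr 1
        funext j
        rcases j with j | j <;> rfl
      rwa [h3] at h2)
    S (by
      intro x hx i
      rw [map_polarFam]
      simp only [Sum.elim_inl]
      rw [eval_polar_X]
      exact hS x hx i) a R hSa
  refine h1.trans ?_
  rw [mul_assoc, ← mul_pow]
  gcongr
  nlinarith

end Geometry

section Packing

lemma card_le_of_separated {W : Type} [NormedAddCommGroup W] [NormedSpace ℝ W]
    [FiniteDimensional ℝ W] (T : Finset W) {δ : ℝ} (hδ : 0 < δ) (hT : ∀ x ∈ T, ‖x‖ ≤ 1)
    (hsep : ∀ x ∈ T, ∀ y ∈ T, x ≠ y → δ ≤ ‖x - y‖) :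
    (T.card : ℝ) ≤ ((2 + δ) / δ) ^ Module.finrank ℝ W := by
  borelize W
  let μ : Measure W := Measure.addHaar
  let A : Set W := ⋃ c ∈ T, Metric.ball c (δ / 2)
  have D : Set.Pairwise (T : Set W) (Function.onFun Disjoint fun c => Metric.ball c (δ / 2)) := by
    rintro c hc e he hce
    apply Metric.ball_disjoint_ball
    rw [dist_eq_norm]
    convert hsep c hc e he hce
    ring
  have A_subset : A ⊆ Metric.ball (0 : W) (1 + δ / 2) := by
    refine Set.iUnion₂_subset fun x hx => ?_
    apply Metric.ball_subset_ball'
    calc δ / 2 + dist x 0 ≤ δ / 2 + 1 := by rw [dist_zero_right]; gcongr; exact hT x hx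
      _ = 1 + δ / 2 := by ring
  have I : (T.card : ℝ≥0∞) * ENNReal.ofReal ((δ / 2) ^ Module.finrank ℝ W) *
      μ (Metric.ball 0 1) ≤
      ENNReal.ofReal ((1 + δ / 2) ^ Module.finrank ℝ W) * μ (Metric.ball 0 1) := by
    calc (T.card : ℝ≥0∞) * ENNReal.ofReal ((δ / 2) ^ Module.finrank ℝ W) * μ (Metric.ball 0 1)
        = μ A := by
          rw [measure_biUnion_finset D fun c _ => measurableSet_ball]
          simp only [μ.addHaar_ball_of_pos _ (half_pos hδ), Finset.sum_const, nsmul_eq_mul,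
            mul_assoc]
      _ ≤ μ (Metric.ball (0 : W) (1 + δ / 2)) := measure_mono A_subset
      _ = _ := by rw [μ.addHaar_ball_of_pos _ (by positivity)]
  have J : (T.card : ℝ≥0∞) * ENNReal.ofReal ((δ / 2) ^ Module.finrank ℝ W) ≤
      ENNReal.ofReal ((1 + δ / 2) ^ Module.finrank ℝ W) :=
    (ENNReal.mul_le_mul_iff_left (Metric.measure_ball_pos _ _ zero_lt_one).ne'
      measure_ball_lt_top.ne).1 I
  rw [← ENNReal.ofReal_natCast, ← ENNReal.ofReal_mul (by positivity),
    ENNReal.ofReal_le_ofReal_iff (by positivity)] at J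
  have h2 : (2 + δ) / δ = (1 + δ / 2) / (δ / 2) := by field_simp
  rw [h2, div_pow, le_div_iff₀ (by positivity)]
  exact J

lemma exists_maximal_separated {α W : Type} [NormedAddCommGroup W] (S : Finset α) (v : α → W)
    {δ : ℝ} (hδ : 0 < δ) :
    ∃ T ⊆ S, (∀ x ∈ T, ∀ y ∈ T, x ≠ y → δ ≤ ‖v x - v y‖) ∧
      ∀ x ∈ S, ∃ y ∈ T, ‖v x - v y‖ < δ := by
  let 𝒯 := S.powerset.filter fun T => ∀ x ∈ T, ∀ y ∈ T, x ≠ y → δ ≤ ‖v x - v y‖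
  have hne : 𝒯.Nonempty := ⟨∅, by simp [𝒯]⟩
  obtain ⟨T, hT, hmax⟩ := Finset.exists_max_image 𝒯 Finset.card hne
  simp only [𝒯, Finset.mem_filter, Finset.mem_powerset] at hT hmax
  refine ⟨T, hT.1, hT.2, fun x hx => ?_⟩
  by_contra! hcon
  have hxT : x ∉ T := fun h => by
    have := hcon x h
    simp at this
    linarith
  have := hmax (insert x T) ⟨Finset.insert_subset hx hT.1, by
    intro a ha b hb hab
    rw [Finset.mem_insert] at ha hb
    rcases ha with rfl | ha <;> rcases hb with rfl | hb
    · exact absurd rfl hab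
    · exact hcon b hb
    · rw [norm_sub_rev]; exact hcon a ha
    · exact hT.2 a ha b hb hab⟩
  rw [Finset.card_insert_of_notMem hxT] at this
  omega

variable {ι : Type} [Fintype ι]

/-- Distance to the nearest integer. -/
def nd (t : ℝ) : ℝ := |t - round t|

lemma nd_le (t : ℝ) (k : ℤ) : nd t ≤ |t - k| := round_le t k

lemma nd_nonneg (t : ℝ) : 0 ≤ nd t := abs_nonneg _

/-- The integer points of a box at which some linear forms are close to integers. -/
def nearPts (L : ι → (ι → ℤ) →+ ℝ) (p q : ι → ℝ) : Finset (ι → ℤ) :=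
  (Fintype.piFinset fun i => Finset.Icc (-⌊p i⌋) ⌊p i⌋).filter fun u => ∀ i, nd (L i u) ≤ q i

lemma abs_le_floor_iff (a : ℤ) (p : ℝ) : (-⌊p⌋ ≤ a ∧ a ≤ ⌊p⌋) ↔ |(a : ℝ)| ≤ p := by
  rw [abs_le]
  constructor
  · rintro ⟨h1, h2⟩
    have h3 := Int.le_floor.mp h2
    have h4 := Int.le_floor.mp (neg_le.mp h1)
    push_cast at h4
    exact ⟨by linarith, h3⟩
  · rintro ⟨h1, h2⟩
    exact ⟨by rw [neg_le]; apply Int.le_floor.mpr; push_cast; linarith, Int.le_floor.mpr h2⟩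

lemma mem_nearPts {L : ι → (ι → ℤ) →+ ℝ} {p q : ι → ℝ} {u : ι → ℤ} :
    u ∈ nearPts L p q ↔ (∀ i, |(u i : ℝ)| ≤ p i) ∧ ∀ i, nd (L i u) ≤ q i := by
  simp only [nearPts, Finset.mem_filter, Fintype.mem_piFinset, Finset.mem_Icc, abs_le_floor_iff]

/-- The vector of normalized coordinates and normalized fractional parts. -/
def nearVec (L : ι → (ι → ℤ) →+ ℝ) (p q : ι → ℝ) (u : ι → ℤ) : (ι → ℝ) × (ι → ℝ) :=
  (fun i => u i / p i, fun i => (L i u - round (L i u)) / q i)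

lemma norm_nearVec_le {L : ι → (ι → ℤ) →+ ℝ} {p q : ι → ℝ} (hp : ∀ i, 0 < p i)
    (hq : ∀ i, 0 < q i) {u : ι → ℤ} (hu : u ∈ nearPts L p q) : ‖nearVec L p q u‖ ≤ 1 := by
  rw [mem_nearPts] at hu
  rw [Prod.norm_def, max_le_iff, pi_norm_le_iff_of_nonneg zero_le_one,
    pi_norm_le_iff_of_nonneg zero_le_one]
  refine ⟨fun i => ?_, fun i => ?_⟩
  · simp only [nearVec, Real.norm_eq_abs, abs_div, abs_of_pos (hp i)]
    rw [div_le_one (hp i)]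
    exact hu.1 i
  · simp only [nearVec, Real.norm_eq_abs, abs_div, abs_of_pos (hq i)]
    rw [div_le_one (hq i)]
    exact hu.2 i

lemma sub_mem_nearPts {L : ι → (ι → ℤ) →+ ℝ} {p q : ι → ℝ} (hp : ∀ i, 0 < p i)
    (hq : ∀ i, 0 < q i) {u v : ι → ℤ} {ρ : ℝ} (hρ : 0 < ρ)
    (h : ‖nearVec L p q u - nearVec L p q v‖ ≤ 1 / ρ) :
    u - v ∈ nearPts L (fun i => p i / ρ) (fun i => q i / ρ) := by
  have h0 : (0 : ℝ) ≤ 1 / ρ := by positivity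
  rw [Prod.norm_def, max_le_iff, pi_norm_le_iff_of_nonneg h0, pi_norm_le_iff_of_nonneg h0] at h
  rw [mem_nearPts]
  refine ⟨fun i => ?_, fun i => ?_⟩
  · have := h.1 i
    simp only [nearVec, Prod.fst_sub, Pi.sub_apply, Real.norm_eq_abs, ← sub_div, abs_div,
      abs_of_pos (hp i)] at this
    rw [div_le_iff₀ (hp i)] at this
    simp only [Pi.sub_apply, Int.cast_sub]
    refine this.trans (le_of_eq ?_)
    ring
  · have := h.2 i
    simp only [nearVec, Prod.snd_sub, Pi.sub_apply, Real.norm_eq_abs, ← sub_div, abs_div,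
      abs_of_pos (hq i)] at this
    rw [div_le_iff₀ (hq i)] at this
    refine (nd_le _ (round (L i u) - round (L i v))).trans ?_
    rw [map_sub]
    push_cast
    refine le_trans (le_of_eq ?_) (this.trans (le_of_eq ?_))
    · congr 1; ring
    · ring

lemma card_nearPts_le_mul {L : ι → (ι → ℤ) →+ ℝ} {p q : ι → ℝ} (hp : ∀ i, 0 < p i)
    (hq : ∀ i, 0 < q i) {ρ : ℝ} (hρ : 0 < ρ) :
    ∃ T ⊆ nearPts L p q, (∀ x ∈ T, ∀ y ∈ T, x ≠ y →
        1 / ρ ≤ ‖nearVec L p q x - nearVec L p q y‖) ∧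
      (nearPts L p q).card ≤
        T.card * (nearPts L (fun i => p i / ρ) (fun i => q i / ρ)).card := by
  obtain ⟨T, hTS, hsep, hcov⟩ := exists_maximal_separated (nearPts L p q) (nearVec L p q)
    (δ := 1 / ρ) (by positivity)
  refine ⟨T, hTS, hsep, ?_⟩
  rw [← Finset.card_product]
  choose! g hg using hcov
  refine Finset.card_le_card_of_injOn (fun u => (g u, u - g u)) ?_ ?_
  · intro u hu
    have := hg u hu
    rw [Finset.mem_coe, Finset.mem_product]
    exact ⟨this.1, sub_mem_nearPts hp hq hρ this.2.le⟩
  · intro u _ v _ huv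
    simp only [Prod.mk.injEq] at huv
    have := huv.2
    rw [huv.1] at this
    exact sub_left_injective this

lemma card_le_of_separated_image {α W : Type} [NormedAddCommGroup W] [NormedSpace ℝ W]
    [FiniteDimensional ℝ W] (T : Finset α) (v : α → W) {ρ : ℝ} (hρ : 0 < ρ)
    (hT : ∀ x ∈ T, ‖v x‖ ≤ 1)
    (hsep : ∀ x ∈ T, ∀ y ∈ T, x ≠ y → 1 / ρ ≤ ‖v x - v y‖) :
    (T.card : ℝ) ≤ (1 + 2 * ρ) ^ Module.finrank ℝ W := by
  have hinj : Set.InjOn v T := fun x hx y hy hxy => by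
    by_contra hne
    have := hsep x hx y hy hne
    rw [hxy, sub_self, norm_zero] at this
    have : 0 < 1 / ρ := by positivity
    linarith
  rw [← Finset.card_image_of_injOn hinj]
  have := card_le_of_separated (T.image v) (δ := 1 / ρ) (by positivity)
    (by simpa using hT) (by
      intro a ha b hb hab
      rw [Finset.mem_image] at ha hb
      obtain ⟨x, hx, rfl⟩ := ha
      obtain ⟨y, hy, rfl⟩ := hb
      exact hsep x hx y hy fun h => hab (by rw [h]))
  convert this using 2
  field_simp
  ring

/-- An isotropic subspace of a symplectic space of dimension `2N` has dimension at most `N`. -/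
lemma finrank_le_of_isotropic (w : ι → ℝ) (hw : ∀ i, 0 < w i)
    (W : Submodule ℝ ((ι → ℝ) × (ι → ℝ)))
    (hW : ∀ x ∈ W, ∀ y ∈ W, ∑ i, w i * (x.1 i * y.2 i - x.2 i * y.1 i) = 0) :
    Module.finrank ℝ W ≤ Fintype.card ι := by
  let J : ((ι → ℝ) × (ι → ℝ)) →ₗ[ℝ] ((ι → ℝ) × (ι → ℝ)) →ₗ[ℝ] ℝ :=
    LinearMap.mk₂ ℝ (fun x y => ∑ i, w i * (x.1 i * y.2 i - x.2 i * y.1 i))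
      (by intro a b c; simp only [Prod.fst_add, Prod.snd_add, Pi.add_apply,
            ← Finset.sum_add_distrib]; exact Finset.sum_congr rfl fun _ _ => by ring)
      (by intro a b c; simp only [Prod.smul_fst, Prod.smul_snd, Pi.smul_apply, smul_eq_mul,
            Finset.mul_sum]; exact Finset.sum_congr rfl fun _ _ => by ring)
      (by intro a b c; simp only [Prod.fst_add, Prod.snd_add, Pi.add_apply,
            ← Finset.sum_add_distrib]; exact Finset.sum_congr rfl fun _ _ => by ring)
      (by intro a b c; simp only [Prod.smul_fst, Prod.smul_snd, Pi.smul_apply, smul_eq_mul,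
            Finset.mul_sum]; exact Finset.sum_congr rfl fun _ _ => by ring)
  have hJ : ∀ x y, J x y = ∑ i, w i * (x.1 i * y.2 i - x.2 i * y.1 i) := fun _ _ => rfl
  have hnd : LinearMap.BilinForm.Nondegenerate J := by
    have hrefl : LinearMap.IsRefl J := by
      intro x y h
      rw [hJ] at h ⊢
      rw [← neg_eq_zero, ← Finset.sum_neg_distrib, ← h]
      exact Finset.sum_congr rfl fun _ _ => by ring
    refine (LinearMap.IsRefl.nondegenerate_iff_separatingLeft hrefl).mpr ?_
    intro x hx
    have h1 : x.1 = 0 := by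
      ext i
      have := hx (0, Pi.single i 1)
      rw [hJ, Finset.sum_eq_single i] at this
      · simpa [(hw i).ne'] using this
      · intro j _ hj; simp [hj]
      · simp
    have h2 : x.2 = 0 := by
      ext i
      have := hx (Pi.single i 1, 0)
      rw [hJ, Finset.sum_eq_single i] at this
      · simpa [(hw i).ne'] using this
      · intro j _ hj; simp [hj]
      · simp
    exact Prod.ext h1 h2
  have h1 := LinearMap.BilinForm.finrank_orthogonal hnd W
  have h2 : W ≤ LinearMap.BilinForm.orthogonal J W := by
    intro x hx
    rw [LinearMap.BilinForm.mem_orthogonal_iff]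
    intro y hy
    exact hW y hy x hx
  have h3 := Submodule.finrank_mono h2
  rw [h1] at h3
  have h4 := W.finrank_le
  simp only [Module.finrank_prod, Module.finrank_fintype_fun_eq_card] at h3 h4
  omega

lemma card_nearPts_le_crude {L : ι → (ι → ℤ) →+ ℝ} {p q : ι → ℝ} (hp : ∀ i, 0 < p i)
    (hq : ∀ i, 0 < q i) {ρ : ℝ} (hρ : 0 < ρ) :
    ((nearPts L p q).card : ℝ) ≤ (1 + 2 * ρ) ^ (2 * Fintype.card ι) *
      (nearPts L (fun i => p i / ρ) (fun i => q i / ρ)).card := by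
  obtain ⟨T, hTS, hsep, hcard⟩ := card_nearPts_le_mul (L := L) hp hq hρ
  have h1 := card_le_of_separated_image T (nearVec L p q) hρ
    (fun x hx => norm_nearVec_le hp hq (hTS hx)) hsep
  simp only [Module.finrank_prod, Module.finrank_fintype_fun_eq_card, ← two_mul] at h1
  calc ((nearPts L p q).card : ℝ) ≤ T.card *
      (nearPts L (fun i => p i / ρ) (fun i => q i / ρ)).card := by exact_mod_cast hcard
    _ ≤ _ := by gcongr

lemma card_nearPts_le_symplectic {L : ι → (ι → ℤ) →+ ℝ} {p q : ι → ℝ} (hp : ∀ i, 0 < p i)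
    (hq : ∀ i, 0 < q i) (hsymm : ∀ u v, ∑ i, L i u * (v i : ℝ) = ∑ i, L i v * (u i : ℝ))
    (hpq : ∑ i, 2 * (p i * q i) < 1) {ρ : ℝ} (hρ : 0 < ρ) :
    ((nearPts L p q).card : ℝ) ≤ (1 + 2 * ρ) ^ Fintype.card ι *
      (nearPts L (fun i => p i / ρ) (fun i => q i / ρ)).card := by
  obtain ⟨T, hTS, hsep, hcard⟩ := card_nearPts_le_mul (L := L) hp hq hρ
  let W := Submodule.span ℝ (nearVec L p q '' (T : Set (ι → ℤ)))
  have hiso : ∀ x ∈ T, ∀ y ∈ T, ∑ i, p i * q i * ((nearVec L p q x).1 i * (nearVec L p q y).2 i -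
      (nearVec L p q x).2 i * (nearVec L p q y).1 i) = 0 := by
    intro x hx y hy
    have e1 : ∑ i, p i * q i * ((nearVec L p q x).1 i * (nearVec L p q y).2 i -
        (nearVec L p q x).2 i * (nearVec L p q y).1 i) =
        ((∑ i, (round (L i x) * y i - x i * round (L i y)) : ℤ) : ℝ) := by
      have e2 : ∀ i, p i * q i * ((nearVec L p q x).1 i * (nearVec L p q y).2 i -
        (nearVec L p q x).2 i * (nearVec L p q y).1 i) =
        (L i y * x i - L i x * y i) + (round (L i x) * y i - x i * round (L i y)) := by
        intro i
        have := (hp i).ne'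
        have := (hq i).ne'
        simp only [nearVec]
        field_simp
        ring
      simp only [e2, Finset.sum_add_distrib]
      rw [Finset.sum_sub_distrib, hsymm y x, sub_self, zero_add]
      push_cast
      rfl
    have e3 : |∑ i, p i * q i * ((nearVec L p q x).1 i * (nearVec L p q y).2 i -
        (nearVec L p q x).2 i * (nearVec L p q y).1 i)| < 1 := by
      refine lt_of_le_of_lt (Finset.abs_sum_le_sum_abs _ _) (lt_of_le_of_lt ?_ hpq)
      refine Finset.sum_le_sum fun i _ => ?_
      have hb : ∀ z ∈ T, |(nearVec L p q z).1 i| ≤ 1 ∧ |(nearVec L p q z).2 i| ≤ 1 := by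
        intro z hz
        have := norm_nearVec_le hp hq (hTS hz)
        rw [Prod.norm_def, max_le_iff] at this
        exact ⟨(norm_le_pi_norm (nearVec L p q z).1 i).trans this.1,
          (norm_le_pi_norm (nearVec L p q z).2 i).trans this.2⟩
      have hpq0 : 0 < p i * q i := mul_pos (hp i) (hq i)
      rw [abs_mul, abs_of_pos hpq0]
      have h1 := abs_sub ((nearVec L p q x).1 i * (nearVec L p q y).2 i)
        ((nearVec L p q x).2 i * (nearVec L p q y).1 i)
      rw [abs_mul, abs_mul] at h1
      have h2 := mul_le_one₀ (hb x hx).1 (abs_nonneg _) (hb y hy).2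
      have h3 := mul_le_one₀ (hb x hx).2 (abs_nonneg _) (hb y hy).1
      nlinarith
    rw [e1] at e3 ⊢
    rw [← Int.cast_abs] at e3
    have : |∑ i, (round (L i x) * y i - x i * round (L i y))| < 1 := by exact_mod_cast e3
    rw [Int.abs_lt_one_iff.mp this]
    simp
  have hW : Module.finrank ℝ W ≤ Fintype.card ι := by
    refine finrank_le_of_isotropic (fun i => p i * q i) (fun i => mul_pos (hp i) (hq i)) W ?_
    intro x hx y hy
    induction hx, hy using Submodule.span_induction₂ with
    | mem_mem x y hx hy =>
      obtain ⟨a, ha, rfl⟩ := hx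
      obtain ⟨b, hb, rfl⟩ := hy
      exact hiso a ha b hb
    | zero_left y hy => simp
    | zero_right x hx => simp
    | add_left x y z hx hy hz h1 h2 =>
      have := congrArg₂ (· + ·) h1 h2
      simp only [← Finset.sum_add_distrib, add_zero] at this
      rw [← this]
      refine Finset.sum_congr rfl fun i _ => ?_
      simp only [Prod.fst_add, Prod.snd_add, Pi.add_apply]; ring
    | add_right x y z hx hy hz h1 h2 =>
      have := congrArg₂ (· + ·) h1 h2
      simp only [← Finset.sum_add_distrib, add_zero] at this
      rw [← this]
      refine Finset.sum_congr rfl fun i _ => ?_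
      simp only [Prod.fst_add, Prod.snd_add, Pi.add_apply]; ring
    | smul_left c x y hx hy h =>
      have := congrArg (c * ·) h
      simp only [Finset.mul_sum, mul_zero] at this
      rw [← this]
      refine Finset.sum_congr rfl fun i _ => ?_
      simp only [Prod.smul_fst, Prod.smul_snd, Pi.smul_apply, smul_eq_mul]; ring
    | smul_right c x y hx hy h =>
      have := congrArg (c * ·) h
      simp only [Finset.mul_sum, mul_zero] at this
      rw [← this]
      refine Finset.sum_congr rfl fun i _ => ?_
      simp only [Prod.smul_fst, Prod.smul_snd, Pi.smul_apply, smul_eq_mul]; ring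
  have h1 := card_le_of_separated_image T.attach
    (fun x => (⟨nearVec L p q x, Submodule.subset_span ⟨x, x.2, rfl⟩⟩ : W)) hρ
    (fun x _ => norm_nearVec_le hp hq (hTS x.2))
    (fun x _ y _ hxy => hsep x x.2 y y.2 fun h => hxy (Subtype.ext h))
  rw [Finset.card_attach] at h1
  calc ((nearPts L p q).card : ℝ) ≤ T.card *
      (nearPts L (fun i => p i / ρ) (fun i => q i / ρ)).card := by exact_mod_cast hcard
    _ ≤ _ := by
      gcongr
      exact h1.trans (pow_le_pow_right₀ (by linarith) hW)

lemma nearPts_mono {L : ι → (ι → ℤ) →+ ℝ} {p q p' q' : ι → ℝ} (hp : ∀ i, p i ≤ p' i)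
    (hq : ∀ i, q i ≤ q' i) : nearPts L p q ⊆ nearPts L p' q' := fun u hu => by
  rw [mem_nearPts] at hu ⊢
  exact ⟨fun i => (hu.1 i).trans (hp i), fun i => (hu.2 i).trans (hq i)⟩

/-- Davenport's shrinking lemma. -/
lemma exists_card_nearPts_le (ι : Type) [Fintype ι] (κ : ℝ) (hκ : 0 ≤ κ) :
    ∃ Cc : ℝ, 0 < Cc ∧ ∀ (L : ι → (ι → ℤ) →+ ℝ) (p q : ι → ℝ), (∀ i, 0 < p i) → (∀ i, 0 < q i) →
      (∀ i, p i * q i ≤ κ) →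
      (∀ u v, ∑ i, L i u * (v i : ℝ) = ∑ i, L i v * (u i : ℝ)) → ∀ ρ : ℝ, 1 ≤ ρ →
      ((nearPts L p q).card : ℝ) ≤ Cc * ρ ^ Fintype.card ι *
        (nearPts L (fun i => p i / ρ) (fun i => q i / ρ)).card := by
  set N := Fintype.card ι with hN
  set ρ₀ : ℝ := 2 * (N + 1) * κ + 1 with hρ₀
  have hρ₀1 : 1 ≤ ρ₀ := by
    have : 0 ≤ 2 * ((N : ℝ) + 1) * κ := by positivity
    linarith
  refine ⟨(1 + 2 * ρ₀) ^ (2 * N) * 3 ^ N, by positivity, ?_⟩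
  intro L p q hp hq hpq hsymm ρ hρ
  have hρ0 : 0 < ρ := by linarith
  have hρ₀0 : 0 < ρ₀ := by linarith
  have hc := card_nearPts_le_crude (L := L) hp hq hρ₀0
  rcases le_total ρ ρ₀ with h | h
  · have hsub : nearPts L (fun i => p i / ρ₀) (fun i => q i / ρ₀) ⊆
        nearPts L (fun i => p i / ρ) (fun i => q i / ρ) :=
      nearPts_mono (fun i => div_le_div_of_nonneg_left (hp i).le hρ0 h)
        (fun i => div_le_div_of_nonneg_left (hq i).le hρ0 h)
    have h3 : (1 : ℝ) ≤ 3 ^ N * ρ ^ N :=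
      one_le_mul_of_one_le_of_one_le (one_le_pow₀ (by norm_num)) (one_le_pow₀ hρ)
    calc ((nearPts L p q).card : ℝ) ≤ (1 + 2 * ρ₀) ^ (2 * N) *
          (nearPts L (fun i => p i / ρ) (fun i => q i / ρ)).card := by
          refine hc.trans ?_
          gcongr
      _ = (1 + 2 * ρ₀) ^ (2 * N) * 1 *
          (nearPts L (fun i => p i / ρ) (fun i => q i / ρ)).card := by ring
      _ ≤ (1 + 2 * ρ₀) ^ (2 * N) * (3 ^ N * ρ ^ N) *
          (nearPts L (fun i => p i / ρ) (fun i => q i / ρ)).card := by gcongr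
      _ = _ := by ring
  · have hs := card_nearPts_le_symplectic (L := L) (p := fun i => p i / ρ₀)
      (q := fun i => q i / ρ₀) (fun i => div_pos (hp i) hρ₀0) (fun i => div_pos (hq i) hρ₀0)
      hsymm (by
        calc ∑ i, 2 * (p i / ρ₀ * (q i / ρ₀)) ≤ ∑ i : ι, 2 * κ / ρ₀ := by
              refine Finset.sum_le_sum fun i _ => ?_
              have e1 : 2 * (p i / ρ₀ * (q i / ρ₀)) = 2 * (p i * q i) / ρ₀ / ρ₀ := by
                field_simp
              rw [e1]
              have := mul_pos (hp i) (hq i)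
              calc 2 * (p i * q i) / ρ₀ / ρ₀ ≤ 2 * (p i * q i) / ρ₀ :=
                    div_le_self (by positivity) hρ₀1
                _ ≤ 2 * κ / ρ₀ := by gcongr; exact hpq i
          _ = N * (2 * κ) / ρ₀ := by
              rw [Finset.sum_const, Finset.card_univ, nsmul_eq_mul, ← hN]; ring
          _ < 1 := by
              rw [div_lt_one hρ₀0, hρ₀]
              nlinarith) (ρ := ρ / ρ₀) (by positivity)
    have e : ∀ x : ℝ, x / ρ₀ / (ρ / ρ₀) = x / ρ := fun x => by field_simp
    simp only [e] at hs
    have h3 : 1 + 2 * (ρ / ρ₀) ≤ 3 * ρ := by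
      have : ρ / ρ₀ ≤ ρ := div_le_self hρ0.le hρ₀1
      linarith
    calc ((nearPts L p q).card : ℝ) ≤ (1 + 2 * ρ₀) ^ (2 * N) *
          ((1 + 2 * (ρ / ρ₀)) ^ N *
            (nearPts L (fun i => p i / ρ) (fun i => q i / ρ)).card) := by
          refine hc.trans ?_
          gcongr
      _ ≤ (1 + 2 * ρ₀) ^ (2 * N) * ((3 * ρ) ^ N *
            (nearPts L (fun i => p i / ρ) (fun i => q i / ρ)).card) := by gcongr
      _ = _ := by rw [mul_pow]; ring

end Packing

section MultiShrink

variable {ι : Type} [Fintype ι]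

/-- The integer points `h` of a box for which the multiples `α Φ_i(h)` of the multilinear forms
are close to integers. -/
def multiPts (k : ℕ) (G : MvPolynomial ι ℤ) (α : ℝ) (p : Fin k → ι → ℝ) (q : ι → ℝ) :
    Finset (Fin k → ι → ℤ) :=
  (Fintype.piFinset fun j => Fintype.piFinset fun i => Finset.Icc (-⌊p j i⌋) ⌊p j i⌋).filter
    fun h => ∀ i, nd (α * (polar k G i h : ℤ)) ≤ q i

lemma mem_multiPts {k : ℕ} {G : MvPolynomial ι ℤ} {α : ℝ} {p : Fin k → ι → ℝ} {q : ι → ℝ}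
    {h : Fin k → ι → ℤ} :
    h ∈ multiPts k G α p q ↔
      (∀ j i, |(h j i : ℝ)| ≤ p j i) ∧ ∀ i, nd (α * (polar k G i h : ℤ)) ≤ q i := by
  simp only [multiPts, Finset.mem_filter, Fintype.mem_piFinset, Finset.mem_Icc, abs_le_floor_iff]

lemma multiPts_mono {k : ℕ} {G : MvPolynomial ι ℤ} {α : ℝ} {p p' : Fin k → ι → ℝ} {q q' : ι → ℝ}
    (hp : ∀ j i, p j i ≤ p' j i) (hq : ∀ i, q i ≤ q' i) :
    multiPts k G α p q ⊆ multiPts k G α p' q' := fun h hh => by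
  rw [mem_multiPts] at hh ⊢
  exact ⟨fun j i => (hh.1 j i).trans (hp j i), fun i => (hh.2 i).trans (hq i)⟩

/-- The linear forms obtained from the multilinear forms by fixing all but one variable. -/
def partialForm (k : ℕ) (G : MvPolynomial ι ℤ) (α : ℝ) (g : Fin k → ι → ℤ) (j : Fin k) (i : ι) :
    (ι → ℤ) →+ ℝ :=
  AddMonoidHom.mk' (fun u => α * (polar k G i (Function.update g j u) : ℤ)) fun u v => by
    rw [polar_update_add]; push_cast; ring

lemma partialForm_apply (k : ℕ) (G : MvPolynomial ι ℤ) (α : ℝ) (g : Fin k → ι → ℤ) (j : Fin k)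
    (i : ι) (u : ι → ℤ) :
    partialForm k G α g j i u = α * (polar k G i (Function.update g j u) : ℤ) := rfl

lemma partialForm_symm (k : ℕ) (G : MvPolynomial ι ℤ) (α : ℝ) (g : Fin k → ι → ℤ) (j : Fin k)
    (u v : ι → ℤ) : ∑ i, partialForm k G α g j i u * (v i : ℝ) =
      ∑ i, partialForm k G α g j i v * (u i : ℝ) := by
  simp only [partialForm_apply, mul_assoc, ← Finset.mul_sum]
  congr 1
  exact_mod_cast polar_symm k G g j u v

lemma card_multiPts_le_update {κ Cc : ℝ} (hCc : 0 < Cc)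
    (hshrink : ∀ (L : ι → (ι → ℤ) →+ ℝ) (p q : ι → ℝ), (∀ i, 0 < p i) → (∀ i, 0 < q i) →
      (∀ i, p i * q i ≤ κ) →
      (∀ u v, ∑ i, L i u * (v i : ℝ) = ∑ i, L i v * (u i : ℝ)) → ∀ ρ : ℝ, 1 ≤ ρ →
      ((nearPts L p q).card : ℝ) ≤ Cc * ρ ^ Fintype.card ι *
        (nearPts L (fun i => p i / ρ) (fun i => q i / ρ)).card)
    {k : ℕ} (G : MvPolynomial ι ℤ) (α : ℝ) (p : Fin k → ι → ℝ) (q : ι → ℝ) (j : Fin k)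
    (hp : ∀ i, 0 < p j i) (hq : ∀ i, 0 < q i) (hpq : ∀ i, p j i * q i ≤ κ) {ρ : ℝ} (hρ : 1 ≤ ρ) :
    ((multiPts k G α p q).card : ℝ) ≤ Cc * ρ ^ Fintype.card ι *
      (multiPts k G α (Function.update p j fun i => p j i / ρ) (fun i => q i / ρ)).card := by
  set S := multiPts k G α p q with hS
  set S' := multiPts k G α (Function.update p j fun i => p j i / ρ) (fun i => q i / ρ) with hS'
  let π : (Fin k → ι → ℤ) → (Fin k → ι → ℤ) := fun h => Function.update h j 0
  set B := S.image π ∪ S'.image π with hB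
  have h1 : S.card = ∑ g ∈ B, (S.filter fun h => π h = g).card :=
    Finset.card_eq_sum_card_fiberwise fun h hh =>
      Finset.mem_union_left _ (Finset.mem_image_of_mem _ hh)
  have h2 : S'.card = ∑ g ∈ B, (S'.filter fun h => π h = g).card :=
    Finset.card_eq_sum_card_fiberwise fun h hh =>
      Finset.mem_union_right _ (Finset.mem_image_of_mem _ hh)
  rw [h1, h2]
  push_cast
  rw [Finset.mul_sum]
  refine Finset.sum_le_sum fun g _ => ?_
  rcases (S.filter fun h => π h = g).eq_empty_or_nonempty with he | ⟨h0, hh0⟩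
  · rw [he]; simp only [Finset.card_empty, Nat.cast_zero]; positivity
  rw [Finset.mem_filter, hS, mem_multiPts] at hh0
  obtain ⟨⟨hbox, -⟩, hg⟩ := hh0
  have hg' : ∀ j', j' ≠ j → ∀ i, |(g j' i : ℝ)| ≤ p j' i := by
    intro j' hj' i
    rw [← hg]
    simp only [π, Function.update_of_ne hj']
    exact hbox j' i
  have hgj : g j = 0 := by rw [← hg]; simp [π]
  have c1 : (S.filter fun h => π h = g).card ≤ (nearPts (partialForm k G α g j) (p j) q).card := by
    have hup : ∀ h, π h = g → Function.update g j (h j) = h := by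
      intro h hh
      rw [← hh]
      simp [π]
    refine Finset.card_le_card_of_injOn (fun h => h j) ?_ ?_
    · intro h hh
      rw [Finset.mem_coe, Finset.mem_filter, hS, mem_multiPts] at hh
      rw [Finset.mem_coe, mem_nearPts]
      refine ⟨hh.1.1 j, fun i => ?_⟩
      rw [partialForm_apply, hup h hh.2]
      exact hh.1.2 i
    · intro h hh h' hh' heq
      rw [Finset.mem_coe, Finset.mem_filter] at hh hh'
      rw [← hup h hh.2, ← hup h' hh'.2]
      simp only at heq
      rw [heq]
  have c2 : (nearPts (partialForm k G α g j) (fun i => p j i / ρ) (fun i => q i / ρ)).card ≤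
      (S'.filter fun h => π h = g).card := by
    refine Finset.card_le_card_of_injOn (fun u => Function.update g j u) ?_ ?_
    · intro u hu
      rw [Finset.mem_coe, mem_nearPts] at hu
      rw [Finset.mem_coe, Finset.mem_filter, hS', mem_multiPts]
      refine ⟨⟨fun j' i => ?_, hu.2⟩, ?_⟩
      · by_cases hj' : j' = j
        · subst hj'
          simp only [Function.update_self]
          exact hu.1 i
        · simp only [Function.update_of_ne hj']
          exact hg' j' hj' i
      · simp only [π, Function.update_idem]
        rw [← hgj, Function.update_eq_self]
    · exact (Function.update_injective g j).injOn
  calc ((S.filter fun h => π h = g).card : ℝ)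
      ≤ (nearPts (partialForm k G α g j) (p j) q).card := by exact_mod_cast c1
    _ ≤ Cc * ρ ^ Fintype.card ι *
        (nearPts (partialForm k G α g j) (fun i => p j i / ρ) (fun i => q i / ρ)).card :=
        hshrink _ _ _ hp hq hpq (partialForm_symm k G α g j) ρ hρ
    _ ≤ _ := by gcongr

theorem exists_card_multiPts_le (ι : Type) [Fintype ι] (k : ℕ) :
    ∃ Cc : ℝ, 0 < Cc ∧ ∀ (G : MvPolynomial ι ℤ) (α : ℝ) (A : ι → ℝ), (∀ i, 0 < A i) →
      ∀ Z : ℝ, 0 < Z → Z ≤ 1 →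
      ((multiPts k G α (fun _ i => 6 * A i) (fun i => 1 / A i)).card : ℝ) ≤
        Cc * (Z⁻¹) ^ (Fintype.card ι * k) *
          (multiPts k G α (fun _ i => A i * Z) (fun i => Z ^ k / A i)).card := by
  obtain ⟨C₁, hC₁, hsh⟩ := exists_card_nearPts_le ι 6 (by norm_num)
  refine ⟨(C₁ * 6 ^ Fintype.card ι) ^ k, by positivity, ?_⟩
  intro G α A hA Z hZ hZ1
  set N := Fintype.card ι with hN
  set ρ : ℝ := 6 / Z with hρ
  have hρ1 : 1 ≤ ρ := by rw [hρ, le_div_iff₀ hZ]; linarith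
  have hρ0 : 0 < ρ := by linarith
  let pt : ℕ → Fin k → ι → ℝ := fun t j i => if (j : ℕ) < t then 6 * A i / ρ else 6 * A i
  have key : ∀ t ≤ k, ((multiPts k G α (fun _ i => 6 * A i) (fun i => 1 / A i)).card : ℝ) ≤
      (C₁ * ρ ^ N) ^ t * (multiPts k G α (pt t) (fun i => 1 / A i / ρ ^ t)).card := by
    intro t
    induction t with
    | zero => intro _; simp [pt]
    | succ t ih =>
      intro ht
      have h1 := card_multiPts_le_update hC₁ hsh G α (pt t) (fun i => 1 / A i / ρ ^ t) ⟨t, ht⟩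
        (fun i => by simp only [pt, lt_irrefl, if_false]; linarith [hA i])
        (fun i => by have := hA i; positivity)
        (fun i => by
          have := hA i
          simp only [pt, lt_irrefl, if_false]
          calc 6 * A i * (1 / A i / ρ ^ t) = 6 / ρ ^ t := by field_simp
            _ ≤ 6 := div_le_self (by norm_num) (one_le_pow₀ hρ1)) hρ1
      have e1 : (Function.update (pt t) ⟨t, ht⟩ fun i => pt t ⟨t, ht⟩ i / ρ) = pt (t + 1) := by
        funext j i
        by_cases hj : j = ⟨t, ht⟩
        · subst hj; simp [pt]
        · rw [Function.update_of_ne hj]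
          have : (j : ℕ) ≠ t := fun h => hj (Fin.ext h)
          simp only [pt]
          by_cases h2 : (j : ℕ) < t
          · rw [if_pos h2, if_pos (by omega)]
          · rw [if_neg h2, if_neg (by omega)]
      rw [e1] at h1
      have e2 : (fun i => 1 / A i / ρ ^ t / ρ) = fun i => 1 / A i / ρ ^ (t + 1) := by
        funext i; rw [pow_succ, div_div (1 / A i)]
      rw [e2] at h1
      calc ((multiPts k G α (fun _ i => 6 * A i) (fun i => 1 / A i)).card : ℝ)
          ≤ (C₁ * ρ ^ N) ^ t * (multiPts k G α (pt t) (fun i => 1 / A i / ρ ^ t)).card :=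
            ih (by omega)
        _ ≤ (C₁ * ρ ^ N) ^ t * (C₁ * ρ ^ N *
            (multiPts k G α (pt (t + 1)) (fun i => 1 / A i / ρ ^ (t + 1))).card) := by gcongr
        _ = _ := by rw [pow_succ]; ring
  refine (key k le_rfl).trans ?_
  have hsub : multiPts k G α (pt k) (fun i => 1 / A i / ρ ^ k) ⊆
      multiPts k G α (fun _ i => A i * Z) (fun i => Z ^ k / A i) := by
    refine multiPts_mono (fun j i => ?_) (fun i => ?_)
    · simp only [pt, j.2, if_true, hρ]
      apply le_of_eq; field_simp
    · have := hA i
      rw [hρ, div_pow]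
      calc 1 / A i / (6 ^ k / Z ^ k) = Z ^ k / A i / 6 ^ k := by field_simp
        _ ≤ Z ^ k / A i := div_le_self (by positivity) (one_le_pow₀ (by norm_num))
  calc (C₁ * ρ ^ N) ^ k * ((multiPts k G α (pt k) (fun i => 1 / A i / ρ ^ k)).card : ℝ)
      ≤ (C₁ * ρ ^ N) ^ k * (multiPts k G α (fun _ i => A i * Z) (fun i => Z ^ k / A i)).card := by
        gcongr
    _ = _ := by
      rw [hρ, div_eq_mul_inv, mul_pow 6 Z⁻¹, ← mul_assoc, mul_pow _ (Z⁻¹ ^ N), ← pow_mul]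

end MultiShrink

section Exponential

lemma eexp_eq (t : ℝ) : eexp t = Complex.exp ((2 * Real.pi * t : ℝ) * Complex.I) := by
  unfold eexp; congr 1; push_cast; ring

lemma norm_eexp (t : ℝ) : ‖eexp t‖ = 1 := by
  rw [eexp_eq, Complex.norm_exp_ofReal_mul_I]

lemma eexp_add (s t : ℝ) : eexp (s + t) = eexp s * eexp t := by
  unfold eexp; rw [← Complex.exp_add]; congr 1; push_cast; ring

lemma eexp_zero : eexp 0 = 1 := by simp [eexp]

lemma eexp_neg (t : ℝ) : eexp (-t) = (starRingEnd ℂ) (eexp t) := by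
  rw [eexp_eq, eexp_eq, ← Complex.exp_conj]
  congr 1
  rw [map_mul, Complex.conj_I, Complex.conj_ofReal]
  push_cast; ring

lemma eexp_int (k : ℤ) : eexp k = 1 := by
  unfold eexp
  rw [show (2 * Real.pi * Complex.I * ((k : ℝ) : ℂ) : ℂ) = k * (2 * Real.pi * Complex.I) by
    push_cast; ring]
  exact Complex.exp_int_mul_two_pi_mul_I k

lemma eexp_add_int (t : ℝ) (k : ℤ) : eexp (t + k) = eexp t := by
  rw [eexp_add, eexp_int, mul_one]

lemma eexp_sum {κ : Type} (s : Finset κ) (f : κ → ℝ) : eexp (∑ i ∈ s, f i) = ∏ i ∈ s, eexp (f i) := by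
  induction s using Finset.induction_on with
  | empty => simp [eexp_zero]
  | insert a s ha ih => rw [Finset.sum_insert ha, Finset.prod_insert ha, eexp_add, ih]

lemma eexp_mul_nat (t : ℝ) (k : ℕ) : eexp (t * k) = eexp t ^ k := by
  induction k with
  | zero => simp [eexp_zero]
  | succ k ih => rw [pow_succ, ← ih, ← eexp_add]; congr 1; push_cast; ring

lemma continuous_eexp : Continuous eexp := by
  unfold eexp; fun_prop

end Exponential

section Weyl

variable {ι : Type} [Fintype ι]

lemma norm_sq_box_le (L : ι → ℤ) (ψ : (ι → ℤ) → ℝ) (a b : ι → ℤ) (hab : ∀ i, b i - a i ≤ L i) :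
    ‖∑ x ∈ Finset.Icc a b, eexp (ψ x)‖ ^ 2 ≤ ∑ h ∈ Finset.Icc (-L) L,
      ‖∑ x ∈ Finset.Icc (a ⊔ (a - h)) (b ⊓ (b - h)), eexp (ψ (x + h) - ψ x)‖ := by
  have e1 : (∑ x ∈ Finset.Icc a b, eexp (ψ x)) *
      (starRingEnd ℂ) (∑ x ∈ Finset.Icc a b, eexp (ψ x)) =
      ∑ h ∈ Finset.Icc (-L) L,
        ∑ x ∈ Finset.Icc (a ⊔ (a - h)) (b ⊓ (b - h)), eexp (ψ (x + h) - ψ x) := by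
    rw [mul_comm, map_sum, Finset.sum_mul]
    have e2 : ∀ x ∈ Finset.Icc a b, (starRingEnd ℂ) (eexp (ψ x)) * ∑ y ∈ Finset.Icc a b, eexp (ψ y) =
        ∑ h ∈ (Finset.Icc (-L) L).filter (fun h => x + h ∈ Finset.Icc a b),
          eexp (ψ (x + h) - ψ x) := by
      intro x hx
      rw [Finset.mul_sum]
      refine Finset.sum_nbij' (fun y => y - x) (fun h => x + h) ?_ ?_ ?_ ?_ ?_
      · intro y hy
        simp only [Finset.mem_filter, Finset.mem_Icc, Pi.le_def] at hy hx ⊢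
        refine ⟨⟨fun i => ?_, fun i => ?_⟩, ?_⟩
        · have := hab i; have := hx.2 i; have := hy.1 i; simp only [Pi.neg_apply, Pi.sub_apply]; omega
        · have := hab i; have := hx.1 i; have := hy.2 i; simp only [Pi.sub_apply]; omega
        · simpa using hy
      · intro h hh
        exact (Finset.mem_filter.1 hh).2
      · intro y _; simp
      · intro h _; simp
      · intro y _
        rw [← eexp_neg, ← eexp_add]; congr 1; simp; ring
    rw [Finset.sum_congr rfl e2]
    refine Finset.sum_comm' fun x h => ?_
    simp only [Finset.mem_filter, Finset.mem_Icc, Pi.le_def, Pi.sub_apply, Pi.add_apply, sup_le_iff, le_inf_iff]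
    constructor
    · rintro ⟨⟨h1, h2⟩, h3, h4, h5⟩
      exact ⟨⟨⟨h1, fun i => by have := h4 i; omega⟩, ⟨h2, fun i => by have := h5 i; omega⟩⟩, h3⟩
    · rintro ⟨⟨h1, h2⟩, h3⟩
      exact ⟨⟨h1.1, h2.1⟩, h3, fun i => by have := h1.2 i; omega,
        fun i => by have := h2.2 i; omega⟩
  have e3 : ‖∑ x ∈ Finset.Icc a b, eexp (ψ x)‖ ^ 2 = ‖(∑ x ∈ Finset.Icc a b, eexp (ψ x)) *
      (starRingEnd ℂ) (∑ x ∈ Finset.Icc a b, eexp (ψ x))‖ := by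
    rw [norm_mul, RCLike.norm_conj, sq]
  rw [e3, e1]
  exact norm_sum_le _ _

lemma exists_weyl_differencing (L : ι → ℤ) (hL : ∀ i, 0 ≤ L i) (k : ℕ) (ψ : (ι → ℤ) → ℝ)
    (a b : ι → ℤ) (hab : ∀ i, b i - a i ≤ L i) :
    ∃ a' b' : (Fin k → ι → ℤ) → ι → ℤ, (∀ h i, b' h i - a' h i ≤ L i) ∧
      ‖∑ x ∈ Finset.Icc a b, eexp (ψ x)‖ ^ (2 ^ k) ≤
        ((Finset.Icc (-L) L).card : ℝ) ^ (2 ^ k - k - 1) *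
        ∑ h ∈ Fintype.piFinset fun _ : Fin k => Finset.Icc (-L) L,
          ‖∑ x ∈ Finset.Icc (a' h) (b' h), eexp (iterDiff k ψ h x)‖ := by
  induction k generalizing ψ a b with
  | zero =>
    refine ⟨fun _ => a, fun _ => b, fun _ => hab, ?_⟩
    simp [iterDiff]
  | succ k ih =>
    set 𝓗 := Finset.Icc (-L) L with h𝓗
    have hpos : (0 : ℝ) < 𝓗.card := by
      have : (0 : ι → ℤ) ∈ 𝓗 := by
        simp only [h𝓗, Finset.mem_Icc, Pi.le_def]
        exact ⟨fun i => by simpa using hL i, fun i => by simpa using hL i⟩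
      exact_mod_cast Finset.card_pos.2 ⟨0, this⟩
    have hstep : ∀ h0 : ι → ℤ, ∀ i, (b ⊓ (b - h0)) i - (a ⊔ (a - h0)) i ≤ L i := by
      intro h0 i
      have := hab i
      simp only [Pi.sup_apply, Pi.inf_apply, Pi.sub_apply]
      omega
    choose a' b' hab' hle using fun h0 : ι → ℤ =>
      ih (fun x => ψ (x + h0) - ψ x) _ _ (hstep h0)
    refine ⟨fun h => a' (h 0) (Fin.tail h), fun h => b' (h 0) (Fin.tail h),
      fun h i => hab' _ _ _, ?_⟩
    have h2k : k + 1 ≤ 2 ^ k := Nat.lt_two_pow_self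
    have e1 : ‖∑ x ∈ Finset.Icc a b, eexp (ψ x)‖ ^ (2 ^ (k + 1)) =
        (‖∑ x ∈ Finset.Icc a b, eexp (ψ x)‖ ^ 2) ^ (2 ^ k) := by
      rw [← pow_mul, pow_succ, mul_comm]
    set T : (ι → ℤ) → ℝ := fun h =>
      ‖∑ x ∈ Finset.Icc (a ⊔ (a - h)) (b ⊓ (b - h)), eexp (ψ (x + h) - ψ x)‖ with hT
    have e2 : (∑ h ∈ 𝓗, T h) ^ (2 ^ k) ≤ (𝓗.card : ℝ) ^ (2 ^ k - 1) * ∑ h ∈ 𝓗, T h ^ (2 ^ k) := by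
      obtain ⟨t, ht⟩ : ∃ t, 2 ^ k = t + 1 := ⟨2 ^ k - 1, by omega⟩
      rw [ht, Nat.add_sub_cancel]
      have h1 := pow_sum_div_card_le_sum_pow (s := 𝓗) (f := T) (n := t)
        (fun i _ => norm_nonneg _)
      rw [div_le_iff₀ (by positivity)] at h1
      linarith
    calc ‖∑ x ∈ Finset.Icc a b, eexp (ψ x)‖ ^ (2 ^ (k + 1))
        ≤ (∑ h ∈ 𝓗, T h) ^ (2 ^ k) := by
          rw [e1]; exact pow_le_pow_left₀ (by positivity) (norm_sq_box_le L ψ a b hab) _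
      _ ≤ _ := e2
      _ ≤ (𝓗.card : ℝ) ^ (2 ^ k - 1) * ∑ h0 ∈ 𝓗, ((𝓗.card : ℝ) ^ (2 ^ k - k - 1) *
          ∑ h ∈ Fintype.piFinset fun _ : Fin k => 𝓗,
          ‖∑ x ∈ Finset.Icc (a' h0 h) (b' h0 h), eexp (iterDiff k (fun x => ψ (x + h0) - ψ x) h x)‖) := by
          gcongr with h0 _
          exact hle h0
      _ = _ := by
          rw [← Finset.mul_sum, ← mul_assoc, ← pow_add]
          congr 1
          · congr 1; rw [pow_succ]; omega
          · rw [← Finset.sum_product']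
            refine Finset.sum_nbij' (fun p => Fin.cons p.1 p.2) (fun h => (h 0, Fin.tail h))
              ?_ ?_ ?_ ?_ ?_
            · rintro ⟨p, g⟩ hp
              rw [Finset.mem_product] at hp
              rw [Fintype.mem_piFinset]
              intro j
              refine Fin.cases ?_ (fun j => ?_) j
              · simpa using hp.1
              · simpa using Fintype.mem_piFinset.1 hp.2 j
            · intro h hh
              rw [Fintype.mem_piFinset] at hh
              rw [Finset.mem_product, Fintype.mem_piFinset]
              exact ⟨hh 0, fun j => hh j.succ⟩
            · rintro ⟨p, g⟩ _; simp
            · intro h _; simp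
            · rintro ⟨p, g⟩ _; simp [iterDiff]

lemma iterDiff_comp {M A B : Type} [AddCommGroup M] [AddCommGroup A] [AddCommGroup B] (g : A →+ B)
    (k : ℕ) (f : M → A) (h : Fin k → M) (x : M) :
    iterDiff k (fun x => g (f x)) h x = g (iterDiff k f h x) := by
  induction k generalizing f with
  | zero => rfl
  | succ k ih =>
    simp only [iterDiff]
    rw [← ih]
    simp only [map_sub]

lemma norm_sum_linear (c : ι → ℝ) (c0 : ℝ) (a b : ι → ℤ) :
    ‖∑ x ∈ Finset.Icc a b, eexp (∑ i, c i * x i + c0)‖ =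
      ∏ i, ‖∑ t ∈ Finset.Icc (a i) (b i), eexp (c i * t)‖ := by
  simp only [eexp_add, eexp_sum]
  rw [← Finset.sum_mul, norm_mul, norm_eexp, mul_one, ← norm_prod, Finset.prod_univ_sum]
  rfl

lemma norm_sub_one_ge (θ : ℝ) : 4 * nd θ ≤ ‖eexp θ - 1‖ := by
  have h1 : eexp θ = eexp (θ - round θ) := by
    rw [← eexp_add_int (θ - round θ) (round θ)]; congr 1; ring
  rw [h1, eexp_eq, mul_comm _ Complex.I, Complex.norm_exp_I_mul_ofReal_sub_one]
  set s := θ - round θ with hs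
  have hs1 : |s| ≤ 1 / 2 := abs_sub_round θ
  have hnd : nd θ = |s| := rfl
  rw [hnd, norm_mul]
  have h2 : ‖Real.sin (2 * Real.pi * s / 2)‖ = Real.sin (Real.pi * |s|) := by
    rw [Real.norm_eq_abs, show 2 * Real.pi * s / 2 = Real.pi * s by ring]
    have h4 : 0 ≤ Real.sin (Real.pi * |s|) :=
      Real.sin_nonneg_of_nonneg_of_le_pi (by positivity) (by nlinarith [Real.pi_pos, abs_nonneg s])
    rcases abs_cases s with ⟨h, _⟩ | ⟨h, _⟩
    · rw [h] at h4 ⊢; exact abs_of_nonneg h4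
    · rw [h] at h4 ⊢
      rw [mul_neg, Real.sin_neg] at h4 ⊢
      exact abs_of_nonpos (by linarith)
  rw [h2]
  have h3 := Real.mul_le_sin (x := Real.pi * |s|) (by positivity) (by nlinarith [Real.pi_pos])
  have h5 : 2 / Real.pi * (Real.pi * |s|) = 2 * |s| := by field_simp
  rw [h5] at h3
  simp only [Real.norm_eq_abs, Nat.abs_ofNat]
  linarith

lemma norm_sum_geom_le (θ : ℝ) (h : 0 < nd θ) (a b : ℤ) :
    ‖∑ t ∈ Finset.Icc a b, eexp (θ * t)‖ ≤ 1 / (2 * nd θ) := by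
  have h1 := norm_sub_one_ge θ
  have hpos : 0 < ‖eexp θ - 1‖ := by linarith
  have h2 : ∑ t ∈ Finset.Icc a b, eexp (θ * t) =
      eexp (θ * a) * ∑ j ∈ Finset.range (b + 1 - a).toNat, eexp θ ^ j := by
    rw [Int.Icc_eq_finset_map, Finset.sum_map, Finset.mul_sum]
    refine Finset.sum_congr rfl fun j _ => ?_
    rw [← eexp_mul_nat, ← eexp_add]
    congr 1
    simp; ring
  have h3 := geom_sum_mul (eexp θ) (b + 1 - a).toNat
  have h4 : ‖∑ j ∈ Finset.range (b + 1 - a).toNat, eexp θ ^ j‖ * ‖eexp θ - 1‖ ≤ 2 := by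
    rw [← norm_mul, h3]
    refine (norm_sub_le _ _).trans ?_
    rw [norm_pow, norm_eexp]; norm_num
  rw [h2, norm_mul, norm_eexp, one_mul, le_div_iff₀ (by linarith)]
  have h5 : 0 ≤ ‖∑ j ∈ Finset.range (b + 1 - a).toNat, eexp θ ^ j‖ := norm_nonneg _
  nlinarith

lemma nd_ge_of_fract (θ : ℝ) : min (Int.fract θ) (1 - Int.fract θ) ≤ nd θ :=
  le_of_eq (abs_sub_round_eq_min θ).symm

/-- The cell of the fractional part of `θ` when the unit interval is cut into `Q` pieces. -/
def cell (Q : ℕ) (θ : ℝ) : ℕ := ⌊Q * Int.fract θ⌋₊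

lemma cell_lt {Q : ℕ} (hQ : 1 ≤ Q) (θ : ℝ) : cell Q θ < Q := by
  have : (0 : ℝ) < Q := by exact_mod_cast hQ
  rw [cell, Nat.floor_lt (mul_nonneg this.le (Int.fract_nonneg θ))]
  nlinarith [Int.fract_lt_one θ]

lemma nd_sub_le_of_cell_eq {Q : ℕ} (hQ : 1 ≤ Q) {s t : ℝ} (h : cell Q s = cell Q t) :
    nd (s - t) ≤ 1 / Q := by
  have hQ0 : (0 : ℝ) < Q := by exact_mod_cast hQ
  have hs0 := mul_nonneg hQ0.le (Int.fract_nonneg s)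
  have ht0 := mul_nonneg hQ0.le (Int.fract_nonneg t)
  have hs1 := Nat.floor_le hs0
  have ht1 := Nat.floor_le ht0
  have hs2 := Nat.lt_floor_add_one ((Q : ℝ) * Int.fract s)
  have ht2 := Nat.lt_floor_add_one ((Q : ℝ) * Int.fract t)
  unfold cell at h
  rw [h] at hs1 hs2
  have h2 := nd_le (s - t) (⌊s⌋ - ⌊t⌋)
  refine h2.trans ?_
  have e : s - t - ((⌊s⌋ - ⌊t⌋ : ℤ) : ℝ) = Int.fract s - Int.fract t := by
    push_cast [Int.fract]; ring
  rw [e, abs_le, ← neg_div, div_le_iff₀ hQ0, le_div_iff₀ hQ0]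
  constructor <;> linarith

/-- The bound for a geometric sum depending on the cell of the argument. -/
def cellBd (B : ℝ) (Q c : ℕ) : ℝ := 4 * B / (c + 1) + 4 * B / ((Q : ℝ) - c)

lemma norm_sum_le_cellBd {B : ℝ} {Q : ℕ} (hQ : 1 ≤ Q) (hQB : Q ≤ B) (θ : ℝ) (a b : ℤ)
    (hab : (b : ℝ) - a + 1 ≤ B) :
    ‖∑ t ∈ Finset.Icc a b, eexp (θ * t)‖ ≤ cellBd B Q (cell Q θ) := by
  have hQ0 : (0 : ℝ) < Q := by exact_mod_cast hQ
  have hB : 0 < B := by linarith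
  set c := cell Q θ with hc
  have hcQ : c < Q := cell_lt hQ θ
  have hcQ' : (c : ℝ) + 1 ≤ Q := by exact_mod_cast hcQ
  have htriv : ‖∑ t ∈ Finset.Icc a b, eexp (θ * t)‖ ≤ B := by
    refine (norm_sum_le _ _).trans ?_
    simp only [norm_eexp, Finset.sum_const, nsmul_eq_mul, mul_one, Int.card_Icc]
    rcases le_total 0 (b + 1 - a) with h | h
    · have : (((b + 1 - a).toNat : ℤ) : ℝ) = ((b + 1 - a : ℤ) : ℝ) := by rw [Int.toNat_of_nonneg h]
      push_cast at this; rw [this]; linarith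
    · rw [Int.toNat_of_nonpos h]; simpa using hB.le
  have hp1 : 0 ≤ 4 * B / ((c : ℝ) + 1) := by positivity
  have hp2 : 0 ≤ 4 * B / ((Q : ℝ) - c) := div_nonneg (by linarith) (by linarith)
  unfold cellBd
  rcases Nat.eq_zero_or_pos c with h0 | h0
  · rw [h0] at hp2 ⊢; norm_num at hp2 ⊢; linarith
  rcases (Nat.lt_or_ge (c + 1) Q).symm with h1 | h1
  · have : (Q : ℝ) - c = 1 := by
      have : (Q : ℝ) = c + 1 := by exact_mod_cast (le_antisymm h1 hcQ)
      linarith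
    rw [this]; linarith
  have hc1 : (1 : ℝ) ≤ c := by exact_mod_cast h0
  have hc2 : (c : ℝ) + 2 ≤ Q := by exact_mod_cast h1
  have hf0 := mul_nonneg hQ0.le (Int.fract_nonneg θ)
  have hf1 : (c : ℝ) ≤ Q * Int.fract θ := Nat.floor_le hf0
  have hf2 : (Q : ℝ) * Int.fract θ < c + 1 := Nat.lt_floor_add_one _
  set f := Int.fract θ with hf
  have hfpos : 0 < f := by by_contra hh; push Not at hh; nlinarith
  have hf1pos : 0 < 1 - f := by by_contra hh; push Not at hh; nlinarith
  have hnd := nd_ge_of_fract θ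
  rw [← hf] at hnd
  have hndpos : 0 < nd θ := lt_of_lt_of_le (lt_min hfpos hf1pos) hnd
  refine (norm_sum_geom_le θ hndpos a b).trans ?_
  rcases min_choice f (1 - f) with h2 | h2
  · rw [h2] at hnd
    refine le_trans ?_ (le_add_of_nonneg_right hp2)
    rw [div_le_div_iff₀ (by positivity) (by positivity), one_mul]
    nlinarith
  · rw [h2] at hnd
    refine le_trans ?_ (le_add_of_nonneg_left hp1)
    rw [div_le_div_iff₀ (by positivity) (by linarith), one_mul]
    nlinarith

lemma sum_cellBd_le {B : ℝ} (hB : 0 ≤ B) (Q : ℕ) :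
    ∑ c ∈ Finset.range Q, cellBd B Q c ≤ 8 * B * (1 + Real.log Q) := by
  have h1 := harmonic_le_one_add_log Q
  have h2 : ((harmonic Q : ℚ) : ℝ) = ∑ c ∈ Finset.range Q, ((c : ℝ) + 1)⁻¹ := by
    simp [harmonic]
  rw [h2] at h1
  have h3 : ∑ c ∈ Finset.range Q, 4 * B / ((Q : ℝ) - c) =
      ∑ c ∈ Finset.range Q, 4 * B / ((c : ℝ) + 1) := by
    rw [← Finset.sum_range_reflect]
    refine Finset.sum_congr rfl fun c hc => ?_
    rw [Finset.mem_range] at hc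
    congr 1
    rw [Nat.cast_sub (by omega), Nat.cast_sub (by omega)]
    push_cast; ring
  simp only [cellBd]
  rw [Finset.sum_add_distrib, h3]
  simp only [div_eq_mul_inv, ← Finset.mul_sum]
  nlinarith

lemma cellBd_nonneg {B : ℝ} (hB : 0 ≤ B) {Q c : ℕ} (hc : c < Q) : 0 ≤ cellBd B Q c := by
  have : (c : ℝ) + 1 ≤ Q := by exact_mod_cast hc
  have h2 : 0 ≤ 4 * B / ((Q : ℝ) - c) := div_nonneg (by linarith) (by linarith)
  unfold cellBd; positivity

end Weyl

section WeylBox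

variable {ι : Type} [Fintype ι]

lemma card_fiber_cell_le (k : ℕ) (G : MvPolynomial ι ℤ) (α : ℝ) (A : ι → ℝ) (hA : ∀ i, 1 ≤ A i)
    (c : ι → ℕ) :
    ((Fintype.piFinset fun _ : Fin (k + 1) => Finset.Icc (-fun i => ⌊3 * A i⌋) (fun i => ⌊3 * A i⌋)).filter
      fun h => (fun i => cell ⌈A i⌉₊ (α * (polar (k + 1) G i h : ℤ))) = c).card ≤
    (multiPts (k + 1) G α (fun _ i => 6 * A i) (fun i => 1 / A i)).card := by
  set S := (Fintype.piFinset fun _ : Fin (k + 1) =>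
    Finset.Icc (-fun i => ⌊3 * A i⌋) (fun i => ⌊3 * A i⌋)).filter
      fun h => (fun i => cell ⌈A i⌉₊ (α * (polar (k + 1) G i h : ℤ))) = c with hS
  have hmem : ∀ h ∈ S, (∀ j i, |(h j i : ℝ)| ≤ 3 * A i) ∧
      ∀ i, cell ⌈A i⌉₊ (α * (polar (k + 1) G i h : ℤ)) = c i := by
    intro h hh
    rw [hS, Finset.mem_filter, Fintype.mem_piFinset] at hh
    refine ⟨fun j i => ?_, fun i => congrFun hh.2 i⟩
    rw [← abs_le_floor_iff]
    have := Finset.mem_Icc.1 (hh.1 j)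
    exact ⟨this.1 i, this.2 i⟩
  have hrep : ∀ t : Fin k → ι → ℤ, ∃ u : ι → ℤ, (∃ v, Fin.cons v t ∈ S) → Fin.cons u t ∈ S := by
    intro t
    by_cases h : ∃ v : ι → ℤ, (Fin.cons v t : Fin (k + 1) → ι → ℤ) ∈ S
    · exact ⟨h.choose, fun _ => h.choose_spec⟩
    · exact ⟨0, fun h' => absurd h' h⟩
  choose u hu using hrep
  refine Finset.card_le_card_of_injOn (fun h => Function.update h 0 (h 0 - u (Fin.tail h))) ?_ ?_
  · intro h hh
    have hhS : h ∈ S := hh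
    have hu' : (Fin.cons (u (Fin.tail h)) (Fin.tail h) : Fin (k + 1) → ι → ℤ) ∈ S :=
      hu _ ⟨h 0, by rw [Fin.cons_self_tail]; exact hhS⟩
    obtain ⟨h1, h2⟩ := hmem _ hhS
    obtain ⟨h3, h4⟩ := hmem _ hu'
    rw [Finset.mem_coe, mem_multiPts]
    constructor
    · intro j i
      have hAi := hA i
      refine Fin.cases ?_ (fun j => ?_) j
      · have e1 := h1 0 i
        have e2 := h3 0 i
        simp only [Fin.cons_zero] at e2
        simp only [Function.update_self, Pi.sub_apply, Int.cast_sub]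
        refine (abs_sub _ _).trans ?_
        linarith
      · beta_reduce
        rw [Function.update_of_ne (Fin.succ_ne_zero j)]
        have := h1 j.succ i
        linarith
    · intro i
      have hAi := hA i
      have hu0 : (Fin.cons (u (Fin.tail h)) (Fin.tail h) : Fin (k + 1) → ι → ℤ) =
          Function.update h 0 (u (Fin.tail h)) := by
        funext j
        refine Fin.cases ?_ (fun j => ?_) j
        · simp
        · rw [Function.update_of_ne (Fin.succ_ne_zero j)]; rfl
      have h5 : polar (k + 1) G i h = polar (k + 1) G i
          (Function.update h 0 (h 0 - u (Fin.tail h))) +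
          polar (k + 1) G i (Function.update h 0 (u (Fin.tail h))) := by
        rw [← polar_update_add, sub_add_cancel, Function.update_eq_self]
      have h6 := nd_sub_le_of_cell_eq (Nat.one_le_ceil_iff.2 (by linarith)) ((h2 i).trans (h4 i).symm)
      rw [hu0, ← mul_sub, ← Int.cast_sub, h5, add_sub_cancel_right] at h6
      refine h6.trans ?_
      exact one_div_le_one_div_of_le (by linarith) (Nat.le_ceil _)
  · intro h hh h' hh' heq
    have ht : Fin.tail h = Fin.tail h' := by
      funext j
      have := congrFun heq j.succ
      simp only [Function.update_of_ne (Fin.succ_ne_zero j)] at this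
      exact this
    have h0 := congrFun heq 0
    simp only [Function.update_self, ht] at h0
    rw [← Fin.cons_self_tail h, ← Fin.cons_self_tail h', ht, sub_left_injective h0]

/-- Weyl's inequality for boxes: a power of the exponential sum is bounded by the number of
solutions of the associated system of Diophantine inequalities. -/
lemma exists_weyl_box_le (ι : Type) [Fintype ι] (k : ℕ) : ∃ Cc : ℝ, 0 < Cc ∧
    ∀ (G : MvPolynomial ι ℤ), DegLt G (k + 3) → ∀ (α : ℝ) (A : ι → ℝ), (∀ i, 1 ≤ A i) →
      ∀ a b : ι → ℤ, (∀ i, ((b i : ℝ) - a i) ≤ 3 * A i) →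
      ‖∑ x ∈ Finset.Icc a b, eexp (α * (eval x G : ℤ))‖ ^ (2 ^ (k + 1)) ≤
        Cc * (∏ i, A i) ^ (2 ^ (k + 1) - (k + 1)) * (∏ i, (1 + Real.log (2 * A i))) *
          (multiPts (k + 1) G α (fun _ i => 6 * A i) (fun i => 1 / A i)).card := by
  set N := Fintype.card ι with hN
  refine ⟨(7 ^ N) ^ (2 ^ (k + 1) - (k + 1) - 1) * 32 ^ N, by positivity, ?_⟩
  intro G hG α A hA a b hab
  set L : ι → ℤ := fun i => ⌊3 * A i⌋ with hL
  have hL0 : ∀ i, 0 ≤ L i := fun i => Int.floor_nonneg.2 (by linarith [hA i])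
  have habL : ∀ i, b i - a i ≤ L i := fun i => Int.le_floor.2 (by push_cast; exact hab i)
  obtain ⟨a', b', hab', hW⟩ := exists_weyl_differencing L hL0 (k + 1)
    (fun x => α * (eval x G : ℤ)) a b habL
  have h2k : k + 1 + 1 ≤ 2 ^ (k + 1) := Nat.lt_two_pow_self
  set 𝓗 := Finset.Icc (-L) L with h𝓗
  have hVpos : 0 < ∏ i, A i := Finset.prod_pos fun i _ => by linarith [hA i]
  have hHcard : (𝓗.card : ℝ) ≤ 7 ^ N * ∏ i, A i := by
    rw [h𝓗, Pi.card_Icc]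
    push_cast
    rw [hN, ← Finset.card_univ, ← Finset.prod_const, ← Finset.prod_mul_distrib]
    refine Finset.prod_le_prod (fun i _ => by positivity) fun i _ => ?_
    have h1 : (L i : ℝ) ≤ 3 * A i := Int.floor_le _
    have h2 : ((Finset.Icc ((-L) i) (L i)).card : ℝ) = 2 * L i + 1 := by
      rw [Int.card_Icc]
      have h3 : (((L i + 1 - (-L) i).toNat : ℤ) : ℝ) = ((L i + 1 - (-L) i : ℤ) : ℝ) := by
        rw [Int.toNat_of_nonneg]; have := hL0 i; simp only [Pi.neg_apply]; omega
      rw [Int.cast_natCast] at h3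
      rw [h3]; simp only [Pi.neg_apply]; push_cast; ring
    rw [h2]; linarith [hA i]
  set M := (multiPts (k + 1) G α (fun _ i => 6 * A i) (fun i => 1 / A i)).card with hM
  set cl : (Fin (k + 1) → ι → ℤ) → ι → ℕ := fun h i =>
    cell ⌈A i⌉₊ (α * (polar (k + 1) G i h : ℤ)) with hcl
  have hQ1 : ∀ i, 1 ≤ ⌈A i⌉₊ := fun i => Nat.one_le_ceil_iff.2 (by linarith [hA i])
  have hQA : ∀ i, (⌈A i⌉₊ : ℝ) ≤ 2 * A i := fun i => by
    have := Nat.ceil_lt_add_one (a := A i) (by linarith [hA i]); linarith [hA i]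
  have hinner : ∀ h : Fin (k + 1) → ι → ℤ,
      ‖∑ x ∈ Finset.Icc (a' h) (b' h), eexp (iterDiff (k + 1) (fun x => α * (eval x G : ℤ)) h x)‖ ≤
        ∏ i, cellBd (4 * A i) ⌈A i⌉₊ (cl h i) := by
    intro h
    obtain ⟨c, hc⟩ := iterDiff_eval (k + 1) hG h
    have e1 : ∀ x, iterDiff (k + 1) (fun x => α * (eval x G : ℤ)) h x =
        ∑ i, (α * (polar (k + 1) G i h : ℤ)) * (x i : ℝ) + α * c := by
      intro x
      have := iterDiff_comp ((AddMonoidHom.mulLeft α).comp (Int.castAddHom ℝ)) (k + 1)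
        (fun x => eval x G) h x
      simp only [AddMonoidHom.comp_apply, AddMonoidHom.coe_mulLeft, Int.coe_castAddHom] at this
      rw [this, hc]
      push_cast
      rw [mul_add, Finset.mul_sum]
      simp only [mul_assoc]
    simp only [e1]
    rw [norm_sum_linear]
    refine Finset.prod_le_prod (fun i _ => norm_nonneg _) fun i _ => ?_
    refine norm_sum_le_cellBd (hQ1 i) (by linarith [hQA i, hA i]) _ _ _ ?_
    have h1 : ((b' h i - a' h i : ℤ) : ℝ) ≤ L i := by exact_mod_cast hab' h i
    have h2 : (L i : ℝ) ≤ 3 * A i := Int.floor_le _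
    push_cast at h1
    linarith [hA i]
  have hsum : ∑ h ∈ Fintype.piFinset fun _ : Fin (k + 1) => 𝓗,
      ∏ i, cellBd (4 * A i) ⌈A i⌉₊ (cl h i) ≤
      M * ∏ i, (8 * (4 * A i) * (1 + Real.log (2 * A i))) := by
    have hmaps : ∀ h ∈ Fintype.piFinset fun _ : Fin (k + 1) => 𝓗,
        cl h ∈ Fintype.piFinset fun i => Finset.range ⌈A i⌉₊ := by
      intro h _
      rw [Fintype.mem_piFinset]
      intro i
      exact Finset.mem_range.2 (cell_lt (hQ1 i) _)
    rw [← Finset.sum_fiberwise_of_maps_to hmaps]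
    calc ∑ c ∈ Fintype.piFinset fun i => Finset.range ⌈A i⌉₊,
          ∑ h ∈ (Fintype.piFinset fun _ : Fin (k + 1) => 𝓗).filter (fun h => cl h = c),
            ∏ i, cellBd (4 * A i) ⌈A i⌉₊ (cl h i)
        ≤ ∑ c ∈ Fintype.piFinset fun i => Finset.range ⌈A i⌉₊,
            (M : ℝ) * ∏ i, cellBd (4 * A i) ⌈A i⌉₊ (c i) := by
          refine Finset.sum_le_sum fun c hc => ?_
          have hnn : 0 ≤ ∏ i, cellBd (4 * A i) ⌈A i⌉₊ (c i) :=
            Finset.prod_nonneg fun i _ => cellBd_nonneg (by linarith [hA i])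
              (Finset.mem_range.1 (Fintype.mem_piFinset.1 hc i))
          have e2 : ∑ h ∈ (Fintype.piFinset fun _ : Fin (k + 1) => 𝓗).filter (fun h => cl h = c),
            ∏ i, cellBd (4 * A i) ⌈A i⌉₊ (cl h i) =
            ((Fintype.piFinset fun _ : Fin (k + 1) => 𝓗).filter (fun h => cl h = c)).card *
              ∏ i, cellBd (4 * A i) ⌈A i⌉₊ (c i) := by
            rw [← nsmul_eq_mul]
            refine Finset.sum_eq_card_nsmul fun h hh => ?_
            rw [(Finset.mem_filter.1 hh).2]
          rw [e2]
          refine mul_le_mul_of_nonneg_right ?_ hnn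
          exact_mod_cast card_fiber_cell_le k G α A hA c
      _ = M * ∏ i, ∑ c ∈ Finset.range ⌈A i⌉₊, cellBd (4 * A i) ⌈A i⌉₊ c := by
          rw [← Finset.mul_sum, Finset.prod_univ_sum]
      _ ≤ M * ∏ i, (8 * (4 * A i) * (1 + Real.log (2 * A i))) := by
          refine mul_le_mul_of_nonneg_left ?_ (by positivity)
          refine Finset.prod_le_prod (fun i _ => Finset.sum_nonneg fun c hc =>
            cellBd_nonneg (by linarith [hA i]) (Finset.mem_range.1 hc)) fun i _ => ?_
          have hAi := hA i
          refine (sum_cellBd_le (by linarith) _).trans ?_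
          have : Real.log ⌈A i⌉₊ ≤ Real.log (2 * A i) :=
            Real.log_le_log (by exact_mod_cast hQ1 i) (hQA i)
          gcongr
  refine hW.trans ?_
  have hpi : ∏ i, (8 * (4 * A i) * (1 + Real.log (2 * A i))) =
      32 ^ N * (∏ i, A i) * ∏ i, (1 + Real.log (2 * A i)) := by
    rw [hN, ← Finset.card_univ, ← Finset.prod_const, ← Finset.prod_mul_distrib,
      ← Finset.prod_mul_distrib]
    exact Finset.prod_congr rfl fun i _ => by ring
  have hlog : 0 ≤ ∏ i, (1 + Real.log (2 * A i)) :=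
    Finset.prod_nonneg fun i _ => by
      have := Real.log_nonneg (x := 2 * A i) (by linarith [hA i]); linarith
  calc (𝓗.card : ℝ) ^ (2 ^ (k + 1) - (k + 1) - 1) *
        ∑ h ∈ Fintype.piFinset fun _ : Fin (k + 1) => 𝓗,
        ‖∑ x ∈ Finset.Icc (a' h) (b' h), eexp (iterDiff (k + 1) (fun x => α * (eval x G : ℤ)) h x)‖
      ≤ (7 ^ N * ∏ i, A i) ^ (2 ^ (k + 1) - (k + 1) - 1) *
        (M * ∏ i, (8 * (4 * A i) * (1 + Real.log (2 * A i)))) := by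
        refine mul_le_mul (pow_le_pow_left₀ (by positivity) hHcard _) ?_
          (Finset.sum_nonneg fun _ _ => norm_nonneg _) (by positivity)
        exact (Finset.sum_le_sum fun h _ => hinner h).trans hsum
    _ = _ := by
        rw [hpi, mul_pow]
        obtain ⟨t, ht⟩ : ∃ t, 2 ^ (k + 1) - (k + 1) = t + 1 := ⟨2 ^ (k + 1) - (k + 1) - 1, by omega⟩
        rw [ht, Nat.add_sub_cancel, pow_succ (∏ i, A i)]
        ring

end WeylBox

section Bounds

lemma exists_aeval_lipschitz {σ : Type} [Fintype σ] (F : MvPolynomial σ ℤ) :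
    ∃ C : ℝ, 0 < C ∧ (∀ v : σ → ℝ, ‖v‖ ≤ 1 → |aeval v F| ≤ C) ∧
      ∀ v w : σ → ℝ, ‖v‖ ≤ 1 → ‖w‖ ≤ 1 → |aeval v F - aeval w F| ≤ C * ‖v - w‖ := by
  induction F using MvPolynomial.induction_on with
  | C a =>
    refine ⟨|(a : ℝ)| + 1, by positivity, fun v _ => by simp, fun v w _ _ => ?_⟩
    simp only [algHom_C, sub_self, abs_zero]
    positivity
  | add p q hp hq =>
    obtain ⟨C₁, h1, h2, h3⟩ := hp
    obtain ⟨C₂, h4, h5, h6⟩ := hq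
    refine ⟨C₁ + C₂, by positivity, fun v hv => ?_, fun v w hv hw => ?_⟩
    · rw [map_add]; exact (abs_add_le _ _).trans (add_le_add (h2 v hv) (h5 v hv))
    · rw [map_add, map_add, add_sub_add_comm, add_mul]
      exact (abs_add_le _ _).trans (add_le_add (h3 v w hv hw) (h6 v w hv hw))
  | mul_X p i hp =>
    obtain ⟨C₁, h1, h2, h3⟩ := hp
    refine ⟨2 * C₁, by positivity, fun v hv => ?_, fun v w hv hw => ?_⟩
    · rw [map_mul, aeval_X, abs_mul]
      have := (norm_le_pi_norm v i).trans hv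
      rw [Real.norm_eq_abs] at this
      nlinarith [h2 v hv, abs_nonneg (v i), abs_nonneg (aeval v p)]
    · rw [map_mul, map_mul, aeval_X, aeval_X]
      have e : aeval v p * v i - aeval w p * w i =
        aeval v p * (v i - w i) + (aeval v p - aeval w p) * w i := by ring
      rw [e]
      have h4 := norm_le_pi_norm (v - w) i
      have h5 := (norm_le_pi_norm w i).trans hw
      rw [Real.norm_eq_abs] at h4 h5
      rw [Pi.sub_apply] at h4
      have h6 := h3 v w hv hw
      have h7 := h2 v hv
      refine (abs_add_le _ _).trans ?_
      rw [abs_mul, abs_mul]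
      have h8 : |aeval v p| * |v i - w i| ≤ C₁ * ‖v - w‖ := by gcongr
      have h9 : |aeval v p - aeval w p| * |w i| ≤ C₁ * ‖v - w‖ * 1 := by gcongr
      linarith

lemma exists_polar_bound (k : ℕ) (F : MvPolynomial (Idx n m r) ℤ) :
    ∃ C : ℝ, 0 < C ∧ ∀ z : Fin (n - m + 1) → ℝ, ‖z‖ ≤ 1 → ∀ i (h : Fin k → VIdx m r → ℝ),
      |polar k (spec z F) i h| ≤ C * ∏ j, ‖h j‖ := by
  induction k generalizing F with
  | zero =>
    choose C hC hb _ using fun i : VIdx m r => exists_aeval_lipschitz (pderiv (embIdx i) F)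
    refine ⟨1 + ∑ i, C i, by have := Finset.sum_nonneg fun i (_ : i ∈ Finset.univ) => (hC i).le; linarith,
      fun z hz i h => ?_⟩
    simp only [polar, Finset.univ_eq_empty, Finset.prod_empty, mul_one]
    rw [pderiv_spec, ← eval_zero, eval_spec]
    have h1 := hb i (Sum.elim 0 (Sum.elim 0 z)) ((pi_norm_le_iff_of_nonneg zero_le_one).2
      (by
        rintro (a | a | a)
        · simp
        · simp
        · simpa using (norm_le_pi_norm z a).trans hz))
    have h2 := Finset.single_le_sum (f := C) (fun i _ => (hC i).le) (Finset.mem_univ i)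
    refine le_trans h1 ?_
    linarith
  | succ k ih =>
    choose C hC hb using fun a : VIdx m r => ih (pderiv (embIdx a) F)
    refine ⟨1 + ∑ i, C i, by have := Finset.sum_nonneg fun i (_ : i ∈ Finset.univ) => (hC i).le; linarith,
      fun z hz i h => ?_⟩
    have hP : 0 ≤ ∏ j, ‖h j‖ := Finset.prod_nonneg fun j _ => norm_nonneg _
    calc |polar (k + 1) (spec z F) i h|
        = |∑ a, h 0 a * polar k (spec z (pderiv (embIdx a) F)) i (Fin.tail h)| := by
          simp only [polar, pderiv_spec]
      _ ≤ ∑ a, |h 0 a| * |polar k (spec z (pderiv (embIdx a) F)) i (Fin.tail h)| := by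
          refine (Finset.abs_sum_le_sum_abs _ _).trans (le_of_eq ?_)
          simp only [abs_mul]
      _ ≤ ∑ a, ‖h 0‖ * (C a * ∏ j, ‖Fin.tail h j‖) := by
          refine Finset.sum_le_sum fun a _ => ?_
          have := norm_le_pi_norm (h 0) a
          rw [Real.norm_eq_abs] at this
          exact mul_le_mul this (hb a z hz i _) (abs_nonneg _) (norm_nonneg _)
      _ = (∑ a, C a) * ∏ j, ‖h j‖ := by
          rw [Fin.prod_univ_succ, Finset.sum_mul]
          refine Finset.sum_congr rfl fun a _ => ?_
          simp only [Fin.tail]; ring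
      _ ≤ _ := by nlinarith

/-- The weights of the variables: `1` for `𝐱` and `l` for `𝐲`. -/
def wt (m r : ℕ) (l : ℝ) : VIdx m r → ℝ := Sum.elim (fun _ => 1) (fun _ => l)

lemma wt_pos {l : ℝ} (hl : 0 < l) (i : VIdx m r) : 0 < wt m r l i := by
  rcases i with i | i
  · exact one_pos
  · exact hl

lemma one_le_wt {l : ℝ} (hl : 1 ≤ l) (i : VIdx m r) : 1 ≤ wt m r l i := by
  rcases i with i | i
  · exact le_rfl
  · exact hl

lemma prod_wt (l : ℝ) : ∏ i : VIdx m r, wt m r l i = l ^ (m - r) := by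
  simp [wt, Fintype.prod_sum_type]

lemma exists_polar_weight_bound (k : ℕ) {F : MvPolynomial (Idx n m r) ℤ} {d₁ d₂ : ℕ}
    (hF : Bihomogeneous F d₁ d₂) :
    ∃ C : ℝ, 1 ≤ C ∧ ∀ z : Fin (n - m + 1) → ℤ, 1 ≤ ‖z‖ → ∀ X : ℝ, 0 ≤ X →
      ∀ w : Fin k → VIdx m r → ℤ, (∀ j i, |(w j i : ℝ)| ≤ wt m r ‖z‖ i * X) →
      ∀ i, wt m r ‖z‖ i * |((polar k (spec z F) i w : ℤ) : ℝ)| ≤ C * ‖z‖ ^ d₂ * X ^ k := by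
  obtain ⟨C, hC, hb⟩ := exists_polar_bound k F
  refine ⟨C + 1, by linarith, fun z hz X hX w hw i => ?_⟩
  set l := ‖z‖ with hl
  have hl0 : 0 < l := by linarith
  set z' : Fin (n - m + 1) → ℝ := fun k => (z k : ℝ) / l with hz'
  have hz'1 : ‖z'‖ ≤ 1 := by
    rw [pi_norm_le_iff_of_nonneg zero_le_one]
    intro k
    rw [hz', norm_div, Real.norm_of_nonneg hl0.le, div_le_one hl0]
    exact norm_le_pi_norm z k
  have hzz : (fun k => l * z' k) = fun k => (z k : ℝ) := by
    funext k; simp only [hz']; field_simp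
  have h1 := scaleVars_spec hF l z'
  rw [hzz] at h1
  change scaleVars (wt m r l) _ = _ at h1
  have h2 := polar_scaleVars k (wt m r l) (spec (fun k => (z k : ℝ)) F) i
    (fun j a => (w j a : ℝ) / wt m r l a)
  rw [h1, polar_C_mul] at h2
  have e : (fun (j : Fin k) a => wt m r l a * ((w j a : ℝ) / wt m r l a)) =
      fun j a => (Int.castRingHom ℝ) (w j a) := by
    funext j a
    have := wt_pos hl0 a
    simp only [eq_intCast]; field_simp
  have e2 : spec (fun k => (z k : ℝ)) F = map (Int.castRingHom ℝ) (spec z F) := by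
    rw [map_spec]; rfl
  rw [e, e2, polar_map] at h2
  rw [eq_intCast] at h2
  have h3 := hb z' hz'1 i (fun j a => (w j a : ℝ) / wt m r l a)
  have h4 : ∏ j : Fin k, ‖fun a => (w j a : ℝ) / wt m r l a‖ ≤ X ^ k := by
    calc ∏ j : Fin k, ‖fun a => (w j a : ℝ) / wt m r l a‖ ≤ ∏ j : Fin k, X := by
          refine Finset.prod_le_prod (fun j _ => norm_nonneg _) fun j _ => ?_
          rw [pi_norm_le_iff_of_nonneg hX]
          intro a
          have h5 := wt_pos (m := m) (r := r) hl0 a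
          rw [norm_div, Real.norm_of_nonneg h5.le, div_le_iff₀ h5, mul_comm]
          exact hw j a
      _ = X ^ k := by simp
  rw [← abs_of_pos (wt_pos (m := m) (r := r) hl0 i), ← abs_mul, ← h2, abs_mul,
    abs_of_nonneg (by positivity : 0 ≤ l ^ d₂)]
  calc l ^ d₂ * |polar k (spec z' F) i fun j a => (w j a : ℝ) / wt m r l a|
      ≤ l ^ d₂ * (C * X ^ k) := by
        gcongr
        exact h3.trans (by gcongr)
    _ ≤ (C + 1) * l ^ d₂ * X ^ k := by
        have : 0 ≤ l ^ d₂ * X ^ k := by positivity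
        nlinarith

lemma exists_card_weight_zeros_le (k : ℕ) (F : MvPolynomial (Idx n m r) ℤ) (d₂ : ℕ)
    (hF : Bihomogeneous F (k + 2) d₂) (D' : ℕ) :
    ∃ C : ℝ, 0 < C ∧ ∀ z : Fin (n - m + 1) → ℤ, 1 ≤ ‖z‖ →
      dimV1z F (fun k => (z k : ℂ)) ≤ ((D' : ℕ) : ℕ∞) →
      ∀ X : ℝ, 1 ≤ X → ∀ S : Finset (Fin (k + 1) → VIdx m r → ℤ),
      (∀ w ∈ S, ∀ j i, |(w j i : ℝ)| ≤ wt m r ‖z‖ i * X) →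
      (∀ w ∈ S, ∀ i, polar (k + 1) (spec z F) i w = 0) →
      (S.card : ℝ) ≤ C * (‖z‖ ^ (m - r)) ^ (k + 1) *
        X ^ (k * Fintype.card (VIdx m r) + D') := by
  obtain ⟨Cc, hCc⟩ := exists_card_polar_zeros_le k F d₂ hF D'
  set N := Fintype.card (VIdx m r) with hN
  set D := k * N + D' with hD
  refine ⟨(Cc + 1) * 2 ^ D * (5 ^ N) ^ (k + 1), by positivity, fun z hz hdim X hX S hSb hS0 => ?_⟩
  set l := ‖z‖ with hl
  set R := ⌈X⌉₊ with hR
  have hR1 : 1 ≤ R := Nat.one_le_ceil_iff.2 (by linarith)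
  have hRX : X ≤ R := Nat.le_ceil X
  have hR2 : (R : ℝ) ≤ 2 * X := by
    have := Nat.ceil_lt_add_one (a := X) (by linarith); linarith
  have hR0 : (0 : ℝ) < R := by linarith
  have hR0' : (0 : ℤ) < R := by exact_mod_cast hR1
  set cl : (Fin (k + 1) → VIdx m r → ℤ) → Fin (k + 1) → VIdx m r → ℤ := fun w j i => w j i / R
    with hcl
  set T : Finset (Fin (k + 1) → VIdx m r → ℤ) := Fintype.piFinset fun _ => Fintype.piFinset fun i =>
    Finset.Icc (-⌈wt m r l i⌉) ⌈wt m r l i⌉ with hT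
  have hmaps : ∀ w ∈ S, cl w ∈ T := by
    intro w hw
    rw [hT, Fintype.mem_piFinset]
    intro j
    rw [Fintype.mem_piFinset]
    intro i
    have h1 := hSb w hw j i
    have h2 : 0 < wt m r l i := wt_pos (by linarith) i
    have h3 : wt m r l i ≤ ⌈wt m r l i⌉ := Int.le_ceil _
    have h4 : |(w j i : ℝ)| ≤ ⌈wt m r l i⌉ * R := h1.trans (by gcongr)
    have h5 : |w j i| ≤ ⌈wt m r l i⌉ * R := by exact_mod_cast h4
    rw [abs_le] at h5
    rw [Finset.mem_Icc]
    constructor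
    · rw [Int.le_ediv_iff_mul_le hR0']; linarith
    · have := Int.ediv_le_ediv hR0' h5.2
      rwa [Int.mul_ediv_cancel _ hR0'.ne'] at this
  have hfib : ∀ t ∈ T, (S.filter fun w => cl w = t).card ≤ Cc * R ^ D := by
    intro t _
    set e : (Fin (k + 1) → VIdx m r → ℤ) → (Fin (k + 1) × VIdx m r → ℤ) := fun w p => w p.1 p.2
      with he
    have he_inj : Function.Injective e := fun w w' h => by
      funext j i; exact congrFun h (j, i)
    rw [← Finset.card_image_of_injective _ he_inj]
    refine hCc _ hdim R hR1 (fun p => t p.1 p.2 * R) _ ?_ ?_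
    · intro x hx i
      obtain ⟨w, hw, rfl⟩ := Finset.mem_image.1 hx
      have h1 := hS0 w (Finset.mem_filter.1 hw).1 i
      have h2 := polar_map (Int.castRingHom ℂ) (k + 1) (spec z F) i w
      rw [h1, map_zero, map_spec] at h2
      exact h2
    · intro x hx p
      obtain ⟨w, hw, rfl⟩ := Finset.mem_image.1 hx
      have h1 := congrFun (congrFun (Finset.mem_filter.1 hw).2 p.1) p.2
      rw [← h1]
      constructor
      · exact Int.ediv_mul_le _ hR0'.ne'
      · have := Int.lt_ediv_add_one_mul_self (w p.1 p.2) hR0'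
        rw [add_mul, one_mul] at this
        exact this
  have h1 := Finset.card_le_mul_card_image_of_maps_to hmaps (Cc * R ^ D) hfib
  have hTcard : (T.card : ℝ) ≤ (5 ^ N * l ^ (m - r)) ^ (k + 1) := by
    have e0 : (T.card : ℝ) = (∏ i : VIdx m r,
        ((Finset.Icc (-⌈wt m r l i⌉) ⌈wt m r l i⌉).card : ℝ)) ^ (k + 1) := by
      rw [hT, Fintype.card_piFinset, Finset.prod_const, Finset.card_univ, Fintype.card_fin,
        Fintype.card_piFinset, Nat.cast_pow, Nat.cast_prod]
    rw [e0]
    refine pow_le_pow_left₀ (Finset.prod_nonneg fun i _ => Nat.cast_nonneg _) ?_ _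
    rw [← prod_wt (m := m) (r := r) l, hN, ← Finset.card_univ (α := VIdx m r), ← Finset.prod_const,
      ← Finset.prod_mul_distrib]
    refine Finset.prod_le_prod (fun i _ => by positivity) fun i _ => ?_
    have h2 : 1 ≤ wt m r l i := one_le_wt hz i
    have h3 := Int.ceil_lt_add_one (wt m r l i)
    have h4 : (0 : ℤ) ≤ ⌈wt m r l i⌉ := Int.ceil_nonneg (by linarith)
    rw [Int.card_Icc]
    have h5 : (((⌈wt m r l i⌉ + 1 - -⌈wt m r l i⌉).toNat : ℤ) : ℝ) =
        ((⌈wt m r l i⌉ + 1 - -⌈wt m r l i⌉ : ℤ) : ℝ) := by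
      rw [Int.toNat_of_nonneg]; omega
    rw [Int.cast_natCast] at h5
    rw [h5]; push_cast; linarith
  calc (S.card : ℝ) ≤ ((Cc * R ^ D * T.card : ℕ) : ℝ) := by exact_mod_cast h1
    _ = Cc * (R : ℝ) ^ D * T.card := by push_cast; ring
    _ ≤ (Cc + 1) * (2 * X) ^ D * (5 ^ N * l ^ (m - r)) ^ (k + 1) := by
        gcongr
        linarith
    _ = _ := by rw [mul_pow, mul_pow]; ring

end Bounds

section BoxBound

lemma exists_log_pow_le (N : ℕ) {η : ℝ} (hη : 0 < η) :
    ∃ c : ℝ, 1 ≤ c ∧ ∀ t : ℝ, 1 ≤ t → (1 + Real.log (2 * t)) ^ N ≤ c * t ^ η := by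
  set s := η / (N + 1) with hs
  have hs0 : 0 < s := by positivity
  refine ⟨(1 + 2 ^ s / s) ^ N, one_le_pow₀ (by
    have : (0 : ℝ) < 2 ^ s / s := by positivity
    linarith), fun t ht => ?_⟩
  have h1 := Real.log_le_rpow_div (x := 2 * t) (by linarith) hs0
  have h0 := Real.log_nonneg (x := 2 * t) (by linarith)
  rw [Real.mul_rpow (by norm_num) (by linarith)] at h1
  have h2 : 1 ≤ t ^ s := Real.one_le_rpow ht hs0.le
  calc (1 + Real.log (2 * t)) ^ N ≤ ((1 + 2 ^ s / s) * t ^ s) ^ N := by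
        refine pow_le_pow_left₀ (by linarith) ?_ _
        calc 1 + Real.log (2 * t) ≤ t ^ s + 2 ^ s * t ^ s / s := by linarith
          _ = _ := by ring
    _ = (1 + 2 ^ s / s) ^ N * t ^ (s * N) := by rw [mul_pow, Real.rpow_mul_natCast (by linarith)]
    _ ≤ _ := by
        gcongr
        rw [hs, div_mul_eq_mul_div, div_le_iff₀ (by positivity)]; nlinarith

lemma nd_neg (t : ℝ) : nd (-t) = nd t := by
  have h : ∀ s : ℝ, nd (-s) ≤ nd s := fun s => by
    have := nd_le (-s) (-round s)
    refine this.trans (le_of_eq ?_)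
    rw [nd, Int.cast_neg, ← abs_neg]; congr 1; ring
  exact le_antisymm (h t) (by simpa using h (-t))

lemma nd_nat_mul_le (d : ℕ) (t : ℝ) : nd (d * t) ≤ d * nd t := by
  have h := nd_le (d * t) (d * round t)
  refine h.trans (le_of_eq ?_)
  rw [nd]; push_cast
  rw [← mul_sub, abs_mul, Nat.abs_cast]

/-- The major arc condition for `α` at the level `X`. -/
def Maj (C₀ : ℝ) (k d₂ d : ℕ) (l P X α : ℝ) : Prop :=
  ∃ q : ℕ, 1 ≤ q ∧ (q : ℝ) ≤ C₀ * l ^ d₂ * X ^ (k + 1) ∧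
    nd (α * (d * q)) ≤ X ^ (k + 1) / (d ^ (k + 1) * P ^ (k + 2))

/-- The polynomial `F(d𝐱, 𝐲, 𝐳)` in the variables `(𝐱, 𝐲)`. -/
def dPoly (F : MvPolynomial (Idx n m r) ℤ) (d : ℕ) (z : Fin (n - m + 1) → ℤ) :
    MvPolynomial (VIdx m r) ℤ :=
  scaleVars (Sum.elim (fun _ => (d : ℤ)) (fun _ => 1)) (spec z F)

lemma eval_dPoly (F : MvPolynomial (Idx n m r) ℤ) (d : ℕ) (z : Fin (n - m + 1) → ℤ)
    (x : VIdx m r → ℤ) : eval x (dPoly F d z) =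
      evalF F (fun i => (d : ℤ) * x (Sum.inl i)) (fun j => x (Sum.inr j)) z := by
  rw [dPoly, eval_scaleVars, eval_spec]
  simp

lemma dPoly_degLt {F : MvPolynomial (Idx n m r) ℤ} {d₁ d₂ : ℕ} (hF : Bihomogeneous F d₁ d₂)
    (d : ℕ) (z : Fin (n - m + 1) → ℤ) : DegLt (dPoly F d z) (d₁ + 1) := by
  have h : (dPoly F d z).IsHomogeneous (1 * d₁) := by
    refine IsHomogeneous.aeval (spec_isHomogeneous hF z) _ fun i => ?_
    simpa using (isHomogeneous_C (VIdx m r) _).mul (isHomogeneous_X ℤ i)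
  intro s hs
  by_contra hne
  have := h hne
  have h1 := congrFun (congrArg DFunLike.coe (Finsupp.degree_eq_weight_one (R := ℕ) (σ := VIdx m r))) s
  have h2 : s.degree = 1 * d₁ := h1.trans this
  omega

/-- The number of points in the box with sides `P` and `dlP`. -/
def boxVol (m r : ℕ) (d : ℕ) (l P : ℝ) : ℝ := P ^ (r + 1) * (P * (d * l)) ^ (m - r)

lemma prod_side (d : ℕ) (l P : ℝ) :
    ∏ i : VIdx m r, P * wt m r (d * l) i = boxVol m r d l P := by
  simp [boxVol, wt, Fintype.prod_sum_type]

lemma card_multiPts_le_of_not_maj (k : ℕ) (F : MvPolynomial (Idx n m r) ℤ) (d₂ : ℕ)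
    (hF : Bihomogeneous F (k + 2) d₂) (D' : ℕ) :
    ∃ C₀ : ℝ, 1 ≤ C₀ ∧ ∃ C : ℝ, 0 < C ∧ ∀ d : ℕ, 1 ≤ d → ∀ P : ℝ, 1 ≤ P →
      ∀ z : Fin (n - m + 1) → ℤ, 1 ≤ ‖z‖ →
      dimV1z F (fun k => (z k : ℂ)) ≤ ((D' : ℕ) : ℕ∞) → ∀ X : ℝ, 1 ≤ X → ∀ α,
      ¬ Maj C₀ k d₂ d ‖z‖ P X α →
      ((multiPts (k + 1) (dPoly F d z) α (fun _ i => P * wt m r (d * ‖z‖) i * (X / (d * P)))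
        (fun i => (X / (d * P)) ^ (k + 1) / (P * wt m r (d * ‖z‖) i))).card : ℝ) ≤
      C * (‖z‖ ^ (m - r)) ^ (k + 1) * X ^ (k * Fintype.card (VIdx m r) + D') := by
  obtain ⟨C₀, hC₀, hw⟩ := exists_polar_weight_bound (k + 1) hF
  obtain ⟨C, hC, hcount⟩ := exists_card_weight_zeros_le k F d₂ hF D'
  refine ⟨C₀, hC₀, C, hC, fun d hd P hP z hz hdim X hX α hmaj => ?_⟩
  set l := ‖z‖ with hl
  have hd0 : (0 : ℝ) < d := by exact_mod_cast hd
  have hd1 : (1 : ℝ) ≤ d := by exact_mod_cast hd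
  set dw : VIdx m r → ℤ := Sum.elim (fun _ => (d : ℤ)) (fun _ => 1) with hdw
  have hdw0 : ∀ i, dw i ≠ 0 := by
    rintro (i | i)
    · simp [hdw]; omega
    · simp [hdw]
  set φ : (Fin (k + 1) → VIdx m r → ℤ) → Fin (k + 1) → VIdx m r → ℤ := fun h j a => dw a * h j a
    with hφ
  have hinj : Function.Injective φ := fun h h' e => by
    funext j a
    exact mul_left_cancel₀ (hdw0 a) (congrFun (congrFun e j) a)
  rw [← Finset.card_image_of_injective _ hinj]
  have hbd : ∀ h ∈ multiPts (k + 1) (dPoly F d z) α (fun _ i => P * wt m r (d * l) i * (X / (d * P)))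
        (fun i => (X / (d * P)) ^ (k + 1) / (P * wt m r (d * l) i)),
      ∀ j i, |(φ h j i : ℝ)| ≤ wt m r l i * X := by
    intro h hh j i
    have h1 := (mem_multiPts.1 hh).1 j i
    simp only [hφ]
    push_cast
    rw [abs_mul]
    rcases i with i | i
    · simp only [wt, hdw, Sum.elim_inl, mul_one, one_mul] at h1 ⊢
      push_cast
      rw [abs_of_pos hd0]
      calc (d : ℝ) * |(h j (Sum.inl i) : ℝ)| ≤ d * (P * (X / (d * P))) := by gcongr
        _ = X := by field_simp
    · simp only [wt, hdw, Sum.elim_inr] at h1 ⊢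
      push_cast
      rw [abs_one, one_mul]
      refine h1.trans (le_of_eq ?_)
      field_simp
  refine hcount z hz hdim X hX _ ?_ ?_
  · intro w hw'
    obtain ⟨h, hh, rfl⟩ := Finset.mem_image.1 hw'
    exact hbd h hh
  · intro w hw' i
    obtain ⟨h, hh, rfl⟩ := Finset.mem_image.1 hw'
    by_contra hne
    apply hmaj
    refine ⟨(polar (k + 1) (spec z F) i (φ h)).natAbs, Int.natAbs_pos.2 hne, ?_, ?_⟩
    · have h1 := hw z hz X (by linarith) (φ h) (hbd h hh) i
      have h2 : 1 ≤ wt m r l i := one_le_wt hz i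
      rw [Nat.cast_natAbs, Int.cast_abs]
      refine le_trans ?_ h1
      exact le_mul_of_one_le_left (abs_nonneg _) h2
    · have h1 := (mem_multiPts.1 hh).2 i
      have h2 : polar (k + 1) (dPoly F d z) i h = dw i * polar (k + 1) (spec z F) i (φ h) :=
        polar_scaleVars (k + 1) dw (spec z F) i h
      rw [h2] at h1
      set p := polar (k + 1) (spec z F) i (φ h) with hp
      have h3 : nd (α * (d * (p.natAbs : ℝ))) = nd (α * (d * (p : ℝ))) := by
        rw [Nat.cast_natAbs, Int.cast_abs]
        rcases abs_choice (p : ℝ) with h4 | h4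
        · rw [h4]
        · rw [h4, mul_neg, mul_neg, nd_neg]
      rw [h3]
      rcases i with i | i
      · simp only [wt, hdw, Sum.elim_inl, mul_one] at h1
        push_cast at h1
        refine h1.trans (le_of_eq ?_)
        rw [div_pow, mul_pow]; field_simp; ring
      · simp only [wt, hdw, Sum.elim_inr, one_mul] at h1
        have h5 := nd_nat_mul_le d (α * p)
        rw [show α * (d * (p : ℝ)) = d * (α * p) by ring]
        calc nd (d * (α * p)) ≤ d * nd (α * p) := h5
          _ ≤ d * ((X / (d * P)) ^ (k + 1) / (P * (d * l))) := by gcongr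
          _ = X ^ (k + 1) / (d ^ (k + 1) * P ^ (k + 2)) / l := by
            rw [div_pow, mul_pow]; field_simp; ring
          _ ≤ _ := div_le_self (by positivity) hz

lemma boxVol_pos (d : ℕ) (hd : 1 ≤ d) {l P : ℝ} (hl : 0 < l) (hP : 0 < P) : 0 < boxVol m r d l P := by
  have : (0 : ℝ) < d := by exact_mod_cast hd
  unfold boxVol; positivity

/-- The bound for the exponential sum over boxes on the minor arcs. -/
lemma exists_box_bound (hrm : r ≤ m) (k : ℕ) (F : MvPolynomial (Idx n m r) ℤ) (d₂ : ℕ)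
    (hF : Bihomogeneous F (k + 2) d₂) (D' c₀ : ℕ) (hD' : D' + c₀ = m + 1) :
    ∃ C₀ : ℝ, 1 ≤ C₀ ∧ ∀ ε : ℝ, 0 < ε → ∃ C : ℝ, 1 ≤ C ∧ ∀ d : ℕ, 1 ≤ d → ∀ P : ℝ, 1 ≤ P →
      ∀ z : Fin (n - m + 1) → ℤ, 1 ≤ ‖z‖ →
      dimV1z F (fun k => (z k : ℂ)) ≤ ((D' : ℕ) : ℕ∞) → ∀ X : ℝ, 1 ≤ X → X ≤ d * P → ∀ α,
      ¬ Maj C₀ k d₂ d ‖z‖ P X α → ∀ a b : VIdx m r → ℤ,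
      (∀ i, (b i : ℝ) - a i ≤ 3 * (P * wt m r (d * ‖z‖) i)) →
      ‖∑ x ∈ Finset.Icc a b, eexp (α * (eval x (dPoly F d z) : ℤ))‖ ≤
        C * boxVol m r d ‖z‖ P * (d * ‖z‖ * P) ^ ε *
          (d : ℝ) ^ (((k + 1 : ℕ) : ℝ) * (r + 1) / 2 ^ (k + 1)) * X ^ (-((c₀ : ℝ) / 2 ^ (k + 1))) := by
  obtain ⟨C₀, hC₀, C₁, hC₁, hcount⟩ := card_multiPts_le_of_not_maj k F d₂ hF D'
  obtain ⟨C₂, hC₂, hweyl⟩ := exists_weyl_box_le (VIdx m r) k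
  obtain ⟨C₃, hC₃, hshrink⟩ := exists_card_multiPts_le (VIdx m r) (k + 1)
  refine ⟨C₀, hC₀, fun ε hε => ?_⟩
  set M : ℕ := 2 ^ (k + 1) with hM
  have hM1 : k + 1 + 1 ≤ M := Nat.lt_two_pow_self
  have hM0 : (0 : ℝ) < M := by positivity
  set N := Fintype.card (VIdx m r) with hN
  have hNm : N = m + 1 := by rw [hN]; simp; omega
  obtain ⟨C₄, hC₄, hlog⟩ := exists_log_pow_le N (η := ε * M) (by positivity)
  refine ⟨max 1 (C₂ * C₄ * (C₃ * C₁)), le_max_left _ _, ?_⟩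
  intro d hd P hP z hz hdim X hX hXd α hmaj a b hab
  set l := ‖z‖ with hl
  have hd1 : (1 : ℝ) ≤ d := by exact_mod_cast hd
  have hd0 : (0 : ℝ) < d := by linarith
  have hl0 : 0 < l := by linarith
  have hP0 : 0 < P := by linarith
  have hX0 : 0 < X := by linarith
  have hdl : 1 ≤ (d : ℝ) * l := one_le_mul_of_one_le_of_one_le hd1 hz
  have hA : ∀ i, 1 ≤ P * wt m r (d * l) i := fun i =>
    one_le_mul_of_one_le_of_one_le hP (one_le_wt hdl i)
  have hA0 : ∀ i, 0 < P * wt m r (d * l) i := fun i => by linarith [hA i]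
  set V := boxVol m r d l P with hV
  have hV0 : 0 < V := boxVol_pos d hd hl0 hP0
  set Z := X / (d * P) with hZ
  have hZ0 : 0 < Z := by positivity
  have hZ1 : Z ≤ 1 := by rw [hZ, div_le_one (by positivity)]; exact hXd
  have h1 := hweyl (dPoly F d z) (dPoly_degLt hF d z) α _ hA a b hab
  have h2 := hshrink (dPoly F d z) α _ hA0 Z hZ0 hZ1
  have h3 := hcount d hd P hP z hz hdim X hX α hmaj
  set t := (d : ℝ) * l * P with ht
  have ht1 : 1 ≤ t := one_le_mul_of_one_le_of_one_le hdl hP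
  have h4 : ∏ i : VIdx m r, (1 + Real.log (2 * (P * wt m r (d * l) i))) ≤ C₄ * t ^ (ε * M) := by
    refine le_trans ?_ (hlog t ht1)
    calc ∏ i : VIdx m r, (1 + Real.log (2 * (P * wt m r (d * l) i)))
        ≤ ∏ i : VIdx m r, (1 + Real.log (2 * t)) := by
          refine Finset.prod_le_prod (fun i _ => ?_) fun i _ => ?_
          · have := Real.log_nonneg (x := 2 * (P * wt m r (d * l) i)) (by linarith [hA i])
            linarith
          · have h5 := hA0 i
            have h6 : wt m r (d * l) i ≤ d * l := by
              rcases i with i | i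
              · exact hdl
              · exact le_rfl
            have : P * wt m r (d * l) i ≤ t := by rw [ht, mul_comm]; gcongr
            gcongr
      _ = _ := by rw [Finset.prod_const, Finset.card_univ]
  set S := ‖∑ x ∈ Finset.Icc a b, eexp (α * (eval x (dPoly F d z) : ℤ))‖ with hS
  have h5 : S ^ M ≤ C₂ * C₄ * (C₃ * C₁) * (V ^ M * t ^ (ε * M) *
      (d : ℝ) ^ ((k + 1) * (r + 1)) * X⁻¹ ^ c₀) := by
    rw [prod_side, ← hV] at h1
    refine le_trans (le_of_eq ?_) (h1.trans ?_)
    · rw [hS]; congr!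
    have h6 := h2.trans (mul_le_mul_of_nonneg_left h3 (by positivity))
    have h7 : 0 ≤ ∏ i : VIdx m r, (1 + Real.log (2 * (P * wt m r (d * l) i))) :=
      Finset.prod_nonneg fun i _ => by
        have := Real.log_nonneg (x := 2 * (P * wt m r (d * l) i)) (by linarith [hA i])
        linarith
    have h8 : C₂ * V ^ (M - (k + 1)) *
          (∏ i : VIdx m r, (1 + Real.log (2 * (P * wt m r (d * l) i)))) *
          (multiPts (k + 1) (dPoly F d z) α (fun _ i => 6 * (P * wt m r (d * l) i))
            fun i => 1 / (P * wt m r (d * l) i)).card ≤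
        C₂ * V ^ (M - (k + 1)) * (C₄ * t ^ (ε * M)) *
          (C₃ * Z⁻¹ ^ (N * (k + 1)) * (C₁ * (l ^ (m - r)) ^ (k + 1) * X ^ (k * N + D'))) := by
      gcongr
    refine h8.trans (le_of_eq ?_)
    have h9 : V ^ M = V ^ (M - (k + 1)) * V ^ (k + 1) := by rw [← pow_add]; congr 1; omega
    have h10 : Z⁻¹ ^ (N * (k + 1)) * (l ^ (m - r)) ^ (k + 1) * X ^ (k * N + D') =
        V ^ (k + 1) * (d : ℝ) ^ ((k + 1) * (r + 1)) * X⁻¹ ^ c₀ := by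
      have e1 : X⁻¹ ^ (N * (k + 1)) * X ^ (k * N + D') = X⁻¹ ^ c₀ := by
        have : N * (k + 1) = (k * N + D') + c₀ := by rw [add_assoc, hD', ← hNm]; ring
        rw [this, pow_add, mul_right_comm, ← mul_pow, inv_mul_cancel₀ hX0.ne', one_pow, one_mul]
      have e2 : (d * P) ^ (N * (k + 1)) * (l ^ (m - r)) ^ (k + 1) =
          V ^ (k + 1) * (d : ℝ) ^ ((k + 1) * (r + 1)) := by
        rw [pow_mul, mul_comm (k + 1) (r + 1), pow_mul (d : ℝ), ← mul_pow, ← mul_pow]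
        congr 1
        rw [hV, boxVol, hNm, show m + 1 = (r + 1) + (m - r) by omega]
        simp only [mul_pow, pow_add]; ring
      have e3 : Z⁻¹ = (d * P) * X⁻¹ := by rw [hZ, inv_div, div_eq_mul_inv]
      rw [e3, mul_pow, ← e2, ← e1]; ring
    rw [h9]
    calc _ = C₂ * C₄ * (C₃ * C₁) * V ^ (M - (k + 1)) * t ^ (ε * M) *
          (Z⁻¹ ^ (N * (k + 1)) * (l ^ (m - r)) ^ (k + 1) * X ^ (k * N + D')) := by ring
      _ = _ := by rw [h10]; ring
  have hS0 : 0 ≤ S := norm_nonneg _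
  have hMne : M ≠ 0 := by omega
  rw [← pow_le_pow_iff_left₀ hS0 (by positivity) hMne]
  refine h5.trans ?_
  set C := max 1 (C₂ * C₄ * (C₃ * C₁)) with hC
  have hCM : C₂ * C₄ * (C₃ * C₁) ≤ C ^ M :=
    (le_max_right _ _).trans (le_self_pow₀ (le_max_left _ _) hMne)
  have hM' : (M : ℝ) = 2 ^ (k + 1) := by rw [hM]; push_cast; rfl
  have e1 : ((d : ℝ) ^ (((k + 1 : ℕ) : ℝ) * (r + 1) / 2 ^ (k + 1))) ^ M =
      (d : ℝ) ^ ((k + 1) * (r + 1)) := by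
    rw [← Real.rpow_mul_natCast hd0.le, hM', div_mul_cancel₀ _ (by positivity), ← Real.rpow_natCast (d : ℝ)]
    congr 1; push_cast; ring
  have e2 : (X ^ (-((c₀ : ℝ) / 2 ^ (k + 1)))) ^ M = X⁻¹ ^ c₀ := by
    rw [← Real.rpow_mul_natCast hX0.le, hM', neg_mul, div_mul_cancel₀ _ (by positivity),
      Real.rpow_neg hX0.le, Real.rpow_natCast, inv_pow]
  have e3 : (t ^ ε) ^ M = t ^ (ε * M) := by rw [Real.rpow_mul_natCast (by linarith)]
  rw [mul_pow, mul_pow, mul_pow, mul_pow, e1, e2, e3]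
  calc _ ≤ C ^ M * (V ^ M * t ^ (ε * M) * (d : ℝ) ^ ((k + 1) * (r + 1)) * X⁻¹ ^ c₀) := by gcongr
    _ = _ := by ring

end BoxBound

section Cells

variable {ι : Type} [Fintype ι]

/-- A half-open box with corner `p` and side lengths `s`. -/
def boxCell (s p : ι → ℝ) : Set (ι → ℝ) := Set.pi Set.univ fun i => Set.Ico (p i) (p i + s i)

lemma measurableSet_boxCell (s p : ι → ℝ) : MeasurableSet (boxCell s p) :=
  MeasurableSet.univ_pi fun _ => measurableSet_Ico

lemma volume_boxCell {s : ι → ℝ} (hs : ∀ i, 0 < s i) (p : ι → ℝ) :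
    volume (boxCell s p) = ENNReal.ofReal (∏ i, s i) := by
  rw [boxCell, volume_pi_pi, ENNReal.ofReal_prod_of_nonneg fun i _ => (hs i).le]
  simp

/-- The corner of the cell with index `t`. -/
def corner (o s : ι → ℝ) (t : ι → ℤ) : ι → ℝ := fun i => o i + t i * s i

lemma mem_boxCell_corner_iff {o s : ι → ℝ} (hs : ∀ i, 0 < s i) (t : ι → ℤ) (v : ι → ℝ) :
    v ∈ boxCell s (corner o s t) ↔ t = fun i => ⌊(v i - o i) / s i⌋ := by
  simp only [boxCell, corner, Set.mem_univ_pi, Set.mem_Ico, funext_iff]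
  refine forall_congr' fun i => ?_
  rw [eq_comm, Int.floor_eq_iff, le_div_iff₀ (hs i), div_lt_iff₀ (hs i)]
  constructor
  · rintro ⟨h1, h2⟩; constructor <;> nlinarith
  · rintro ⟨h1, h2⟩; constructor <;> nlinarith

lemma pairwise_disjoint_boxCell {o s : ι → ℝ} (hs : ∀ i, 0 < s i) :
    Pairwise (Function.onFun Disjoint fun t : ι → ℤ => boxCell s (corner o s t)) := by
  intro t t' hne
  rw [Function.onFun, Set.disjoint_left]
  intro v h1 h2
  rw [mem_boxCell_corner_iff hs] at h1 h2
  exact hne (h1.trans h2.symm)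

lemma norm_sub_le_of_mem_boxCell {s p v : ι → ℝ} {w : ℝ} (hw0 : 0 ≤ w) (hw : ∀ i, s i ≤ w)
    (hv : v ∈ boxCell s p) : ‖v - p‖ ≤ w := by
  rw [pi_norm_le_iff_of_nonneg hw0]
  intro i
  have := hv i (Set.mem_univ i)
  rw [Set.mem_Ico] at this
  rw [Pi.sub_apply, Real.norm_eq_abs, abs_of_nonneg (by linarith [this.1])]
  linarith [hw i, this.2]

lemma card_mul_prod_le {o s : ι → ℝ} (hs : ∀ i, 0 < s i) (T : Finset (ι → ℤ)) {B : Set (ι → ℝ)}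
    {c : ℝ} (hc : 0 ≤ c) (hB : volume B ≤ ENNReal.ofReal c)
    (h : ∀ t ∈ T, boxCell s (corner o s t) ⊆ B) : (T.card : ℝ) * ∏ i, s i ≤ c := by
  have h1 : volume (⋃ t ∈ T, boxCell s (corner o s t)) ≤ volume B :=
    measure_mono (Set.iUnion₂_subset h)
  rw [measure_biUnion_finset (fun t _ t' _ hne => pairwise_disjoint_boxCell hs hne)
    fun t _ => measurableSet_boxCell _ _] at h1
  simp only [volume_boxCell hs, Finset.sum_const, nsmul_eq_mul] at h1
  have h2 := h1.trans hB
  rw [← ENNReal.ofReal_natCast, ← ENNReal.ofReal_mul (by positivity)] at h2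
  exact (ENNReal.ofReal_le_ofReal_iff hc).1 h2

/-- Comparison of a Riemann sum with the integral. -/
lemma norm_riemann_sum_sub_le {o s : ι → ℝ} (hs : ∀ i, 0 < s i) (T : Finset (ι → ℤ))
    (f : (ι → ℝ) → ℂ) (g : (ι → ℤ) → ℂ) (hf : Integrable f) (h : (ι → ℝ) → ℝ) (hh : Integrable h)
    (hh0 : ∀ v, 0 ≤ h v)
    (hsupp : ∀ v, f v ≠ 0 → (fun i => ⌊(v i - o i) / s i⌋) ∈ T)
    (hfg : ∀ t ∈ T, ∀ v ∈ boxCell s (corner o s t), ‖g t - f v‖ ≤ h v) :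
    ‖((∏ i, s i : ℝ) : ℂ) * ∑ t ∈ T, g t - ∫ v, f v‖ ≤ ∫ v, h v := by
  set C := fun t : ι → ℤ => boxCell s (corner o s t) with hC
  have hm : ∀ t, MeasurableSet (C t) := fun t => measurableSet_boxCell _ _
  have hdis : (T : Set (ι → ℤ)).PairwiseDisjoint C :=
    fun t _ t' _ hne => pairwise_disjoint_boxCell hs hne
  have h1 : ∫ v, f v = ∑ t ∈ T, ∫ v in C t, f v := by
    rw [← integral_biUnion_finset T (fun t _ => hm t) hdis fun t _ => hf.integrableOn]
    refine (setIntegral_eq_integral_of_forall_compl_eq_zero fun v hv => ?_).symm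
    by_contra hne
    refine hv (Set.mem_biUnion (hsupp v hne) ?_)
    rw [hC, mem_boxCell_corner_iff hs]
  have h2 : ∀ t, ((∏ i, s i : ℝ) : ℂ) * g t = ∫ _ in C t, g t := fun t => by
    rw [setIntegral_const, Measure.real, volume_boxCell hs,
      ENNReal.toReal_ofReal (Finset.prod_nonneg fun i _ => (hs i).le), Complex.real_smul]
  rw [h1, Finset.mul_sum, Finset.sum_congr rfl fun t _ => h2 t, ← Finset.sum_sub_distrib]
  have hfin : ∀ t, volume (C t) ≠ ⊤ := fun t => by rw [volume_boxCell hs]; exact ENNReal.ofReal_ne_top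
  have hI : ∀ t, IntegrableOn (fun _ => g t) (C t) := fun t => integrableOn_const (hfin t)
  calc _ ≤ ∑ t ∈ T, ‖(∫ _ in C t, g t) - ∫ v in C t, f v‖ := norm_sum_le _ _
    _ ≤ ∑ t ∈ T, ∫ v in C t, h v := by
        refine Finset.sum_le_sum fun t ht => ?_
        rw [← integral_sub (hI t) hf.integrableOn]
        refine (norm_integral_le_integral_norm _).trans ?_
        refine setIntegral_mono_on (((hI t).sub hf.integrableOn).norm)
          hh.integrableOn (hm t) fun v hv => hfg t ht v hv
    _ = ∫ v in ⋃ t ∈ T, C t, h v := by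
        rw [integral_biUnion_finset T (fun t _ => hm t) hdis fun t _ => hh.integrableOn]
    _ ≤ ∫ v, h v := setIntegral_le_integral hh (Filter.Eventually.of_forall hh0)

end Cells

section Boundary

variable {ι : Type} [Fintype ι]

lemma volume_slab_le (i : ι) {a b : ℝ} (hab : a ≤ b) :
    volume {v : ι → ℝ | ‖v‖ ≤ 6 ∧ a ≤ v i ∧ v i ≤ b} ≤
      ENNReal.ofReal (12 ^ Fintype.card ι * (b - a)) := by
  have hsub : {v : ι → ℝ | ‖v‖ ≤ 6 ∧ a ≤ v i ∧ v i ≤ b} ⊆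
      Set.pi Set.univ (Function.update (fun _ => Set.Icc (-6 : ℝ) 6) i (Set.Icc a b)) := by
    rintro v ⟨h1, h2⟩ j -
    by_cases hj : j = i
    · subst hj; simpa using h2
    · rw [Function.update_of_ne hj]
      have := (norm_le_pi_norm v j).trans h1
      rw [Real.norm_eq_abs, abs_le] at this
      exact this
  refine (measure_mono hsub).trans ?_
  rw [volume_pi_pi, ← Finset.mul_prod_erase _ _ (Finset.mem_univ i), Function.update_self]
  rw [Finset.prod_congr rfl (g := fun _ => ENNReal.ofReal 12) fun j hj => by
    rw [Function.update_of_ne (Finset.ne_of_mem_erase hj), Real.volume_Icc]; norm_num]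
  rw [Finset.prod_const, Real.volume_Icc, ← ENNReal.ofReal_pow (by norm_num),
    ← ENNReal.ofReal_mul (by linarith)]
  refine ENNReal.ofReal_le_ofReal ?_
  rw [mul_comm]
  refine mul_le_mul_of_nonneg_right (pow_le_pow_right₀ (by norm_num) ?_) (by linarith)
  exact Finset.card_le_univ _

lemma volume_slab_add_le {i j : ι} (hij : i ≠ j) {c : ℝ} (hc : |c| ≤ 1) {w : ℝ} (hw : 0 ≤ w) :
    volume {v : ι → ℝ | ‖v‖ ≤ 3 ∧ |v i + c * v j| ≤ w} ≤
      ENNReal.ofReal (12 ^ Fintype.card ι * (2 * w)) := by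
  set t : Matrix.TransvectionStruct ι ℝ := ⟨i, j, hij, c⟩
  have hp := Real.volume_preserving_transvectionStruct t
  have hT : ∀ v : ι → ℝ, Matrix.toLin' t.toMatrix v = Function.update v i (v i + c * v j) := by
    intro v
    funext a
    simp only [t, Matrix.TransvectionStruct.toMatrix, Matrix.transvection, Matrix.toLin'_apply,
      Matrix.add_mulVec, Matrix.one_mulVec, Pi.add_apply]
    by_cases ha : a = i
    · subst ha; simp [Matrix.mulVec, dotProduct, Matrix.single_apply]
    · simp [Matrix.mulVec, dotProduct, Ne.symm ha, ha]
  have hle := volume_slab_le i (a := -w) (b := w) (by linarith)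
  rw [show w - -w = 2 * w by ring] at hle
  refine le_trans ?_ hle
  have hmeas : MeasurableSet {v : ι → ℝ | ‖v‖ ≤ 6 ∧ -w ≤ v i ∧ v i ≤ w} := by
    refine IsClosed.measurableSet ?_
    exact (isClosed_le continuous_norm continuous_const).inter
      ((isClosed_le continuous_const (continuous_apply i)).inter
        (isClosed_le (continuous_apply i) continuous_const))
  rw [← hp.measure_preimage hmeas.nullMeasurableSet]
  refine measure_mono ?_
  rintro v ⟨h1, h2⟩
  have hvi := (norm_le_pi_norm v i).trans h1
  have hvj := (norm_le_pi_norm v j).trans h1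
  rw [Real.norm_eq_abs] at hvi hvj
  rw [Set.mem_preimage, hT]
  refine ⟨?_, ?_⟩
  · rw [pi_norm_le_iff_of_nonneg (by norm_num)]
    intro a
    by_cases ha : a = i
    · subst ha
      rw [Function.update_self, Real.norm_eq_abs]
      refine (abs_add_le _ _).trans ?_
      rw [abs_mul]
      nlinarith [abs_nonneg c, abs_nonneg (v j)]
    · rw [Function.update_of_ne ha]
      linarith [(norm_le_pi_norm v a).trans h1]
  · rw [Function.update_self]
    exact abs_le.1 h2

/-- A neighbourhood of the boundary of the region. -/
def nearBdry (ι : Type) [Fintype ι] (w : ℝ) : Set (ι → ℝ) :=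
  {v | ‖v‖ ≤ 3 ∧ ((∃ i, |v i| ≤ w) ∨ (∃ i, |(|v i| - 1)| ≤ w) ∨
    ∃ i j, i ≠ j ∧ |(|v i| - |v j|)| ≤ w)}

lemma measurableSet_nearBdry (w : ℝ) : MeasurableSet (nearBdry ι w) := by
  have e : nearBdry ι w = {v | ‖v‖ ≤ 3} ∩ ((⋃ i, {v | |v i| ≤ w}) ∪ ((⋃ i, {v | |(|v i| - 1)| ≤ w}) ∪
      ⋃ i, ⋃ j, {v | i ≠ j ∧ |(|v i| - |v j|)| ≤ w})) := by
    ext v; simp [nearBdry]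
  rw [e]
  refine (measurableSet_le measurable_norm measurable_const).inter (MeasurableSet.union ?_
    (MeasurableSet.union ?_ ?_))
  · refine MeasurableSet.iUnion fun i => (IsClosed.measurableSet ?_)
    exact isClosed_le (by fun_prop) continuous_const
  · refine MeasurableSet.iUnion fun i => (IsClosed.measurableSet ?_)
    exact isClosed_le (by fun_prop) continuous_const
  · refine MeasurableSet.iUnion fun i => MeasurableSet.iUnion fun j => ?_
    by_cases hij : i = j
    · simp [hij]
    · simp only [ne_eq, hij, not_false_eq_true, true_and]
      refine (IsClosed.measurableSet ?_)
      exact isClosed_le (by fun_prop) continuous_const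

lemma exists_volume_nearBdry_le (ι : Type) [Fintype ι] :
    ∃ C : ℝ, 0 < C ∧ ∀ w : ℝ, 0 ≤ w → volume (nearBdry ι w) ≤ ENNReal.ofReal (C * w) := by
  set N := Fintype.card ι
  set D : ℝ := 12 ^ N * 2 with hD
  have hD0 : 0 < D := by positivity
  refine ⟨(N + 2 * N + 2 * N * N + 1) * D, by positivity, fun w hw => ?_⟩
  have hsub : nearBdry ι w ⊆
      (⋃ i, {v : ι → ℝ | ‖v‖ ≤ 6 ∧ -w ≤ v i ∧ v i ≤ w}) ∪
      ((⋃ i, ({v : ι → ℝ | ‖v‖ ≤ 6 ∧ 1 - w ≤ v i ∧ v i ≤ 1 + w} ∪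
        {v : ι → ℝ | ‖v‖ ≤ 6 ∧ -1 - w ≤ v i ∧ v i ≤ -1 + w})) ∪
      ⋃ i, ⋃ j, ({v : ι → ℝ | i ≠ j ∧ ‖v‖ ≤ 3 ∧ |v i + 1 * v j| ≤ w} ∪
        {v : ι → ℝ | i ≠ j ∧ ‖v‖ ≤ 3 ∧ |v i + (-1) * v j| ≤ w})) := by
    rintro v ⟨h3, ⟨i, h⟩ | ⟨i, h⟩ | ⟨i, j, hij, h⟩⟩
    · refine Or.inl (Set.mem_iUnion.2 ⟨i, by linarith, abs_le.1 h⟩)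
    · refine Or.inr (Or.inl (Set.mem_iUnion.2 ⟨i, ?_⟩))
      rcases abs_choice (v i) with e | e <;> rw [e] at h
      · left; refine ⟨by linarith, ?_, ?_⟩ <;> linarith [(abs_le.1 h).1, (abs_le.1 h).2]
      · right; refine ⟨by linarith, ?_, ?_⟩ <;> linarith [(abs_le.1 h).1, (abs_le.1 h).2]
    · refine Or.inr (Or.inr (Set.mem_iUnion₂.2 ⟨i, j, ?_⟩))
      rcases abs_choice (v i) with e | e <;> rcases abs_choice (v j) with e' | e' <;> rw [e, e'] at h
      · right; refine ⟨hij, h3, ?_⟩; convert h using 2; ring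
      · left; refine ⟨hij, h3, ?_⟩; convert h using 2; ring
      · left; refine ⟨hij, h3, ?_⟩; rw [← abs_neg]; convert h using 2; ring
      · right; refine ⟨hij, h3, ?_⟩; rw [← abs_neg]; convert h using 2; ring
  set e := ENNReal.ofReal (D * w) with he
  have hslab : ∀ (i : ι) (a b : ℝ), b - a = 2 * w →
      volume {v : ι → ℝ | ‖v‖ ≤ 6 ∧ a ≤ v i ∧ v i ≤ b} ≤ e := fun i a b h => by
    refine (volume_slab_le i (by linarith)).trans (le_of_eq ?_)
    rw [he, h, hD]; congr 1; ring
  have hshear : ∀ (i j : ι) (c : ℝ), |c| ≤ 1 →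
      volume {v : ι → ℝ | i ≠ j ∧ ‖v‖ ≤ 3 ∧ |v i + c * v j| ≤ w} ≤ e := fun i j c hc => by
    by_cases hij : i = j
    · simp [hij]
    · simp only [ne_eq, hij, not_false_eq_true, true_and]
      refine (volume_slab_add_le hij hc hw).trans (le_of_eq ?_)
      rw [he, hD]; congr 1; ring
  have hsum : ∀ f : ι → ENNReal, ∀ b, (∀ i, f i ≤ b) → ∑ i, f i ≤ N * b := fun f b hb => by
    refine (Finset.sum_le_card_nsmul Finset.univ f b fun i _ => hb i).trans (le_of_eq ?_)
    rw [nsmul_eq_mul]; rfl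
  have h1 : volume (nearBdry ι w) ≤ N * e + (N * (e + e) + N * (N * (e + e))) := by
    refine (measure_mono hsub).trans ((measure_union_le _ _).trans (add_le_add ?_
      ((measure_union_le _ _).trans (add_le_add ?_ ?_))))
    · exact (measure_iUnion_fintype_le _ _).trans (hsum _ _ fun i => hslab i _ _ (by ring))
    · exact (measure_iUnion_fintype_le _ _).trans (hsum _ _ fun i =>
        (measure_union_le _ _).trans (add_le_add (hslab i _ _ (by ring)) (hslab i _ _ (by ring))))
    · refine (measure_iUnion_fintype_le _ _).trans (hsum _ _ fun i =>
        (measure_iUnion_fintype_le _ _).trans (hsum _ _ fun j =>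
        (measure_union_le _ _).trans (add_le_add (hshear i j 1 (by simp))
          (hshear i j (-1) (by simp)))))
  refine h1.trans ?_
  rw [he, ← ENNReal.ofReal_add (by positivity) (by positivity), ← ENNReal.ofReal_natCast,
    ← ENNReal.ofReal_mul (by positivity), ← ENNReal.ofReal_mul (by positivity),
    ← ENNReal.ofReal_mul (by positivity), ← ENNReal.ofReal_add (by positivity) (by positivity),
    ← ENNReal.ofReal_add (by positivity) (by positivity)]
  refine ENNReal.ofReal_le_ofReal ?_
  have : 0 ≤ D * w := by positivity
  nlinarith

end Boundary

section Region

lemma exists_apply_eq_norm {ι E : Type} [Fintype ι] [Nonempty ι] [NormedAddCommGroup E] (v : ι → E) :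
    ∃ i, ‖v‖ = ‖v i‖ := by
  obtain ⟨i, hi⟩ := Finite.exists_max fun i => ‖v i‖
  exact ⟨i, le_antisymm ((pi_norm_le_iff_of_nonneg (norm_nonneg _)).2 hi) (norm_le_pi_norm v i)⟩

lemma exists_nat_eq_norm {ι : Type} [Fintype ι] (x : ι → ℤ) : ∃ h : ℕ, ‖x‖ = h := by
  rcases isEmpty_or_nonempty ι with h | h
  · exact ⟨0, by simp [Subsingleton.elim x 0]⟩
  · obtain ⟨i, hi⟩ := exists_apply_eq_norm x
    refine ⟨(x i).natAbs, ?_⟩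
    rw [hi, Int.norm_eq_abs, Nat.cast_natAbs, Int.cast_abs]

lemma norm_comp_inl_sub_le (v p : VIdx m r → ℝ) :
    |‖v ∘ Sum.inl‖ - ‖p ∘ Sum.inl‖| ≤ ‖v - p‖ :=
  (abs_norm_sub_norm_le _ _).trans ((pi_norm_le_iff_of_nonneg (norm_nonneg _)).2 fun i =>
    norm_le_pi_norm (v - p) (Sum.inl i))

lemma norm_comp_inr_sub_le (v p : VIdx m r → ℝ) :
    |‖v ∘ Sum.inr‖ - ‖p ∘ Sum.inr‖| ≤ ‖v - p‖ :=
  (abs_norm_sub_norm_le _ _).trans ((pi_norm_le_iff_of_nonneg (norm_nonneg _)).2 fun i =>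
    norm_le_pi_norm (v - p) (Sum.inr i))

lemma mem_nearBdry_of_diagonal {v p : VIdx m r → ℝ} {w c : ℝ} (hv : ‖v‖ ≤ 3) (hw : ‖v - p‖ ≤ w)
    (hc : |‖p ∘ Sum.inl‖ - ‖p ∘ Sum.inr‖| ≤ c) : v ∈ nearBdry (VIdx m r) (c + 2 * w) := by
  have h1 := norm_comp_inl_sub_le v p
  have h2 := norm_comp_inr_sub_le v p
  have h3 : |‖v ∘ Sum.inl‖ - ‖v ∘ Sum.inr‖| ≤ c + 2 * w := by
    rw [abs_le] at *
    constructor <;> linarith [h1.1, h1.2, h2.1, h2.2, hc.1, hc.2]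
  refine ⟨hv, ?_⟩
  obtain ⟨i, hi⟩ := exists_apply_eq_norm (v ∘ (Sum.inl : Fin (r + 1) → VIdx m r))
  rcases isEmpty_or_nonempty (Fin (m - r)) with h | h
  · refine Or.inl ⟨Sum.inl i, ?_⟩
    have : (v ∘ (Sum.inr : Fin (m - r) → VIdx m r)) = 0 := Subsingleton.elim _ _
    rw [this, norm_zero, sub_zero, abs_norm, hi] at h3
    exact h3
  · obtain ⟨j, hj⟩ := exists_apply_eq_norm (v ∘ (Sum.inr : Fin (m - r) → VIdx m r))
    refine Or.inr (Or.inr ⟨Sum.inl i, Sum.inr j, by simp, ?_⟩)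
    rw [hi, hj] at h3
    exact h3

lemma mem_nearBdry_of_norm {ι : Type} [Fintype ι] {v p : ι → ℝ} {w : ℝ} (hv : ‖v‖ ≤ 3)
    (hw : ‖v - p‖ ≤ w) (h : ‖p‖ ≤ 1 ∧ 1 < ‖v‖ ∨ ‖v‖ ≤ 1 ∧ 1 < ‖p‖) : v ∈ nearBdry ι w := by
  have hw0 : 0 ≤ w := (norm_nonneg _).trans hw
  have key : ∀ a b : ι → ℝ, ‖a‖ ≤ 1 → 1 < ‖b‖ → ∃ i, |a i| ≤ 1 ∧ 1 < |b i| := by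
    intro a b ha hb
    by_contra! hcon
    have : ‖b‖ ≤ 1 := (pi_norm_le_iff_of_nonneg zero_le_one).2 fun i =>
      hcon i ((norm_le_pi_norm a i).trans ha)
    linarith
  refine ⟨hv, Or.inr (Or.inl ?_)⟩
  have h2 : ∀ i, |(|v i| - |p i|)| ≤ w := fun i =>
    (abs_abs_sub_abs_le_abs_sub _ _).trans ((norm_le_pi_norm (v - p) i).trans hw)
  rcases h with ⟨h3, h4⟩ | ⟨h3, h4⟩ <;> obtain ⟨i, hi, hi'⟩ := key _ _ h3 h4 <;>
    refine ⟨i, ?_⟩ <;> have := abs_le.1 (h2 i) <;> rw [abs_le] <;> constructor <;> linarith [this.1, this.2]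

/-- The integer points with `‖𝐱‖ ≤ a` and `‖𝐲‖ < b`. -/
def boxPts (m r : ℕ) (a b : ℝ) : Finset (VIdx m r → ℤ) :=
  Finset.Icc (Sum.elim (fun _ => -⌊a⌋) (fun _ => -(⌈b⌉ - 1))) (Sum.elim (fun _ => ⌊a⌋) (fun _ => ⌈b⌉ - 1))

lemma mem_boxPts {a b : ℝ} (ha : 0 ≤ a) (hb : 0 < b) {v : VIdx m r → ℤ} :
    v ∈ boxPts m r a b ↔ ‖v ∘ Sum.inl‖ ≤ a ∧ ‖v ∘ Sum.inr‖ < b := by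
  rw [pi_norm_le_iff_of_nonneg ha, pi_norm_lt_iff hb, boxPts, Finset.mem_Icc, Pi.le_def, Pi.le_def,
    ← forall_and]
  rw [Sum.forall]
  refine and_congr (forall_congr' fun i => ?_) (forall_congr' fun j => ?_)
  · simp only [Sum.elim_inl, Function.comp]
    rw [abs_le_floor_iff, Int.norm_eq_abs]
  · simp only [Sum.elim_inr, Function.comp]
    rw [Int.norm_eq_abs, ← abs_le, Int.le_sub_one_iff, Int.lt_ceil, Int.cast_abs]

/-- The integer points with `‖𝐱‖ ≤ P` and `‖𝐲‖ < b‖𝐱‖`. -/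
def regPts (m r : ℕ) (b P : ℝ) : Finset (VIdx m r → ℤ) :=
  (boxPts m r P (b * P)).filter fun v => ‖v ∘ Sum.inl‖ ≤ P ∧ ‖v ∘ Sum.inr‖ < b * ‖v ∘ Sum.inl‖

lemma mem_regPts {b P : ℝ} (hb : 0 < b) (hP : 0 < P) {v : VIdx m r → ℤ} :
    v ∈ regPts m r b P ↔ ‖v ∘ Sum.inl‖ ≤ P ∧ ‖v ∘ Sum.inr‖ < b * ‖v ∘ Sum.inl‖ := by
  rw [regPts, Finset.mem_filter, mem_boxPts hP.le (by positivity)]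
  refine ⟨fun h => h.2, fun h => ⟨⟨h.1, h.2.trans_le ?_⟩, h⟩⟩
  gcongr
  exact h.1

/-- Rescaled integer points. -/
def sclPt (b P : ℝ) (v : VIdx m r → ℤ) : VIdx m r → ℝ := fun i => v i / (P * wt m r b i)

lemma norm_comp_inl_sclPt {b P : ℝ} (hP : 0 < P) (v : VIdx m r → ℤ) :
    ‖sclPt b P v ∘ Sum.inl‖ = ‖v ∘ Sum.inl‖ / P := by
  have : sclPt b P v ∘ Sum.inl = P⁻¹ • fun i => ((v ∘ Sum.inl) i : ℝ) := by
    funext i; simp [sclPt, wt]; ring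
  rw [this, norm_smul, Real.norm_eq_abs, abs_of_pos (by positivity), div_eq_inv_mul]
  congr 1

lemma norm_comp_inr_sclPt {b P : ℝ} (hb : 0 < b) (hP : 0 < P) (v : VIdx m r → ℤ) :
    ‖sclPt b P v ∘ Sum.inr‖ = ‖v ∘ Sum.inr‖ / (P * b) := by
  have : sclPt b P v ∘ Sum.inr = (P * b)⁻¹ • fun i => ((v ∘ Sum.inr) i : ℝ) := by
    funext i; simp [sclPt, wt]; ring
  rw [this, norm_smul, Real.norm_eq_abs, abs_of_pos (by positivity), div_eq_inv_mul]
  congr 1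

lemma norm_eq_max_comp (v : VIdx m r → ℝ) : ‖v‖ = max ‖v ∘ Sum.inl‖ ‖v ∘ Sum.inr‖ := by
  refine le_antisymm ?_ (max_le ?_ ?_)
  · rw [pi_norm_le_iff_of_nonneg (le_max_of_le_left (norm_nonneg _))]
    rintro (i | j)
    · exact le_max_of_le_left (norm_le_pi_norm (v ∘ Sum.inl) i)
    · exact le_max_of_le_right (norm_le_pi_norm (v ∘ Sum.inr) j)
  · exact (pi_norm_le_iff_of_nonneg (norm_nonneg _)).2 fun i => norm_le_pi_norm v _
  · exact (pi_norm_le_iff_of_nonneg (norm_nonneg _)).2 fun i => norm_le_pi_norm v _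

lemma mem_regPts_iff_sclPt {b P : ℝ} (hb : 0 < b) (hP : 0 < P) {v : VIdx m r → ℤ} :
    v ∈ regPts m r b P ↔ ‖sclPt b P v‖ ≤ 1 ∧ ‖sclPt b P v ∘ Sum.inr‖ < ‖sclPt b P v ∘ Sum.inl‖ := by
  rw [mem_regPts hb hP, norm_eq_max_comp, norm_comp_inl_sclPt hP, norm_comp_inr_sclPt hb hP]
  rw [max_le_iff, div_le_one hP, div_lt_div_iff₀ (by positivity) hP]
  have e : ‖v ∘ Sum.inr‖ * P < ‖v ∘ Sum.inl‖ * (P * b) ↔ ‖v ∘ Sum.inr‖ < b * ‖v ∘ Sum.inl‖ := by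
    rw [show ‖v ∘ Sum.inl‖ * (P * b) = (b * ‖v ∘ Sum.inl‖) * P by ring]
    exact mul_lt_mul_iff_left₀ hP
  rw [e]
  refine ⟨fun h => ⟨⟨h.1, ?_⟩, h.2⟩, fun h => ⟨h.1.1, h.2⟩⟩
  rw [div_le_one (by positivity), mul_comm P]
  exact h.2.le.trans (by gcongr; exact h.1)

lemma prod_side_inv (b P : ℝ) :
    ∏ i : VIdx m r, 1 / (P * wt m r b i) = (P ^ (r + 1) * (P * b) ^ (m - r))⁻¹ := by
  simp [wt, Fintype.prod_sum_type, mul_comm]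
  left; rw [← mul_inv, inv_pow]

lemma corner_zero_side (b P : ℝ) (v : VIdx m r → ℤ) :
    corner 0 (fun i => 1 / (P * wt m r b i)) v = sclPt b P v := by
  funext i; simp [corner, sclPt]; ring

lemma side_le {b P : ℝ} (hb : 1 ≤ b) (hP : 1 ≤ P) (i : VIdx m r) : 1 / (P * wt m r b i) ≤ 1 / P := by
  have := one_le_wt (m := m) (r := r) hb i
  gcongr
  exact le_mul_of_one_le_right (by linarith) this

lemma card_le_of_near (C : ℝ) {B : Set (VIdx m r → ℝ)} (hB : volume B ≤ ENNReal.ofReal C)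
    (hC : 0 ≤ C) {b P : ℝ} (hb : 1 ≤ b) (hP : 1 ≤ P) (T : Finset (VIdx m r → ℤ))
    (hT : ∀ t ∈ T, ∀ v, ‖v - sclPt b P t‖ ≤ 1 / P → v ∈ B) :
    (T.card : ℝ) ≤ C * (P ^ (r + 1) * (P * b) ^ (m - r)) := by
  have hs : ∀ i : VIdx m r, 0 < 1 / (P * wt m r b i) := fun i => by
    have := wt_pos (m := m) (r := r) (l := b) (by linarith) i
    positivity
  have h := card_mul_prod_le (o := 0) hs T hC hB fun t ht v hv => by
    rw [corner_zero_side] at hv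
    exact hT t ht v (norm_sub_le_of_mem_boxCell (by positivity) (side_le hb hP) hv)
  rw [prod_side_inv] at h
  have hV : 0 < P ^ (r + 1) * (P * b) ^ (m - r) := by positivity
  rwa [← div_eq_mul_inv, div_le_iff₀ hV] at h

lemma card_regPts_le {b P : ℝ} (hb : 1 ≤ b) (hP : 1 ≤ P) :
    ((regPts m r b P).card : ℝ) ≤ 6 ^ Fintype.card (VIdx m r) * (P ^ (r + 1) * (P * b) ^ (m - r)) := by
  refine card_le_of_near _ (B := Metric.closedBall 0 3) ?_ (by positivity) hb hP _ fun t ht v hv => ?_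
  · rw [Real.volume_pi_closedBall _ (by norm_num)]; norm_num
  · have h1 := ((mem_regPts_iff_sclPt (by linarith) (by linarith)).1 ht).1
    rw [mem_closedBall_zero_iff]
    have h2 : (1 : ℝ) / P ≤ 1 := by rw [div_le_one (by linarith)]; exact hP
    have h3 := norm_le_norm_add_norm_sub' v (sclPt b P t)
    linarith

end Region

section RegionSum

/-- Sums over the region are controlled by sums over boxes. -/
lemma exists_norm_sum_regPts_le (m r : ℕ) : ∃ C : ℝ, 0 < C ∧ ∀ b : ℝ, 1 ≤ b → ∀ P : ℝ, 1 ≤ P →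
    ∀ ψ : (VIdx m r → ℤ) → ℂ, (∀ v, ‖ψ v‖ ≤ 1) → ∀ B : ℝ,
    (∀ u v : VIdx m r → ℤ, (∀ i, (v i : ℝ) - u i ≤ 3 * (P * wt m r b i)) →
      ‖∑ x ∈ Finset.Icc u v, ψ x‖ ≤ B) → ∀ κ : ℕ, 1 ≤ κ →
    ‖∑ x ∈ regPts m r b P, ψ x‖ ≤
      (P / κ + 1) * (2 * B) + C * (P ^ (r + 1) * (P * b) ^ (m - r)) * ((κ - 1) / P) := by
  obtain ⟨C, hC, hvol⟩ := exists_volume_nearBdry_le (VIdx m r)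
  refine ⟨3 * C, by positivity, fun b hb P hP ψ hψ B hB κ hκ => ?_⟩
  have hb0 : 0 < b := by linarith
  have hP0 : 0 < P := by linarith
  have hκ0 : (0 : ℝ) < κ := by exact_mod_cast hκ
  have hbox : ∀ a c : ℝ, 0 ≤ a → a ≤ P → 0 < c → c ≤ b * P →
      ‖∑ x ∈ boxPts m r a c, ψ x‖ ≤ B := by
    intro a c ha haP hc hcP
    refine hB _ _ ?_
    rintro (i | j)
    · have := Int.floor_le a
      simp only [Sum.elim_inl, wt]
      push_cast; linarith
    · have := Int.ceil_lt_add_one c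
      simp only [Sum.elim_inr, wt]
      push_cast; nlinarith
  choose H hH using fun v : VIdx m r → ℤ => exists_nat_eq_norm (v ∘ Sum.inl)
  set j := fun v : VIdx m r → ℤ => (H v - 1) / κ with hj
  set R := regPts m r b P with hR
  set Pn := ⌊P⌋₊ with hPn
  have hPn1 : 1 ≤ Pn := Nat.le_floor (by simpa using hP)
  have hmem : ∀ v, v ∈ R ↔ ‖v ∘ Sum.inl‖ ≤ P ∧ ‖v ∘ Sum.inr‖ < b * ‖v ∘ Sum.inl‖ := fun v =>
    mem_regPts hb0 hP0
  have hH1 : ∀ v ∈ R, 1 ≤ H v ∧ H v ≤ Pn := by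
    intro v hv
    have h := (hmem v).1 hv
    rw [hH] at h
    constructor
    · rw [Nat.one_le_iff_ne_zero]
      intro h0
      rw [h0] at h
      have := norm_nonneg (v ∘ Sum.inr)
      simp at h; linarith [h.2]
    · exact Nat.le_floor h.1
  have hjv : ∀ v ∈ R, j v * κ + 1 ≤ H v ∧ H v ≤ (j v + 1) * κ := by
    intro v hv
    have h1 := hH1 v hv
    have h2 := Nat.div_mul_le_self (H v - 1) κ
    have h3 := Nat.lt_div_mul_add (a := H v - 1) (b := κ) (by omega)
    simp only [hj, add_mul, one_mul]
    omega
  have hjuniq : ∀ v, ∀ i : ℕ, i * κ + 1 ≤ H v → H v ≤ (i + 1) * κ → j v = i := by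
    intro v i h1 h2
    simp only [hj]
    rw [add_mul, one_mul] at h2
    rw [Nat.div_eq_iff (by omega)]
    rw [mul_comm] at *; omega
  set good := R.filter fun v => ‖v ∘ Sum.inr‖ < b * (j v * κ + 1) with hgood
  set bad := R.filter fun v => ¬ ‖v ∘ Sum.inr‖ < b * (j v * κ + 1) with hbad
  have hsplit : ∑ x ∈ R, ψ x = ∑ x ∈ good, ψ x + ∑ x ∈ bad, ψ x :=
    (Finset.sum_filter_add_sum_filter_not _ _ _).symm
  have hbadcard : (bad.card : ℝ) ≤ 3 * C * (P ^ (r + 1) * (P * b) ^ (m - r)) * ((κ - 1) / P) := by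
    have hbadp : ∀ v ∈ bad, v ∈ R ∧ b * (j v * κ + 1) ≤ ‖v ∘ Sum.inr‖ := fun v hv => by
      rw [hbad, Finset.mem_filter, not_lt] at hv; exact hv
    rcases hκ.eq_or_lt with h1 | h1
    · have : bad = ∅ := by
        refine Finset.eq_empty_of_forall_notMem fun v hv => ?_
        obtain ⟨h2, h3⟩ := hbadp v hv
        have h4 := hjv v h2
        have h5 := ((hmem v).1 h2).2
        have h6 : H v = j v * κ + 1 := by rw [← h1] at h4 ⊢; omega
        rw [hH, h6] at h5
        push_cast at h5
        linarith
      rw [this, ← h1]; simp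
    · have h2 : (2 : ℝ) ≤ κ := by exact_mod_cast h1
      have hw : (0 : ℝ) ≤ (κ - 1) / P + 2 * (1 / P) := by
        have : (0 : ℝ) ≤ κ - 1 := by linarith
        positivity
      have h3 := card_le_of_near (C * ((κ - 1) / P + 2 * (1 / P))) (hvol _ hw) (by positivity) hb hP bad
        fun t ht v hv => ?_
      · refine h3.trans ?_
        have h4 : C * ((κ - 1) / P + 2 * (1 / P)) ≤ 3 * C * ((κ - 1) / P) := by
          rw [mul_comm 3 C, mul_assoc]
          refine mul_le_mul_of_nonneg_left ?_ hC.le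
          rw [mul_one_div, ← add_div, mul_div_assoc']
          gcongr; linarith
        calc _ ≤ 3 * C * ((κ - 1) / P) * (P ^ (r + 1) * (P * b) ^ (m - r)) := by gcongr
          _ = _ := by ring
      · obtain ⟨h4, h5⟩ := hbadp t ht
        have h6 := hjv t h4
        have h7 := (mem_regPts_iff_sclPt hb0 hP0).1 h4
        have h8 : (1 : ℝ) / P ≤ 1 := by rw [div_le_one (by linarith)]; exact hP
        have h9 := norm_le_norm_add_norm_sub' v (sclPt b P t)
        refine mem_nearBdry_of_diagonal (by linarith [h7.1]) hv ?_
        rw [abs_of_pos (by linarith [h7.2]), norm_comp_inl_sclPt hP0, norm_comp_inr_sclPt hb0 hP0, hH]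
        have h10 : (j t * κ + 1) / P ≤ ‖t ∘ Sum.inr‖ / (P * b) := by
          rw [div_le_div_iff₀ hP0 (by positivity)]
          calc ((j t : ℝ) * κ + 1) * (P * b) = b * (j t * κ + 1) * P := by ring
            _ ≤ _ := by gcongr
        have h11 : (H t : ℝ) ≤ (j t + 1) * κ := by exact_mod_cast h6.2
        have h12 : (H t : ℝ) / P ≤ (j t + 1) * κ / P := by gcongr
        calc (H t : ℝ) / P - ‖t ∘ Sum.inr‖ / (P * b) ≤ (j t + 1) * κ / P - (j t * κ + 1) / P := by linarith
          _ = (κ - 1) / P := by ring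
  have hblock : ∀ i ∈ Finset.range ((Pn - 1) / κ + 1),
      ‖∑ x ∈ good.filter (fun v => j v = i), ψ x‖ ≤ 2 * B := by
    intro i hi
    have hi' : i * κ + 1 ≤ Pn := by
      have h1 : i ≤ (Pn - 1) / κ := by have := Finset.mem_range.1 hi; omega
      have h2 := (Nat.le_div_iff_mul_le (by omega)).1 h1
      omega
    have hi'' : (i : ℝ) * κ + 1 ≤ P := by
      have h1 : ((i * κ + 1 : ℕ) : ℝ) ≤ P := (Nat.cast_le.2 hi').trans (Nat.floor_le hP0.le)
      exact_mod_cast h1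
    have hiκ : (0 : ℝ) ≤ i * κ := by positivity
    set a := min P ((i + 1) * κ) with ha
    have ha0 : 0 ≤ a := le_min hP0.le (by positivity)
    have hc0 : 0 < b * (i * κ + 1) := by positivity
    have hcP : b * (i * κ + 1) ≤ b * P := by gcongr
    have e : good.filter (fun v => j v = i) =
        boxPts m r a (b * (i * κ + 1)) \ boxPts m r (i * κ) (b * (i * κ + 1)) := by
      ext v
      rw [Finset.mem_filter, hgood, Finset.mem_filter, Finset.mem_sdiff, mem_boxPts ha0 hc0,
        mem_boxPts hiκ hc0, hH]
      constructor
      · rintro ⟨⟨h1, h2⟩, h3⟩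
        have h4 := hjv v h1
        have h5 := (hmem v).1 h1
        rw [hH] at h5
        rw [h3] at h2 h4
        have h6 : (H v : ℝ) ≤ (i + 1) * κ := by exact_mod_cast h4.2
        have h7 : (i : ℝ) * κ + 1 ≤ H v := by exact_mod_cast h4.1
        refine ⟨⟨le_min h5.1 h6, h2⟩, fun h => ?_⟩
        linarith [h.1]
      · rintro ⟨⟨h1, h2⟩, h3⟩
        have h4 : (i : ℝ) * κ < H v := by
          by_contra! hc
          exact h3 ⟨hc, h2⟩
        have h5 : i * κ + 1 ≤ H v := by
          have : i * κ < H v := by exact_mod_cast h4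
          omega
        have h6 : H v ≤ (i + 1) * κ := by
          have : (H v : ℝ) ≤ ((i + 1) * κ : ℕ) := by push_cast; exact h1.trans (min_le_right _ _)
          exact_mod_cast this
        have h7 := hjuniq v i h5 h6
        refine ⟨⟨(hmem v).2 ⟨?_, ?_⟩, by rw [h7]; exact h2⟩, h7⟩
        · rw [hH]; exact h1.trans (min_le_left _ _)
        · rw [hH]
          refine h2.trans_le ?_
          gcongr
          exact_mod_cast h5
    have hsub : boxPts m r (i * κ) (b * (i * κ + 1)) ⊆ boxPts m r a (b * (i * κ + 1)) := by
      intro v hv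
      rw [mem_boxPts ha0 hc0]
      rw [mem_boxPts hiκ hc0] at hv
      refine ⟨hv.1.trans (le_min (by linarith) ?_), hv.2⟩
      nlinarith
    rw [e, Finset.sum_sdiff_eq_sub hsub]
    refine (norm_sub_le _ _).trans ?_
    have h1 := hbox a _ ha0 (min_le_left _ _) hc0 hcP
    have h2 := hbox (i * κ) _ hiκ (by linarith) hc0 hcP
    linarith
  have hB0 : 0 ≤ B := (norm_nonneg _).trans (hbox 1 1 zero_le_one hP one_pos (one_le_mul_of_one_le_of_one_le hb hP))
  have hgoodsum : ‖∑ x ∈ good, ψ x‖ ≤ (P / κ + 1) * (2 * B) := by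
    rw [← Finset.sum_fiberwise_of_maps_to (t := Finset.range ((Pn - 1) / κ + 1)) (g := j)]
    · refine (norm_sum_le _ _).trans ((Finset.sum_le_sum hblock).trans ?_)
      rw [Finset.sum_const, Finset.card_range, nsmul_eq_mul]
      refine mul_le_mul_of_nonneg_right ?_ (by positivity)
      push_cast
      have h1 : (((Pn - 1) / κ : ℕ) : ℝ) ≤ ((Pn - 1 : ℕ) : ℝ) / κ := Nat.cast_div_le
      have h2 : ((Pn - 1 : ℕ) : ℝ) ≤ P := (Nat.cast_le.2 (Nat.sub_le _ _)).trans (Nat.floor_le hP0.le)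
      have h3 : ((Pn - 1 : ℕ) : ℝ) / κ ≤ P / κ := by gcongr
      linarith
    · intro v hv
      have h1 := hH1 v (Finset.mem_filter.1 hv).1
      rw [Finset.mem_range, Nat.lt_succ_iff]
      exact Nat.div_le_div_right (by omega)
  rw [hsplit]
  refine (norm_add_le _ _).trans (add_le_add hgoodsum ?_)
  refine (norm_sum_le _ _).trans (le_trans ?_ hbadcard)
  refine (Finset.sum_le_card_nsmul _ _ 1 fun v _ => hψ v).trans ?_
  simp

/-- The exponential sum over the region. -/
def regSum (F : MvPolynomial (Idx n m r) ℤ) (d : ℕ) (z : Fin (n - m + 1) → ℤ) (P α : ℝ) : ℂ :=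
  ∑ x ∈ regPts m r (d * ‖z‖) P, eexp (α * (eval x (dPoly F d z) : ℤ))

lemma norm_regSum_le {F : MvPolynomial (Idx n m r) ℤ} {d : ℕ} (hd : 1 ≤ d)
    {z : Fin (n - m + 1) → ℤ} (hz : 1 ≤ ‖z‖) {P : ℝ} (hP : 1 ≤ P) (α : ℝ) :
    ‖regSum F d z P α‖ ≤ 6 ^ Fintype.card (VIdx m r) * boxVol m r d ‖z‖ P := by
  have hd1 : (1 : ℝ) ≤ d := by exact_mod_cast hd
  refine (norm_sum_le _ _).trans (le_trans ?_
    (card_regPts_le (one_le_mul_of_one_le_of_one_le hd1 hz) hP))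
  refine (Finset.sum_le_card_nsmul _ _ 1 fun v _ => (norm_eexp _).le).trans ?_
  simp

/-- The bound for the exponential sum over the region on the minor arcs. -/
lemma exists_regSum_bound (hrm : r ≤ m) (k : ℕ) (F : MvPolynomial (Idx n m r) ℤ) (d₂ : ℕ)
    (hF : Bihomogeneous F (k + 2) d₂) (D' c₀ : ℕ) (hD' : D' + c₀ = m + 1) :
    ∃ C₀ : ℝ, 1 ≤ C₀ ∧
      (∀ ε : ℝ, 0 < ε → ∃ C : ℝ, 1 ≤ C ∧ ∀ d : ℕ, 1 ≤ d → ∀ P : ℝ, 1 ≤ P →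
        ∀ z : Fin (n - m + 1) → ℤ, 1 ≤ ‖z‖ →
        dimV1z F (fun k => (z k : ℂ)) ≤ ((D' : ℕ) : ℕ∞) → ∀ X : ℝ, 1 ≤ X → X ≤ d * P → ∀ α,
        ¬ Maj C₀ k d₂ d ‖z‖ P X α → ∀ a b : VIdx m r → ℤ,
        (∀ i, (b i : ℝ) - a i ≤ 3 * (P * wt m r (d * ‖z‖) i)) →
        ‖∑ x ∈ Finset.Icc a b, eexp (α * (eval x (dPoly F d z) : ℤ))‖ ≤
          C * boxVol m r d ‖z‖ P * (d * ‖z‖ * P) ^ ε *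
            (d : ℝ) ^ (((k + 1 : ℕ) : ℝ) * (r + 1) / 2 ^ (k + 1)) *
            X ^ (-((c₀ : ℝ) / 2 ^ (k + 1)))) ∧
      ∀ ε : ℝ, 0 < ε → ∃ C : ℝ, 1 ≤ C ∧ ∀ d : ℕ, 1 ≤ d → ∀ P : ℝ, 1 ≤ P →
        ∀ z : Fin (n - m + 1) → ℤ, 1 ≤ ‖z‖ →
        dimV1z F (fun k => (z k : ℂ)) ≤ ((D' : ℕ) : ℕ∞) → ∀ X : ℝ, 1 ≤ X → X ≤ d * P → ∀ α,
        ¬ Maj C₀ k d₂ d ‖z‖ P X α →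
        ‖regSum F d z P α‖ ≤ C * boxVol m r d ‖z‖ P * (d * ‖z‖ * P) ^ ε *
          (d : ℝ) ^ (((k + 1 : ℕ) : ℝ) * (r + 1) / 2 ^ (k + 1)) *
          X ^ (-((c₀ : ℝ) / 2 ^ (k + 2))) := by
  obtain ⟨C₀, hC₀, hbox⟩ := exists_box_bound hrm k F d₂ hF D' c₀ hD'
  refine ⟨C₀, hC₀, hbox, fun ε hε => ?_⟩
  obtain ⟨C₁, hC₁, hb⟩ := hbox ε hε
  obtain ⟨C₂, hC₂, hr⟩ := exists_norm_sum_regPts_le m r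
  set N := Fintype.card (VIdx m r)
  refine ⟨4 * C₁ + C₂ + 6 ^ N, by have : (0 : ℝ) < 6 ^ N := by positivity
                                  linarith, ?_⟩
  intro d hd P hP z hz hdim X hX hXd α hmaj
  set l := ‖z‖ with hl
  set e₀ := ((k + 1 : ℕ) : ℝ) * (r + 1) / 2 ^ (k + 1) with he₀
  have he₀0 : 0 ≤ e₀ := by positivity
  have hd1 : (1 : ℝ) ≤ d := by exact_mod_cast hd
  have hd0 : (0 : ℝ) < d := by linarith
  have hl0 : 0 < l := by linarith
  have hX0 : 0 < X := by linarith
  have hdl : 1 ≤ (d : ℝ) * l := one_le_mul_of_one_le_of_one_le hd1 hz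
  set V := boxVol m r d l P with hV
  have hV0 : 0 < V := boxVol_pos d hd hl0 (by linarith)
  have ht1 : 1 ≤ (d : ℝ) * l * P := one_le_mul_of_one_le_of_one_le hdl hP
  set S := ((d : ℝ) * l * P) ^ (ε / 2) * (d : ℝ) ^ (e₀ / 2) * X ^ (-((c₀ : ℝ) / 2 ^ (k + 2))) with hS
  have hS0 : 0 < S := by positivity
  have hSle : S ≤ (d * l * P) ^ ε * (d : ℝ) ^ e₀ * X ^ (-((c₀ : ℝ) / 2 ^ (k + 2))) := by
    rw [hS]
    gcongr
    · linarith
    · linarith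
  have hSsq : S * S = (d * l * P) ^ ε * (d : ℝ) ^ e₀ * X ^ (-((c₀ : ℝ) / 2 ^ (k + 1))) := by
    have a1 : (d * l * P) ^ ε = (d * l * P) ^ (ε / 2) * (d * l * P) ^ (ε / 2) := by
      rw [← Real.rpow_add (by linarith)]; congr 1; ring
    have a2 : (d : ℝ) ^ e₀ = (d : ℝ) ^ (e₀ / 2) * (d : ℝ) ^ (e₀ / 2) := by
      rw [← Real.rpow_add (by linarith)]; congr 1; ring
    have a3 : X ^ (-((c₀ : ℝ) / 2 ^ (k + 1))) =
        X ^ (-((c₀ : ℝ) / 2 ^ (k + 2))) * X ^ (-((c₀ : ℝ) / 2 ^ (k + 2))) := by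
      rw [← Real.rpow_add (by linarith)]; congr 1; rw [pow_succ 2 (k + 1)]; ring
    rw [a1, a2, a3, hS]; ring
  suffices hmain : ‖regSum F d z P α‖ ≤ (4 * C₁ + C₂ + 6 ^ N) * V * S by
    refine hmain.trans ?_
    calc _ ≤ (4 * C₁ + C₂ + 6 ^ N) * V * ((d * l * P) ^ ε * (d : ℝ) ^ e₀ *
          X ^ (-((c₀ : ℝ) / 2 ^ (k + 2)))) := by gcongr
      _ = _ := by ring
  rcases le_total 1 S with h1 | h1
  · refine (norm_regSum_le hd hz hP α).trans ?_
    have : (0 : ℝ) ≤ 4 * C₁ + C₂ := by linarith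
    calc 6 ^ N * V ≤ 6 ^ N * V * S := le_mul_of_one_le_right (by positivity) h1
      _ ≤ _ := by gcongr; linarith
  · set κ := ⌊P * S⌋₊ + 1 with hκ
    have hκ1 : P * S ≤ κ := by rw [hκ]; push_cast; exact (Nat.lt_floor_add_one _).le
    have hκ2 : (κ : ℝ) - 1 ≤ P * S := by
      rw [hκ]; push_cast; rw [add_sub_cancel_right]; exact Nat.floor_le (by positivity)
    have h2 := hr (d * l) hdl P hP (fun x => eexp (α * (eval x (dPoly F d z) : ℤ)))
      (fun v => (norm_eexp _).le) _ (hb d hd P hP z hz hdim X hX hXd α hmaj) κ (by omega)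
    rw [show C₁ * boxVol m r d l P * (d * l * P) ^ ε * (d : ℝ) ^ e₀ *
      X ^ (-((c₀ : ℝ) / 2 ^ (k + 1))) = C₁ * V * (S * S) by rw [hSsq]; ring] at h2
    refine h2.trans ?_
    have h3 : P / κ + 1 ≤ 2 / S := by
      have h4 : P / κ ≤ 1 / S := by
        rw [div_le_div_iff₀ (by positivity) hS0]; linarith
      have h5 : 1 ≤ 1 / S := by rw [le_div_iff₀ hS0]; linarith
      rw [show 2 / S = 1 / S + 1 / S by ring]; linarith
    have h6 : ((κ : ℝ) - 1) / P ≤ S := by rw [div_le_iff₀ (by linarith)]; linarith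
    calc _ ≤ 2 / S * (2 * (C₁ * V * (S * S))) + C₂ * V * S := by
          have : C₂ * (P ^ (r + 1) * (P * (d * l)) ^ (m - r)) * (((κ : ℝ) - 1) / P) ≤ C₂ * V * S :=
            mul_le_mul_of_nonneg_left h6 (by positivity)
          gcongr
      _ = (4 * C₁ + C₂) * V * S := by field_simp; ring
      _ ≤ _ := by
        have : (0 : ℝ) ≤ 6 ^ N := by positivity
        refine mul_le_mul_of_nonneg_right (mul_le_mul_of_nonneg_right ?_ hV0.le) hS0.le
        linarith

end RegionSum

section Layers

lemma Maj.mono {C₀ : ℝ} {k d₂ d : ℕ} {l P X X' α : ℝ} (h : Maj C₀ k d₂ d l P X α) (hC₀ : 0 ≤ C₀)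
    (hl : 0 ≤ l) (hP : 0 ≤ P) (hX : 0 ≤ X) (hXX' : X ≤ X') : Maj C₀ k d₂ d l P X' α := by
  obtain ⟨q, h1, h2, h3⟩ := h
  exact ⟨q, h1, h2.trans (by gcongr), h3.trans (by gcongr)⟩

lemma maj_of_le {C₀ : ℝ} {k d₂ d : ℕ} {l P X : ℝ} (hC₀ : 1 ≤ C₀) (hd : 1 ≤ d) (hl : 1 ≤ l)
    (hP : 1 ≤ P) (hX : d * P ≤ X) (α : ℝ) : Maj C₀ k d₂ d l P X α := by
  have hd1 : (1 : ℝ) ≤ d := by exact_mod_cast hd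
  have hdP : 1 ≤ (d : ℝ) * P := one_le_mul_of_one_le_of_one_le hd1 hP
  refine Maj.mono (X := d * P) ?_ (by linarith) (by linarith) (by linarith) (by linarith) hX
  have hPn : 0 < ⌊P⌋₊ := Nat.le_floor (by simpa using hP)
  obtain ⟨q, hq, hqP, hq'⟩ := Real.exists_nat_abs_mul_sub_round_le (α * d) hPn
  refine ⟨q, hq, ?_, ?_⟩
  · have h1 : (q : ℝ) ≤ P := (Nat.cast_le.2 hqP).trans (Nat.floor_le (by linarith))
    have h2 : P ≤ d * P := le_mul_of_one_le_left (by linarith) hd1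
    have h3 : (d : ℝ) * P ≤ (d * P) ^ (k + 1) := le_self_pow₀ hdP (by omega)
    have h4 : 1 ≤ C₀ * l ^ d₂ := one_le_mul_of_one_le_of_one_le hC₀ (one_le_pow₀ hl)
    have h5 := le_mul_of_one_le_left (by positivity : 0 ≤ ((d : ℝ) * P) ^ (k + 1)) h4
    linarith
  · rw [show α * (d * (q : ℝ)) = q * (α * d) by ring]
    refine hq'.trans ?_
    have h1 : (1 : ℝ) / (⌊P⌋₊ + 1) ≤ 1 / P := by
      gcongr
      exact (Nat.lt_floor_add_one P).le
    refine h1.trans (le_of_eq ?_)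
    field_simp
    ring

/-- A union of intervals containing the `α ∈ [-1, 1]` with `Maj`. -/
def majSet (C₀ : ℝ) (k d₂ d : ℕ) (l P X : ℝ) : Set ℝ :=
  ⋃ q ∈ Finset.Icc 1 ⌊C₀ * l ^ d₂ * X ^ (k + 1)⌋₊, ⋃ i ∈ Finset.Icc (-((d * q : ℕ) : ℤ)) ((d * q : ℕ) : ℤ),
    Set.Icc (((i : ℝ) - X ^ (k + 1) / (d ^ (k + 1) * P ^ (k + 2))) / (d * q : ℕ))
      (((i : ℝ) + X ^ (k + 1) / (d ^ (k + 1) * P ^ (k + 2))) / (d * q : ℕ))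

lemma measurableSet_majSet (C₀ : ℝ) (k d₂ d : ℕ) (l P X : ℝ) :
    MeasurableSet (majSet C₀ k d₂ d l P X) :=
  Finset.measurableSet_biUnion _ fun _ _ => Finset.measurableSet_biUnion _ fun _ _ => measurableSet_Icc

lemma mem_majSet {C₀ : ℝ} {k d₂ d : ℕ} {l P X α : ℝ} (hd : 1 ≤ d) (hα : α ∈ Set.Icc (-1 : ℝ) 1)
    (h : Maj C₀ k d₂ d l P X α) : α ∈ majSet C₀ k d₂ d l P X := by
  obtain ⟨q, h1, h2, h3⟩ := h
  have hu : 1 ≤ d * q := Nat.mul_pos hd h1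
  have hu1 : (1 : ℝ) ≤ (d * q : ℕ) := by exact_mod_cast hu
  refine Set.mem_biUnion (Finset.mem_coe.2 (Finset.mem_Icc.2 ⟨h1, Nat.le_floor h2⟩)) ?_
  rw [← Nat.cast_mul] at h3
  set u := d * q
  simp only [Set.mem_iUnion]
  refine ⟨round (α * (u : ℝ)), Finset.mem_Icc.2 ?_, ?_⟩
  · have h4 : -(u : ℝ) ≤ α * u ∧ α * u ≤ u := by constructor <;> nlinarith [hα.1, hα.2]
    rw [round_eq]
    constructor
    · rw [Int.le_floor]; push_cast; linarith [h4.1]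
    · rw [← Int.lt_add_one_iff, Int.floor_lt]; push_cast; linarith [h4.2]
  · rw [nd, abs_le] at h3
    rw [Set.mem_Icc, div_le_iff₀ (by linarith), le_div_iff₀ (by linarith)]
    constructor <;> linarith [h3.1, h3.2]

lemma volume_majSet_le {C₀ : ℝ} (k d₂ : ℕ) {d : ℕ} {l P X : ℝ} (hC₀ : 0 ≤ C₀) (hd : 1 ≤ d)
    (hl : 0 ≤ l) (hP : 0 < P) (hX : 0 ≤ X) : volume (majSet C₀ k d₂ d l P X) ≤
      ENNReal.ofReal (6 * C₀ * l ^ d₂ * X ^ (2 * (k + 1)) / (d ^ (k + 1) * P ^ (k + 2))) := by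
  have hd0 : (0 : ℝ) < d := by exact_mod_cast hd
  set δ := X ^ (k + 1) / (d ^ (k + 1) * P ^ (k + 2)) with hδ
  have hδ0 : 0 ≤ δ := by positivity
  set Q := ⌊C₀ * l ^ d₂ * X ^ (k + 1)⌋₊ with hQ
  have h1 : ∀ q ∈ Finset.Icc 1 Q, volume (⋃ i ∈ Finset.Icc (-((d * q : ℕ) : ℤ)) ((d * q : ℕ) : ℤ),
      Set.Icc (((i : ℝ) - δ) / (d * q : ℕ)) (((i : ℝ) + δ) / (d * q : ℕ))) ≤ ENNReal.ofReal (6 * δ) := by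
    intro q hq
    have hu : 1 ≤ d * q := Nat.mul_pos hd (Finset.mem_Icc.1 hq).1
    have hu1 : (1 : ℝ) ≤ (d * q : ℕ) := by exact_mod_cast hu
    set u := d * q
    refine (measure_biUnion_finset_le _ _).trans ?_
    simp only [Real.volume_Icc]
    rw [Finset.sum_congr rfl (g := fun _ => ENNReal.ofReal (2 * δ / u)) fun i _ => by congr 1; ring,
      Finset.sum_const, nsmul_eq_mul, ← ENNReal.ofReal_natCast, ← ENNReal.ofReal_mul (by positivity)]
    refine ENNReal.ofReal_le_ofReal ?_
    have hc : ((Finset.Icc (-(u : ℤ)) u).card : ℝ) ≤ 3 * u := by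
      rw [Int.card_Icc]
      have : (((u : ℤ) + 1 - -(u : ℤ)).toNat) = 2 * u + 1 := by omega
      rw [this]; push_cast; linarith
    calc _ ≤ (3 * (u : ℝ)) * (2 * δ / u) := by gcongr
      _ = 6 * δ := by field_simp; ring
  refine (measure_biUnion_finset_le _ _).trans ((Finset.sum_le_sum h1).trans ?_)
  rw [Finset.sum_const, nsmul_eq_mul, Nat.card_Icc, ← ENNReal.ofReal_natCast,
    ← ENNReal.ofReal_mul (by positivity)]
  refine ENNReal.ofReal_le_ofReal ?_
  rw [add_tsub_cancel_right]
  have h2 : (Q : ℝ) ≤ C₀ * l ^ d₂ * X ^ (k + 1) := Nat.floor_le (by positivity)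
  calc (Q : ℝ) * (6 * δ) ≤ (C₀ * l ^ d₂ * X ^ (k + 1)) * (6 * δ) := by gcongr
    _ = _ := by rw [hδ, mul_comm 2 (k + 1), pow_mul]; ring

/-- Integration over dyadic layers. -/
lemma exists_layer_bound (k : ℕ) {K C₀ : ℝ} (hC₀ : 1 ≤ C₀) (hK : 2 * ((k : ℝ) + 1) < K) :
    ∃ C : ℝ, 1 ≤ C ∧ ∀ (d₂ d : ℕ), 1 ≤ d → ∀ l : ℝ, 1 ≤ l → ∀ P : ℝ, 1 ≤ P → ∀ X₀ : ℝ, 1 ≤ X₀ →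
      ∀ (S : ℝ → ℂ) (A : ℝ), 0 ≤ A → (∀ X, 1 ≤ X → X ≤ d * P → ∀ α, ¬ Maj C₀ k d₂ d l P X α →
        ‖S α‖ ≤ A * X ^ (-K)) →
      ∃ h : ℝ → ℝ, Integrable h ∧ (∀ α, 0 ≤ h α) ∧
        (∀ α ∈ Set.Icc (-1 : ℝ) 1, ¬ Maj C₀ k d₂ d l P X₀ α → ‖S α‖ ≤ h α) ∧
        ∫ α, h α ≤ C * (A * l ^ d₂ / (d ^ (k + 1) * P ^ (k + 2))) * X₀ ^ (2 * ((k : ℝ) + 1) - K) := by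
  set ρ := K - 2 * ((k : ℝ) + 1) with hρ
  have hρ0 : 0 < ρ := by linarith
  have hθ1 : (2 : ℝ) ^ (-ρ) < 1 := Real.rpow_lt_one_of_one_lt_of_neg (by norm_num) (by linarith)
  have hθ0 : 0 < (2 : ℝ) ^ (-ρ) := by positivity
  set C := 6 * C₀ * 2 ^ (2 * (k + 1)) * (1 - (2 : ℝ) ^ (-ρ))⁻¹ with hC
  refine ⟨max 1 C, le_max_left _ _, ?_⟩
  intro d₂ d hd l hl P hP X₀ hX₀ S A hA hS
  have hd1 : (1 : ℝ) ≤ d := by exact_mod_cast hd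
  have hd0 : (0 : ℝ) < d := by linarith
  set J := ⌈(d : ℝ) * P⌉₊ with hJ
  have hJ' : (d : ℝ) * P ≤ 2 ^ J * X₀ := by
    have h1 : (d : ℝ) * P ≤ J := Nat.le_ceil _
    have h2 : (J : ℝ) < 2 ^ J := by exact_mod_cast Nat.lt_two_pow_self
    have h3 : (2 : ℝ) ^ J ≤ 2 ^ J * X₀ := le_mul_of_one_le_right (by positivity) hX₀
    linarith
  set M := fun j : ℕ => majSet C₀ k d₂ d l P (2 ^ (j + 1) * X₀) with hM
  have hMm : ∀ j, MeasurableSet (M j) := fun j => measurableSet_majSet _ _ _ _ _ _ _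
  have hMv : ∀ j, volume (M j) ≤ ENNReal.ofReal
      (6 * C₀ * l ^ d₂ * (2 ^ (j + 1) * X₀) ^ (2 * (k + 1)) / (d ^ (k + 1) * P ^ (k + 2))) := fun j =>
    volume_majSet_le k d₂ (by linarith) hd (by linarith) (by linarith) (by positivity)
  have hMt : ∀ j, volume (M j) ≠ ⊤ := fun j => ne_top_of_le_ne_top ENNReal.ofReal_ne_top (hMv j)
  have hMr : ∀ j, volume.real (M j) ≤
      6 * C₀ * l ^ d₂ * (2 ^ (j + 1) * X₀) ^ (2 * (k + 1)) / (d ^ (k + 1) * P ^ (k + 2)) := fun j =>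
    ENNReal.toReal_le_of_le_ofReal (by positivity) (hMv j)
  set c := fun j : ℕ => A * (2 ^ j * X₀) ^ (-K) with hc
  have hc0 : ∀ j, 0 ≤ c j := fun j => by positivity
  have h_int : ∀ j, Integrable ((M j).indicator fun _ => c j) := fun j =>
    (integrable_indicator_iff (hMm j)).2 (integrableOn_const (hMt j))
  refine ⟨fun α => ∑ j ∈ Finset.range J, (M j).indicator (fun _ => c j) α,
    integrable_finsetSum _ fun j _ => h_int j, fun α => Finset.sum_nonneg fun j _ =>
      Set.indicator_nonneg (fun _ _ => hc0 j) _, ?_, ?_⟩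
  · intro α hα hmaj
    have hex : ∃ j, Maj C₀ k d₂ d l P (2 ^ j * X₀) α := ⟨J, maj_of_le hC₀ hd hl hP hJ' α⟩
    have h1 := Nat.find_spec hex
    have h0 : Nat.find hex ≠ 0 := by
      intro h
      rw [h] at h1
      simp at h1
      exact hmaj h1
    obtain ⟨j, hj⟩ := Nat.exists_eq_succ_of_ne_zero h0
    rw [hj] at h1
    have h2 : ¬ Maj C₀ k d₂ d l P (2 ^ j * X₀) α := Nat.find_min hex (by omega)
    have hjJ : j < J := by
      have := Nat.find_min' hex (maj_of_le hC₀ hd hl hP hJ' α)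
      omega
    have h3 : (2 : ℝ) ^ j * X₀ ≤ d * P := by
      by_contra! hcon
      exact h2 (maj_of_le hC₀ hd hl hP hcon.le α)
    have h4 : 1 ≤ (2 : ℝ) ^ j * X₀ := one_le_mul_of_one_le_of_one_le (one_le_pow₀ (by norm_num)) hX₀
    refine (hS _ h4 h3 α h2).trans ?_
    have h5 : (M j).indicator (fun _ => c j) α = c j := Set.indicator_of_mem (mem_majSet hd hα h1) _
    refine le_trans (le_of_eq h5.symm) ?_
    exact Finset.single_le_sum (f := fun j => (M j).indicator (fun _ => c j) α)
      (fun i _ => Set.indicator_nonneg (fun _ _ => hc0 i) _) (Finset.mem_range.2 hjJ)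
  · rw [integral_finsetSum _ fun j _ => h_int j]
    set U := A * l ^ d₂ / (d ^ (k + 1) * P ^ (k + 2)) with hU
    have hU0 : 0 ≤ U := by positivity
    have h1 : ∀ j, ∫ α, (M j).indicator (fun _ => c j) α ≤
        6 * C₀ * 2 ^ (2 * (k + 1)) * U * X₀ ^ (-ρ) * ((2 : ℝ) ^ (-ρ)) ^ j := by
      intro j
      rw [integral_indicator (hMm j), setIntegral_const, smul_eq_mul]
      refine (mul_le_mul_of_nonneg_right (hMr j) (hc0 j)).trans (le_of_eq ?_)
      have e1 : ((2 : ℝ) ^ (j + 1) * X₀) ^ (2 * (k + 1)) =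
          2 ^ (2 * (k + 1)) * (2 ^ j * X₀) ^ (2 * ((k : ℝ) + 1)) := by
        rw [show 2 * ((k : ℝ) + 1) = ((2 * (k + 1) : ℕ) : ℝ) by push_cast; ring, Real.rpow_natCast,
          ← mul_pow]
        congr 1; ring
      have e2 : ((2 : ℝ) ^ j * X₀) ^ (2 * ((k : ℝ) + 1)) * (2 ^ j * X₀) ^ (-K) =
          X₀ ^ (-ρ) * ((2 : ℝ) ^ (-ρ)) ^ j := by
        rw [← Real.rpow_add (by positivity), show 2 * ((k : ℝ) + 1) + -K = -ρ by rw [hρ]; ring,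
          Real.mul_rpow (by positivity) (by positivity), ← Real.rpow_natCast 2 j,
          ← Real.rpow_mul (by norm_num), ← Real.rpow_mul_natCast (by norm_num)]
        rw [mul_comm (j : ℝ)]; ring
      rw [e1, hc]
      calc _ = 6 * C₀ * 2 ^ (2 * (k + 1)) * U * (((2 : ℝ) ^ j * X₀) ^ (2 * ((k : ℝ) + 1)) *
            (2 ^ j * X₀) ^ (-K)) := by rw [hU]; ring
        _ = _ := by rw [e2]; ring
    refine (Finset.sum_le_sum fun j _ => h1 j).trans ?_
    rw [← Finset.mul_sum]
    have h2 : ∑ j ∈ Finset.range J, ((2 : ℝ) ^ (-ρ)) ^ j ≤ (1 - (2 : ℝ) ^ (-ρ))⁻¹ := by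
      rw [← tsum_geometric_of_lt_one hθ0.le hθ1]
      exact (summable_geometric_of_lt_one hθ0.le hθ1).sum_le_tsum _ fun _ _ => by positivity
    rw [show 2 * ((k : ℝ) + 1) - K = -ρ by rw [hρ]; ring]
    have h3 : 0 ≤ C₀ := by linarith
    calc _ ≤ 6 * C₀ * 2 ^ (2 * (k + 1)) * U * X₀ ^ (-ρ) * (1 - (2 : ℝ) ^ (-ρ))⁻¹ := by gcongr
      _ = C * U * X₀ ^ (-ρ) := by rw [hC]; ring
      _ ≤ _ := by
        gcongr
        exact le_max_right _ _

lemma integral_eexp_mul_int (c : ℤ) (a : ℝ) :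
    ∫ α in a..(a + 1), eexp (α * c) = if c = 0 then 1 else 0 := by
  split_ifs with h
  · subst h; simp [eexp_zero]
  · have hne : (2 * Real.pi * Complex.I * c : ℂ) ≠ 0 := by
      simp [Real.pi_ne_zero, h]
    have e : ∀ α : ℝ, eexp (α * c) = Complex.exp ((2 * Real.pi * Complex.I * c) * α) := fun α => by
      rw [eexp]; congr 1; push_cast; ring
    simp only [e]
    rw [integral_exp_mul_complex hne]
    have : Complex.exp ((2 * Real.pi * Complex.I * c) * ((a + 1 : ℝ) : ℂ)) =
        Complex.exp ((2 * Real.pi * Complex.I * c) * (a : ℂ)) := by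
      rw [Complex.exp_eq_exp_iff_exists_int]
      exact ⟨c, by push_cast; ring⟩
    rw [this, sub_self, zero_div]

lemma continuous_regSum (F : MvPolynomial (Idx n m r) ℤ) (d : ℕ) (z : Fin (n - m + 1) → ℤ) (P : ℝ) :
    Continuous (regSum F d z P) :=
  continuous_finsetSum _ fun x _ => continuous_eexp.comp (by fun_prop)

/-- The number of solutions in the region. -/
def regCount (F : MvPolynomial (Idx n m r) ℤ) (d : ℕ) (z : Fin (n - m + 1) → ℤ) (P : ℝ) : ℕ :=
  ((regPts m r (d * ‖z‖) P).filter fun x => eval x (dPoly F d z) = 0).card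

lemma regCount_eq_integral (F : MvPolynomial (Idx n m r) ℤ) (d : ℕ) (z : Fin (n - m + 1) → ℤ)
    (P a : ℝ) : (regCount F d z P : ℂ) = ∫ α in a..(a + 1), regSum F d z P α := by
  unfold regSum
  rw [intervalIntegral.integral_finsetSum
    (f := fun x α => eexp (α * ((eval x (dPoly F d z) : ℤ) : ℝ))) fun x _ =>
    (show Continuous fun α : ℝ => eexp (α * ((eval x (dPoly F d z) : ℤ) : ℝ)) from
      continuous_eexp.comp (by fun_prop)).intervalIntegrable _ _]
  simp only [integral_eexp_mul_int]
  rw [Finset.sum_ite, regCount]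
  simp

end Layers

section Approximation

/-- The form `F(𝐮, l𝐯, 𝐳)` with `l = |𝐳|`. -/
def normForm (F : MvPolynomial (Idx n m r) ℤ) (z : Fin (n - m + 1) → ℤ) (v : VIdx m r → ℝ) : ℝ :=
  evalF F (fun i => v (Sum.inl i)) (fun j => ‖z‖ * v (Sum.inr j)) (fun k => (z k : ℝ))

lemma continuous_normForm (F : MvPolynomial (Idx n m r) ℤ) (z : Fin (n - m + 1) → ℤ) :
    Continuous (normForm F z) := by
  unfold normForm evalF
  have h : Continuous fun x : Idx n m r → ℝ => aeval x F := by
    have := MvPolynomial.continuous_eval (map (algebraMap ℤ ℝ) F)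
    refine this.congr fun x => ?_
    rw [eval_map, aeval_def]
  refine h.comp (continuous_pi ?_)
  rintro (i | j | k) <;> simp only [Sum.elim_inl, Sum.elim_inr] <;> fun_prop

lemma exists_normForm_bound (F : MvPolynomial (Idx n m r) ℤ) {d₁ d₂ : ℕ} (hF : Bihomogeneous F d₁ d₂) :
    ∃ C : ℝ, 0 < C ∧ ∀ z : Fin (n - m + 1) → ℤ, 1 ≤ ‖z‖ → ∀ v w : VIdx m r → ℝ, ‖v‖ ≤ 1 → ‖w‖ ≤ 1 →
      |normForm F z v - normForm F z w| ≤ C * ‖z‖ ^ d₂ * ‖v - w‖ := by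
  obtain ⟨C, hC, -, hlip⟩ := exists_aeval_lipschitz F
  refine ⟨C, hC, fun z hz v w hv hw => ?_⟩
  have hz0 : 0 < ‖z‖ := by linarith
  set ζ : Fin (n - m + 1) → ℝ := fun k => (z k : ℝ) / ‖z‖ with hζ
  set e : (VIdx m r → ℝ) → Idx n m r → ℝ := fun v =>
    Sum.elim (fun i => v (Sum.inl i)) (Sum.elim (fun j => v (Sum.inr j)) ζ) with he
  have h1 : ∀ v, normForm F z v = ‖z‖ ^ d₂ * aeval (e v) F := by
    intro v
    have := hF ℝ 1 ‖z‖ (fun i => v (Sum.inl i)) (fun j => v (Sum.inr j)) ζ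
    rw [one_pow, one_mul (‖z‖ ^ d₂)] at this
    refine Eq.trans ?_ this
    rw [normForm]
    congr 1
    · funext i; ring
    · funext j; ring
    · funext k; rw [hζ]; field_simp
  have hζ1 : ∀ k, |ζ k| ≤ 1 := fun k => by
    rw [hζ]; simp only
    rw [abs_div, abs_of_pos hz0, div_le_one hz0]
    exact norm_le_pi_norm z k
  have h2 : ∀ v : VIdx m r → ℝ, ‖v‖ ≤ 1 → ‖e v‖ ≤ 1 := by
    intro v hv
    rw [pi_norm_le_iff_of_nonneg zero_le_one]
    rintro (i | j | k)
    · exact (norm_le_pi_norm v _).trans hv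
    · exact (norm_le_pi_norm v _).trans hv
    · exact hζ1 k
  have h3 : ‖e v - e w‖ ≤ ‖v - w‖ := by
    rw [pi_norm_le_iff_of_nonneg (norm_nonneg _)]
    rintro (i | j | k)
    · exact norm_le_pi_norm (v - w) _
    · exact norm_le_pi_norm (v - w) _
    · simp [he]
  rw [h1, h1, ← mul_sub, abs_mul, abs_of_nonneg (by positivity)]
  calc _ ≤ ‖z‖ ^ d₂ * (C * ‖e v - e w‖) := by
        gcongr; exact hlip _ _ (h2 v hv) (h2 w hw)
    _ ≤ ‖z‖ ^ d₂ * (C * ‖v - w‖) := by gcongr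
    _ = _ := by ring

/-- The integrand of `I_𝐳(γ)`. -/
def oscFun (F : MvPolynomial (Idx n m r) ℤ) (z : Fin (n - m + 1) → ℤ) (γ : ℝ) (v : VIdx m r → ℝ) : ℂ :=
  if ‖v‖ ≤ 1 ∧ ‖v ∘ Sum.inr‖ < ‖v ∘ Sum.inl‖ then eexp (γ * normForm F z v) else 0

lemma IbetaZ_eq (F : MvPolynomial (Idx n m r) ℤ) (z : Fin (n - m + 1) → ℤ) (γ : ℝ) :
    IbetaZ F z γ = ∫ v, oscFun F z γ v := by
  have h := (volume_measurePreserving_sumPiEquivProdPi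
    (fun _ : Fin (r + 1) ⊕ Fin (m - r) => ℝ)).integral_comp'
    (g := fun p : (Fin (r + 1) → ℝ) × (Fin (m - r) → ℝ) =>
    if ‖p.1‖ ≤ 1 ∧ ‖p.2‖ ≤ 1 ∧ ‖p.2‖ < ‖p.1‖ then
      eexp (γ * evalF F p.1 (fun j => ‖z‖ * p.2 j) (fun k => (z k : ℝ)))
    else 0)
  rw [IbetaZ, ← h]
  refine integral_congr_ae (Filter.Eventually.of_forall fun v => ?_)
  simp only [oscFun, norm_eq_max_comp v, max_le_iff, and_assoc]
  rfl

lemma norm_oscFun_le (F : MvPolynomial (Idx n m r) ℤ) (z : Fin (n - m + 1) → ℤ) (γ : ℝ)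
    (v : VIdx m r → ℝ) : ‖oscFun F z γ v‖ ≤ (Metric.closedBall 0 1).indicator (fun _ => 1) v := by
  unfold oscFun
  split_ifs with h
  · rw [norm_eexp, Set.indicator_of_mem]
    simpa using h.1
  · rw [norm_zero]
    exact Set.indicator_nonneg (fun _ _ => zero_le_one) _

lemma measurable_oscFun_uncurry (F : MvPolynomial (Idx n m r) ℤ) (z : Fin (n - m + 1) → ℤ) :
    Measurable fun p : ℝ × (VIdx m r → ℝ) => oscFun F z p.1 p.2 := by
  unfold oscFun
  have h1 : Continuous fun p : ℝ × (VIdx m r → ℝ) => ‖p.2 ∘ Sum.inr‖ :=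
    Continuous.norm (by fun_prop : Continuous fun p : ℝ × (VIdx m r → ℝ) => fun j => p.2 (Sum.inr j))
  have h2 : Continuous fun p : ℝ × (VIdx m r → ℝ) => ‖p.2 ∘ Sum.inl‖ :=
    Continuous.norm (by fun_prop : Continuous fun p : ℝ × (VIdx m r → ℝ) => fun j => p.2 (Sum.inl j))
  have h3 : Measurable fun p : ℝ × (VIdx m r → ℝ) => ‖p.2‖ := by fun_prop
  refine Measurable.ite ?_ ?_ measurable_const
  · exact (measurableSet_le h3 measurable_const).inter
      (measurableSet_lt h1.measurable h2.measurable)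
  · exact (continuous_eexp.comp (continuous_fst.mul ((continuous_normForm F z).comp
      continuous_snd))).measurable

lemma integrable_ball_indicator (ι : Type) [Fintype ι] (c ρ : ℝ) :
    Integrable ((Metric.closedBall (0 : ι → ℝ) ρ).indicator fun _ => c) :=
  (integrable_indicator_iff Metric.isClosed_closedBall.measurableSet).2
    (integrableOn_const (measure_closedBall_lt_top.ne))

lemma integrable_oscFun (F : MvPolynomial (Idx n m r) ℤ) (z : Fin (n - m + 1) → ℤ) (γ : ℝ) :
    Integrable (oscFun F z γ) := by
  refine (integrable_ball_indicator (VIdx m r) 1 1).mono'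
    ((measurable_oscFun_uncurry F z).comp (measurable_prodMk_left (x := γ))).aestronglyMeasurable ?_
  exact Filter.Eventually.of_forall (norm_oscFun_le F z γ)

lemma integral_ball_indicator (ι : Type) [Fintype ι] (c : ℝ) {ρ : ℝ} (hρ : 0 ≤ ρ) :
    ∫ v : ι → ℝ, (Metric.closedBall (0 : ι → ℝ) ρ).indicator (fun _ => c) v =
      (2 * ρ) ^ Fintype.card ι * c := by
  rw [integral_indicator Metric.isClosed_closedBall.measurableSet, setIntegral_const, smul_eq_mul,
    Measure.real, Real.volume_pi_closedBall _ hρ, ENNReal.toReal_ofReal (by positivity)]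

lemma norm_eexp_sub_le (s t : ℝ) : ‖eexp s - eexp t‖ ≤ 2 * Real.pi * |s - t| := by
  have h : eexp s - eexp t = eexp t * (Complex.exp (Complex.I * ((2 * Real.pi * (s - t) : ℝ) : ℂ)) - 1) := by
    rw [mul_sub, mul_one]
    congr 1
    rw [eexp, eexp, ← Complex.exp_add]; congr 1; push_cast; ring
  rw [h, norm_mul, norm_eexp, one_mul]
  refine (Real.norm_exp_I_mul_ofReal_sub_one_le).trans (le_of_eq ?_)
  rw [Real.norm_eq_abs, abs_mul, abs_of_pos (by positivity : 0 < 2 * Real.pi)]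

lemma eval_dPoly_scale (F : MvPolynomial (Idx n m r) ℤ) {d₁ d₂ : ℕ} (hF : Bihomogeneous F d₁ d₂)
    {d : ℕ} (hd : 1 ≤ d) {z : Fin (n - m + 1) → ℤ} (hz : 1 ≤ ‖z‖) {P : ℝ} (hP : 1 ≤ P)
    (x : VIdx m r → ℤ) :
    ((eval x (dPoly F d z) : ℤ) : ℝ) = (d * P) ^ d₁ * normForm F z (sclPt (d * ‖z‖) P x) := by
  have hd0 : (0 : ℝ) < d := by exact_mod_cast hd
  rw [eval_dPoly, show ((evalF F (fun i => (d : ℤ) * x (Sum.inl i)) (fun j => x (Sum.inr j)) z : ℤ) : ℝ) =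
    Int.castRingHom ℝ (evalF F (fun i => (d : ℤ) * x (Sum.inl i)) (fun j => x (Sum.inr j)) z) from rfl,
    map_evalF]
  have h := hF ℝ (d * P) 1 (fun i => sclPt (d * ‖z‖) P x (Sum.inl i))
    (fun j => ‖z‖ * sclPt (d * ‖z‖) P x (Sum.inr j)) (fun k => (z k : ℝ))
  rw [one_pow, mul_one ((d * P) ^ d₁)] at h
  refine Eq.trans ?_ h
  congr 1
  · funext i; simp [sclPt, wt]; field_simp
  · funext j; simp [sclPt, wt]; field_simp
  · funext k; simp

/-- The sum of `e(β F)` over the points of the region in a fixed residue class. -/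
lemma exists_residue_sum_approx (F : MvPolynomial (Idx n m r) ℤ) {d₁ d₂ : ℕ}
    (hF : Bihomogeneous F d₁ d₂) :
    ∃ C : ℝ, 0 < C ∧ ∀ d : ℕ, 1 ≤ d → ∀ z : Fin (n - m + 1) → ℤ, 1 ≤ ‖z‖ → ∀ P : ℝ, 1 ≤ P →
      ∀ q : ℕ, 1 ≤ q → (q : ℝ) ≤ P → ∀ β : ℝ, ∀ c : VIdx m r → ℤ, (∀ i, 0 ≤ c i) → (∀ i, c i < q) →
      ‖((((q : ℝ) ^ Fintype.card (VIdx m r) / boxVol m r d ‖z‖ P : ℝ)) : ℂ) *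
        (∑ x ∈ (regPts m r (d * ‖z‖) P).filter (fun x => ∀ i, x i % q = c i),
          eexp (β * (eval x (dPoly F d z) : ℤ))) - IbetaZ F z (β * (d * P) ^ d₁)‖ ≤
        C * (q / P) * (1 + |β| * (d * P) ^ d₁ * ‖z‖ ^ d₂) := by
  obtain ⟨C₁, hC₁, hlip⟩ := exists_normForm_bound F hF
  obtain ⟨C₂, hC₂, hvol⟩ := exists_volume_nearBdry_le (VIdx m r)
  set N := Fintype.card (VIdx m r) with hN
  refine ⟨2 ^ N * (2 * Real.pi * C₁) + 4 * C₂, by positivity, ?_⟩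
  intro d hd z hz P hP q hq hqP β c hc0 hcq
  have hd1 : (1 : ℝ) ≤ d := by exact_mod_cast hd
  have hq1 : (1 : ℝ) ≤ q := by exact_mod_cast hq
  have hq0 : (0 : ℝ) < q := by linarith
  have hP0 : 0 < P := by linarith
  set b := (d : ℝ) * ‖z‖ with hb
  have hb1 : 1 ≤ b := one_le_mul_of_one_le_of_one_le hd1 hz
  have hb0 : 0 < b := by linarith
  have hwt := fun i => one_le_wt (m := m) (r := r) hb1 i
  have hwt0 := fun i => wt_pos (m := m) (r := r) hb0 i
  have hwtb : ∀ i, wt m r b i ≤ b := by rintro (i | j) <;> simp [wt, hb1]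
  set γ := β * (d * P) ^ d₁ with hγ
  set s : VIdx m r → ℝ := fun i => q / (P * wt m r b i) with hs
  set o : VIdx m r → ℝ := fun i => c i / (P * wt m r b i) with ho
  have hs0 : ∀ i, 0 < s i := fun i => by have := hwt0 i; positivity
  set w := (q : ℝ) / P with hw
  have hw0 : 0 < w := by positivity
  have hw1 : w ≤ 1 := by rw [hw, div_le_one hP0]; exact hqP
  have hsw : ∀ i, s i ≤ w := fun i => by
    have := hwt i
    simp only [hs, hw]
    gcongr
    exact le_mul_of_one_le_right hP0.le this
  have hprod : ∏ i, s i = (q : ℝ) ^ N / boxVol m r d ‖z‖ P := by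
    rw [hs, Finset.prod_div_distrib, Finset.prod_const, Finset.card_univ, ← hN, ← prod_side]
  set ξ : (VIdx m r → ℤ) → VIdx m r → ℤ := fun t i => c i + q * t i with hξ
  have hcorner : ∀ t, corner o s t = sclPt b P (ξ t) := by
    intro t; funext i
    simp only [corner, sclPt, ho, hs, hξ]; push_cast; ring
  set M : ℤ := ⌈P * b⌉ + 2 with hM
  have hMle : P * b + 2 ≤ M := by rw [hM]; push_cast; linarith [Int.le_ceil (P * b)]
  set T : Finset (VIdx m r → ℤ) := Fintype.piFinset fun _ => Finset.Icc (-M) M with hT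
  have hmemT : ∀ t : VIdx m r → ℤ, (∀ i, |(t i : ℝ)| ≤ M) → t ∈ T := by
    intro t ht
    rw [hT, Fintype.mem_piFinset]
    intro i
    have := ht i
    rw [Finset.mem_Icc, ← abs_le]
    exact_mod_cast this
  set g : (VIdx m r → ℤ) → ℂ := fun t =>
    if ξ t ∈ regPts m r b P then eexp (β * (eval (ξ t) (dPoly F d z) : ℤ)) else 0 with hg
  have hgsum : ∑ t ∈ T, g t = ∑ x ∈ (regPts m r b P).filter (fun x => ∀ i, x i % q = c i),
      eexp (β * (eval x (dPoly F d z) : ℤ)) := by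
    rw [hg, ← Finset.sum_filter]
    symm
    have hξdiv : ∀ x : VIdx m r → ℤ, (∀ i, x i % q = c i) → ξ (fun i => x i / q) = x := by
      intro x hx; funext i
      simp only [hξ]
      rw [← hx i]; exact Int.emod_add_mul_ediv _ _
    refine Finset.sum_bij' (fun x _ => fun i => x i / (q : ℤ)) (fun t _ => ξ t) ?_ ?_ ?_ ?_ ?_
    · intro x hx
      obtain ⟨hx1, hx2⟩ := Finset.mem_filter.1 hx
      refine Finset.mem_filter.2 ⟨hmemT _ fun i => ?_, by rwa [hξdiv x hx2]⟩
      have h1 := ((mem_regPts_iff_sclPt hb0 hP0).1 hx1).1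
      have h2 := (norm_le_pi_norm _ i).trans h1
      have h3 := hwt0 i
      rw [sclPt, Real.norm_eq_abs, abs_div, abs_of_pos (by positivity : 0 < P * wt m r b i),
        div_le_one (by positivity)] at h2
      have h4 : |(x i : ℝ)| ≤ P * b := h2.trans (by gcongr; exact hwtb i)
      have h5 : |x i / (q : ℤ)| ≤ |x i| := by
        rw [Int.abs_eq_natAbs, Int.abs_eq_natAbs]
        exact_mod_cast Int.natAbs_ediv_le_natAbs (x i) q
      calc |((x i / (q : ℤ) : ℤ) : ℝ)| ≤ |(x i : ℝ)| := by exact_mod_cast h5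
        _ ≤ M := by linarith
    · intro t ht
      obtain ⟨ht1, ht2⟩ := Finset.mem_filter.1 ht
      refine Finset.mem_filter.2 ⟨ht2, fun i => ?_⟩
      simp only [hξ]
      rw [Int.add_mul_emod_self_left, Int.emod_eq_of_lt (hc0 i) (hcq i)]
    · intro x hx
      exact hξdiv x (Finset.mem_filter.1 hx).2
    · intro t ht
      funext i
      simp only [hξ]
      rw [Int.add_mul_ediv_left _ _ (by positivity), Int.ediv_eq_zero_of_lt (hc0 i) (hcq i), zero_add]
    · intro x hx
      rw [hξdiv x (Finset.mem_filter.1 hx).2]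
  set K := 2 * Real.pi * (|γ| * (C₁ * ‖z‖ ^ d₂ * w)) with hK
  have hK0 : 0 ≤ K := by positivity
  set h : (VIdx m r → ℝ) → ℝ := fun v => (Metric.closedBall (0 : VIdx m r → ℝ) 1).indicator (fun _ => K) v +
    (nearBdry (VIdx m r) (4 * w)).indicator (fun _ => 1) v with hh
  have hvt : volume (nearBdry (VIdx m r) (4 * w)) ≠ ⊤ :=
    ne_top_of_le_ne_top ENNReal.ofReal_ne_top (hvol (4 * w) (by positivity))
  have hi1 := integrable_ball_indicator (VIdx m r) K 1
  have hi2 : Integrable ((nearBdry (VIdx m r) (4 * w)).indicator fun _ => (1 : ℝ)) :=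
    (integrable_indicator_iff (measurableSet_nearBdry _)).2 (integrableOn_const hvt)
  have key := norm_riemann_sum_sub_le (o := o) hs0 T (oscFun F z γ) g (integrable_oscFun F z γ) h
    (hi1.add hi2) (fun v => add_nonneg (Set.indicator_nonneg (fun _ _ => hK0) _)
      (Set.indicator_nonneg (fun _ _ => zero_le_one) _)) ?_ ?_
  · rw [hgsum, hprod, ← IbetaZ_eq] at key
    refine key.trans ?_
    rw [hh, integral_add hi1 hi2, integral_ball_indicator _ _ zero_le_one, integral_indicator
      (measurableSet_nearBdry _), setIntegral_const, smul_eq_mul, mul_one, mul_one]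
    have h1 : volume.real (nearBdry (VIdx m r) (4 * w)) ≤ C₂ * (4 * w) :=
      ENNReal.toReal_le_of_le_ofReal (by positivity) (hvol _ (by positivity))
    have h2 : |γ| = |β| * (d * P) ^ d₁ := by
      rw [hγ, abs_mul, abs_of_nonneg (by positivity : (0 : ℝ) ≤ (d * P) ^ d₁)]
    rw [← h2]
    have h3 : 0 ≤ |γ| * ‖z‖ ^ d₂ := by positivity
    calc _ ≤ 2 ^ N * K + C₂ * (4 * w) := by linarith
      _ = (2 ^ N * (2 * Real.pi * C₁)) * w * (|γ| * ‖z‖ ^ d₂) + 4 * C₂ * w * 1 := by rw [hK]; ring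
      _ ≤ (2 ^ N * (2 * Real.pi * C₁)) * w * (1 + |γ| * ‖z‖ ^ d₂) +
          4 * C₂ * w * (1 + |γ| * ‖z‖ ^ d₂) := by gcongr <;> linarith
      _ = _ := by ring
  · intro v hv
    have hv1 : ‖v‖ ≤ 1 := by
      by_contra hcon
      exact hv (if_neg fun hh => hcon hh.1)
    refine hmemT _ fun i => ?_
    have h1 := (norm_le_pi_norm v i).trans hv1
    rw [Real.norm_eq_abs, abs_le] at h1
    have h2 : (v i - o i) / s i = (v i * (P * wt m r b i) - c i) / q := by
      have := hwt0 i
      simp only [ho, hs]; field_simp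
    have h3 : (0 : ℝ) ≤ c i := by exact_mod_cast hc0 i
    have h4 : (c i : ℝ) ≤ q := by exact_mod_cast (hcq i).le
    have h5 : P * wt m r b i ≤ P * b := by gcongr; exact hwtb i
    have h6 : 0 < P * wt m r b i := mul_pos hP0 (hwt0 i)
    have h7 : |(v i * (P * wt m r b i)) / q| ≤ P * b := by
      rw [abs_div, abs_mul, abs_of_pos h6, abs_of_pos hq0, div_le_iff₀ hq0]
      calc |v i| * (P * wt m r b i) ≤ 1 * (P * b) := by
            gcongr; exact abs_le.2 h1
        _ ≤ P * b * q := by nlinarith [mul_pos hP0 hb0]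
    have h8 : 0 ≤ (c i : ℝ) / q ∧ (c i : ℝ) / q ≤ 1 :=
      ⟨by positivity, by rw [div_le_one hq0]; exact h4⟩
    rw [h2, sub_div]
    rw [abs_le] at h7 ⊢
    have h9 := Int.floor_le (v i * (P * wt m r b i) / q - c i / q)
    have h10 := Int.lt_floor_add_one (v i * (P * wt m r b i) / q - c i / q)
    constructor <;> linarith [h7.1, h7.2, h8.1, h8.2]
  · intro t ht v hv
    rw [hcorner] at hv
    set p := sclPt b P (ξ t) with hp
    have hvp : ‖v - p‖ ≤ w := norm_sub_le_of_mem_boxCell hw0.le hsw hv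
    have hK' : 0 ≤ (Metric.closedBall (0 : VIdx m r → ℝ) 1).indicator (fun _ => K) v :=
      Set.indicator_nonneg (fun _ _ => hK0) _
    have hB' : 0 ≤ (nearBdry (VIdx m r) (4 * w)).indicator (fun _ => (1 : ℝ)) v :=
      Set.indicator_nonneg (fun _ _ => zero_le_one) _
    have hbd : v ∈ nearBdry (VIdx m r) (4 * w) → 1 ≤ h v := by
      intro hv
      have : (nearBdry (VIdx m r) (4 * w)).indicator (fun _ => (1 : ℝ)) v = 1 := Set.indicator_of_mem hv _
      simp only [hh]; linarith
    have hmono : ∀ w', w' ≤ 4 * w → v ∈ nearBdry (VIdx m r) w' → v ∈ nearBdry (VIdx m r) (4 * w) := by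
      rintro w' hw' ⟨h1, h2⟩
      refine ⟨h1, ?_⟩
      rcases h2 with ⟨i, h2⟩ | ⟨i, h2⟩ | ⟨i, j, hij, h2⟩
      · exact Or.inl ⟨i, h2.trans hw'⟩
      · exact Or.inr (Or.inl ⟨i, h2.trans hw'⟩)
      · exact Or.inr (Or.inr ⟨i, j, hij, h2.trans hw'⟩)
    have hgv : g t = if ‖p‖ ≤ 1 ∧ ‖p ∘ Sum.inr‖ < ‖p ∘ Sum.inl‖ then eexp (γ * normForm F z p) else 0 := by
      simp only [hg, mem_regPts_iff_sclPt hb0 hP0]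
      refine if_congr Iff.rfl ?_ rfl
      rw [eval_dPoly_scale F hF hd hz hP, ← mul_assoc]
    have h3 : ‖v‖ ≤ ‖p‖ + w := by
      have := norm_sub_norm_le v p; linarith
    have h1 := norm_comp_inl_sub_le v p
    have h2 := norm_comp_inr_sub_le v p
    rw [abs_le] at h1 h2
    have hnear : (‖p‖ ≤ 1 ∨ ‖v‖ ≤ 1) →
        (¬ ((‖p‖ ≤ 1 ∧ ‖p ∘ Sum.inr‖ < ‖p ∘ Sum.inl‖) ↔ (‖v‖ ≤ 1 ∧ ‖v ∘ Sum.inr‖ < ‖v ∘ Sum.inl‖))) →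
        v ∈ nearBdry (VIdx m r) (4 * w) := by
      intro h0 hne
      have hv3 : ‖v‖ ≤ 3 := by rcases h0 with h0 | h0 <;> linarith
      by_cases hpn : ‖p‖ ≤ 1 <;> by_cases hvn : ‖v‖ ≤ 1
      · refine hmono (2 * w + 2 * w) (by linarith) (mem_nearBdry_of_diagonal hv3 hvp ?_)
        rw [abs_le]
        simp only [hpn, hvn, true_and] at hne
        by_cases hc : ‖p ∘ Sum.inr‖ < ‖p ∘ Sum.inl‖
        · have hc' : ¬ ‖v ∘ Sum.inr‖ < ‖v ∘ Sum.inl‖ := fun h => hne ⟨fun _ => h, fun _ => hc⟩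
          constructor <;> linarith [h1.1, h1.2, h2.1, h2.2]
        · have hc' : ‖v ∘ Sum.inr‖ < ‖v ∘ Sum.inl‖ := by
            by_contra h; exact hne ⟨fun h' => absurd h' hc, fun h' => absurd h' h⟩
          constructor <;> linarith [h1.1, h1.2, h2.1, h2.2]
      · exact hmono w (by linarith) (mem_nearBdry_of_norm hv3 hvp (Or.inl ⟨hpn, not_le.1 hvn⟩))
      · exact hmono w (by linarith) (mem_nearBdry_of_norm hv3 hvp (Or.inr ⟨hvn, not_le.1 hpn⟩))
      · exact absurd h0 (by tauto)
    rw [hgv, oscFun]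
    split_ifs with ha hb' hb'
    · refine (norm_eexp_sub_le _ _).trans ?_
      have hv1 : (Metric.closedBall (0 : VIdx m r → ℝ) 1).indicator (fun _ => K) v = K :=
        Set.indicator_of_mem (by simpa using hb'.1) _
      have : 2 * Real.pi * |γ * normForm F z p - γ * normForm F z v| ≤ K := by
        rw [← mul_sub, abs_mul, hK]
        gcongr
        refine (hlip z hz p v ha.1 hb'.1).trans ?_
        rw [norm_sub_rev]
        gcongr
      simp only [hh]; linarith
    · rw [sub_zero, norm_eexp]
      exact hbd (hnear (Or.inl ha.1) fun h => hb' (h.1 ha))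
    · rw [zero_sub, norm_neg, norm_eexp]
      exact hbd (hnear (Or.inr hb'.1) fun h => ha (h.2 hb'))
    · rw [sub_zero, norm_zero]
      exact add_nonneg hK' hB'

end Approximation

section CompleteSums

lemma intCast_eval_dPoly (F : MvPolynomial (Idx n m r) ℤ) (d : ℕ) (z : Fin (n - m + 1) → ℤ) (q : ℕ)
    (x : VIdx m r → ℤ) : ((eval x (dPoly F d z) : ℤ) : ZMod q) =
      evalF F (fun i => (d : ZMod q) * ((x (Sum.inl i) : ℤ) : ZMod q))
        (fun j => ((x (Sum.inr j) : ℤ) : ZMod q)) (fun k => ((z k : ℤ) : ZMod q)) := by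
  rw [eval_dPoly]
  refine (map_evalF (Int.castRingHom (ZMod q)) F _ _ _).trans ?_
  simp

lemma eexp_div_mul_congr (a : ℤ) {q : ℕ} (hq : 1 ≤ q) {x y : ℤ} (h : (x : ZMod q) = y) :
    eexp ((a : ℝ) / q * x) = eexp ((a : ℝ) / q * y) := by
  rw [ZMod.intCast_eq_intCast_iff_dvd_sub] at h
  obtain ⟨c, hc⟩ := h
  have hq0 : (q : ℝ) ≠ 0 := by positivity
  have hy : (y : ℝ) = x + q * c := by
    have : y = x + q * c := by linarith
    rw [this]; push_cast; ring
  rw [hy, show (a : ℝ) / q * (x + q * c) = a / q * x + ((a * c : ℤ) : ℝ) by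
    push_cast; field_simp, eexp_add_int]

lemma SaqdZ_eq (F : MvPolynomial (Idx n m r) ℤ) (d : ℕ) (z : Fin (n - m + 1) → ℤ) (a q : ℕ) [NeZero q] :
    SaqdZ F d z a q = ∑ b : VIdx m r → ZMod q,
      eexp ((a : ℝ) / q * ((eval (fun i => ((b i).val : ℤ)) (dPoly F d z) : ℤ) : ℝ)) := by
  rw [SaqdZ, tsum_fintype, ← (Equiv.sumArrowEquivProdArrow (Fin (r + 1)) (Fin (m - r)) (ZMod q)).sum_comp]
  refine Finset.sum_congr rfl fun b _ => ?_
  have hq : 1 ≤ q := NeZero.one_le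
  rw [← Int.cast_natCast (R := ℝ) (ZMod.val _), ← Int.cast_natCast (R := ℝ) a]
  refine eexp_div_mul_congr a hq ?_
  rw [intCast_eval_dPoly]
  simp only [ZMod.natCast_val, ZMod.cast_id', id_eq, ZMod.intCast_cast]
  rfl

lemma sum_eq_sum_residues (q : ℕ) [NeZero q] (T : Finset (VIdx m r → ℤ))
    (f : (VIdx m r → ℤ) → ℂ) :
    ∑ x ∈ T, f x = ∑ b : VIdx m r → ZMod q, ∑ x ∈ T.filter (fun x => ∀ i, x i % q = ((b i).val : ℤ)), f x := by
  rw [← Finset.sum_fiberwise T (fun x => fun i => ((x i : ℤ) : ZMod q)) f]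
  refine Finset.sum_congr rfl fun b _ => Finset.sum_congr (Finset.filter_congr fun x _ => ?_) fun _ _ => rfl
  rw [funext_iff]
  refine forall_congr' fun i => ?_
  rw [← ZMod.val_intCast, Int.natCast_inj]
  exact (ZMod.val_injective q).eq_iff.symm

/-- Approximation of the exponential sum near a rational point. -/
lemma exists_regSum_approx (F : MvPolynomial (Idx n m r) ℤ) {d₁ d₂ : ℕ} (hF : Bihomogeneous F d₁ d₂) :
    ∃ C : ℝ, 0 < C ∧ ∀ d : ℕ, 1 ≤ d → ∀ z : Fin (n - m + 1) → ℤ, 1 ≤ ‖z‖ → ∀ P : ℝ, 1 ≤ P →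
      ∀ q : ℕ, 1 ≤ q → (q : ℝ) ≤ P → ∀ (a : ℕ) (β : ℝ),
      ‖regSum F d z P (a / q + β) - (((q : ℝ) ^ Fintype.card (VIdx m r))⁻¹ * boxVol m r d ‖z‖ P : ℝ) *
        SaqdZ F d z a q * IbetaZ F z (β * (d * P) ^ d₁)‖ ≤
        C * boxVol m r d ‖z‖ P * (q / P) * (1 + |β| * (d * P) ^ d₁ * ‖z‖ ^ d₂) := by
  obtain ⟨C, hC, h⟩ := exists_residue_sum_approx F hF
  refine ⟨C, hC, ?_⟩
  intro d hd z hz P hP q hq hqP a β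
  have : NeZero q := ⟨by omega⟩
  have hq0 : (0 : ℝ) < q := by exact_mod_cast hq
  have hV : 0 < boxVol m r d ‖z‖ P := boxVol_pos d hd (by linarith) (by linarith)
  set V := boxVol m r d ‖z‖ P with hVdef
  set N := Fintype.card (VIdx m r) with hN
  set I := IbetaZ F z (β * (d * P) ^ d₁) with hI
  set E := C * (q / P) * (1 + |β| * (d * P) ^ d₁ * ‖z‖ ^ d₂) with hE
  set w : ℝ := ((q : ℝ) ^ N)⁻¹ * V with hw
  have hw0 : 0 < w := by positivity
  set B : (VIdx m r → ZMod q) → ℂ := fun b =>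
    eexp ((a : ℝ) / q * ((eval (fun i => ((b i).val : ℤ)) (dPoly F d z) : ℤ) : ℝ)) with hB
  set R : (VIdx m r → ZMod q) → ℂ := fun b =>
    ∑ x ∈ (regPts m r (d * ‖z‖) P).filter (fun x => ∀ i, x i % q = ((b i).val : ℤ)),
          eexp (β * (eval x (dPoly F d z) : ℤ)) with hR
  have h1 : regSum F d z P (a / q + β) = ∑ b, B b * R b := by
    rw [regSum, sum_eq_sum_residues q]
    refine Finset.sum_congr rfl fun b _ => ?_
    rw [hR, Finset.mul_sum]
    refine Finset.sum_congr rfl fun x hx => ?_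
    rw [add_mul, eexp_add]
    congr 1
    have := eexp_div_mul_congr a hq (x := eval x (dPoly F d z))
      (y := eval (fun i => ((b i).val : ℤ)) (dPoly F d z)) ?_
    · simpa [hB] using this
    · have hx2 := (Finset.mem_filter.1 hx).2
      have hx3 : ∀ i, ((x i : ℤ) : ZMod q) = b i := fun i => by
        have h3 := hx2 i
        rw [← ZMod.val_intCast, Int.natCast_inj] at h3
        exact ZMod.val_injective q h3
      rw [intCast_eval_dPoly, intCast_eval_dPoly]
      simp only [hx3, ZMod.natCast_val, ZMod.cast_id', id_eq, ZMod.intCast_cast]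
  have h2 : ∀ b, ‖R b - w * I‖ ≤ w * E := by
    intro b
    have h3 := h d hd z hz P hP q hq hqP β (fun i => ((b i).val : ℤ)) (fun i => by positivity)
      (fun i => by exact_mod_cast ZMod.val_lt (b i))
    have e : R b - w * I = (w : ℂ) * ((((q : ℝ) ^ N / V : ℝ) : ℂ) * R b - I) := by
      rw [mul_sub, ← mul_assoc, ← Complex.ofReal_mul, show w * ((q : ℝ) ^ N / V) = 1 by
        rw [hw]; field_simp, Complex.ofReal_one, one_mul]
    rw [e, norm_mul, Complex.norm_real, Real.norm_of_nonneg hw0.le]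
    exact mul_le_mul_of_nonneg_left h3 hw0.le
  rw [h1, SaqdZ_eq, mul_assoc, mul_comm (w : ℂ), mul_assoc, Finset.sum_mul, ← Finset.sum_sub_distrib]
  refine (norm_sum_le_of_le _ (f := fun b => B b * R b - B b * (I * w)) (n := fun _ => w * E)
    fun b _ => ?_).trans ?_
  · rw [← mul_sub, norm_mul, hB, norm_eexp, one_mul, mul_comm I]
    exact h2 b
  · rw [Finset.sum_const, Finset.card_univ, Fintype.card_fun, ZMod.card, nsmul_eq_mul, ← hN]
    refine le_of_eq ?_
    rw [hw, hE]; push_cast; field_simp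

end CompleteSums

section SingularSeries

lemma inv_le_nd_div {A : ℤ} {q : ℕ} (hq : 1 ≤ q) (h : ¬ (q : ℤ) ∣ A) : 1 / (q : ℝ) ≤ nd ((A : ℝ) / q) := by
  have hq0 : (0 : ℝ) < q := by exact_mod_cast hq
  set c := round ((A : ℝ) / q)
  have h1 : A - q * c ≠ 0 := fun h0 => h ⟨c, by linarith⟩
  have h2 : (1 : ℝ) ≤ |((A - q * c : ℤ) : ℝ)| := by exact_mod_cast Int.one_le_abs h1
  rw [nd, show (A : ℝ) / q - c = ((A - q * c : ℤ) : ℝ) / q by push_cast; field_simp, abs_div,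
    abs_of_pos hq0]
  gcongr

lemma not_maj_rational {C₀ : ℝ} {k d₂ d : ℕ} {l X : ℝ} (hd : 1 ≤ d) {a q : ℕ}
    (hq : 1 ≤ q) (haq : Nat.gcd a q = 1) (hX0 : 0 ≤ X)
    (h1 : C₀ * l ^ d₂ * X ^ (k + 1) < q / d) (h2 : X < d * q) :
    ¬ Maj C₀ k d₂ d l q X ((a : ℝ) / q) := by
  rintro ⟨q', hq1, hq2, hq3⟩
  have hd0 : (0 : ℝ) < d := by exact_mod_cast hd
  have hq0 : (0 : ℝ) < q := by exact_mod_cast hq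
  have h3 : d * q' < q := by
    have := hq2.trans_lt h1
    rw [lt_div_iff₀ hd0] at this
    have h4 : ((q' * d : ℕ) : ℝ) < (q : ℕ) := by push_cast; exact this
    rw [mul_comm]
    exact_mod_cast h4
  have h4 : ¬ (q : ℤ) ∣ ((a * (d * q') : ℕ) : ℤ) := by
    rw [Int.natCast_dvd_natCast]
    intro hdvd
    have := (Nat.Coprime.symm haq).dvd_of_dvd_mul_left hdvd
    have h5 : 0 < d * q' := Nat.mul_pos hd hq1
    exact absurd (Nat.le_of_dvd h5 this) (by omega)
  have h5 := inv_le_nd_div hq h4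
  rw [show (((a * (d * q') : ℕ) : ℤ) : ℝ) / q = (a : ℝ) / q * (d * q') by push_cast; ring] at h5
  have h6 : X ^ (k + 1) / ((d : ℝ) ^ (k + 1) * (q : ℝ) ^ (k + 2)) < 1 / q := by
    rw [div_lt_div_iff₀ (by positivity) hq0, one_mul]
    calc X ^ (k + 1) * q < (d * q) ^ (k + 1) * q := by gcongr
      _ = _ := by ring
  linarith

lemma card_filter_emod_eq (c : ℕ) {q v : ℕ} (hv : v < q) :
    ((Finset.Icc (0 : ℤ) (c * q - 1)).filter fun x => x % q = (v : ℤ)).card = c := by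
  have hq : (0 : ℤ) < q := by omega
  have h := Int.Ico_filter_modEq_card 0 (c * q) hq v
  have e1 : (((c * q : ℤ) : ℚ) - ((v : ℤ) : ℚ)) / ((q : ℤ) : ℚ) =
      (((0 : ℤ) : ℚ) - ((v : ℤ) : ℚ)) / ((q : ℤ) : ℚ) + ((c : ℤ) : ℚ) := by
    have : (((q : ℤ) : ℚ)) ≠ 0 := by exact_mod_cast hq.ne'
    field_simp; push_cast; ring
  rw [e1, Int.ceil_add_intCast] at h
  have e2 : (Finset.Icc (0 : ℤ) (c * q - 1)).filter (fun x => x % q = (v : ℤ)) =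
      (Finset.Ico (0 : ℤ) (c * q)).filter (fun x => x ≡ v [ZMOD q]) := by
    ext x
    rw [Finset.mem_filter, Finset.mem_filter, Finset.mem_Icc, Finset.mem_Ico]
    simp only [Int.ModEq]
    rw [Int.emod_eq_of_lt (by positivity : (0 : ℤ) ≤ v) (by exact_mod_cast hv), Int.le_sub_one_iff]
  rw [e2]
  have h3 : (0 : ℤ) ≤ c := by positivity
  have : (((Finset.Ico (0 : ℤ) (c * q)).filter (fun x => x ≡ v [ZMOD q])).card : ℤ) = c := by
    rw [h, add_sub_cancel_left, max_eq_left h3]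
  exact_mod_cast this

/-- The complete sum as an incomplete one over a box with sides divisible by `q`. -/
lemma sum_box_eq_mul_SaqdZ (F : MvPolynomial (Idx n m r) ℤ) (d : ℕ) (z : Fin (n - m + 1) → ℤ)
    {a q : ℕ} (hq : 1 ≤ q) (c : VIdx m r → ℕ) :
    ∑ x ∈ Finset.Icc (0 : VIdx m r → ℤ) (fun i => c i * q - 1),
      eexp ((a : ℝ) / q * (eval x (dPoly F d z) : ℤ)) = (∏ i, (c i : ℂ)) * SaqdZ F d z a q := by
  have : NeZero q := ⟨by omega⟩
  rw [sum_eq_sum_residues q, SaqdZ_eq, Finset.mul_sum]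
  refine Finset.sum_congr rfl fun b _ => ?_
  rw [Finset.sum_congr rfl (g := fun _ =>
    eexp ((a : ℝ) / q * (eval (fun i => ((b i).val : ℤ)) (dPoly F d z) : ℤ))), Finset.sum_const,
    nsmul_eq_mul]
  · congr 1
    have e : (Finset.Icc (0 : VIdx m r → ℤ) (fun i => c i * q - 1)).filter
        (fun x => ∀ i, x i % q = ((b i).val : ℤ)) = Fintype.piFinset fun i =>
          (Finset.Icc (0 : ℤ) (c i * q - 1)).filter fun x => x % q = ((b i).val : ℤ) := by
      ext x
      simp only [Finset.mem_filter, Finset.mem_Icc, Fintype.mem_piFinset, Pi.le_def, ← forall_and]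
      rfl
    rw [e, Fintype.card_piFinset]
    simp only [card_filter_emod_eq _ (ZMod.val_lt _)]
    push_cast; rfl
  · intro x hx
    have hx2 := (Finset.mem_filter.1 hx).2
    have hx3 : ∀ i, ((x i : ℤ) : ZMod q) = b i := fun i => by
      have h3 := hx2 i
      rw [← ZMod.val_intCast, Int.natCast_inj] at h3
      exact ZMod.val_injective q h3
    have := eexp_div_mul_congr a hq (x := eval x (dPoly F d z))
      (y := eval (fun i => ((b i).val : ℤ)) (dPoly F d z)) ?_
    · simpa using this
    · rw [intCast_eval_dPoly, intCast_eval_dPoly]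
      simp only [hx3, ZMod.natCast_val, ZMod.cast_id', id_eq, ZMod.intCast_cast]

/-- The hypothesis that Weyl's inequality holds on boxes. -/
def BoxBound (C₀ : ℝ) (k : ℕ) (F : MvPolynomial (Idx n m r) ℤ) (d₂ D' c₀ : ℕ) : Prop :=
  ∀ ε : ℝ, 0 < ε → ∃ C : ℝ, 1 ≤ C ∧ ∀ d : ℕ, 1 ≤ d → ∀ P : ℝ, 1 ≤ P →
    ∀ z : Fin (n - m + 1) → ℤ, 1 ≤ ‖z‖ →
    dimV1z F (fun k => (z k : ℂ)) ≤ ((D' : ℕ) : ℕ∞) → ∀ X : ℝ, 1 ≤ X → X ≤ d * P → ∀ α,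
    ¬ Maj C₀ k d₂ d ‖z‖ P X α → ∀ a b : VIdx m r → ℤ,
    (∀ i, (b i : ℝ) - a i ≤ 3 * (P * wt m r (d * ‖z‖) i)) →
    ‖∑ x ∈ Finset.Icc a b, eexp (α * (eval x (dPoly F d z) : ℤ))‖ ≤
      C * boxVol m r d ‖z‖ P * (d * ‖z‖ * P) ^ ε *
        (d : ℝ) ^ (((k + 1 : ℕ) : ℝ) * (r + 1) / 2 ^ (k + 1)) * X ^ (-((c₀ : ℝ) / 2 ^ (k + 1)))

lemma norm_SaqdZ_le (F : MvPolynomial (Idx n m r) ℤ) (d : ℕ) (z : Fin (n - m + 1) → ℤ) (a : ℕ)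
    {q : ℕ} (hq : 1 ≤ q) : ‖SaqdZ F d z a q‖ ≤ (q : ℝ) ^ Fintype.card (VIdx m r) := by
  have : NeZero q := ⟨by omega⟩
  rw [SaqdZ_eq]
  refine (norm_sum_le_of_le _ (n := fun _ => 1) fun b _ => (norm_eexp _).le).trans (le_of_eq ?_)
  rw [Finset.sum_const, Finset.card_univ, Fintype.card_fun, ZMod.card, nsmul_eq_mul, mul_one]
  push_cast; rfl

lemma exists_SaqdZ_bound {C₀ : ℝ} (hC₀ : 1 ≤ C₀) (k : ℕ) (F : MvPolynomial (Idx n m r) ℤ) (d₂ : ℕ)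
    (D' c₀ : ℕ) (hc₀ : 4 * ((k : ℝ) + 1) ≤ (c₀ : ℝ) / 2 ^ (k + 1)) (hbox : BoxBound C₀ k F d₂ D' c₀)
    {ε : ℝ} (hε : 0 < ε) :
    ∃ C : ℝ, 1 ≤ C ∧ ∀ d : ℕ, 1 ≤ d → ∀ z : Fin (n - m + 1) → ℤ, 1 ≤ ‖z‖ →
      dimV1z F (fun k => (z k : ℂ)) ≤ ((D' : ℕ) : ℕ∞) → ∀ a q : ℕ, 1 ≤ q → Nat.gcd a q = 1 →
      ∀ t : ℝ, 0 ≤ t → t ≤ 4 → ‖SaqdZ F d z a q‖ ≤ C * (q : ℝ) ^ Fintype.card (VIdx m r) *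
        (d * ‖z‖ * q) ^ ε * (d : ℝ) ^ (((k + 1 : ℕ) : ℝ) * (r + 1) / 2 ^ (k + 1)) *
        (‖z‖ ^ d₂ * d / q) ^ t := by
  obtain ⟨C, hC, hb⟩ := hbox ε hε
  refine ⟨C * (2 * C₀) ^ 4, by
    have : 1 ≤ (2 * C₀) ^ 4 := one_le_pow₀ (by linarith)
    nlinarith, ?_⟩
  intro d hd z hz hdim a q hq haq t ht0 ht4
  have hd1 : (1 : ℝ) ≤ d := by exact_mod_cast hd
  have hq1 : (1 : ℝ) ≤ q := by exact_mod_cast hq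
  have hd0 : (0 : ℝ) < d := by linarith
  have hq0 : (0 : ℝ) < q := by linarith
  set l := ‖z‖ with hl
  have hl0 : 0 < l := by linarith
  have hL1 : 1 ≤ l ^ d₂ := one_le_pow₀ hz
  set N := Fintype.card (VIdx m r) with hN
  set e₀ := ((k + 1 : ℕ) : ℝ) * (r + 1) / 2 ^ (k + 1) with he₀
  have he₀0 : 0 ≤ e₀ := by positivity
  have hde : 1 ≤ (d : ℝ) ^ e₀ := Real.one_le_rpow hd1 he₀0
  have hdl : 1 ≤ (d * l * q : ℝ) :=
    one_le_mul_of_one_le_of_one_le (one_le_mul_of_one_le_of_one_le hd1 hz) hq1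
  have hdlε : 1 ≤ (d * l * q : ℝ) ^ ε := Real.one_le_rpow hdl hε.le
  set Y := q / (2 * C₀ * l ^ d₂ * d) with hY
  have hY0 : 0 < Y := by positivity
  have hYt : Y ^ (-t) ≤ (2 * C₀) ^ 4 * (l ^ d₂ * d / q) ^ t := by
    have e : Y ^ (-t) = (2 * C₀) ^ t * (l ^ d₂ * d / q) ^ t := by
      rw [Real.rpow_neg hY0.le, ← Real.inv_rpow hY0.le, ← Real.mul_rpow (by positivity) (by positivity)]
      congr 1
      rw [hY]; field_simp
    rw [e]
    gcongr
    calc (2 * C₀) ^ t ≤ (2 * C₀) ^ (4 : ℝ) := Real.rpow_le_rpow_of_exponent_le (by linarith) ht4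
      _ = _ := by norm_cast
  have main : ‖SaqdZ F d z a q‖ ≤ C * (q : ℝ) ^ N * (d * l * q) ^ ε * (d : ℝ) ^ e₀ * Y ^ (-t) := by
    rcases lt_or_ge Y 1 with hY1 | hY1
    · refine (norm_SaqdZ_le F d z a hq).trans ?_
      have h1 : 1 ≤ Y ^ (-t) := Real.one_le_rpow_of_pos_of_le_one_of_nonpos hY0 hY1.le (by linarith)
      have h2 : 1 ≤ C * (d * l * q) ^ ε * (d : ℝ) ^ e₀ * Y ^ (-t) :=
        one_le_mul_of_one_le_of_one_le (one_le_mul_of_one_le_of_one_le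
          (one_le_mul_of_one_le_of_one_le hC hdlε) hde) h1
      calc (q : ℝ) ^ N ≤ (q : ℝ) ^ N * (C * (d * l * q) ^ ε * (d : ℝ) ^ e₀ * Y ^ (-t)) :=
            le_mul_of_one_le_right (by positivity) h2
        _ = _ := by ring
    · set X := Y ^ (((k : ℝ) + 1)⁻¹) with hX
      have hk0 : (0 : ℝ) < (k : ℝ) + 1 := by positivity
      have hX1 : 1 ≤ X := Real.one_le_rpow hY1 (by positivity)
      have hXk : X ^ (k + 1) = Y := by
        rw [hX, ← Real.rpow_natCast, ← Real.rpow_mul hY0.le]; push_cast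
        rw [inv_mul_cancel₀ hk0.ne', Real.rpow_one]
      have hXY : X ≤ Y := by rw [← hXk]; exact le_self_pow₀ hX1 (by omega)
      have hYq : Y ≤ q / 2 := by
        rw [hY]
        have : 1 ≤ C₀ * l ^ d₂ * d :=
          one_le_mul_of_one_le_of_one_le (one_le_mul_of_one_le_of_one_le hC₀ hL1) hd1
        gcongr
        linarith
      have hXq : X < d * q := by nlinarith
      have hnm : ¬ Maj C₀ k d₂ d l q X ((a : ℝ) / q) := by
        refine not_maj_rational hd hq haq (by linarith) ?_ hXq
        rw [hXk, hY, show C₀ * l ^ d₂ * (q / (2 * C₀ * l ^ d₂ * d)) = q / d / 2 by field_simp]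
        have : 0 < (q : ℝ) / d := by positivity
        linarith
      obtain ⟨h, hh⟩ := exists_nat_eq_norm z
      rw [← hl] at hh
      set c : VIdx m r → ℕ := Sum.elim (fun _ => 1) (fun _ => d * h) with hc
      have hcw : ∀ i, (c i : ℝ) = wt m r (d * l) i := by
        rintro (i | j)
        · simp [hc, wt]
        · simp [hc, wt, hh]
      have h1 := hb d hd q hq1 z hz hdim X hX1 hXq.le ((a : ℝ) / q) hnm 0 (fun i => c i * q - 1) (by
        intro i
        have := wt_pos (m := m) (r := r) (l := d * l) (by positivity) i
        have h2 : 0 < (q : ℝ) * wt m r (d * l) i := by positivity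
        push_cast
        rw [hcw, Pi.zero_apply, Int.cast_zero]
        linarith)
      rw [sum_box_eq_mul_SaqdZ F d z hq c, norm_mul] at h1
      have h3 : ‖∏ i, (c i : ℂ)‖ = ∏ i, wt m r (d * l) i := by
        rw [norm_prod]
        exact Finset.prod_congr rfl fun i _ => by rw [Complex.norm_natCast, hcw]
      have h4 : boxVol m r d l q = (q : ℝ) ^ N * ∏ i, wt m r (d * l) i := by
        rw [← prod_side, Finset.prod_mul_distrib, Finset.prod_const, Finset.card_univ]
      have h5 : 0 < ∏ i : VIdx m r, wt m r (d * l) i :=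
        Finset.prod_pos fun i _ => wt_pos (by positivity) i
      rw [h3, h4] at h1
      have h6 : ‖SaqdZ F d z a q‖ ≤ C * (q : ℝ) ^ N * (d * l * q) ^ ε * (d : ℝ) ^ e₀ *
          X ^ (-((c₀ : ℝ) / 2 ^ (k + 1))) := by
        refine le_of_mul_le_mul_left (h1.trans (le_of_eq ?_)) h5
        ring
      refine h6.trans ?_
      gcongr
      rw [hX, ← Real.rpow_mul hY0.le]
      refine Real.rpow_le_rpow_of_exponent_le hY1 ?_
      have h7 : 4 ≤ ((k : ℝ) + 1)⁻¹ * (c₀ / 2 ^ (k + 1)) := by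
        rw [← div_eq_inv_mul, le_div_iff₀ hk0]; exact hc₀
      linarith
  refine main.trans ?_
  calc _ ≤ C * (q : ℝ) ^ N * (d * l * q) ^ ε * (d : ℝ) ^ e₀ * ((2 * C₀) ^ 4 * (l ^ d₂ * d / q) ^ t) := by
        gcongr
    _ = _ := by ring

/-- The term of the singular series. -/
def seriesTerm (F : MvPolynomial (Idx n m r) ℤ) (d : ℕ) (z : Fin (n - m + 1) → ℤ) (q : ℕ) : ℂ :=
  (q : ℂ) ^ (-((m : ℤ) + 1)) * ∑ a ∈ (Finset.range q).filter fun a => Nat.gcd a q = 1, SaqdZ F d z a q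

lemma seriesTerm_zero (F : MvPolynomial (Idx n m r) ℤ) (d : ℕ) (z : Fin (n - m + 1) → ℤ) :
    seriesTerm F d z 0 = 0 := by simp [seriesTerm]

lemma card_VIdx (hrm : r ≤ m) : Fintype.card (VIdx m r) = m + 1 := by simp; omega

lemma exists_seriesTerm_bound (hrm : r ≤ m) {C₀ : ℝ} (hC₀ : 1 ≤ C₀) (k : ℕ)
    (F : MvPolynomial (Idx n m r) ℤ) (d₂ : ℕ) (D' c₀ : ℕ)
    (hc₀ : 4 * ((k : ℝ) + 1) ≤ (c₀ : ℝ) / 2 ^ (k + 1)) (hbox : BoxBound C₀ k F d₂ D' c₀)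
    {ε : ℝ} (hε : 0 < ε) :
    ∃ C : ℝ, 1 ≤ C ∧ ∀ d : ℕ, 1 ≤ d → ∀ z : Fin (n - m + 1) → ℤ, 1 ≤ ‖z‖ →
      dimV1z F (fun k => (z k : ℂ)) ≤ ((D' : ℕ) : ℕ∞) → ∀ q : ℕ, 1 ≤ q →
      ∀ t : ℝ, 0 ≤ t → t ≤ 4 → ‖seriesTerm F d z q‖ ≤ C * (d * ‖z‖) ^ ε *
        (d : ℝ) ^ (((k + 1 : ℕ) : ℝ) * (r + 1) / 2 ^ (k + 1)) * (‖z‖ ^ d₂ * d) ^ t *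
          (q : ℝ) ^ (1 + ε - t) := by
  obtain ⟨C, hC, h⟩ := exists_SaqdZ_bound hC₀ k F d₂ D' c₀ hc₀ hbox hε
  refine ⟨C, hC, ?_⟩
  intro d hd z hz hdim q hq t ht0 ht4
  have hd0 : (0 : ℝ) < d := by exact_mod_cast hd
  have hq0 : (0 : ℝ) < q := by exact_mod_cast hq
  set l := ‖z‖ with hl
  have hl0 : 0 < l := by linarith
  set e₀ := ((k + 1 : ℕ) : ℝ) * (r + 1) / 2 ^ (k + 1) with he₀
  have h1 : ‖∑ a ∈ (Finset.range q).filter fun a => Nat.gcd a q = 1, SaqdZ F d z a q‖ ≤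
      q * (C * (q : ℝ) ^ (m + 1) * (d * l * q) ^ ε * (d : ℝ) ^ e₀ * (l ^ d₂ * d / q) ^ t) := by
    refine (norm_sum_le_of_le _ fun a ha => h d hd z hz hdim a q hq (Finset.mem_filter.1 ha).2 t ht0 ht4).trans ?_
    rw [Finset.sum_const, nsmul_eq_mul, card_VIdx hrm]
    gcongr
    refine (Finset.card_filter_le _ _).trans (by simp)
  rw [seriesTerm, norm_mul, norm_zpow, Complex.norm_natCast]
  calc _ ≤ (q : ℝ) ^ (-((m : ℤ) + 1)) * (q * (C * (q : ℝ) ^ (m + 1) * (d * l * q) ^ ε * (d : ℝ) ^ e₀ *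
        (l ^ d₂ * d / q) ^ t)) := by gcongr
    _ = (q : ℝ) ^ (-((m : ℤ) + 1)) * (q : ℝ) ^ (m + 1) * (C * (d * l) ^ ε * (d : ℝ) ^ e₀ *
        (l ^ d₂ * d) ^ t * (q * (q : ℝ) ^ ε * ((q : ℝ) ^ t)⁻¹)) := by
      rw [Real.mul_rpow (by positivity) hq0.le, Real.div_rpow (by positivity) hq0.le]; ring
    _ = _ := by
      rw [show (q : ℝ) ^ (-((m : ℤ) + 1)) * (q : ℝ) ^ (m + 1) = 1 by
        rw [← zpow_natCast, ← zpow_add₀ hq0.ne']; push_cast; simp, one_mul]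
      congr 1
      rw [← Real.rpow_neg hq0.le, show (1 + ε - t) = 1 + ε + -t by ring, Real.rpow_add hq0,
        Real.rpow_add hq0, Real.rpow_one]

end SingularSeries

section SeriesSum

lemma exists_singSeriesZ_bound (hrm : r ≤ m) {C₀ : ℝ} (hC₀ : 1 ≤ C₀) (k : ℕ)
    (F : MvPolynomial (Idx n m r) ℤ) (d₂ : ℕ) (D' c₀ : ℕ)
    (hc₀ : 4 * ((k : ℝ) + 1) ≤ (c₀ : ℝ) / 2 ^ (k + 1)) (hbox : BoxBound C₀ k F d₂ D' c₀)
    {ε : ℝ} (hε : 0 < ε) (hε2 : ε ≤ 1 / 2) :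
    ∃ C : ℝ, 1 ≤ C ∧ ∀ d : ℕ, 1 ≤ d → ∀ z : Fin (n - m + 1) → ℤ, 1 ≤ ‖z‖ →
      dimV1z F (fun k => (z k : ℂ)) ≤ ((D' : ℕ) : ℕ∞) →
      ‖singSeriesZ F d z‖ ≤ C * (d * ‖z‖) ^ ε *
        (d : ℝ) ^ (((k + 1 : ℕ) : ℝ) * (r + 1) / 2 ^ (k + 1)) * (‖z‖ ^ d₂ * d) ^ (2 + 2 * ε) ∧
      ∀ Q : ℕ, 1 ≤ Q → ‖singSeriesZ F d z - ∑ q ∈ Finset.Icc 1 Q, seriesTerm F d z q‖ ≤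
        C * (d * ‖z‖) ^ ε * (d : ℝ) ^ (((k + 1 : ℕ) : ℝ) * (r + 1) / 2 ^ (k + 1)) *
          (‖z‖ ^ d₂ * d) ^ (4 : ℝ) * (Q : ℝ) ^ (-(1 / 2 : ℝ)) := by
  obtain ⟨C, hC, h⟩ := exists_seriesTerm_bound hrm hC₀ k F d₂ D' c₀ hc₀ hbox hε
  have hs1 : Summable fun q : ℕ => (q : ℝ) ^ (-(1 + ε)) := Real.summable_nat_rpow.2 (by linarith)
  have hs2 : Summable fun q : ℕ => (q : ℝ) ^ (-2 : ℝ) := Real.summable_nat_rpow.2 (by norm_num)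
  set S1 := ∑' q : ℕ, (q : ℝ) ^ (-(1 + ε)) with hS1
  set S2 := ∑' q : ℕ, (q : ℝ) ^ (-2 : ℝ) with hS2
  have hS10 : 0 ≤ S1 := tsum_nonneg fun q => by positivity
  have hS20 : 0 ≤ S2 := tsum_nonneg fun q => by positivity
  refine ⟨C * (1 + S1 + S2), one_le_mul_of_one_le_of_one_le hC (by linarith), ?_⟩
  intro d hd z hz hdim
  have hd0 : (0 : ℝ) < d := by exact_mod_cast hd
  set e₀ := ((k + 1 : ℕ) : ℝ) * (r + 1) / 2 ^ (k + 1) with he₀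
  set B := C * (d * ‖z‖) ^ ε * (d : ℝ) ^ e₀ with hB
  have hz0 : 0 < ‖z‖ := by linarith
  have hB0 : 0 ≤ B := by positivity
  set A := ‖z‖ ^ d₂ * d with hA
  have hA0 : 0 ≤ A := by positivity
  have h1 : ∀ q : ℕ, ‖seriesTerm F d z q‖ ≤ B * A ^ (2 + 2 * ε) * (q : ℝ) ^ (-(1 + ε)) := by
    intro q
    rcases Nat.eq_zero_or_pos q with rfl | hq
    · rw [seriesTerm_zero, norm_zero]; positivity
    · have := h d hd z hz hdim q hq (2 + 2 * ε) (by linarith) (by linarith)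
      rwa [show 1 + ε - (2 + 2 * ε) = -(1 + ε) by ring] at this
  have hsum : Summable (seriesTerm F d z) :=
    Summable.of_norm_bounded (hs1.mul_left _) h1
  have hS : singSeriesZ F d z = ∑' q, seriesTerm F d z q := rfl
  refine ⟨?_, fun Q hQ => ?_⟩
  · rw [hS]
    refine (tsum_of_norm_bounded (hs1.hasSum.mul_left _) h1).trans ?_
    rw [← hS1]
    calc _ = B * A ^ (2 + 2 * ε) * S1 := rfl
      _ ≤ B * A ^ (2 + 2 * ε) * (1 + S1 + S2) := by gcongr; linarith
      _ = _ := by rw [hB]; ring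
  · have hQ0 : (0 : ℝ) < Q := by exact_mod_cast hQ
    set g : ℕ → ℂ := fun q => if q ∈ Finset.Icc 1 Q then seriesTerm F d z q else 0 with hg
    have h2 : HasSum g (∑ q ∈ Finset.Icc 1 Q, seriesTerm F d z q) := by
      have h3 := hasSum_sum_of_ne_finset_zero (f := g) (s := Finset.Icc 1 Q) (L := .unconditional ℕ)
        fun q hq => if_neg hq
      rwa [Finset.sum_congr rfl fun q hq => (if_pos hq : g q = seriesTerm F d z q)] at h3
    have h3 := hsum.hasSum.sub h2
    have h4 : ∀ q, ‖seriesTerm F d z q - g q‖ ≤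
        B * A ^ (4 : ℝ) * (Q : ℝ) ^ (-(1 / 2 : ℝ)) * (q : ℝ) ^ (-2 : ℝ) := by
      intro q
      by_cases hq : q ∈ Finset.Icc 1 Q
      · simp only [hg]
        rw [if_pos hq, sub_self, norm_zero]; positivity
      · simp only [hg]
        rw [if_neg hq, sub_zero]
        rcases Nat.eq_zero_or_pos q with rfl | hq0
        · rw [seriesTerm_zero, norm_zero]; positivity
        · have hqQ : Q < q := by
            by_contra hcon; exact hq (Finset.mem_Icc.2 ⟨hq0, by omega⟩)
          have hq1 : (1 : ℝ) ≤ q := by exact_mod_cast hq0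
          refine (h d hd z hz hdim q hq0 4 (by norm_num) le_rfl).trans ?_
          rw [mul_assoc (B * A ^ (4 : ℝ))]
          gcongr
          calc (q : ℝ) ^ (1 + ε - 4) ≤ (q : ℝ) ^ (-(1 / 2 : ℝ) + (-2)) :=
                Real.rpow_le_rpow_of_exponent_le hq1 (by linarith)
            _ = (q : ℝ) ^ (-(1 / 2 : ℝ)) * (q : ℝ) ^ (-2 : ℝ) := Real.rpow_add (by linarith) _ _
            _ ≤ _ := by
              gcongr ?_ * _
              exact Real.rpow_le_rpow_of_nonpos hQ0 (by exact_mod_cast hqQ.le) (by norm_num)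
    rw [hS, ← h3.tsum_eq]
    refine (tsum_of_norm_bounded (hs2.hasSum.mul_left _) h4).trans ?_
    calc _ = B * A ^ (4 : ℝ) * (Q : ℝ) ^ (-(1 / 2 : ℝ)) * S2 := rfl
      _ ≤ B * A ^ (4 : ℝ) * (Q : ℝ) ^ (-(1 / 2 : ℝ)) * (1 + S1 + S2) := by gcongr; linarith
      _ = _ := by rw [hB]; ring

end SeriesSum

section SingularIntegral

/-- Weyl's inequality for the sums over the region. -/
def RegBound (C₀ : ℝ) (k : ℕ) (F : MvPolynomial (Idx n m r) ℤ) (d₂ D' c₀ : ℕ) : Prop :=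
  ∀ ε : ℝ, 0 < ε → ∃ C : ℝ, 1 ≤ C ∧ ∀ d : ℕ, 1 ≤ d → ∀ P : ℝ, 1 ≤ P →
    ∀ z : Fin (n - m + 1) → ℤ, 1 ≤ ‖z‖ →
    dimV1z F (fun k => (z k : ℂ)) ≤ ((D' : ℕ) : ℕ∞) → ∀ X : ℝ, 1 ≤ X → X ≤ d * P → ∀ α,
    ¬ Maj C₀ k d₂ d ‖z‖ P X α →
    ‖regSum F d z P α‖ ≤ C * boxVol m r d ‖z‖ P * (d * ‖z‖ * P) ^ ε *
      (d : ℝ) ^ (((k + 1 : ℕ) : ℝ) * (r + 1) / 2 ^ (k + 1)) * X ^ (-((c₀ : ℝ) / 2 ^ (k + 2)))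

lemma norm_IbetaZ_le (F : MvPolynomial (Idx n m r) ℤ) (z : Fin (n - m + 1) → ℤ) (β : ℝ) :
    ‖IbetaZ F z β‖ ≤ 2 ^ Fintype.card (VIdx m r) := by
  rw [IbetaZ_eq]
  refine (norm_integral_le_of_norm_le (integrable_ball_indicator _ 1 1)
    (Filter.Eventually.of_forall (norm_oscFun_le F z β))).trans ?_
  rw [integral_ball_indicator _ _ zero_le_one]; simp

lemma stronglyMeasurable_IbetaZ (F : MvPolynomial (Idx n m r) ℤ) (z : Fin (n - m + 1) → ℤ) :
    StronglyMeasurable (IbetaZ F z) := by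
  have e : IbetaZ F z = fun β => ∫ v, oscFun F z β v := funext (IbetaZ_eq F z)
  rw [e]
  exact (measurable_oscFun_uncurry F z).stronglyMeasurable.integral_prod_right

lemma nd_eq_abs {t : ℝ} (ht : |t| < 1 / 2) : nd t = |t| := by
  have : round t = 0 := by rw [round_eq_zero_iff]; rw [abs_lt] at ht; constructor <;> linarith [ht.1, ht.2]
  rw [nd, this]; simp

set_option maxHeartbeats 1000000 in
lemma exists_IbetaZ_bound {C₀ : ℝ} (hC₀ : 1 ≤ C₀) (k : ℕ) (F : MvPolynomial (Idx n m r) ℤ) (d₂ : ℕ)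
    (hF : Bihomogeneous F (k + 2) d₂)
    (D' c₀ : ℕ) (hc₀ : 4 * ((k : ℝ) + 1) ≤ (c₀ : ℝ) / 2 ^ (k + 1)) (hreg : RegBound C₀ k F d₂ D' c₀)
    {ε : ℝ} (hε : 0 < ε) (hε2 : ε ≤ 1 / 8) :
    ∃ C : ℝ, 1 ≤ C ∧ ∀ z : Fin (n - m + 1) → ℤ, 1 ≤ ‖z‖ →
      dimV1z F (fun k => (z k : ℂ)) ≤ ((D' : ℕ) : ℕ∞) → ∀ β : ℝ,
      ‖IbetaZ F z β‖ ≤ C * ‖z‖ ^ ((1 + d₂) * ε) * (1 + |β|) ^ (-(3 / 2 : ℝ)) := by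
  obtain ⟨C₁, hC₁, hr⟩ := hreg ε hε
  obtain ⟨C₂, hC₂, happ⟩ := exists_regSum_approx F hF
  set N := Fintype.card (VIdx m r) with hN
  set K := C₁ * (2 * C₀) ^ ε * 4 + C₂ with hK
  have hK0 : 0 ≤ K := by positivity
  refine ⟨1 + K * 2 ^ (3 / 2 : ℝ) + 2 ^ N * 3 ^ (3 / 2 : ℝ), by
    have : 0 ≤ K * 2 ^ (3 / 2 : ℝ) := by positivity
    have : (0 : ℝ) ≤ 2 ^ N * 3 ^ (3 / 2 : ℝ) := by positivity
    linarith, ?_⟩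
  intro z hz hdim β
  set l := ‖z‖ with hl
  have hl0 : 0 < l := by linarith
  set L := l ^ d₂ with hL
  have hL1 : 1 ≤ L := one_le_pow₀ hz
  have hlε : 1 ≤ l ^ ((1 + d₂) * ε) := Real.one_le_rpow hz (by positivity)
  set b := |β| with hb
  have hb0 : 0 ≤ b := abs_nonneg _
  rcases lt_or_ge b 2 with hb2 | hb2
  · refine (norm_IbetaZ_le F z β).trans ?_
    have h1 : (3 : ℝ) ^ (3 / 2 : ℝ) * (1 + b) ^ (-(3 / 2 : ℝ)) ≥ 1 := by
      rw [Real.rpow_neg (by positivity), ← div_eq_mul_inv, ge_iff_le, one_le_div (by positivity)]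
      gcongr; linarith
    have h2 : 0 ≤ (1 + K * 2 ^ (3 / 2 : ℝ)) * (l ^ ((1 + d₂) * ε) * (1 + b) ^ (-(3 / 2 : ℝ))) := by positivity
    calc (2 : ℝ) ^ N = 2 ^ N * (1 * 1) := by ring
      _ ≤ 2 ^ N * (l ^ ((1 + d₂) * ε) * ((3 : ℝ) ^ (3 / 2 : ℝ) * (1 + b) ^ (-(3 / 2 : ℝ)))) := by
        gcongr
      _ ≤ _ := by linarith
  · have hbp : 0 < b := by linarith
    have hC₀0 : 0 < C₀ := by linarith
    set P := 2 * C₀ * b ^ 4 * L with hP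
    have hP1 : C₀ * L * b ^ 2 < P := by
      have : b ^ 2 ≤ b ^ 4 := pow_le_pow_right₀ (by linarith) (by norm_num)
      have h2 : 0 < C₀ * L * b ^ 2 := by positivity
      calc C₀ * L * b ^ 2 < 2 * (C₀ * L * b ^ 2) := by linarith
        _ ≤ 2 * (C₀ * L * b ^ 4) := by gcongr
        _ = _ := by rw [hP]; ring
    have hP2 : L * b ^ 4 ≤ P := by
      rw [hP]
      calc L * b ^ 4 = 1 * (L * b ^ 4) := by ring
        _ ≤ (2 * C₀) * (L * b ^ 4) := by gcongr; linarith
        _ = _ := by ring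
    have hbP : b ≤ P := by
      calc b ≤ b ^ 4 := le_self_pow₀ (by linarith) (by norm_num)
        _ ≤ L * b ^ 4 := le_mul_of_one_le_left (by positivity) hL1
        _ ≤ P := hP2
    have hP0 : 0 < P := by linarith
    have hPone : 1 ≤ P := by linarith
    have hPd : P ≤ P ^ (k + 2) := le_self_pow₀ hPone (by omega)
    set Y := b / 2 with hY
    have hY1 : 1 ≤ Y := by rw [hY]; linarith
    have hY0 : 0 < Y := by linarith
    set X := Y ^ (((k : ℝ) + 1)⁻¹) with hX
    have hk0 : (0 : ℝ) < (k : ℝ) + 1 := by positivity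
    have hX1 : 1 ≤ X := Real.one_le_rpow hY1 (by positivity)
    have hXk : X ^ (k + 1) = Y := by
      rw [hX, ← Real.rpow_natCast, ← Real.rpow_mul hY0.le]; push_cast
      rw [inv_mul_cancel₀ hk0.ne', Real.rpow_one]
    have hXY : X ≤ Y := by rw [← hXk]; exact le_self_pow₀ hX1 (by omega)
    set α := β / P ^ (k + 2) with hα
    have hαb : |α| = b / P ^ (k + 2) := by
      rw [hα, abs_div, abs_of_pos (by positivity : 0 < P ^ (k + 2))]
    have hnm : ¬ Maj C₀ k d₂ 1 l P X α := by
      rintro ⟨q, h1, h2, h3⟩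
      have hq1 : (1 : ℝ) ≤ q := by exact_mod_cast h1
      have hs : |α * ((1 : ℕ) * (q : ℝ))| = b * q / P ^ (k + 2) := by
        rw [abs_mul, hαb, Nat.cast_one, one_mul, Nat.abs_cast]; ring
      rw [hXk] at h2
      have hlt : |α * ((1 : ℕ) * (q : ℝ))| < 1 / 2 := by
        rw [hs, div_lt_iff₀ (by positivity)]
        calc b * q ≤ b * (C₀ * L * Y) := by gcongr
          _ = 1 / 2 * (C₀ * L * b ^ 2) := by rw [hY]; ring
          _ < 1 / 2 * P ^ (k + 2) := by gcongr; linarith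
      have hnd : b / P ^ (k + 2) ≤ nd (α * ((1 : ℕ) * (q : ℝ))) := by
        rw [nd_eq_abs hlt, hs]
        gcongr
        exact le_mul_of_one_le_right hb0 hq1
      have h4 := hnd.trans h3
      rw [hXk, Nat.cast_one, one_pow, one_mul,
        div_le_div_iff_of_pos_right (by positivity), hY] at h4
      linarith
    have hw := hr 1 le_rfl P hPone z hz hdim X hX1 (by rw [Nat.cast_one, one_mul]; linarith) α hnm
    have ha := happ 1 le_rfl z hz P hPone 1 le_rfl (by simpa using hPone) 0 α
    have hV : 0 < boxVol m r 1 l P := boxVol_pos 1 le_rfl hl0 hP0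
    set V := boxVol m r 1 l P with hVd
    have hβ : α * ((1 : ℕ) * P) ^ (k + 2) = β := by
      rw [Nat.cast_one, one_mul, hα, div_mul_cancel₀ _ (by positivity)]
    have hβ' : |α| * ((1 : ℕ) * P) ^ (k + 2) = b := by
      rw [Nat.cast_one, one_mul, hαb, div_mul_cancel₀ _ (by positivity)]
    have hS : SaqdZ F 1 z 0 1 = 1 := by
      rw [SaqdZ_eq]
      simp [eexp_zero]
    rw [hβ, hβ', hS] at ha
    simp only [Nat.cast_zero, Nat.cast_one, zero_div, zero_add, one_pow, inv_one, one_mul,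
      mul_one] at ha hw
    have hI : ‖IbetaZ F z β‖ ≤ C₁ * (l * P) ^ ε * X ^ (-((c₀ : ℝ) / 2 ^ (k + 2))) +
        C₂ * (1 / P) * (1 + b * L) := by
      have e1 : ‖(V : ℂ) * IbetaZ F z β‖ = V * ‖IbetaZ F z β‖ := by
        rw [norm_mul, Complex.norm_real, Real.norm_of_nonneg hV.le]
      have e2 := norm_sub_norm_le ((V : ℂ) * IbetaZ F z β) (regSum F 1 z P α)
      rw [norm_sub_rev, e1] at e2
      refine le_of_mul_le_mul_left ?_ hV
      calc V * ‖IbetaZ F z β‖ ≤ ‖regSum F 1 z P α‖ +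
            ‖regSum F 1 z P α - (V : ℂ) * IbetaZ F z β‖ := by linarith
        _ ≤ _ := add_le_add hw ha
        _ = _ := by simp only [Real.one_rpow]; ring
    have hXe : X ^ (-((c₀ : ℝ) / 2 ^ (k + 2))) ≤ 4 * b ^ (-2 : ℝ) := by
      have hh : (2 : ℝ) ≤ ((k : ℝ) + 1)⁻¹ * ((c₀ : ℝ) / 2 ^ (k + 2)) := by
        rw [inv_mul_eq_div, le_div_iff₀ hk0, pow_succ, ← div_div]
        linarith
      calc X ^ (-((c₀ : ℝ) / 2 ^ (k + 2)))
          = Y ^ (-(((k : ℝ) + 1)⁻¹ * ((c₀ : ℝ) / 2 ^ (k + 2)))) := by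
            rw [hX, ← Real.rpow_mul hY0.le]; congr 1; ring
        _ ≤ Y ^ (-2 : ℝ) := Real.rpow_le_rpow_of_exponent_le hY1 (by linarith)
        _ = 4 * b ^ (-2 : ℝ) := by
            rw [hY, Real.rpow_neg (by positivity), Real.rpow_neg (by positivity),
              Real.rpow_two, Real.rpow_two]
            field_simp
            norm_num
    have hlP : (l * P) ^ ε = (2 * C₀) ^ ε * l ^ ((1 + d₂) * ε) * b ^ (4 * ε) := by
      rw [Real.rpow_mul hl0.le, Real.rpow_mul hb0, show (1 + d₂ : ℝ) = ((1 + d₂ : ℕ) : ℝ) by push_cast; ring,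
        Real.rpow_natCast, show (4 : ℝ) = ((4 : ℕ) : ℝ) by norm_num, Real.rpow_natCast,
        ← Real.mul_rpow (by positivity) (by positivity), ← Real.mul_rpow (by positivity) (by positivity)]
      congr 1
      rw [hP, hL]; ring
    have hb1 : b ^ (4 * ε) * b ^ (-2 : ℝ) ≤ b ^ (-(3 / 2) : ℝ) := by
      rw [← Real.rpow_add hbp]
      exact Real.rpow_le_rpow_of_exponent_le (by linarith) (by linarith)
    have hb3 : 1 / P * (1 + b * L) ≤ b ^ (-(3 / 2) : ℝ) := by
      have h1 : 1 ≤ b * L := one_le_mul_of_one_le_of_one_le (by linarith) hL1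
      calc 1 / P * (1 + b * L) ≤ 1 / P * (b * L + b * L) := by gcongr
        _ = 1 / C₀ * b ^ (-3 : ℝ) := by
          rw [hP, Real.rpow_neg hb0, show (3 : ℝ) = ((3 : ℕ) : ℝ) by norm_num, Real.rpow_natCast]
          field_simp
          norm_num
        _ ≤ 1 * b ^ (-(3 / 2) : ℝ) := by
          gcongr
          · rw [div_le_one hC₀0]; exact hC₀
          · linarith
          · norm_num
        _ = _ := one_mul _
    have hb4 : b ^ (-(3 / 2) : ℝ) ≤ 2 ^ (3 / 2 : ℝ) * (1 + b) ^ (-(3 / 2) : ℝ) := by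
      calc b ^ (-(3 / 2) : ℝ) ≤ ((1 + b) / 2) ^ (-(3 / 2) : ℝ) :=
            Real.rpow_le_rpow_of_nonpos (by positivity) (by linarith) (by norm_num)
        _ = _ := by
          rw [Real.div_rpow (by positivity) (by positivity),
            Real.rpow_neg (by norm_num : (0 : ℝ) ≤ 2), div_inv_eq_mul, mul_comm]
    set W := l ^ ((1 + d₂) * ε) with hW
    calc ‖IbetaZ F z β‖ ≤ C₁ * ((2 * C₀) ^ ε * W * b ^ (4 * ε)) * (4 * b ^ (-2 : ℝ)) +
          C₂ * (b ^ (-(3 / 2) : ℝ)) := by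
          refine hI.trans ?_
          rw [hlP, mul_assoc C₂]
          gcongr
      _ = C₁ * (2 * C₀) ^ ε * 4 * W * (b ^ (4 * ε) * b ^ (-2 : ℝ)) + C₂ * (1 * b ^ (-(3 / 2) : ℝ)) := by ring
      _ ≤ C₁ * (2 * C₀) ^ ε * 4 * W * b ^ (-(3 / 2) : ℝ) + C₂ * (W * b ^ (-(3 / 2) : ℝ)) := by gcongr
      _ = K * W * b ^ (-(3 / 2) : ℝ) := by rw [hK]; ring
      _ ≤ K * W * (2 ^ (3 / 2 : ℝ) * (1 + b) ^ (-(3 / 2) : ℝ)) := by gcongr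
      _ = (K * 2 ^ (3 / 2 : ℝ)) * (W * (1 + b) ^ (-(3 / 2) : ℝ)) := by ring
      _ ≤ (1 + K * 2 ^ (3 / 2 : ℝ) + 2 ^ N * 3 ^ (3 / 2 : ℝ)) * (W * (1 + b) ^ (-(3 / 2) : ℝ)) := by
        gcongr
        have : (0 : ℝ) ≤ 2 ^ N * 3 ^ (3 / 2 : ℝ) := by positivity
        linarith
      _ = _ := by ring

end SingularIntegral

section Consequences

lemma exists_integral_tail_bound : ∃ c : ℝ, 1 ≤ c ∧ ∀ (f : ℝ → ℂ) (A : ℝ), 0 ≤ A →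
    StronglyMeasurable f → (∀ β, ‖f β‖ ≤ A * (1 + |β|) ^ (-(3 / 2 : ℝ))) →
    Integrable f ∧ ‖∫ β, f β‖ ≤ c * A ∧
    ∀ B : ℝ, 1 ≤ B → ‖(∫ β, f β) - ∫ β in (-B)..B, f β‖ ≤ c * A * B ^ (-(1 / 4 : ℝ)) := by
  have hg : Integrable fun β : ℝ => (1 + |β|) ^ (-(5 / 4 : ℝ)) := by
    have := integrable_one_add_norm (E := ℝ) (μ := volume) (r := 5 / 4) (by simp; norm_num)
    simpa [Real.norm_eq_abs] using this
  set c₁ := ∫ β : ℝ, (1 + |β|) ^ (-(5 / 4 : ℝ)) with hc₁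
  have hc0 : 0 ≤ c₁ := integral_nonneg fun β => by positivity
  refine ⟨1 + c₁, by linarith, fun f A hA hf hb => ?_⟩
  have hle : ∀ β, ‖f β‖ ≤ A * (1 + |β|) ^ (-(5 / 4 : ℝ)) := fun β => (hb β).trans <|
    mul_le_mul_of_nonneg_left (Real.rpow_le_rpow_of_exponent_le (by linarith [abs_nonneg β])
      (by norm_num)) hA
  have h_int : Integrable f := (hg.const_mul A).mono' hf.aestronglyMeasurable
    (Filter.Eventually.of_forall hle)
  refine ⟨h_int, ?_, fun B hB => ?_⟩
  · calc ‖∫ β, f β‖ ≤ ∫ β, A * (1 + |β|) ^ (-(5 / 4 : ℝ)) :=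
          norm_integral_le_of_norm_le (hg.const_mul A) (Filter.Eventually.of_forall hle)
      _ = A * c₁ := by rw [integral_const_mul]
      _ ≤ _ := by nlinarith
  · rw [intervalIntegral.integral_of_le (by linarith),
      ← integral_add_compl (measurableSet_Ioc (a := -B) (b := B)) h_int, add_sub_cancel_left]
    have hB0 : 0 < B := by linarith
    calc ‖∫ β in (Set.Ioc (-B) B)ᶜ, f β‖
        ≤ ∫ β in (Set.Ioc (-B) B)ᶜ, A * B ^ (-(1 / 4 : ℝ)) * (1 + |β|) ^ (-(5 / 4 : ℝ)) := by
          refine norm_integral_le_of_norm_le (hg.const_mul _).integrableOn ?_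
          refine (ae_restrict_mem measurableSet_Ioc.compl).mono fun β hβ => ?_
          have hβB : B ≤ |β| := by
            by_contra! h
            rw [abs_lt] at h
            exact hβ ⟨h.1, h.2.le⟩
          have h1 : 0 < 1 + |β| := by positivity
          refine (hb β).trans ?_
          rw [show (-(3 / 2) : ℝ) = -(1 / 4) + -(5 / 4) by norm_num, Real.rpow_add h1, ← mul_assoc]
          have h2 : (1 + |β|) ^ (-(1 / 4) : ℝ) ≤ B ^ (-(1 / 4) : ℝ) :=
            Real.rpow_le_rpow_of_nonpos hB0 (by linarith) (by norm_num)
          refine mul_le_mul_of_nonneg_right (mul_le_mul_of_nonneg_left h2 hA) ?_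
          positivity
      _ ≤ ∫ β, A * B ^ (-(1 / 4 : ℝ)) * (1 + |β|) ^ (-(5 / 4 : ℝ)) :=
          setIntegral_le_integral (hg.const_mul _) (Filter.Eventually.of_forall fun β => by positivity)
      _ = A * B ^ (-(1 / 4 : ℝ)) * c₁ := by rw [integral_const_mul]
      _ ≤ _ := by
        have : 0 ≤ A * B ^ (-(1 / 4 : ℝ)) := by positivity
        nlinarith

lemma exists_JZ_bound {C₀ : ℝ} (hC₀ : 1 ≤ C₀) (k : ℕ) (F : MvPolynomial (Idx n m r) ℤ) (d₂ : ℕ)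
    (hF : Bihomogeneous F (k + 2) d₂)
    (D' c₀ : ℕ) (hc₀ : 4 * ((k : ℝ) + 1) ≤ (c₀ : ℝ) / 2 ^ (k + 1)) (hreg : RegBound C₀ k F d₂ D' c₀)
    {ε : ℝ} (hε : 0 < ε) (hε2 : ε ≤ 1 / 8) :
    ∃ C : ℝ, 1 ≤ C ∧ ∀ z : Fin (n - m + 1) → ℤ, 1 ≤ ‖z‖ →
      dimV1z F (fun k => (z k : ℂ)) ≤ ((D' : ℕ) : ℕ∞) →
      ‖JZ F z‖ ≤ C * ‖z‖ ^ ((1 + d₂) * ε) ∧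
      ∀ B : ℝ, 1 ≤ B → ‖JZ F z - ∫ β in (-B)..B, IbetaZ F z β‖ ≤
        C * ‖z‖ ^ ((1 + d₂) * ε) * B ^ (-(1 / 4 : ℝ)) := by
  obtain ⟨C, hC, h⟩ := exists_IbetaZ_bound hC₀ k F d₂ hF D' c₀ hc₀ hreg hε hε2
  obtain ⟨c, hc, ht⟩ := exists_integral_tail_bound
  refine ⟨c * C, one_le_mul_of_one_le_of_one_le hc hC, fun z hz hdim => ?_⟩
  obtain ⟨_, h2, h3⟩ := ht (IbetaZ F z) (C * ‖z‖ ^ ((1 + d₂) * ε)) (by positivity)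
    (stronglyMeasurable_IbetaZ F z) (h z hz hdim)
  refine ⟨h2.trans (by rw [mul_assoc]), fun B hB => (h3 B hB).trans (le_of_eq (by ring))⟩

lemma exists_minor_bound {C₀ : ℝ} (hC₀ : 1 ≤ C₀) (k : ℕ) (F : MvPolynomial (Idx n m r) ℤ) (d₂ : ℕ)
    (D' c₀ : ℕ) (hc₀ : 2 * ((k : ℝ) + 1) < (c₀ : ℝ) / 2 ^ (k + 2)) (hreg : RegBound C₀ k F d₂ D' c₀)
    {ε : ℝ} (hε : 0 < ε) :
    ∃ C : ℝ, 1 ≤ C ∧ ∀ d : ℕ, 1 ≤ d → ∀ P : ℝ, 1 ≤ P → ∀ z : Fin (n - m + 1) → ℤ, 1 ≤ ‖z‖ →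
      dimV1z F (fun k => (z k : ℂ)) ≤ ((D' : ℕ) : ℕ∞) → ∀ X₀ : ℝ, 1 ≤ X₀ →
      ∃ h : ℝ → ℝ, Integrable h ∧ (∀ α, 0 ≤ h α) ∧
        (∀ α ∈ Set.Icc (-1 : ℝ) 1, ¬ Maj C₀ k d₂ d ‖z‖ P X₀ α → ‖regSum F d z P α‖ ≤ h α) ∧
        ∫ α, h α ≤ C * (boxVol m r d ‖z‖ P * (d * ‖z‖ * P) ^ ε *
          (d : ℝ) ^ (((k + 1 : ℕ) : ℝ) * (r + 1) / 2 ^ (k + 1)) * ‖z‖ ^ d₂ /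
            (d ^ (k + 1) * P ^ (k + 2))) * X₀ ^ (2 * ((k : ℝ) + 1) - (c₀ : ℝ) / 2 ^ (k + 2)) := by
  obtain ⟨C₁, hC₁, h₁⟩ := hreg ε hε
  obtain ⟨C₂, hC₂, h₂⟩ := exists_layer_bound k hC₀ hc₀
  refine ⟨C₂ * C₁, one_le_mul_of_one_le_of_one_le hC₂ hC₁, fun d hd P hP z hz hdim X₀ hX₀ => ?_⟩
  have hV := boxVol_pos (m := m) (r := r) (P := P) (l := ‖z‖) d hd (by linarith) (by linarith)
  obtain ⟨h, hi, h0, hb, hI⟩ := h₂ d₂ d hd ‖z‖ hz P hP X₀ hX₀ (regSum F d z P)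
    (C₁ * boxVol m r d ‖z‖ P * (d * ‖z‖ * P) ^ ε *
      (d : ℝ) ^ (((k + 1 : ℕ) : ℝ) * (r + 1) / 2 ^ (k + 1))) (by positivity)
    (fun X h1 h2 α hα => h₁ d hd P hP z hz hdim X h1 h2 α hα)
  refine ⟨h, hi, h0, hb, hI.trans (le_of_eq ?_)⟩
  ring

lemma exists_regCount_bound {C₀ : ℝ} (hC₀ : 1 ≤ C₀) (k : ℕ) (F : MvPolynomial (Idx n m r) ℤ) (d₂ : ℕ)
    (D' c₀ : ℕ) (hc₀ : 2 * ((k : ℝ) + 1) < (c₀ : ℝ) / 2 ^ (k + 2)) (hreg : RegBound C₀ k F d₂ D' c₀)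
    {ε : ℝ} (hε : 0 < ε) :
    ∃ C : ℝ, 1 ≤ C ∧ ∀ d : ℕ, 1 ≤ d → ∀ P : ℝ, 1 ≤ P → ∀ z : Fin (n - m + 1) → ℤ, 1 ≤ ‖z‖ →
      dimV1z F (fun k => (z k : ℂ)) ≤ ((D' : ℕ) : ℕ∞) →
      (regCount F d z P : ℝ) ≤ C * (boxVol m r d ‖z‖ P * (d * ‖z‖ * P) ^ ε *
          (d : ℝ) ^ (((k + 1 : ℕ) : ℝ) * (r + 1) / 2 ^ (k + 1)) * ‖z‖ ^ d₂ /
            (d ^ (k + 1) * P ^ (k + 2))) := by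
  obtain ⟨C, hC, hh⟩ := exists_minor_bound hC₀ k F d₂ D' c₀ hc₀ hreg hε
  set N := Fintype.card (VIdx m r) with hN
  refine ⟨C + 6 ^ N * (6 * C₀), by
    have : 0 ≤ 6 ^ N * (6 * C₀) := by positivity
    linarith, fun d hd P hP z hz hdim => ?_⟩
  have hd1 : (1 : ℝ) ≤ d := by exact_mod_cast hd
  have hV := boxVol_pos (m := m) (r := r) (P := P) (l := ‖z‖) d hd (by linarith) (by linarith)
  obtain ⟨h, hi, h0, hb, hI⟩ := hh d hd P hP z hz hdim 1 le_rfl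
  rw [Real.one_rpow, mul_one] at hI
  set V := boxVol m r d ‖z‖ P with hVd
  set T := majSet C₀ k d₂ d ‖z‖ P 1 with hT
  have hTm : MeasurableSet T := measurableSet_majSet _ _ _ _ _ _ _
  have hTv := volume_majSet_le (C₀ := C₀) k d₂ (d := d) (l := ‖z‖) (P := P) (X := 1)
    (by linarith) hd (by linarith) (by linarith) zero_le_one
  rw [one_pow, mul_one] at hTv
  set B := 6 * C₀ * ‖z‖ ^ d₂ / (d ^ (k + 1) * P ^ (k + 2)) with hBd
  have hB0 : 0 ≤ B := by positivity
  have hTi : Integrable (T.indicator fun _ : ℝ => 6 ^ N * V) := by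
    rw [integrable_indicator_iff hTm]
    exact integrableOn_const (hTv.trans_lt ENNReal.ofReal_lt_top).ne
  have hTI : ∫ α, T.indicator (fun _ : ℝ => 6 ^ N * V) α ≤ 6 ^ N * V * B := by
    rw [integral_indicator hTm, setIntegral_const, smul_eq_mul, mul_comm]
    gcongr
    exact ENNReal.toReal_le_of_le_ofReal hB0 hTv
  have hle : ∀ α ∈ Set.Ioc (0 : ℝ) 1, ‖regSum F d z P α‖ ≤
      h α + T.indicator (fun _ : ℝ => 6 ^ N * V) α := fun α hα => by
    have hα' : α ∈ Set.Icc (-1 : ℝ) 1 := ⟨by linarith [hα.1], hα.2⟩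
    by_cases hm : Maj C₀ k d₂ d ‖z‖ P 1 α
    · rw [Set.indicator_of_mem (mem_majSet hd hα' hm)]
      linarith [h0 α, norm_regSum_le (F := F) hd hz hP α]
    · have := hb α hα' hm
      have h2 : 0 ≤ T.indicator (fun _ : ℝ => 6 ^ N * V) α :=
        Set.indicator_nonneg (fun _ _ => by positivity) _
      linarith
  have hcount : (regCount F d z P : ℝ) ≤ ∫ α, (h α + T.indicator (fun _ : ℝ => 6 ^ N * V) α) := by
    have e := regCount_eq_integral F d z P 0
    rw [zero_add, intervalIntegral.integral_of_le zero_le_one] at e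
    calc (regCount F d z P : ℝ) = ‖(regCount F d z P : ℂ)‖ := by simp
      _ ≤ ∫ α in Set.Ioc (0 : ℝ) 1, (h α + T.indicator (fun _ : ℝ => 6 ^ N * V) α) := by
        rw [e]
        exact norm_integral_le_of_norm_le (hi.add hTi).integrableOn
          ((ae_restrict_mem measurableSet_Ioc).mono hle)
      _ ≤ _ := setIntegral_le_integral (hi.add hTi) (Filter.Eventually.of_forall fun α =>
          add_nonneg (h0 α) (Set.indicator_nonneg (fun _ _ => by positivity) _))
  rw [integral_add hi hTi] at hcount
  have hε1 : 1 ≤ (d * ‖z‖ * P) ^ ε := Real.one_le_rpow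
    (one_le_mul_of_one_le_of_one_le (one_le_mul_of_one_le_of_one_le hd1 hz) hP) hε.le
  have he1 : 1 ≤ (d : ℝ) ^ (((k + 1 : ℕ) : ℝ) * (r + 1) / 2 ^ (k + 1)) :=
    Real.one_le_rpow hd1 (by positivity)
  have hVB : 6 ^ N * V * B ≤ 6 ^ N * (6 * C₀) * (V * (d * ‖z‖ * P) ^ ε *
      (d : ℝ) ^ (((k + 1 : ℕ) : ℝ) * (r + 1) / 2 ^ (k + 1)) * ‖z‖ ^ d₂ /
      (d ^ (k + 1) * P ^ (k + 2))) := by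
    calc 6 ^ N * V * B
        = 6 ^ N * (6 * C₀) * (V * 1 * 1 * ‖z‖ ^ d₂ / (d ^ (k + 1) * P ^ (k + 2))) := by
          rw [hBd]; ring
      _ ≤ _ := by gcongr
  rw [add_mul]
  linarith

end Consequences

section Circle

/-- The pairs `(q, a)` with `q ≤ Q` and `a` a reduced residue modulo `q`. -/
def fareyPts (Q : ℕ) : Finset ((_ : ℕ) × ℕ) :=
  (Finset.Icc 1 Q).sigma fun q => (Finset.range q).filter fun a => Nat.gcd a q = 1

lemma card_fareyPts_le (Q : ℕ) : (fareyPts Q).card ≤ Q ^ 2 := by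
  rw [fareyPts, Finset.card_sigma]
  refine (Finset.sum_le_card_nsmul _ _ Q fun q hq => ?_).trans ?_
  · refine (Finset.card_filter_le _ _).trans ?_
    rw [Finset.card_range]; exact (Finset.mem_Icc.1 hq).2
  · rw [Nat.card_Icc, smul_eq_mul, Nat.add_sub_cancel, sq]

/-- The arc of radius `τ` around `a / q`. -/
def fareyArc (τ : ℝ) (p : (_ : ℕ) × ℕ) : Set ℝ :=
  Set.Ioc ((p.2 : ℝ) / p.1 - τ) ((p.2 : ℝ) / p.1 + τ)

lemma fareyArc_subset {Q : ℕ} {τ : ℝ} (hτ : 2 * τ * Q ^ 2 < 1) (hτ0 : 0 < τ) {p : (_ : ℕ) × ℕ}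
    (hp : p ∈ fareyPts Q) : fareyArc τ p ⊆ Set.Ioc (-τ) (1 - τ) := by
  obtain ⟨q, a⟩ := p
  simp only [fareyPts, Finset.mem_sigma, Finset.mem_Icc, Finset.mem_filter, Finset.mem_range] at hp
  obtain ⟨⟨h1, h2⟩, h3, -⟩ := hp
  have hq : (1 : ℝ) ≤ q := by exact_mod_cast h1
  have hqQ : (q : ℝ) ≤ Q := by exact_mod_cast h2
  have ha : (a : ℝ) + 1 ≤ q := by exact_mod_cast h3
  have hq0 : (0 : ℝ) < q := by linarith
  have h4 : 2 * τ * q < 1 := lt_of_le_of_lt (by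
    gcongr
    calc (q : ℝ) ≤ Q := hqQ
      _ ≤ (Q : ℝ) ^ 2 := le_self_pow₀ (by linarith) (by norm_num)) hτ
  have h5 : (a : ℝ) / q ≤ 1 - 2 * τ := by
    rw [div_le_iff₀ hq0]; nlinarith
  have h6 : 0 ≤ (a : ℝ) / q := by positivity
  exact Set.Ioc_subset_Ioc (by simp only; linarith) (by simp only; linarith)

lemma fareyArc_disjoint {Q : ℕ} {τ : ℝ} (hτ : 2 * τ * Q ^ 2 < 1) (hτ0 : 0 < τ) :
    Set.Pairwise (fareyPts Q : Set ((_ : ℕ) × ℕ)) (Function.onFun Disjoint (fareyArc τ)) := by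
  rintro ⟨q, a⟩ hp ⟨q', a'⟩ hp' hne
  rw [Function.onFun, Set.disjoint_left]
  intro α h1 h2
  simp only [fareyPts, Finset.mem_coe, Finset.mem_sigma, Finset.mem_Icc, Finset.mem_filter,
    Finset.mem_range] at hp hp'
  obtain ⟨⟨q1, qQ⟩, -, hc⟩ := hp
  obtain ⟨⟨q1', qQ'⟩, -, hc'⟩ := hp'
  have hq : (0 : ℝ) < q := by exact_mod_cast q1
  have hq' : (0 : ℝ) < q' := by exact_mod_cast q1'
  have hQ : (q : ℝ) ≤ Q := by exact_mod_cast qQ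
  have hQ' : (q' : ℝ) ≤ Q := by exact_mod_cast qQ'
  simp only [fareyArc, Set.mem_Ioc] at h1 h2
  have hd : |(a : ℝ) / q - a' / q'| < 2 * τ := by rw [abs_lt]; constructor <;> linarith [h1.1, h1.2, h2.1, h2.2]
  have he : |((a * q' : ℤ) - a' * q : ℤ)| < 1 := by
    have : |(((a * q' : ℤ) - a' * q : ℤ) : ℝ)| < 1 := by
      have e : (((a * q' : ℤ) - a' * q : ℤ) : ℝ) = ((a : ℝ) / q - a' / q') * (q * q') := by
        push_cast; field_simp
      rw [e, abs_mul, abs_of_pos (mul_pos hq hq')]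
      calc |(a : ℝ) / q - a' / q'| * (q * q') ≤ 2 * τ * (q * q') := by gcongr
        _ ≤ 2 * τ * (Q * Q) := by gcongr
        _ < 1 := by rw [← sq]; exact hτ
    exact_mod_cast this
  rw [Int.abs_lt_one_iff, sub_eq_zero] at he
  have he' : a * q' = a' * q := by exact_mod_cast he
  have d1 : q ∣ q' := Nat.Coprime.dvd_of_dvd_mul_left (Nat.Coprime.symm hc) ⟨a', by rw [he', mul_comm]⟩
  have d2 : q' ∣ q := Nat.Coprime.dvd_of_dvd_mul_left (Nat.Coprime.symm hc') ⟨a, by rw [← he', mul_comm]⟩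
  have hqq := Nat.dvd_antisymm d1 d2
  subst hqq
  have haa : a = a' := Nat.eq_of_mul_eq_mul_right q1 he'
  exact hne (by rw [haa])

lemma circle_method {Q : ℕ} {τ : ℝ} (hτ : 2 * τ * Q ^ 2 < 1) (hτ0 : 0 < τ)
    {S : ℝ → ℂ} (hS : Continuous S) (c : ℕ → ℕ → ℂ) {g : ℝ → ℂ} (hg : IntervalIntegrable g volume (-τ) τ)
    {E : ℝ} (hE : ∀ p ∈ fareyPts Q, ∀ β, |β| ≤ τ → ‖S (p.2 / p.1 + β) - c p.1 p.2 * g β‖ ≤ E)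
    {h : ℝ → ℝ} (hh : Integrable h) (hh0 : ∀ α, 0 ≤ h α)
    (hm : ∀ α ∈ Set.Ioc (-τ) (1 - τ), (∀ p ∈ fareyPts Q, α ∉ fareyArc τ p) → ‖S α‖ ≤ h α) :
    ‖(∫ α in (-τ)..(-τ + 1), S α) - (∑ p ∈ fareyPts Q, c p.1 p.2) * ∫ β in (-τ)..τ, g β‖ ≤
      Q ^ 2 * (2 * τ * E) + ∫ α, h α := by
  set I := Set.Ioc (-τ) (1 - τ) with hI
  have hSI : IntegrableOn S I := (hS.integrableOn_Icc).mono_set Set.Ioc_subset_Icc_self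
  set U := ⋃ p ∈ fareyPts Q, fareyArc τ p with hU
  have hUm : MeasurableSet U := Finset.measurableSet_biUnion _ fun p _ => measurableSet_Ioc
  have hUI : U ⊆ I := Set.iUnion₂_subset fun p hp => fareyArc_subset hτ hτ0 hp
  have harc : ∀ p : (_ : ℕ) × ℕ, ∫ α in fareyArc τ p, S α = ∫ β in (-τ)..τ, S (p.2 / p.1 + β) := by
    intro p
    rw [fareyArc, ← intervalIntegral.integral_of_le (by linarith),
      intervalIntegral.integral_comp_add_left (fun α => S α) ((p.2 : ℝ) / p.1), ← sub_eq_add_neg]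
  have h1 : ∫ α in (-τ)..(-τ + 1), S α =
      (∑ p ∈ fareyPts Q, ∫ β in (-τ)..τ, S (p.2 / p.1 + β)) + ∫ α in I \ U, S α := by
    rw [intervalIntegral.integral_of_le (by linarith), show -τ + 1 = 1 - τ by ring, ← hI,
      setIntegral_sdiff hUm hSI hUI, hU, integral_biUnion_finset (s := fareyArc τ) _ (fun p _ => measurableSet_Ioc)
      (fareyArc_disjoint hτ hτ0) (fun p hp => hSI.mono_set (fareyArc_subset hτ hτ0 hp)),
      Finset.sum_congr rfl fun p _ => harc p]
    ring
  have h2 : ‖∫ α in I \ U, S α‖ ≤ ∫ α, h α := by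
    refine (norm_integral_le_of_norm_le hh.integrableOn
      ((ae_restrict_mem (measurableSet_Ioc.diff hUm)).mono fun α hα => hm α hα.1 fun p hp hαp =>
        hα.2 (Set.mem_biUnion hp hαp))).trans ?_
    exact setIntegral_le_integral hh (Filter.Eventually.of_forall hh0)
  have h3 : ∀ p ∈ fareyPts Q, ‖(∫ β in (-τ)..τ, S (p.2 / p.1 + β)) -
      c p.1 p.2 * ∫ β in (-τ)..τ, g β‖ ≤ 2 * τ * E := by
    intro p hp
    have hSc : Continuous fun β => S (p.2 / p.1 + β) := hS.comp (by fun_prop)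
    rw [← intervalIntegral.integral_const_mul, ← intervalIntegral.integral_sub
      (hSc.intervalIntegrable _ _) (hg.const_mul _)]
    refine (intervalIntegral.norm_integral_le_of_norm_le_const (C := E) fun β hβ => ?_).trans ?_
    · rw [Set.uIoc_of_le (by linarith)] at hβ
      exact hE p hp β (abs_le.2 ⟨hβ.1.le, hβ.2⟩)
    · rw [abs_of_nonneg (by linarith)]
      exact le_of_eq (by ring)
  rw [h1, Finset.sum_mul, add_sub_right_comm, ← Finset.sum_sub_distrib]
  refine (norm_add_le _ _).trans (add_le_add ((norm_sum_le_of_le _ h3).trans ?_) h2)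
  rw [Finset.sum_const, nsmul_eq_mul]
  rcases (fareyPts Q).eq_empty_or_nonempty with he | ⟨p, hp⟩
  · have : Q = 0 := by
      by_contra hQ
      have : (⟨1, 0⟩ : (_ : ℕ) × ℕ) ∈ fareyPts Q := by
        simp [fareyPts]; omega
      rw [he] at this; simp at this
    rw [he, this]; simp
  · have hE0 : 0 ≤ E := (norm_nonneg _).trans (hE p hp 0 (by rw [abs_zero]; exact hτ0.le))
    gcongr
    exact_mod_cast card_fareyPts_le Q

lemma sum_fareyPts (Q : ℕ) (f : ℕ → ℕ → ℂ) : ∑ p ∈ fareyPts Q, f p.1 p.2 =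
    ∑ q ∈ Finset.Icc 1 Q, ∑ a ∈ (Finset.range q).filter fun a => Nat.gcd a q = 1, f q a := by
  rw [fareyPts, Finset.sum_sigma]

lemma exists_mem_fareyArc {C₀ : ℝ} {k d₂ d Q : ℕ} {l P X α τ : ℝ} (hd : 1 ≤ d) (hP : 1 ≤ P)
    (hX : 0 ≤ X)
    (hτ : 2 * τ * Q ^ 2 < 1) (hτX : X ^ (k + 1) / P ^ (k + 2) < τ)
    (hQ : C₀ * l ^ d₂ * X ^ (k + 1) * d ≤ Q) (hα : α ∈ Set.Ioc (-τ) (1 - τ))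
    (h : Maj C₀ k d₂ d l P X α) : ∃ p ∈ fareyPts Q, α ∈ fareyArc τ p := by
  obtain ⟨q, h1, h2, h3⟩ := h
  have hd1 : (1 : ℝ) ≤ d := by exact_mod_cast hd
  have hq1 : (1 : ℝ) ≤ q := by exact_mod_cast h1
  have hP0 : 0 < P := by linarith
  set N := d * q with hN
  have hN1 : 1 ≤ N := Nat.mul_pos hd h1
  have hN1' : (1 : ℝ) ≤ N := by exact_mod_cast hN1
  have hN0 : (0 : ℝ) < N := by linarith
  have hNQ : N ≤ Q := by
    have : (N : ℝ) ≤ Q := by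
      rw [hN]; push_cast
      calc (d : ℝ) * q ≤ d * (C₀ * l ^ d₂ * X ^ (k + 1)) := by gcongr
        _ ≤ Q := by linarith
    exact_mod_cast this
  set ρ := X ^ (k + 1) / P ^ (k + 2) with hρ
  have hdist : ∃ j : ℤ, |α - j / N| ≤ ρ := by
    refine ⟨round (α * (d * q)), ?_⟩
    have e : |α - round (α * (d * q)) / N| = nd (α * (d * q)) / N := by
      rw [nd, eq_div_iff hN0.ne']
      nth_rewrite 2 [← abs_of_pos hN0]
      rw [← abs_mul]
      congr 1
      rw [sub_mul, div_mul_cancel₀ _ hN0.ne', hN]; push_cast; ring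
    rw [e]
    calc nd (α * (d * q)) / N ≤ nd (α * (d * q)) / 1 := by
          gcongr
          exact nd_nonneg _
      _ = nd (α * (d * q)) := div_one _
      _ ≤ X ^ (k + 1) / (d ^ (k + 1) * P ^ (k + 2)) := h3
      _ ≤ X ^ (k + 1) / (1 * P ^ (k + 2)) := by
          gcongr
          exact one_le_pow₀ hd1
      _ = ρ := by rw [one_mul]
  obtain ⟨j, hj⟩ := hdist
  have hρ0 : 0 ≤ ρ := by positivity
  have hQ1 : (1 : ℝ) ≤ Q := by exact_mod_cast hN1.trans hNQ
  have hτ0 : 0 < τ := by linarith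
  have hτN : 2 * τ * N < 1 := lt_of_le_of_lt (by
    gcongr
    calc (N : ℝ) ≤ Q := by exact_mod_cast hNQ
      _ ≤ (Q : ℝ) ^ 2 := le_self_pow₀ hQ1 (by norm_num)) hτ
  rw [abs_le] at hj
  have hj0 : 0 ≤ j := by
    have : (-1 : ℝ) < j := by
      have : -(2 * τ) < (j : ℝ) / N := by linarith [hα.1, hj.2]
      rw [lt_div_iff₀ hN0] at this
      linarith
    have : -1 < j := by exact_mod_cast this
    omega
  have hjN : j < N := by
    have : (j : ℝ) < N := by
      have : (j : ℝ) / N < 1 := by linarith [hα.2, hj.1]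
      rwa [div_lt_one hN0] at this
    exact_mod_cast this
  lift j to ℕ using hj0
  have hjN' : j < N := by exact_mod_cast hjN
  set g := Nat.gcd j N with hg
  have hg0 : 0 < g := Nat.gcd_pos_of_pos_right _ hN1
  have hgN : g ∣ N := Nat.gcd_dvd_right _ _
  have hgj : g ∣ j := Nat.gcd_dvd_left _ _
  have hfrac : ((j / g : ℕ) : ℝ) / ((N / g : ℕ) : ℝ) = (j : ℝ) / N := by
    have hg0' : (g : ℝ) ≠ 0 := by exact_mod_cast hg0.ne'
    rw [Nat.cast_div hgj hg0', Nat.cast_div hgN hg0', div_div_div_cancel_right₀ hg0']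
  refine ⟨⟨N / g, j / g⟩, ?_, ?_⟩
  · simp only [fareyPts, Finset.mem_sigma, Finset.mem_Icc, Finset.mem_filter, Finset.mem_range]
    refine ⟨⟨Nat.div_pos (Nat.le_of_dvd hN1 hgN) hg0, (Nat.div_le_self _ _).trans hNQ⟩, ?_, ?_⟩
    · exact Nat.div_lt_div_of_lt_of_dvd hgN hjN'
    · exact Nat.coprime_div_gcd_div_gcd hg0
  · simp only [fareyArc, hfrac, Set.mem_Ioc]
    simp only [Int.cast_natCast] at hj
    constructor <;> linarith [hj.1, hj.2]

end Circle

section MajorArcs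

lemma intervalIntegrable_IbetaZ_mul (F : MvPolynomial (Idx n m r) ℤ) (z : Fin (n - m + 1) → ℤ)
    (V R a b : ℝ) :
    IntervalIntegrable (fun β => (V : ℂ) * IbetaZ F z (β * R)) volume a b := by
  have hm : StronglyMeasurable fun β : ℝ => (V : ℂ) * IbetaZ F z (β * R) :=
    ((stronglyMeasurable_IbetaZ F z).comp_measurable (measurable_id.mul_const R)).const_mul _
  rw [intervalIntegrable_iff]
  refine Measure.integrableOn_of_bounded (M := |V| * 2 ^ Fintype.card (VIdx m r)) (by simp)
    hm.aestronglyMeasurable (Filter.Eventually.of_forall fun β => ?_)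
  rw [norm_mul, Complex.norm_real, Real.norm_eq_abs]
  gcongr
  exact norm_IbetaZ_le F z _

lemma sum_fareyPts_SaqdZ (hrm : r ≤ m) (F : MvPolynomial (Idx n m r) ℤ) (d : ℕ)
    (z : Fin (n - m + 1) → ℤ) (Q : ℕ) :
    ∑ p ∈ fareyPts Q, (((p.1 : ℝ) ^ Fintype.card (VIdx m r))⁻¹ : ℝ) * SaqdZ F d z p.2 p.1 =
      ∑ q ∈ Finset.Icc 1 Q, seriesTerm F d z q := by
  rw [sum_fareyPts Q fun q a => (((q : ℝ) ^ Fintype.card (VIdx m r))⁻¹ : ℝ) * SaqdZ F d z a q]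
  refine Finset.sum_congr rfl fun q _ => ?_
  rw [seriesTerm, Finset.mul_sum]
  refine Finset.sum_congr rfl fun a _ => ?_
  congr 1
  rw [card_VIdx hrm, zpow_neg, show ((m : ℤ) + 1) = ((m + 1 : ℕ) : ℤ) by push_cast; ring, zpow_natCast]
  push_cast; ring

lemma norm_sub_mul_le {S S' J J' : ℂ} {a b e f : ℝ} (ha : ‖S‖ ≤ a) (hb : ‖J‖ ≤ b)
    (he : ‖S - S'‖ ≤ e) (hf : ‖J - J'‖ ≤ f) : ‖S * J - S' * J'‖ ≤ a * f + e * (b + f) := by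
  have e1 : S * J - S' * J' = S * (J - J') + (S - S') * (J - (J - J')) := by ring
  rw [e1]
  refine (norm_add_le _ _).trans ?_
  rw [norm_mul, norm_mul]
  exact add_le_add (mul_le_mul ha hf (norm_nonneg _) ((norm_nonneg _).trans ha))
    (mul_le_mul he ((norm_sub_le _ _).trans (add_le_add hb hf)) (norm_nonneg _)
      ((norm_nonneg _).trans he))

end MajorArcs

section RegimeA

set_option maxHeartbeats 1600000 in
lemma exists_major_bound (hrm : r ≤ m) {C₀ : ℝ} (hC₀ : 1 ≤ C₀) (k : ℕ)
    (F : MvPolynomial (Idx n m r) ℤ) (d₂ : ℕ) (hF : Bihomogeneous F (k + 2) d₂) (D' c₀ : ℕ)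
    (hc₀ : 4 * ((k : ℝ) + 1) < (c₀ : ℝ) / 2 ^ (k + 1)) (hbox : BoxBound C₀ k F d₂ D' c₀)
    (hreg : RegBound C₀ k F d₂ D' c₀) :
    ∃ κ : ℝ, 0 < κ ∧ κ ≤ 1 ∧ ∃ M : ℕ, ∃ C : ℝ, 1 ≤ C ∧ ∀ d : ℕ, 1 ≤ d → ∀ P : ℝ, 1 ≤ P →
      ∀ z : Fin (n - m + 1) → ℤ, 1 ≤ ‖z‖ →
      dimV1z F (fun k => (z k : ℂ)) ≤ ((D' : ℕ) : ℕ∞) → ∀ w : ℝ, 1 ≤ w → d ≤ w → ‖z‖ ≤ w →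
      C * w ^ M ≤ P ^ κ →
      ‖(regCount F d z P : ℂ) - singSeriesZ F d z * JZ F z *
        ((boxVol m r d ‖z‖ P * ((d * P) ^ (k + 2))⁻¹ : ℝ) : ℂ)‖ ≤
      C * (boxVol m r d ‖z‖ P / P ^ (k + 2)) *
        (d : ℝ) ^ (((k + 1 : ℕ) : ℝ) * (r + 1) / 2 ^ (k + 1)) * w ^ M * P ^ (-κ) := by
  have hk0 : (0 : ℝ) < (k : ℝ) + 1 := by positivity
  have hc₀' : 2 * ((k : ℝ) + 1) < (c₀ : ℝ) / 2 ^ (k + 2) := by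
    rw [pow_succ, ← div_div]; linarith
  set σ := (c₀ : ℝ) / 2 ^ (k + 2) - 2 * ((k : ℝ) + 1) with hσ
  have hσ0 : 0 < σ := by linarith
  set η := 1 / (20 * ((k : ℝ) + 1)) with hη
  have hη0 : 0 < η := by positivity
  set s := min (1 / 8) (η * σ / 2) with hs
  have hs0 : 0 < s := by positivity
  have hs1 : s ≤ 1 / 8 := min_le_left _ _
  have hs2 : s ≤ η * σ / 2 := min_le_right _ _
  set κ := min (1 / 40) (η * σ / 2) with hκ
  have hκ0 : 0 < κ := by positivity
  have hκ1 : κ ≤ 1 / 40 := min_le_left _ _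
  have hκ2 : κ ≤ η * σ / 2 := min_le_right _ _
  obtain ⟨C₁, hC₁, h₁⟩ := exists_regSum_approx F hF
  obtain ⟨C₂, hC₂, h₂⟩ := exists_minor_bound hC₀ k F d₂ D' c₀ hc₀' hreg hs0
  obtain ⟨C₃, hC₃, h₃⟩ := exists_JZ_bound hC₀ k F d₂ hF D' c₀ hc₀.le hreg hs0 hs1
  obtain ⟨C₄, hC₄, h₄⟩ := exists_singSeriesZ_bound hrm hC₀ k F d₂ D' c₀ hc₀.le hbox hs0
    (by linarith : s ≤ 1 / 2)
  set M := k + 5 * d₂ + 9 with hM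
  set CC := 3 + 2 * C₀ + 4 * C₁ + C₂ + 5 * C₃ * C₄ with hCC
  have hCC1 : 1 ≤ CC := by
    have : 0 ≤ 5 * C₃ * C₄ := by positivity
    linarith
  refine ⟨κ, hκ0, by linarith, M, CC, hCC1, ?_⟩
  intro d hd P hP z hz hdim w hw hdw hlw hcond
  obtain ⟨h, hhi, hh0, hhb, hhI⟩ := h₂ d hd P hP z hz hdim (P ^ η) (Real.one_le_rpow hP hη0.le)
  obtain ⟨hJ1, hJ2⟩ := h₃ z hz hdim
  obtain ⟨hS1, hS2⟩ := h₄ d hd z hz hdim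
  replace h₁ := h₁ d hd z hz P hP
  set l := ‖z‖ with hl
  set V := boxVol m r d l P with hV
  have hd1 : (1 : ℝ) ≤ d := by exact_mod_cast hd
  have hl0 : 0 < l := by linarith
  have hP0 : 0 < P := by linarith
  have hV0 : 0 < V := boxVol_pos d hd hl0 hP0
  set E := (d : ℝ) ^ (((k + 1 : ℕ) : ℝ) * (r + 1) / 2 ^ (k + 1)) with hE
  have hE1 : 1 ≤ E := Real.one_le_rpow hd1 (by positivity)
  have hw0 : 0 < w := by linarith
  have hwM : 1 ≤ w ^ M := one_le_pow₀ hw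
  have hPκ : P ^ κ ≤ P := by
    calc P ^ κ ≤ P ^ (1 : ℝ) := Real.rpow_le_rpow_of_exponent_le hP (by linarith)
      _ = P := Real.rpow_one P
  have hP3 : 3 ≤ P := by
    have h0 : 0 ≤ 5 * C₃ * C₄ := by positivity
    calc (3 : ℝ) ≤ CC * 1 := by linarith
      _ ≤ CC * w ^ M := by gcongr
      _ ≤ P := hcond.trans hPκ
  set p := P ^ (1 / 10 : ℝ) with hp
  have hp1 : 1 ≤ p := Real.one_le_rpow hP (by norm_num)
  have hp0 : 0 < p := by linarith
  have hp10 : p ^ 10 = P := by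
    rw [hp, ← Real.rpow_natCast, ← Real.rpow_mul hP0.le]; norm_num
  set Q := ⌊p⌋₊ with hQ
  have hQ1 : 1 ≤ Q := Nat.le_floor (by exact_mod_cast hp1)
  have hQ1' : (1 : ℝ) ≤ Q := by exact_mod_cast hQ1
  have hQp : (Q : ℝ) ≤ p := Nat.floor_le hp0.le
  have hpQ : p ≤ 2 * Q := by
    have := (Nat.lt_floor_add_one p).le
    linarith
  have hpP : p ≤ P := by rw [← hp10]; exact le_self_pow₀ hp1 (by norm_num)
  set τ := p / P ^ (k + 2) with hτ
  have hτ0 : 0 < τ := by positivity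
  have hPk : P ^ 2 ≤ P ^ (k + 2) := pow_le_pow_right₀ hP (by omega)
  have hτQ : 2 * τ * (Q : ℝ) ^ 2 < 1 := by
    calc 2 * τ * (Q : ℝ) ^ 2 ≤ 2 * (p / P ^ 2) * p ^ 2 := by rw [hτ]; gcongr
      _ = 2 * p ^ 3 / P ^ 2 := by ring
      _ ≤ 2 * p ^ 10 / P ^ 2 := by
          gcongr
          norm_num
      _ = 2 / P := by rw [hp10]; field_simp
      _ < 1 := by rw [div_lt_one hP0]; linarith
  have hXk : (P ^ η) ^ (k + 1) = P ^ (1 / 20 : ℝ) := by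
    rw [← Real.rpow_natCast, ← Real.rpow_mul hP0.le]
    congr 1
    rw [hη]; push_cast; field_simp
  have hpp : P ^ (1 / 20 : ℝ) * P ^ (1 / 20 : ℝ) = p := by
    rw [← Real.rpow_add hP0, hp]; norm_num
  have hτX : (P ^ η) ^ (k + 1) / P ^ (k + 2) < τ := by
    rw [hXk, hτ]
    gcongr
    exact Real.rpow_lt_rpow_of_exponent_lt (by linarith) (by norm_num)
  have hLw : l ^ d₂ ≤ w ^ d₂ := by gcongr
  have hQbig : C₀ * l ^ d₂ * (P ^ η) ^ (k + 1) * d ≤ Q := by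
    have h0 : 0 ≤ 5 * C₃ * C₄ := by positivity
    have e1 : w ^ (d₂ + 1) ≤ w ^ M := pow_le_pow_right₀ hw (by omega)
    have e2 : 2 * C₀ * w ^ (d₂ + 1) ≤ P ^ (1 / 20 : ℝ) := by
      calc 2 * C₀ * w ^ (d₂ + 1) ≤ CC * w ^ M := by gcongr; linarith
        _ ≤ P ^ κ := hcond
        _ ≤ P ^ (1 / 20 : ℝ) := Real.rpow_le_rpow_of_exponent_le hP (by linarith)
    calc C₀ * l ^ d₂ * (P ^ η) ^ (k + 1) * d ≤ C₀ * w ^ d₂ * P ^ (1 / 20 : ℝ) * w := by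
          rw [hXk]; gcongr
      _ = (2 * C₀ * w ^ (d₂ + 1)) * P ^ (1 / 20 : ℝ) / 2 := by ring
      _ ≤ P ^ (1 / 20 : ℝ) * P ^ (1 / 20 : ℝ) / 2 := by gcongr
      _ ≤ Q := by rw [hpp]; linarith
  set R := (d * P) ^ (k + 2) with hR
  have hR0 : 0 < R := by positivity
  have hτR : τ * R = p * d ^ (k + 2) := by
    rw [hτ, hR, mul_pow]; field_simp
  set B := τ * R with hB
  have hdk : (1 : ℝ) ≤ (d : ℝ) ^ (k + 2) := one_le_pow₀ hd1
  have hpB : p ≤ B := by rw [hτR]; exact le_mul_of_one_le_right hp0.le hdk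
  have hB1 : 1 ≤ B := hp1.trans hpB
  have hQP : (Q : ℝ) ≤ P := hQp.trans hpP
  have hcirc := circle_method hτQ hτ0 (continuous_regSum F d z P)
    (fun q a => (((q : ℝ) ^ Fintype.card (VIdx m r))⁻¹ : ℝ) * SaqdZ F d z a q)
    (intervalIntegrable_IbetaZ_mul F z V R (-τ) τ)
    (E := C₁ * V * (Q / P) * (1 + τ * R * l ^ d₂)) (by
      rintro ⟨q, a⟩ hqa β hβ
      simp only [fareyPts, Finset.mem_sigma, Finset.mem_Icc] at hqa
      have hq1 := hqa.1.1
      have hqQ : (q : ℝ) ≤ Q := by exact_mod_cast hqa.1.2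
      have e := h₁ q hq1 (hqQ.trans hQP) a β
      have e2 : ((((q : ℝ) ^ Fintype.card (VIdx m r))⁻¹ * V : ℝ) : ℂ) * SaqdZ F d z a q *
          IbetaZ F z (β * R) = (((q : ℝ) ^ Fintype.card (VIdx m r))⁻¹ : ℝ) * SaqdZ F d z a q *
          ((V : ℂ) * IbetaZ F z (β * R)) := by push_cast; ring
      rw [e2] at e
      refine e.trans ?_
      gcongr) hhi hh0 (by
      intro α hα hnot
      refine hhb α ⟨?_, ?_⟩ fun hmaj => ?_
      · have : τ < 1 := by
          have h1 : τ ≤ τ * (Q : ℝ) ^ 2 := le_mul_of_one_le_right hτ0.le (one_le_pow₀ hQ1')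
          linarith
        linarith [hα.1]
      · linarith [hα.2]
      · obtain ⟨p', hp', hαp⟩ := exists_mem_fareyArc hd hP (by positivity) hτQ hτX hQbig hα hmaj
        exact hnot p' hp' hαp)
  rw [← regCount_eq_integral, sum_fareyPts_SaqdZ hrm, intervalIntegral.integral_const_mul,
    intervalIntegral.integral_comp_mul_right (fun β => IbetaZ F z β) hR0.ne', neg_mul, ← hB] at hcirc
  set SQ := ∑ q ∈ Finset.Icc 1 Q, seriesTerm F d z q with hSQ
  set JB := ∫ β in (-B)..B, IbetaZ F z β with hJB
  have hdl : ((d : ℝ) * l) ^ s ≤ w ^ 2 := by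
    calc ((d : ℝ) * l) ^ s ≤ (w * w) ^ s := by gcongr
      _ ≤ (w * w) ^ (1 : ℝ) := Real.rpow_le_rpow_of_exponent_le
          (one_le_mul_of_one_le_of_one_le hw hw) (by linarith)
      _ = w ^ 2 := by rw [Real.rpow_one]; ring
  have hlJ : l ^ ((1 + d₂) * s) ≤ w ^ (1 + d₂) := by
    calc l ^ ((1 + d₂) * s) ≤ w ^ ((1 + d₂) * s) := by gcongr
      _ ≤ w ^ ((1 + d₂) * (1 : ℝ)) := Real.rpow_le_rpow_of_exponent_le hw (by gcongr; linarith)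
      _ = w ^ (1 + d₂) := by rw [mul_one, ← Real.rpow_natCast]; push_cast; rfl
  have hBκ : B ^ (-(1 / 4 : ℝ)) ≤ P ^ (-κ) := by
    calc B ^ (-(1 / 4 : ℝ)) ≤ p ^ (-(1 / 4 : ℝ)) :=
          Real.rpow_le_rpow_of_nonpos hp0 hpB (by norm_num)
      _ = P ^ (-(1 / 40) : ℝ) := by rw [hp, ← Real.rpow_mul hP0.le]; norm_num
      _ ≤ P ^ (-κ) := Real.rpow_le_rpow_of_exponent_le hP (by linarith)
  have hQκ : (Q : ℝ) ^ (-(1 / 2 : ℝ)) ≤ 2 * P ^ (-κ) := by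
    calc (Q : ℝ) ^ (-(1 / 2 : ℝ)) ≤ (p / 2) ^ (-(1 / 2 : ℝ)) :=
          Real.rpow_le_rpow_of_nonpos (by positivity) (by linarith) (by norm_num)
      _ = 2 ^ (1 / 2 : ℝ) * p ^ (-(1 / 2) : ℝ) := by
          rw [Real.div_rpow hp0.le (by norm_num), Real.rpow_neg (by norm_num : (0 : ℝ) ≤ 2),
            div_inv_eq_mul, mul_comm]
      _ = 2 ^ (1 / 2 : ℝ) * P ^ (-(1 / 20) : ℝ) := by
          rw [hp, ← Real.rpow_mul hP0.le]; norm_num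
      _ ≤ 2 ^ (1 : ℝ) * P ^ (-κ) := by
          gcongr
          · norm_num
          · norm_num
          · linarith
      _ = _ := by rw [Real.rpow_one]
  set κP := P ^ (-κ) with hκP
  have hκP0 : 0 < κP := by positivity
  have hκP1 : κP ≤ 1 := Real.rpow_le_one_of_one_le_of_nonpos hP (by linarith)
  have hLd : (l ^ d₂ * d) ^ (4 : ℝ) ≤ w ^ (4 * (d₂ + 1)) := by
    calc (l ^ d₂ * d) ^ (4 : ℝ) = (l ^ d₂ * d) ^ 4 := by exact_mod_cast Real.rpow_natCast _ 4
      _ ≤ (w ^ d₂ * w) ^ 4 := by gcongr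
      _ = _ := by rw [← pow_succ, ← pow_mul]; ring_nf
  have hLd1 : 1 ≤ l ^ d₂ * d := one_le_mul_of_one_le_of_one_le (one_le_pow₀ hz) hd1
  have hLd2 : (l ^ d₂ * d) ^ (2 + 2 * s) ≤ w ^ (4 * (d₂ + 1)) :=
    (Real.rpow_le_rpow_of_exponent_le hLd1 (by linarith)).trans hLd
  have hmain : ‖singSeriesZ F d z * JZ F z - SQ * JB‖ ≤ 5 * C₃ * C₄ * E * w ^ M * κP := by
    have a1 : ‖singSeriesZ F d z‖ ≤ C₄ * w ^ 2 * E * w ^ (4 * (d₂ + 1)) := hS1.trans (by gcongr)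
    have a2 : ‖singSeriesZ F d z - SQ‖ ≤ C₄ * w ^ 2 * E * w ^ (4 * (d₂ + 1)) * (2 * κP) :=
      (hS2 Q hQ1).trans (by gcongr)
    have a3 : ‖JZ F z‖ ≤ C₃ * w ^ (1 + d₂) := hJ1.trans (by gcongr)
    have a4 : ‖JZ F z - JB‖ ≤ C₃ * w ^ (1 + d₂) * κP := (hJ2 B hB1).trans (by gcongr)
    refine (norm_sub_mul_le a1 a3 a2 a4).trans ?_
    calc C₄ * w ^ 2 * E * w ^ (4 * (d₂ + 1)) * (C₃ * w ^ (1 + d₂) * κP) +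
          C₄ * w ^ 2 * E * w ^ (4 * (d₂ + 1)) * (2 * κP) *
            (C₃ * w ^ (1 + d₂) + C₃ * w ^ (1 + d₂) * κP)
        = C₃ * C₄ * E * (w ^ 2 * w ^ (4 * (d₂ + 1)) * w ^ (1 + d₂)) * κP * (1 + 2 * (1 + κP)) := by
          ring
      _ ≤ C₃ * C₄ * E * w ^ M * κP * (1 + 2 * (1 + 1)) := by
          gcongr
          rw [← pow_add, ← pow_add]
          exact pow_le_pow_right₀ hw (by omega)
      _ = _ := by ring
  set T := V / P ^ (k + 2) with hT
  have hT0 : 0 < T := by positivity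
  have hterm1 : (Q : ℝ) ^ 2 * (2 * τ * (C₁ * V * (Q / P) * (1 + B * l ^ d₂))) ≤
      4 * C₁ * T * E * w ^ M * κP := by
    have b1 : 1 ≤ B * l ^ d₂ := one_le_mul_of_one_le_of_one_le hB1 (one_le_pow₀ hz)
    have b2 : 1 + B * l ^ d₂ ≤ 2 * (p * w ^ M) := by
      calc 1 + B * l ^ d₂ ≤ 2 * (B * l ^ d₂) := by linarith
        _ ≤ 2 * (p * w ^ (k + 2) * w ^ d₂) := by rw [hτR]; gcongr
        _ = 2 * (p * w ^ (k + 2 + d₂)) := by ring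
        _ ≤ 2 * (p * w ^ M) := by
          gcongr
          omega
    have b3 : p ^ 5 / P ≤ κP := by
      calc p ^ 5 / P = P ^ (-(1 / 2) : ℝ) := by
            rw [hp, ← Real.rpow_natCast, ← Real.rpow_mul hP0.le]
            nth_rewrite 2 [← Real.rpow_one P]
            rw [← Real.rpow_sub hP0]; norm_num
        _ ≤ κP := Real.rpow_le_rpow_of_exponent_le hP (by linarith)
    calc (Q : ℝ) ^ 2 * (2 * τ * (C₁ * V * (Q / P) * (1 + B * l ^ d₂)))
        ≤ p ^ 2 * (2 * τ * (C₁ * V * (p / P) * (2 * (p * w ^ M)))) := by gcongr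
      _ = 4 * C₁ * T * 1 * w ^ M * (p ^ 5 / P) := by rw [hτ, hT]; ring
      _ ≤ _ := by gcongr
  have hterm2 : ∫ α, h α ≤ C₂ * T * E * w ^ M * κP := by
    refine hhI.trans ?_
    have b1 : (d * l * P) ^ s ≤ w ^ 2 * P ^ s := by
      rw [Real.mul_rpow (by positivity) hP0.le]; gcongr
    have b2 : P ^ s * (P ^ η) ^ (2 * ((k : ℝ) + 1) - (c₀ : ℝ) / 2 ^ (k + 2)) ≤ κP := by
      rw [← Real.rpow_mul hP0.le, ← Real.rpow_add hP0]
      refine Real.rpow_le_rpow_of_exponent_le hP ?_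
      have : η * (2 * ((k : ℝ) + 1) - (c₀ : ℝ) / 2 ^ (k + 2)) = -(η * σ) := by rw [hσ]; ring
      rw [this]; linarith
    calc C₂ * (V * (d * l * P) ^ s * E * l ^ d₂ / (d ^ (k + 1) * P ^ (k + 2))) *
          (P ^ η) ^ (2 * ((k : ℝ) + 1) - (c₀ : ℝ) / 2 ^ (k + 2))
        ≤ C₂ * (V * (w ^ 2 * P ^ s) * E * w ^ d₂ / (1 * P ^ (k + 2))) *
          (P ^ η) ^ (2 * ((k : ℝ) + 1) - (c₀ : ℝ) / 2 ^ (k + 2)) := by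
          gcongr
          exact one_le_pow₀ hd1
      _ = C₂ * T * E * w ^ (2 + d₂) *
          (P ^ s * (P ^ η) ^ (2 * ((k : ℝ) + 1) - (c₀ : ℝ) / 2 ^ (k + 2))) := by rw [hT]; ring
      _ ≤ _ := by
          gcongr
          omega
  have hVR : V * R⁻¹ ≤ T := by
    rw [hT, hR, mul_pow, div_eq_mul_inv]
    gcongr
    exact le_mul_of_one_le_left (by positivity) hdk
  have hterm3 : ‖SQ * ((V : ℂ) * (R⁻¹ • JB)) -
      singSeriesZ F d z * JZ F z * ((V * R⁻¹ : ℝ) : ℂ)‖ ≤ T * (5 * C₃ * C₄ * E * w ^ M * κP) := by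
    have e : SQ * ((V : ℂ) * (R⁻¹ • JB)) - singSeriesZ F d z * JZ F z * ((V * R⁻¹ : ℝ) : ℂ) =
        -(((V * R⁻¹ : ℝ) : ℂ) * (singSeriesZ F d z * JZ F z - SQ * JB)) := by
      rw [Complex.real_smul]; push_cast; ring
    rw [e, norm_neg, norm_mul, Complex.norm_real, Real.norm_of_nonneg (by positivity)]
    gcongr
  refine (norm_sub_le_norm_sub_add_norm_sub _ (SQ * ((V : ℂ) * (R⁻¹ • JB))) _).trans ?_
  refine (add_le_add (hcirc.trans (add_le_add hterm1 hterm2)) hterm3).trans ?_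
  have hX : 0 ≤ (3 + 2 * C₀) * (T * E * w ^ M * κP) := by positivity
  calc _ = (4 * C₁ + C₂ + 5 * C₃ * C₄) * (T * E * w ^ M * κP) := by ring
    _ ≤ (4 * C₁ + C₂ + 5 * C₃ * C₄) * (T * E * w ^ M * κP) +
        (3 + 2 * C₀) * (T * E * w ^ M * κP) := by linarith
    _ = _ := by rw [hCC]; ring

end RegimeA

section Asymptotic

set_option maxHeartbeats 1600000 in
lemma exists_asymptotic (hrm : r ≤ m) {C₀ : ℝ} (hC₀ : 1 ≤ C₀) (k : ℕ)
    (F : MvPolynomial (Idx n m r) ℤ) {d₂ : ℕ} (hd₂ : 1 ≤ d₂) (hF : Bihomogeneous F (k + 2) d₂)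
    (D' c₀ : ℕ) (hc₀ : 4 * ((k : ℝ) + 1) < (c₀ : ℝ) / 2 ^ (k + 1)) (hbox : BoxBound C₀ k F d₂ D' c₀)
    (hreg : RegBound C₀ k F d₂ D' c₀) {ε : ℝ} (hε : 0 < ε) :
    ∃ δ : ℝ, 0 < δ ∧ ∃ C : ℝ, 0 < C ∧ ∀ d : ℕ, 1 ≤ d → ∀ P : ℝ, 1 ≤ P →
      ∀ z : Fin (n - m + 1) → ℤ, 1 ≤ ‖z‖ →
      dimV1z F (fun k => (z k : ℂ)) ≤ ((D' : ℕ) : ℕ∞) →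
      ‖(regCount F d z P : ℂ) - singSeriesZ F d z * JZ F z *
        ((boxVol m r d ‖z‖ P * ((d * P) ^ (k + 2))⁻¹ : ℝ) : ℂ)‖ ≤
      C * (boxVol m r d ‖z‖ P / P ^ (k + 2)) *
        (d : ℝ) ^ (((k + 1 : ℕ) : ℝ) * (r + 1) / 2 ^ (k + 1) + ε) * (‖z‖ ^ d₂) ^ 4 * P ^ (-δ) := by
  have hc₀' : 2 * ((k : ℝ) + 1) < (c₀ : ℝ) / 2 ^ (k + 2) := by
    rw [pow_succ, ← div_div]; linarith
  obtain ⟨κ, hκ0, hκ1, M, CA, hCA, hA⟩ := exists_major_bound hrm hC₀ k F d₂ hF D' c₀ hc₀ hbox hreg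
  set W := 4 + (d₂ : ℝ) + 4 * M / κ with hW
  have hW0 : 0 < W := by positivity
  set s := min (κ / 8) (min ε 1 / W) with hs
  have hs0 : 0 < s := by positivity
  have hs1 : s ≤ κ / 8 := min_le_left _ _
  have hsW : s * W ≤ min ε 1 := by
    rw [← le_div_iff₀ hW0]; exact min_le_right _ _
  set y := 4 * M * s / κ with hy
  have hy0 : 0 ≤ y := by positivity
  have hsy : (4 + d₂) * s + y ≤ min ε 1 := by
    refine le_trans (le_of_eq ?_) hsW
    rw [hW, hy]; ring
  have hsy1 : (4 + d₂) * s + y ≤ ε := hsy.trans (min_le_left _ _)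
  have hsy2 : (4 + d₂) * s + y ≤ 1 := hsy.trans (min_le_right _ _)
  have hd₂s : 0 ≤ d₂ * s := by positivity
  obtain ⟨C₃, hC₃, h₃⟩ := exists_JZ_bound hC₀ k F d₂ hF D' c₀ hc₀.le hreg hs0 (by linarith)
  obtain ⟨C₄, hC₄, h₄⟩ := exists_singSeriesZ_bound hrm hC₀ k F d₂ D' c₀ hc₀.le hbox hs0
    (by linarith : s ≤ 1 / 2)
  obtain ⟨C₅, hC₅, h₅⟩ := exists_regCount_bound hC₀ k F d₂ D' c₀ hc₀' hreg hs0
  refine ⟨s, hs0, CA * (1 + C₅ + C₄ * C₃), by positivity, ?_⟩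
  intro d hd P hP z hz hdim
  obtain ⟨hJ, -⟩ := h₃ z hz hdim
  obtain ⟨hS, -⟩ := h₄ d hd z hz hdim
  replace h₅ := h₅ d hd P hP z hz hdim
  replace hA := hA d hd P hP z hz hdim
  set l := ‖z‖ with hl
  set V := boxVol m r d l P with hV
  have hd1 : (1 : ℝ) ≤ d := by exact_mod_cast hd
  have hd0 : (0 : ℝ) < d := by linarith
  have hl0 : 0 < l := by linarith
  have hP0 : 0 < P := by linarith
  have hV0 : 0 < V := boxVol_pos d hd hl0 hP0
  rw [Real.rpow_add hd0]
  set E := (d : ℝ) ^ (((k + 1 : ℕ) : ℝ) * (r + 1) / 2 ^ (k + 1)) with hE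
  have hE0 : 0 < E := by positivity
  set w := (d : ℝ) * l with hw
  have hw1 : 1 ≤ w := one_le_mul_of_one_le_of_one_le hd1 hz
  have hw0 : 0 < w := by linarith
  have hdw : (d : ℝ) ≤ w := le_mul_of_one_le_right hd0.le hz
  have hlw : l ≤ w := le_mul_of_one_le_left hl0.le hd1
  set L := l ^ d₂ with hL
  have hL1 : 1 ≤ L := one_le_pow₀ hz
  have hL0 : 0 < L := by linarith
  have hlL : l ≤ L := le_self_pow₀ hz (by omega)
  set T := V / P ^ (k + 2) with hT
  have hT0 : 0 < T := by positivity
  have hdε : 1 ≤ (d : ℝ) ^ ε := Real.one_le_rpow hd1 hε.le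
  have hL4 : 1 ≤ L ^ 4 := one_le_pow₀ hL1
  rcases le_or_gt (CA * w ^ (2 * M)) (P ^ κ) with hcase | hcase
  · have hwM : w ^ M ≤ w ^ (2 * M) := pow_le_pow_right₀ hw1 (by omega)
    refine (hA w hw1 hdw hlw (le_trans (by gcongr) hcase)).trans ?_
    have h1 : w ^ M ≤ P ^ (κ / 2) := by
      refine le_of_sq_le_sq ?_ (by positivity)
      calc (w ^ M) ^ 2 = 1 * w ^ (2 * M) := by rw [one_mul, ← pow_mul, mul_comm]
        _ ≤ CA * w ^ (2 * M) := by gcongr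
        _ ≤ P ^ κ := hcase
        _ = (P ^ (κ / 2)) ^ 2 := by
          rw [← Real.rpow_natCast, ← Real.rpow_mul hP0.le]; congr 1; push_cast; ring
    have h2 : w ^ M * P ^ (-κ) ≤ P ^ (-s) := by
      calc w ^ M * P ^ (-κ) ≤ P ^ (κ / 2) * P ^ (-κ) := by gcongr
        _ = P ^ (-(κ / 2)) := by rw [← Real.rpow_add hP0]; congr 1; ring
        _ ≤ P ^ (-s) := Real.rpow_le_rpow_of_exponent_le hP (by linarith)
    calc CA * T * E * w ^ M * P ^ (-κ) = CA * 1 * T * (E * 1) * 1 * (w ^ M * P ^ (-κ)) := by ring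
      _ ≤ CA * (1 + C₅ + C₄ * C₃) * T * (E * d ^ ε) * L ^ 4 * P ^ (-s) := by
        have : 0 ≤ C₄ * C₃ := by positivity
        gcongr
        linarith
  · have hP2s : P ^ (2 * s) ≤ CA * w ^ y := by
      calc P ^ (2 * s) = (P ^ κ) ^ (2 * s / κ) := by
            rw [← Real.rpow_mul hP0.le]; congr 1; field_simp
        _ ≤ (CA * w ^ (2 * M)) ^ (2 * s / κ) := by gcongr
        _ = CA ^ (2 * s / κ) * w ^ y := by
            rw [Real.mul_rpow (by positivity) (by positivity), ← Real.rpow_natCast,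
              ← Real.rpow_mul hw0.le]
            congr 2
            rw [hy]; push_cast; ring
        _ ≤ CA ^ (1 : ℝ) * w ^ y := by
            gcongr
            rw [div_le_one hκ0]; linarith
        _ = _ := by rw [Real.rpow_one]
    have hPs : P ^ s ≤ CA * w ^ y * P ^ (-s) := by
      calc P ^ s = P ^ (2 * s) * P ^ (-s) := by rw [← Real.rpow_add hP0]; congr 1; ring
        _ ≤ _ := by gcongr
    have hPone : 1 ≤ CA * w ^ y * P ^ (-s) := (Real.one_le_rpow hP hs0.le).trans hPs
    have hws : ∀ t : ℝ, 0 ≤ t → w ^ t ≤ (d : ℝ) ^ t * L ^ t := fun t ht => by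
      rw [hw, Real.mul_rpow hd0.le hl0.le]; gcongr
    have hL4' : L ^ 4 = L ^ (4 : ℝ) := by exact_mod_cast (Real.rpow_natCast L 4).symm
    have hN : (regCount F d z P : ℝ) ≤ CA * C₅ * T * (E * d ^ ε) * L ^ 4 * P ^ (-s) := by
      have a1 : w ^ s * w ^ y * L ≤ d ^ ε * L ^ 4 := by
        rw [← Real.rpow_add hw0]
        calc w ^ (s + y) * L ≤ ((d : ℝ) ^ (s + y) * L ^ (s + y)) * L ^ (1 : ℝ) := by
              rw [Real.rpow_one]; gcongr; exact hws _ (by positivity)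
          _ = (d : ℝ) ^ (s + y) * L ^ (s + y + 1) := by rw [Real.rpow_add hL0 (s + y)]; ring
          _ ≤ _ := by
              rw [hL4']
              gcongr
              · linarith
              · linarith
      calc (regCount F d z P : ℝ) ≤ C₅ * (V * (w * P) ^ s * E * L / (d ^ (k + 1) * P ^ (k + 2))) := h₅
        _ ≤ C₅ * (V * (w * P) ^ s * E * L / (1 * P ^ (k + 2))) := by
            gcongr
            exact one_le_pow₀ hd1
        _ = C₅ * T * E * (w ^ s * P ^ s * L) := by
            rw [Real.mul_rpow hw0.le hP0.le, hT]; ring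
        _ ≤ C₅ * T * E * (w ^ s * (CA * w ^ y * P ^ (-s)) * L) := by gcongr
        _ = CA * C₅ * T * E * (w ^ s * w ^ y * L) * P ^ (-s) := by ring
        _ ≤ CA * C₅ * T * E * (d ^ ε * L ^ 4) * P ^ (-s) := by gcongr
        _ = _ := by ring
    have hSJ : ‖singSeriesZ F d z * JZ F z * ((V * ((d * P) ^ (k + 2))⁻¹ : ℝ) : ℂ)‖ ≤
        CA * (C₄ * C₃) * T * (E * d ^ ε) * L ^ 4 * P ^ (-s) := by
      have a1 : (L * d) ^ (2 + 2 * s) * ((d : ℝ) ^ (k + 2))⁻¹ ≤ L ^ (2 + 2 * s) * d ^ (2 * s) := by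
        have b1 : (d : ℝ) ^ 2 ≤ d ^ (k + 2) := pow_le_pow_right₀ hd1 (by omega)
        rw [Real.mul_rpow hL0.le hd0.le, Real.rpow_add hd0 2, Real.rpow_two]
        calc L ^ (2 + 2 * s) * ((d : ℝ) ^ 2 * d ^ (2 * s)) * ((d : ℝ) ^ (k + 2))⁻¹
            ≤ L ^ (2 + 2 * s) * ((d : ℝ) ^ (k + 2) * d ^ (2 * s)) * ((d : ℝ) ^ (k + 2))⁻¹ := by gcongr
          _ = _ := by field_simp
      have a2 : w ^ s * w ^ y * (L ^ (2 + 2 * s) * d ^ (2 * s)) * l ^ ((1 + d₂) * s) ≤ d ^ ε * L ^ 4 := by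
        rw [← Real.rpow_add hw0]
        calc w ^ (s + y) * (L ^ (2 + 2 * s) * (d : ℝ) ^ (2 * s)) * l ^ ((1 + d₂) * s)
            ≤ ((d : ℝ) ^ (s + y) * L ^ (s + y)) * (L ^ (2 + 2 * s) * (d : ℝ) ^ (2 * s)) *
              L ^ ((1 + d₂) * s) := by
              gcongr; exact hws _ (by positivity)
          _ = (d : ℝ) ^ (s + y + 2 * s) * L ^ (s + y + (2 + 2 * s) + (1 + d₂) * s) := by
              rw [Real.rpow_add hL0 (s + y + (2 + 2 * s)), Real.rpow_add hL0 (s + y),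
                Real.rpow_add hd0 (s + y)]; ring
          _ ≤ _ := by
              rw [hL4']
              gcongr
              · linarith
              · linarith
      rw [norm_mul, norm_mul, Complex.norm_real, Real.norm_of_nonneg (by positivity)]
      calc ‖singSeriesZ F d z‖ * ‖JZ F z‖ * (V * ((d * P) ^ (k + 2))⁻¹)
          ≤ (C₄ * w ^ s * E * (L * d) ^ (2 + 2 * s)) * (C₃ * l ^ ((1 + d₂) * s)) *
            (V * ((d * P) ^ (k + 2))⁻¹) := by gcongr
        _ = C₄ * C₃ * T * E * (w ^ s * ((L * d) ^ (2 + 2 * s) * ((d : ℝ) ^ (k + 2))⁻¹) *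
            l ^ ((1 + d₂) * s)) * 1 := by
            rw [hT, mul_pow, mul_inv, div_eq_mul_inv]; ring
        _ ≤ C₄ * C₃ * T * E * (w ^ s * (L ^ (2 + 2 * s) * d ^ (2 * s)) *
            l ^ ((1 + d₂) * s)) * (CA * w ^ y * P ^ (-s)) := by gcongr
        _ = CA * (C₄ * C₃) * T * E * (w ^ s * w ^ y * (L ^ (2 + 2 * s) * d ^ (2 * s)) *
            l ^ ((1 + d₂) * s)) * P ^ (-s) := by ring
        _ ≤ CA * (C₄ * C₃) * T * E * (d ^ ε * L ^ 4) * P ^ (-s) := by gcongr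
        _ = _ := by ring
    refine (norm_sub_le _ _).trans ?_
    rw [Complex.norm_natCast]
    refine (add_le_add hN hSJ).trans ?_
    have : 0 ≤ CA * T * (E * d ^ ε) * L ^ 4 * P ^ (-s) := by positivity
    calc _ = CA * (C₅ + C₄ * C₃) * T * (E * d ^ ε) * L ^ 4 * P ^ (-s) := by ring
      _ ≤ CA * (C₅ + C₄ * C₃) * T * (E * d ^ ε) * L ^ 4 * P ^ (-s) +
          CA * T * (E * d ^ ε) * L ^ 4 * P ^ (-s) := by linarith
      _ = _ := by ring

end Asymptotic

section Main

lemma JZ_zero {F : MvPolynomial (Idx n m r) ℤ} {d₁ d₂ : ℕ} (hF : Bihomogeneous F d₁ d₂)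
    (hd₂ : 1 ≤ d₂) : JZ F 0 = 0 := by
  have hev : ∀ x : Fin (r + 1) → ℝ, evalF F x (fun _ => (0 : ℝ)) (fun _ => 0) = 0 := fun x => by
    have h := hF ℝ 1 0 x (fun _ => 0) (fun _ => 0)
    rw [zero_pow (by omega)] at h
    simpa using h
  have hI : ∀ β, IbetaZ F 0 β = IbetaZ F 0 0 := fun β => by
    unfold IbetaZ
    simp [hev]
  rw [JZ, integral_congr_ae (ae_of_all _ hI), integral_const]
  simp [measureReal_def]

lemma ncard_eq_regCount (F : MvPolynomial (Idx n m r) ℤ) {d : ℕ} (hd : 1 ≤ d) {P : ℝ} (hP : 1 ≤ P)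
    {z : Fin (n - m + 1) → ℤ} (hz : 1 ≤ ‖z‖) :
    Set.ncard {xy : (Fin (r + 1) → ℤ) × (Fin (m - r) → ℤ) |
      ‖xy.1‖ ≤ P ∧ ‖xy.2‖ < d * ‖z‖ * ‖xy.1‖ ∧
        evalF F (fun i => (d : ℤ) * xy.1 i) xy.2 z = 0} = regCount F d z P := by
  have hb : (0 : ℝ) < d * ‖z‖ := by
    have : (1 : ℝ) ≤ d := by exact_mod_cast hd
    positivity
  rw [regCount, ← Set.ncard_coe_finset,
    ← Set.ncard_image_of_injective _ (Equiv.sumArrowEquivProdArrow _ _ _).injective]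
  congr 1
  ext xy
  rw [Equiv.image_eq_preimage_symm]
  simp only [Set.mem_ofPred_eq, Set.mem_preimage, Finset.coe_filter,
    mem_regPts hb (zero_lt_one.trans_le hP), eval_dPoly, and_assoc]
  rfl

end Main

/-!
Statement 14: fix `μ ∈ ℕ`, assume `d₁ ≥ 2` and
`K₁ := (n + 2 - dim V₁* - μ)/2^{d₁-1} > 4(d₁-1)`.  Then for every `ε > 0` there exists
`δ > 0` such that, uniformly for all `d ≥ 1`, all `P₁ ≥ 1`, and all
`𝐳 ∈ A₁^μ ∩ ℤ^{n-m+1}` with `l := |𝐳| < P₁^{(d₁-1)/(2d₂)}`: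
`N_{d,𝐳}(P₁) = 𝔖_{d,𝐳} J_𝐳 d^{m-r-d₁} l^{m-r} P₁^{m+1-d₁}
  + O(d^{m-r} max(d^{(d₁-1)(r+1)/2^{d₁-1}+ε}, d^{3-d₁}) l^{m-r+4d₂} P₁^{m+1-d₁-δ})`.
-/
theorem statement14
    (n m r d₁ d₂ : ℕ) (hr1 : 1 ≤ r) (hrm : r ≤ m) (hmn : m ≤ n)
    (hd₁ : 2 ≤ d₁) (hd₂ : 1 ≤ d₂) (hdm : d₁ < m + 1) (hdn : d₂ < n - r + 1)
    (F : MvPolynomial (Idx n m r) ℤ) (hF : Bihomogeneous F d₁ d₂)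
    (mu D₁ : ℕ) (hD₁ : dimV1 F = ((D₁ : ℕ∞) : WithBot ℕ∞))
    (hK₁ : 4 * ((d₁ : ℝ) - 1) < ((n : ℝ) + 2 - D₁ - mu) / 2 ^ (d₁ - 1))
    (ε : ℝ) (hε : 0 < ε) :
    ∃ δ : ℝ, 0 < δ ∧ ∃ Cc : ℝ, 0 < Cc ∧
      ∀ d : ℕ, 1 ≤ d → ∀ P₁ : ℝ, 1 ≤ P₁ → ∀ z : Fin (n - m + 1) → ℤ,
        (fun k => (z k : ℂ)) ∈ A1set F mu D₁ →
        ‖z‖ < P₁ ^ (((d₁ : ℝ) - 1) / (2 * d₂)) →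
        ‖((Set.ncard {xy : (Fin (r + 1) → ℤ) × (Fin (m - r) → ℤ) |
              ‖xy.1‖ ≤ P₁ ∧ ‖xy.2‖ < d * ‖z‖ * ‖xy.1‖ ∧
              evalF F (fun i => (d : ℤ) * xy.1 i) xy.2 z = 0} : ℝ) : ℂ) -
            singSeriesZ F d z * JZ F z *
              (((d : ℝ) ^ ((m : ℤ) - r - d₁) * ‖z‖ ^ (m - r) * P₁ ^ (m + 1 - d₁) : ℝ) : ℂ)‖ ≤
          Cc * (d : ℝ) ^ (m - r) *
            max ((d : ℝ) ^ (((d₁ : ℝ) - 1) * (r + 1) / 2 ^ (d₁ - 1) + ε))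
              ((d : ℝ) ^ ((3 : ℝ) - d₁)) *
            ‖z‖ ^ (m - r + 4 * d₂) * P₁ ^ ((m : ℝ) + 1 - d₁ - δ) := by
  obtain ⟨k, rfl⟩ : ∃ k, d₁ = k + 2 := ⟨d₁ - 2, by omega⟩
  by_cases hlt : D₁ + mu < n - m + 2
  · refine ⟨1, one_pos, 1, one_pos, fun d _ P _ z hz _ => ?_⟩
    obtain ⟨D', h, -⟩ := dimV1z_le_of_mem_A1set hF hd₁ hz
    omega
  push Not at hlt
  have hpow : (0 : ℝ) < 2 ^ (k + 2 - 1) := by positivity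
  have hlt' : D₁ + mu < n + 2 := by
    have h1 : (0 : ℝ) < ((n : ℝ) + 2 - D₁ - mu) / 2 ^ (k + 2 - 1) :=
      lt_of_le_of_lt (by push_cast; linarith [(Nat.cast_nonneg k : (0 : ℝ) ≤ k)]) hK₁
    rw [div_pos_iff_of_pos_right hpow] at h1
    have : (D₁ : ℝ) + mu < n + 2 := by linarith
    exact_mod_cast this
  obtain ⟨D', hD'⟩ : ∃ D', D₁ + mu = D' + (n - m + 2) := ⟨_, (Nat.sub_add_cancel hlt).symm⟩
  obtain ⟨c₀, hc₀⟩ : ∃ c₀, D' + c₀ = m + 1 := ⟨m + 1 - D', by omega⟩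
  have hc : 4 * ((k : ℝ) + 1) < (c₀ : ℝ) / 2 ^ (k + 1) := by
    have h1 : (n : ℝ) + 3 = D₁ + mu + c₀ := by
      have : n + 3 = D₁ + mu + c₀ := by omega
      exact_mod_cast this
    have h2 : ((n : ℝ) + 2 - D₁ - mu) / 2 ^ (k + 1) ≤ (c₀ : ℝ) / 2 ^ (k + 1) := by
      gcongr; linarith
    refine lt_of_eq_of_lt ?_ (hK₁.trans_le h2)
    push_cast; ring
  obtain ⟨C₀, hC₀, hbox, hreg⟩ := exists_regSum_bound hrm k F d₂ hF D' c₀ hc₀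
  obtain ⟨δ, hδ, C, hC, hmain⟩ :=
    exists_asymptotic hrm hC₀ k F hd₂ hF D' c₀ hc hbox hreg hε
  refine ⟨δ, hδ, C, hC, fun d hd P hP z hz _ => ?_⟩
  have hd0 : (0 : ℝ) < d := by exact_mod_cast hd
  have hP0 : 0 < P := zero_lt_one.trans_le hP
  obtain ⟨D'', hD'', hdim⟩ := dimV1z_le_of_mem_A1set hF hd₁ hz
  obtain rfl : D'' = D' := by omega
  obtain ⟨h, hh⟩ := exists_nat_eq_norm z
  rcases Nat.eq_zero_or_pos h with rfl | hpos
  · obtain rfl : z = 0 := norm_eq_zero.mp (by simpa using hh)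
    have hempty : {xy : (Fin (r + 1) → ℤ) × (Fin (m - r) → ℤ) |
        ‖xy.1‖ ≤ P ∧ ‖xy.2‖ < d * ‖(0 : Fin (n - m + 1) → ℤ)‖ * ‖xy.1‖ ∧
          evalF F (fun i => (d : ℤ) * xy.1 i) xy.2 0 = 0} = ∅ := by
      refine Set.eq_empty_of_forall_notMem fun xy hxy => ?_
      have := hxy.2.1
      rw [norm_zero, mul_zero, zero_mul] at this
      exact (norm_nonneg _).not_gt this
    rw [hempty, JZ_zero hF hd₂]
    simp only [Set.ncard_empty, Nat.cast_zero, Complex.ofReal_zero, mul_zero, zero_mul, sub_zero,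
      norm_zero]
    positivity
  have hz1 : 1 ≤ ‖z‖ := by rw [hh]; exact_mod_cast hpos
  have hm1 : m - r + (r + 1) = (m + 1 - (k + 2)) + (k + 2) := by omega
  have hPpow : P ^ (m - r) * P ^ (r + 1) = P ^ (m + 1 - (k + 2)) * P ^ (k + 2) := by
    rw [← pow_add, hm1, pow_add]
  have hdpow : (d : ℝ) ^ ((m : ℤ) - r - ((k + 2 : ℕ) : ℤ)) = d ^ (m - r) * ((d : ℝ) ^ (k + 2))⁻¹ := by
    rw [zpow_sub₀ hd0.ne', zpow_natCast, div_eq_mul_inv, ← Nat.cast_sub hrm, zpow_natCast]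
  have hvol : boxVol m r d ‖z‖ P * ((d * P) ^ (k + 2))⁻¹ =
      (d : ℝ) ^ ((m : ℤ) - r - ((k + 2 : ℕ) : ℤ)) * ‖z‖ ^ (m - r) * P ^ (m + 1 - (k + 2)) := by
    rw [hdpow, boxVol, mul_pow, mul_pow, mul_pow]
    field_simp
    linear_combination hPpow
  have hvol' : boxVol m r d ‖z‖ P / P ^ (k + 2) =
      (d : ℝ) ^ (m - r) * ‖z‖ ^ (m - r) * P ^ (m + 1 - (k + 2)) := by
    rw [boxVol, mul_pow, mul_pow]
    field_simp
    linear_combination hPpow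
  have hPexp : P ^ ((m : ℝ) + 1 - ((k + 2 : ℕ) : ℝ) - δ) = P ^ (m + 1 - (k + 2)) * P ^ (-δ) := by
    rw [← Real.rpow_natCast P (m + 1 - (k + 2)), ← Real.rpow_add hP0, Nat.cast_sub (by omega)]
    congr 1
    push_cast; ring
  have key := hmain d hd P hP z hz1 hdim
  rw [hvol, hvol'] at key
  rw [ncard_eq_regCount F hd hP hz1, hPexp, Complex.ofReal_natCast]
  refine key.trans ?_
  have hexp : (((k + 1 : ℕ) : ℝ) * (r + 1) / 2 ^ (k + 1) + ε) =
      (((k + 2 : ℕ) : ℝ) - 1) * (r + 1) / 2 ^ (k + 2 - 1) + ε := by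
    push_cast
    ring
  rw [hexp]
  calc _ = C * (d : ℝ) ^ (m - r) *
        (d : ℝ) ^ ((((k + 2 : ℕ) : ℝ) - 1) * (r + 1) / 2 ^ (k + 2 - 1) + ε) *
        ‖z‖ ^ (m - r + 4 * d₂) * (P ^ (m + 1 - (k + 2)) * P ^ (-δ)) := by ring
    _ ≤ _ := by
        gcongr
        exact le_max_left _ _

end PaperTM
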